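/- For any fixed α > 0 the following holds for all sufficiently large integers d. There exists a function ε : ℕ → (0,1), depending on α and d, with lim_{k→∞} ε(k) = 0, such that for all integers n ≥ k ≥ 1 and M ≥ 10: with ℙ-probability at least 1 − ε(k) there exists a self-avoiding nearest-neighbor path P = (x_1, …, x_L) on the lattice (1/𝔯)2^{−3n}ℤ^d with at most 4M𝔯·11^n vertices such that |x_1|_1 ≤ 2, |x_L − 2M e_1|_1 ≤ 2, |x_i|_1 ≤ 10M for all i, and h_j(x) − h_{3k}(x) ≥ α(j − 3k) for every integer j with 6k ≤ j ≤ n and every point x ∈ P̄. -/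

import Mathlib

open MeasureTheory ProbabilityTheory

/-- The covariance kernel of the white-noise approximation of the log-correlated field:
`K((n,x),(m,y)) = ∫_{2^{−min(n,m)}}^{1} [vol(B_t(x) ∩ B_t(y)) / vol(B_t(0))] t⁻¹ dt`. -/
noncomputable def wnKernel (d : ℕ) (n m : ℕ) (x y : EuclideanSpace ℝ (Fin d)) : ℝ :=
  ∫ t in Set.Ioc ((2 : ℝ) ^ (-(min n m : ℤ))) 1,
    (volume (Metric.ball x t ∩ Metric.ball y t)).toReal /
      (volume (Metric.ball (0 : EuclideanSpace ℝ (Fin d)) t)).toReal * t⁻¹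

/-- `(h_n(x))_{n ≥ 1}` is a centered Gaussian process with covariance kernel `wnKernel`,
each `h_n(·)(ω)` being continuous. -/
def IsWhiteNoiseField (d : ℕ) {Ω : Type} [MeasurableSpace Ω] (P : Measure Ω)
    (h : ℕ → EuclideanSpace ℝ (Fin d) → Ω → ℝ) : Prop :=
  (∀ n x, Measurable (h n x)) ∧
  (∀ (N : ℕ) (idx : Fin N → ℕ × EuclideanSpace ℝ (Fin d)) (c : Fin N → ℝ),
    (∀ i, 1 ≤ (idx i).1) →
    P.map (fun ω => ∑ i, c i * h (idx i).1 (idx i).2 ω) =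
      gaussianReal 0 (Real.toNNReal (∑ i, ∑ j,
        c i * c j * wnKernel d (idx i).1 (idx j).1 (idx i).2 (idx j).2))) ∧
  (∀ ω n, Continuous (fun x => h n x ω))

section

open MeasureTheory ProbabilityTheory

set_option linter.unusedSectionVars false
set_option linter.unusedVariables false

namespace WN

/-- A linear space of centered Gaussian random variables. -/
structure GaussSpace {Ω : Type} [MeasurableSpace Ω] (P : Measure Ω)
    (V : Submodule ℝ (Ω → ℝ)) : Prop where
  meas : ∀ X ∈ V, Measurable X
  law : ∀ X ∈ V, ∃ v, P.map X = gaussianReal 0 v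

/-- The second moment pairing `E[XY]`. -/
noncomputable def cv {Ω : Type} [MeasurableSpace Ω] (P : Measure Ω) (X Y : Ω → ℝ) : ℝ :=
  ∫ ω, X ω * Y ω ∂P

section
variable {Ω : Type} [MeasurableSpace Ω] {P : Measure Ω} [IsProbabilityMeasure P]
  {V : Submodule ℝ (Ω → ℝ)}

lemma GaussSpace.hasGaussianLaw (hV : GaussSpace P V) {X : Ω → ℝ} (hX : X ∈ V) :
    HasGaussianLaw X P := by
  obtain ⟨v, hv⟩ := hV.law X hX
  exact ⟨by rw [hv]; infer_instance⟩

lemma GaussSpace.memLp (hV : GaussSpace P V) {X : Ω → ℝ} (hX : X ∈ V) : MemLp X 2 P :=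
  (hV.hasGaussianLaw hX).memLp_two

lemma GaussSpace.integrable_mul (hV : GaussSpace P V) {X Y : Ω → ℝ} (hX : X ∈ V) (hY : Y ∈ V) :
    Integrable (fun ω => X ω * Y ω) P :=
  (hV.memLp hX).integrable_mul (hV.memLp hY)

lemma GaussSpace.integral_eq_zero (hV : GaussSpace P V) {X : Ω → ℝ} (hX : X ∈ V) :
    ∫ ω, X ω ∂P = 0 := by
  obtain ⟨v, hv⟩ := hV.law X hX
  have := integral_map (μ := P) (φ := X) (hV.meas X hX).aemeasurable
    (f := fun x : ℝ => x) (by fun_prop)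
  rw [← this, hv, integral_id_gaussianReal]

lemma GaussSpace.map_eq (hV : GaussSpace P V) {X : Ω → ℝ} (hX : X ∈ V) :
    P.map X = gaussianReal 0 (cv P X X).toNNReal := by
  obtain ⟨v, hv⟩ := hV.law X hX
  have h1 : Var[X; P] = v := by
    have := variance_map (μ := P) (Y := X) (X := id) (by fun_prop)
      (hV.meas X hX).aemeasurable
    rw [hv, variance_id_gaussianReal] at this
    simpa using this.symm
  have h2 : cv P X X = v := by
    rw [variance_eq_integral (hV.meas X hX).aemeasurable, hV.integral_eq_zero hX] at h1
    rw [← h1]; simp [cv, sq]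
  rw [hv, h2]; simp

lemma cv_comm (X Y : Ω → ℝ) : cv P X Y = cv P Y X := by
  simp only [cv, mul_comm]

lemma cv_self_nonneg (X : Ω → ℝ) : 0 ≤ cv P X X :=
  integral_nonneg fun ω => mul_self_nonneg _

lemma GaussSpace.cv_add_left (hV : GaussSpace P V) {X Y Z : Ω → ℝ} (hX : X ∈ V) (hY : Y ∈ V)
    (hZ : Z ∈ V) : cv P (X + Y) Z = cv P X Z + cv P Y Z := by
  simp only [cv, Pi.add_apply, add_mul]
  exact integral_add (hV.integrable_mul hX hZ) (hV.integrable_mul hY hZ)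

lemma cv_smul_left (a : ℝ) (X Z : Ω → ℝ) : cv P (a • X) Z = a * cv P X Z := by
  simp only [cv, Pi.smul_apply, smul_eq_mul, mul_assoc]
  exact integral_const_mul _ _

lemma GaussSpace.cv_sub_left (hV : GaussSpace P V) {X Y Z : Ω → ℝ} (hX : X ∈ V) (hY : Y ∈ V)
    (hZ : Z ∈ V) : cv P (X - Y) Z = cv P X Z - cv P Y Z := by
  simp only [cv, Pi.sub_apply, sub_mul]
  exact integral_sub (hV.integrable_mul hX hZ) (hV.integrable_mul hY hZ)

lemma GaussSpace.cv_add_right (hV : GaussSpace P V) {X Y Z : Ω → ℝ} (hX : X ∈ V) (hY : Y ∈ V)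
    (hZ : Z ∈ V) : cv P Z (X + Y) = cv P Z X + cv P Z Y := by
  rw [cv_comm, hV.cv_add_left hX hY hZ, cv_comm X, cv_comm Y]

lemma GaussSpace.cv_sub_right (hV : GaussSpace P V) {X Y Z : Ω → ℝ} (hX : X ∈ V) (hY : Y ∈ V)
    (hZ : Z ∈ V) : cv P Z (X - Y) = cv P Z X - cv P Z Y := by
  rw [cv_comm, hV.cv_sub_left hX hY hZ, cv_comm X, cv_comm Y]

lemma cv_smul_right (a : ℝ) (X Z : Ω → ℝ) : cv P Z (a • X) = a * cv P Z X := by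
  rw [cv_comm, cv_smul_left, cv_comm]

lemma GaussSpace.cv_sum_left (hV : GaussSpace P V) {ι : Type*} (s : Finset ι) {X : ι → Ω → ℝ}
    {Z : Ω → ℝ} (hX : ∀ i ∈ s, X i ∈ V) (hZ : Z ∈ V) :
    cv P (∑ i ∈ s, X i) Z = ∑ i ∈ s, cv P (X i) Z := by
  classical
  induction s using Finset.induction_on with
  | empty => simp [cv]
  | insert a s ha ih =>
    rw [Finset.sum_insert ha, Finset.sum_insert ha,
      hV.cv_add_left (hX a (by simp)) (V.sum_mem fun i hi => hX i (by simp [hi])) hZ,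
      ih fun i hi => hX i (by simp [hi])]

lemma GaussSpace.cv_sum_right (hV : GaussSpace P V) {ι : Type*} (s : Finset ι) {X : ι → Ω → ℝ}
    {Z : Ω → ℝ} (hX : ∀ i ∈ s, X i ∈ V) (hZ : Z ∈ V) :
    cv P Z (∑ i ∈ s, X i) = ∑ i ∈ s, cv P Z (X i) := by
  rw [cv_comm, hV.cv_sum_left s hX hZ]
  simp only [cv_comm]

lemma GaussSpace.covariance_eq (hV : GaussSpace P V) {X Y : Ω → ℝ} (hX : X ∈ V) (hY : Y ∈ V) :
    cov[X, Y; P] = cv P X Y := by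
  rw [covariance_eq_sub (hV.memLp hX) (hV.memLp hY), hV.integral_eq_zero hX]
  simp [cv]

/-- Joint Gaussianity of two finite families in a Gaussian space. -/
lemma GaussSpace.hasGaussianLaw_prod (hV : GaussSpace P V) {κ κ' : Type*} [Finite κ] [Finite κ']
    {X : κ → Ω → ℝ} {Y : κ' → Ω → ℝ} (hX : ∀ q, X q ∈ V) (hY : ∀ q, Y q ∈ V) :
    HasGaussianLaw (fun ω ↦ (fun i ↦ X i ω, fun j ↦ Y j ω)) P := by
  classical
  have := Fintype.ofFinite κ
  have := Fintype.ofFinite κ'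
  refine ⟨isGaussian_of_map_eq_gaussianReal fun L => ⟨0, ?_⟩⟩
  have hmX : ∀ q, Measurable (X q) := fun q => hV.meas _ (hX q)
  have hmY : ∀ q, Measurable (Y q) := fun q => hV.meas _ (hY q)
  have hL : (L ∘ fun ω ↦ (fun i ↦ X i ω, fun j ↦ Y j ω)) =
      (∑ i, L (Pi.single i 1, 0) • X i) + ∑ j, L (0, Pi.single j 1) • Y j := by
    funext ω
    have e1 : ((fun i ↦ X i ω, fun j ↦ Y j ω) : (κ → ℝ) × (κ' → ℝ)) =
        (∑ i, X i ω • ((Pi.single i 1, 0) : (κ → ℝ) × (κ' → ℝ))) +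
          ∑ j, Y j ω • ((0, Pi.single j 1) : (κ → ℝ) × (κ' → ℝ)) := by
      refine Prod.ext ?_ ?_
      · ext i; simp [Prod.fst_sum, Finset.sum_apply, Pi.single_apply]
      · ext i; simp [Prod.snd_sum, Finset.sum_apply, Pi.single_apply]
    simp only [Function.comp_apply, e1, map_add, map_sum, map_smul, Pi.add_apply,
      Finset.sum_apply, Pi.smul_apply, smul_eq_mul]
    congr 1 <;> exact Finset.sum_congr rfl fun i _ => mul_comm _ _
  obtain ⟨v, hv⟩ := hV.law _ (V.add_mem (V.sum_mem fun i (_ : i ∈ Finset.univ) =>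
    V.smul_mem (L (Pi.single i 1, 0)) (hX i)) (V.sum_mem fun j (_ : j ∈ Finset.univ) =>
    V.smul_mem (L (0, Pi.single j 1)) (hY j)))
  refine ⟨v, ?_⟩
  rw [Measure.map_map (by fun_prop) (by fun_prop), hL, hv]

lemma GaussSpace.indepFun (hV : GaussSpace P V) {κ κ' : Type*} [Finite κ] [Finite κ']
    {X : κ → Ω → ℝ} {Y : κ' → Ω → ℝ} (hX : ∀ q, X q ∈ V) (hY : ∀ q, Y q ∈ V)
    (h : ∀ i j, cv P (X i) (Y j) = 0) :
    IndepFun (fun ω i ↦ X i ω) (fun ω j ↦ Y j ω) P :=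
  (hV.hasGaussianLaw_prod hX hY).indepFun_of_covariance_eval fun i j => by
    rw [hV.covariance_eq (hX i) (hY j), h]

lemma lintegral_exp_gaussianReal (v : NNReal) (hv : v ≠ 0) (f : ℝ → ENNReal) (hf : Measurable f) :
    ∫⁻ s, f s * ENNReal.ofReal (Real.exp (s - v / 2)) ∂(gaussianReal 0 v) =
      ∫⁻ s, f (s + v) ∂(gaussianReal 0 v) := by
  have h1 : ∫⁻ s, f (s + v) ∂(gaussianReal 0 v) = ∫⁻ s, f s ∂(gaussianReal v v) := by
    have := gaussianReal_map_add_const (μ := 0) (v := v) (v : ℝ)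
    rw [zero_add] at this
    rw [← this, lintegral_map hf (by fun_prop)]
  have hv' : (v : ℝ) ≠ 0 := by exact_mod_cast hv
  rw [h1, gaussianReal_of_var_ne_zero _ hv, gaussianReal_of_var_ne_zero _ hv,
    lintegral_withDensity_eq_lintegral_mul _ (measurable_gaussianPDF _ _) (by fun_prop),
    lintegral_withDensity_eq_lintegral_mul _ (measurable_gaussianPDF _ _) (by fun_prop)]
  refine lintegral_congr fun s => ?_
  simp only [Pi.mul_apply]
  rw [mul_left_comm, mul_comm (gaussianPDF _ _ _) (f s), gaussianPDF, gaussianPDF,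
    ← ENNReal.ofReal_mul (gaussianPDFReal_nonneg _ _ _)]
  congr 2
  rw [gaussianPDFReal, gaussianPDFReal, mul_assoc, ← Real.exp_add]
  congr 2
  field_simp
  ring

/-- Cameron–Martin formula in a Gaussian space. -/
lemma GaussSpace.cameronMartin (hV : GaussSpace P V) {κ : Type*} [Finite κ]
    {X : κ → Ω → ℝ} (hX : ∀ q, X q ∈ V) {S : Ω → ℝ} (hS : S ∈ V) {A : Set (κ → ℝ)}
    (hA : MeasurableSet A) :
    ∫⁻ ω, A.indicator 1 (fun q => X q ω) * ENNReal.ofReal (Real.exp (S ω - cv P S S / 2)) ∂P =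
      P {ω | (fun q => X q ω + cv P (X q) S) ∈ A} := by
  have hmX : ∀ q, Measurable (X q) := fun q => hV.meas _ (hX q)
  have hmS : Measurable S := hV.meas _ hS
  have hA1 : Measurable (A.indicator (1 : (κ → ℝ) → ENNReal)) := measurable_one.indicator hA
  have hrhs : P {ω | (fun q => X q ω + cv P (X q) S) ∈ A} =
      ∫⁻ ω, A.indicator 1 (fun q => X q ω + cv P (X q) S) ∂P := by
    rw [← lintegral_indicator_one (by measurability)]
    rfl
  rw [hrhs]
  obtain hv | hv := (cv_self_nonneg (P := P) S).eq_or_lt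
  · have hS0 : ∀ᵐ ω ∂P, S ω = 0 := by
      have h1 : ∫ ω, S ω * S ω ∂P = 0 := hv.symm
      rw [integral_eq_zero_iff_of_nonneg (fun ω => mul_self_nonneg _)
        (hV.integrable_mul hS hS)] at h1
      filter_upwards [h1] with ω h
      simpa using h
    have hc : ∀ q, cv P (X q) S = 0 := fun q => by
      rw [cv, integral_eq_zero_of_ae]
      filter_upwards [hS0] with ω h
      simp [h]
    refine lintegral_congr_ae ?_
    filter_upwards [hS0] with ω h
    simp [h, hc, ← hv]
  set v := cv P S S with hvdef
  set c : κ → ℝ := fun q => cv P (X q) S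
  set X' : κ → Ω → ℝ := fun q => X q - (c q / v) • S with hX'
  have hX'V : ∀ q, X' q ∈ V := fun q => V.sub_mem (hX q) (V.smul_mem _ hS)
  have hmX' : ∀ q, Measurable (X' q) := fun q => hV.meas _ (hX'V q)
  have hcov : ∀ q, cv P (X' q) S = 0 := fun q => by
    rw [hX', hV.cv_sub_left (hX q) (V.smul_mem _ hS) hS, cv_smul_left, ← hvdef,
      div_mul_cancel₀ _ hv.ne', sub_self]
  have hind : IndepFun (fun ω i ↦ X' i ω) S P :=
    (hV.indepFun (κ' := Unit) hX'V (fun _ => hS) (fun i _ => hcov i)).comp (φ := id)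
      (ψ := fun f : Unit → ℝ => f ()) measurable_id (measurable_pi_apply ())
  have hmX'' : Measurable (fun ω i ↦ X' i ω) := by fun_prop
  have hprod := (indepFun_iff_map_prod_eq_prod_map_map hmX''.aemeasurable
    hmS.aemeasurable).1 hind
  have hvN : v.toNNReal ≠ 0 := by simpa using hv
  have hvR : (v.toNNReal : ℝ) = v := Real.coe_toNNReal _ hv.le
  have hXX' : ∀ ω, (fun q => X q ω) = fun q => X' q ω + c q / v * S ω := fun ω => by
    funext q; simp [hX', c]
  have hg1 : Measurable fun p : (κ → ℝ) × ℝ => A.indicator (1 : (κ → ℝ) → ENNReal)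
      (fun q => p.1 q + c q / v * p.2) * ENNReal.ofReal (Real.exp (p.2 - v / 2)) :=
    (hA1.comp (by fun_prop)).mul (by fun_prop)
  have hg2 : Measurable fun p : (κ → ℝ) × ℝ => A.indicator (1 : (κ → ℝ) → ENNReal)
      (fun q => p.1 q + c q / v * p.2 + c q) := hA1.comp (by fun_prop)
  have e1 := lintegral_map (μ := P) (g := fun ω => ((fun i ↦ X' i ω), S ω)) hg1
    (hmX''.prodMk hmS)
  have e2 := lintegral_map (μ := P) (g := fun ω => ((fun i ↦ X' i ω), S ω)) hg2
    (hmX''.prodMk hmS)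
  simp only [hXX']
  have hXX'' : ∀ ω, (fun q => X q ω + cv P (X q) S) = fun q => X' q ω + c q / v * S ω + c q := fun ω => by
    funext q; simp [hX', c]
  simp only [hXX'']
  rw [← e1, ← e2, hprod, lintegral_prod _ hg1.aemeasurable, lintegral_prod _ hg2.aemeasurable]
  refine lintegral_congr fun x => ?_
  rw [hV.map_eq hS, ← hvdef]
  have := lintegral_exp_gaussianReal v.toNNReal hvN
    (fun s => A.indicator (1 : (κ → ℝ) → ENNReal) (fun q => x q + c q / v * s))
    (hA1.comp (by fun_prop))
  rw [hvR] at this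
  rw [this]
  refine lintegral_congr fun s => ?_
  congr 1
  funext q
  field_simp
  ring

lemma GaussSpace.measure_ge_le (hV : GaussSpace P V) {X : Ω → ℝ} (hX : X ∈ V) {t v : ℝ}
    (ht : 0 ≤ t) (hv : cv P X X ≤ v) (hv0 : 0 < v) :
    P.real {ω | t ≤ X ω} ≤ Real.exp (-t ^ 2 / (2 * v)) := by
  have hmgf := mgf_gaussianReal (hV.map_eq hX) (t / v)
  have h_int : Integrable (fun ω => Real.exp (t / v * X ω)) P := by
    have := integrable_exp_mul_gaussianReal (μ := 0) (v := (cv P X X).toNNReal) (t / v)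
    rw [← hV.map_eq hX] at this
    exact this.comp_measurable (hV.meas X hX)
  have := measure_ge_le_exp_mul_mgf (μ := P) (X := X) t (t := t / v) (by positivity) h_int
  refine this.trans ?_
  rw [hmgf, ← Real.exp_add]
  refine Real.exp_le_exp.2 ?_
  rw [Real.coe_toNNReal _ (cv_self_nonneg X)]
  have : cv P X X * (t / v) ^ 2 ≤ v * (t / v) ^ 2 := by gcongr
  have e : v * (t / v) ^ 2 = t ^ 2 / v := by field_simp
  have e2 : t / v * t = t ^ 2 / v := by ring
  have e3 : -t ^ 2 / (2 * v) = - (t ^ 2 / v) / 2 := by field_simp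
  rw [e3]
  linarith

end
end WN

end

section

open MeasureTheory ProbabilityTheory
set_option linter.unusedSectionVars false
set_option linter.unusedVariables false

namespace WN

section LocalLemma
variable {Ω : Type} [MeasurableSpace Ω] {P : Measure Ω} [IsProbabilityMeasure P]

lemma real_iInter_insert_ge {good : ℕ → Set Ω} (hm : ∀ u, MeasurableSet (good u)) {c : ℝ}
    (W : Finset ℕ) (w : ℕ)
    (h : P.real ((good w)ᶜ ∩ ⋂ v ∈ W, good v) ≤ c * P.real (⋂ v ∈ W, good v)) :
    (1 - c) * P.real (⋂ v ∈ W, good v) ≤ P.real (⋂ v ∈ insert w W, good v) := by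
  have e : (⋂ v ∈ insert w W, good v) = (⋂ v ∈ W, good v) \ ((good w)ᶜ ∩ ⋂ v ∈ W, good v) := by
    ext ω
    simp only [Finset.mem_insert, Set.mem_iInter, Set.mem_sdiff, Set.mem_inter_iff,
      Set.mem_compl_iff]
    constructor
    · intro h1
      exact ⟨fun v hv => h1 v (Or.inr hv), fun h2 => h2.1 (h1 w (Or.inl rfl))⟩
    · rintro ⟨h1, h2⟩ v (rfl | hv)
      · by_contra h3
        exact h2 ⟨h3, h1⟩
      · exact h1 v hv
  have hm2 : MeasurableSet ((good w)ᶜ ∩ ⋂ v ∈ W, good v) :=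
    (hm w).compl.inter (W.measurableSet_biInter fun v _ => hm v)
  rw [e, measureReal_sdiff Set.inter_subset_right hm2]
  linarith

/-- One-sided local lemma for events with finite range of dependence on a line. -/
lemma local_lemma {good : ℕ → Set Ω} (hm : ∀ u, MeasurableSet (good u)) {δ : ℝ}
    (hδ0 : 0 ≤ δ) (hδ : δ ≤ 1 / 8) (h1 : ∀ u, P.real (good u)ᶜ ≤ δ)
    (h2 : ∀ (u : ℕ) (T : Finset ℕ), (∀ v ∈ T, u + 2 ≤ v ∨ v + 2 ≤ u) →
      P.real ((good u)ᶜ ∩ ⋂ v ∈ T, good v) = P.real (good u)ᶜ * P.real (⋂ v ∈ T, good v))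
    (T : Finset ℕ) (u : ℕ) :
    P.real ((good u)ᶜ ∩ ⋂ v ∈ T, good v) ≤ 2 * δ * P.real (⋂ v ∈ T, good v) := by
  classical
  induction hn : T.card using Nat.strong_induction_on generalizing T u with
  | _ n ih =>
  by_cases huT : u ∈ T
  · have : (good u)ᶜ ∩ ⋂ v ∈ T, good v = ∅ := by
      ext ω
      simp only [Set.mem_inter_iff, Set.mem_compl_iff, Set.mem_iInter, Set.mem_empty_iff_false,
        iff_false, not_and]
      exact fun h h' => h (h' u huT)
    rw [this]
    simp only [measureReal_empty]
    positivity
  set T' := T.filter fun v => u + 2 ≤ v ∨ v + 2 ≤ u with hT'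
  have key : ∀ D : Finset ℕ, D ⊆ T \ T' →
      (1 - 2 * δ) ^ D.card * P.real (⋂ v ∈ T', good v) ≤ P.real (⋂ v ∈ D ∪ T', good v) := by
    intro D
    induction D using Finset.induction_on with
    | empty => intro _; simp
    | insert a s ha ih' =>
      intro hs
      have hs' : s ⊆ T \ T' := fun x hx => hs (Finset.mem_insert_of_mem hx)
      have haT := Finset.mem_sdiff.1 (hs (Finset.mem_insert_self a s))
      have hlt : (s ∪ T').card < n := by
        rw [← hn]
        refine Finset.card_lt_card ⟨?_, fun h => ?_⟩
        · intro x hx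
          rcases Finset.mem_union.1 hx with hx | hx
          · exact (Finset.mem_sdiff.1 (hs' hx)).1
          · exact (Finset.mem_filter.1 hx).1
        · rcases Finset.mem_union.1 (h haT.1) with hx | hx
          · exact ha hx
          · exact haT.2 hx
      have := real_iInter_insert_ge hm (s ∪ T') a (ih _ hlt (s ∪ T') a rfl)
      rw [Finset.insert_union, Finset.card_insert_of_notMem ha, pow_succ']
      refine le_trans ?_ this
      rw [mul_assoc]
      exact mul_le_mul_of_nonneg_left (ih' hs') (by linarith)
  have hcard : (T \ T').card ≤ 2 := by
    have : T \ T' ⊆ {u - 1, u + 1} := by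
      intro v hv
      simp only [hT', Finset.mem_sdiff, Finset.mem_filter, not_and, not_or] at hv
      have h3 : v ≠ u := fun h => huT (h ▸ hv.1)
      have := hv.2 hv.1
      simp only [Finset.mem_insert, Finset.mem_singleton]
      omega
    exact (Finset.card_le_card this).trans Finset.card_le_two
  have h4 := key (T \ T') subset_rfl
  rw [Finset.sdiff_union_of_subset (Finset.filter_subset _ _)] at h4
  have h5 : (1 / 2 : ℝ) ≤ (1 - 2 * δ) ^ (T \ T').card := by
    calc (1 / 2 : ℝ) ≤ (1 - 2 * δ) ^ 2 := by nlinarith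
      _ ≤ _ := pow_le_pow_of_le_one (by linarith) (by linarith) hcard
  have h6 : P.real ((good u)ᶜ ∩ ⋂ v ∈ T, good v) ≤ P.real ((good u)ᶜ ∩ ⋂ v ∈ T', good v) := by
    refine measureReal_mono (Set.inter_subset_inter_right _ ?_)
    exact Set.biInter_subset_biInter_left (fun v hv => (Finset.mem_filter.1 hv).1)
  have h7 := h2 u T' (fun v hv => (Finset.mem_filter.1 hv).2)
  have h8 : 0 ≤ P.real (⋂ v ∈ T', good v) := measureReal_nonneg
  have h9 := h1 u
  nlinarith [mul_le_mul_of_nonneg_right h9 h8, mul_le_mul_of_nonneg_right h5 h8]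

lemma local_lemma_union {good : ℕ → Set Ω} (hm : ∀ u, MeasurableSet (good u)) {δ : ℝ}
    (hδ0 : 0 ≤ δ) (hδ : δ ≤ 1 / 8) (h1 : ∀ u, P.real (good u)ᶜ ≤ δ)
    (h2 : ∀ (u : ℕ) (T : Finset ℕ), (∀ v ∈ T, u + 2 ≤ v ∨ v + 2 ≤ u) →
      P.real ((good u)ᶜ ∩ ⋂ v ∈ T, good v) = P.real (good u)ᶜ * P.real (⋂ v ∈ T, good v))
    (W D : Finset ℕ) :
    (1 - 2 * δ) ^ D.card * P.real (⋂ v ∈ W, good v) ≤ P.real (⋂ v ∈ D ∪ W, good v) := by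
  classical
  induction D using Finset.induction_on with
  | empty => simp
  | insert a s ha ih =>
    rw [Finset.insert_union, Finset.card_insert_of_notMem ha, pow_succ', mul_assoc]
    refine le_trans ?_ (real_iInter_insert_ge hm (s ∪ W) a
      (local_lemma hm hδ0 hδ h1 h2 (s ∪ W) a))
    exact mul_le_mul_of_nonneg_left ih (by linarith)

end LocalLemma

section
variable {Ω : Type} [MeasurableSpace Ω] {P : Measure Ω} [IsProbabilityMeasure P]
  {V : Submodule ℝ (Ω → ℝ)}

/-- The event that the coordinates of `Y + c` in the classes `W` exceed their thresholds. -/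
def thickEvent {Ω κ : Type} (Y : κ → Ω → ℝ) (c th : κ → ℝ) (mac : κ → ℕ) (W : Set ℕ) : Set Ω :=
  {ω | ∀ q, mac q ∈ W → th q ≤ Y q ω + c q}

lemma measurableSet_thresholds {κ : Type} [Finite κ] (p : κ → Prop) (th c : κ → ℝ) :
    MeasurableSet {x : κ → ℝ | ∀ q, p q → th q ≤ x q + c q} := by
  have : {x : κ → ℝ | ∀ q, p q → th q ≤ x q + c q} =
      ⋂ q, {x : κ → ℝ | p q → th q ≤ x q + c q} := by ext; simp
  rw [this]
  refine MeasurableSet.iInter fun q => ?_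
  by_cases h : p q
  · simp only [h, forall_const]
    exact measurableSet_le (by fun_prop) (by fun_prop)
  · simp [h]

lemma GaussSpace.measurableSet_thickEvent (hV : GaussSpace P V) {κ : Type} [Finite κ]
    {Y : κ → Ω → ℝ} (hY : ∀ q, Y q ∈ V) (c th : κ → ℝ) (mac : κ → ℕ) (W : Set ℕ) :
    MeasurableSet (thickEvent Y c th mac W) := by
  have hm : Measurable (fun ω q => Y q ω) := measurable_pi_lambda _ fun q => hV.meas _ (hY q)
  exact hm (measurableSet_thresholds (fun q => mac q ∈ W) th c)

lemma GaussSpace.indepSet_thickEvent (hV : GaussSpace P V) {κ : Type} [Finite κ]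
    {Y Y' : κ → Ω → ℝ} (hY : ∀ q, Y q ∈ V) (hY' : ∀ q, Y' q ∈ V) (c c' th : κ → ℝ)
    (mac : κ → ℕ) (W W' : Set ℕ)
    (h : ∀ q q', mac q ∈ W → mac q' ∈ W' → cv P (Y q) (Y' q') = 0) :
    IndepSet (thickEvent Y c th mac W) (thickEvent Y' c' th mac W') P := by
  have hind := hV.indepFun (κ := {q // mac q ∈ W}) (κ' := {q // mac q ∈ W'})
    (X := fun q => Y q.1) (Y := fun q => Y' q.1) (fun q => hY _) (fun q => hY' _)
    (fun i j => h _ _ i.2 j.2)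
  have m1 := (measurableSet_thresholds (fun _ => True) (fun q : {q // mac q ∈ W} => th q.1)
      (fun q => c q.1))
  have m2 := (measurableSet_thresholds (fun _ => True) (fun q : {q // mac q ∈ W'} => th q.1)
      (fun q => c' q.1))
  refine (indepSet_iff_measure_inter_eq_mul (hV.measurableSet_thickEvent hY _ _ _ _)
    (hV.measurableSet_thickEvent hY' _ _ _ _) P).2 ?_
  have h1 := hind.measure_inter_preimage_eq_mul _ _ m1 m2
  convert h1 using 2
  · congr 1
    · ext ω; simp [thickEvent]
    · ext ω; simp [thickEvent]
  · congr 1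
    ext ω; simp [thickEvent]
  · congr 1
    ext ω; simp [thickEvent]

lemma thickEvent_iInter {Ω κ : Type} (Y : κ → Ω → ℝ) (c th : κ → ℝ) (mac : κ → ℕ)
    (W : Finset ℕ) :
    ⋂ v ∈ W, thickEvent Y c th mac {v} = thickEvent Y c th mac W := by
  ext ω
  simp only [Set.mem_iInter, thickEvent, Set.mem_ofPred_eq, Set.mem_singleton_iff,
    Finset.mem_coe]
  exact ⟨fun h q hq => h _ hq q rfl, fun h v hv q hq => h q (hq ▸ hv)⟩

/-- Removing the classes `D` increases the probability of the thick event by a bounded factor. -/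
lemma GaussSpace.thickEvent_union_ge (hV : GaussSpace P V) {κ : Type} [Finite κ]
    {Y : κ → Ω → ℝ} (hY : ∀ q, Y q ∈ V) (c th : κ → ℝ) (mac : κ → ℕ) {δ : ℝ}
    (hδ0 : 0 ≤ δ) (hδ : δ ≤ 1 / 8)
    (h1 : ∀ I, P.real {ω | ∃ q, mac q = I ∧ Y q ω + c q < th q} ≤ δ)
    (h3 : ∀ q q', mac q + 2 ≤ mac q' → cv P (Y q) (Y q') = 0) (W D : Finset ℕ) :
    (1 - 2 * δ) ^ D.card * P.real (thickEvent Y c th mac W) ≤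
      P.real (thickEvent Y c th mac (D ∪ W : Finset ℕ)) := by
  have hmeas := fun W : Set ℕ => hV.measurableSet_thickEvent hY c th mac W
  rw [← thickEvent_iInter, ← thickEvent_iInter]
  refine local_lemma_union (fun u => hmeas {u}) hδ0 hδ (fun u => ?_) (fun u T hT => ?_) W D
  · convert h1 u using 2
    ext ω
    simp [thickEvent]
  · rw [thickEvent_iInter]
    have := hV.indepSet_thickEvent hY hY c c th mac {u} T (fun q q' hq hq' => by
      have e : mac q = u := hq
      rcases hT _ hq' with h | h
      · exact h3 q q' (by omega)
      · rw [cv_comm]; exact h3 q' q (by omega))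
    have h4 := (indepSet_iff_measure_inter_eq_mul (hmeas _) (hmeas _) P).1 this
    have h5 : P.real (thickEvent Y c th mac {u} ∩ thickEvent Y c th mac T) =
        P.real (thickEvent Y c th mac {u}) * P.real (thickEvent Y c th mac T) := by
      simp only [Measure.real, h4, ENNReal.toReal_mul]
    have h6 := measureReal_inter_add_sdiff (μ := P) (s := thickEvent Y c th mac T) (hmeas {u})
    have h7 : (thickEvent Y c th mac {u})ᶜ ∩ thickEvent Y c th mac T =
        thickEvent Y c th mac T \ thickEvent Y c th mac {u} := by
      rw [Set.inter_comm, Set.sdiff_eq]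
    rw [h7, probReal_compl_eq_one_sub (hmeas _)]
    rw [Set.inter_comm, h5] at h6
    linarith


lemma GaussSpace.shifted_pair_le (hV : GaussSpace P V) {κ : Type} [Finite κ]
    {Y Y' : κ → Ω → ℝ} (hY : ∀ q, Y q ∈ V) (hY' : ∀ q, Y' q ∈ V) {S S' : Ω → ℝ} (hS : S ∈ V)
    (hS' : S' ∈ V) {mac : κ → ℕ} {N : ℕ} (hmac : ∀ q, mac q < N) {th : κ → ℝ} {δ : ℝ}
    (hδ0 : 0 ≤ δ) (hδ : δ ≤ 1 / 8)
    (h2 : ∀ I, P.real {ω | ∃ q, mac q = I ∧ Y q ω + cv P (Y q) S < th q} ≤ δ)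
    (h2' : ∀ I, P.real {ω | ∃ q, mac q = I ∧ Y' q ω + cv P (Y' q) S' < th q} ≤ δ)
    (h3 : ∀ q q', mac q + 2 ≤ mac q' → cv P (Y q) (Y q') = 0)
    (h3' : ∀ q q', mac q + 2 ≤ mac q' → cv P (Y' q) (Y' q') = 0)
    (A : Finset ℕ) (h4 : ∀ q, mac q ∉ A → cv P (Y q) S' = 0 ∧ cv P (Y' q) S = 0)
    (h4' : ∀ q q', mac q ∉ A → mac q' ∉ A → cv P (Y q) (Y' q') = 0) :
    P.real {ω | (∀ q, th q ≤ Y q ω + cv P (Y q) (S + S')) ∧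
        ∀ q, th q ≤ Y' q ω + cv P (Y' q) (S + S')} ≤
      (((1 - 2 * δ) ^ 2)⁻¹) ^ A.card *
        (P.real (thickEvent Y (fun q => cv P (Y q) S) th mac Set.univ) *
          P.real (thickEvent Y' (fun q => cv P (Y' q) S') th mac Set.univ)) := by
  set W : Finset ℕ := Finset.range N \ A
  have hW : ∀ q, mac q ∈ A ∪ W := fun q => by
    simp only [W, Finset.mem_union, Finset.mem_sdiff, Finset.mem_range, hmac q, true_and]
    exact em _
  have hWA : ∀ {n}, n ∈ W → n ∉ A := fun h => (Finset.mem_sdiff.1 h).2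
  have e : ∀ (X : κ → Ω → ℝ) (c : κ → ℝ), thickEvent X c th mac (A ∪ W : Finset ℕ) =
      thickEvent X c th mac Set.univ := by
    intro X c
    ext ω
    simp only [thickEvent, Finset.mem_coe, hW, Set.mem_univ]
  have k1 := hV.thickEvent_union_ge hY (fun q => cv P (Y q) S) th mac hδ0 hδ h2 h3 W A
  have k2 := hV.thickEvent_union_ge hY' (fun q => cv P (Y' q) S') th mac hδ0 hδ h2' h3' W A
  rw [e] at k1 k2
  have hind := hV.indepSet_thickEvent hY hY' (fun q => cv P (Y q) S) (fun q => cv P (Y' q) S') th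
    mac W W (fun q q' h h' => h4' q q' (hWA h) (hWA h'))
  have hind2 := (indepSet_iff_measure_inter_eq_mul (hV.measurableSet_thickEvent hY _ _ _ _)
    (hV.measurableSet_thickEvent hY' _ _ _ _) P).1 hind
  set TW := P.real (thickEvent Y (fun q => cv P (Y q) S) th mac W)
  set TW' := P.real (thickEvent Y' (fun q => cv P (Y' q) S') th mac W)
  set T := P.real (thickEvent Y (fun q => cv P (Y q) S) th mac Set.univ)
  set T' := P.real (thickEvent Y' (fun q => cv P (Y' q) S') th mac Set.univ)
  have hle : P.real {ω | (∀ q, th q ≤ Y q ω + cv P (Y q) (S + S')) ∧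
        ∀ q, th q ≤ Y' q ω + cv P (Y' q) (S + S')} ≤ TW * TW' := by
    have : TW * TW' = P.real (thickEvent Y (fun q => cv P (Y q) S) th mac W ∩
        thickEvent Y' (fun q => cv P (Y' q) S') th mac W) := by
      simp only [TW, TW', Measure.real, hind2, ENNReal.toReal_mul]
    rw [this]
    refine measureReal_mono ?_
    rintro ω ⟨ha, hb⟩
    refine ⟨fun q hq => ?_, fun q hq => ?_⟩
    · have := ha q
      rwa [hV.cv_add_right hS hS' (hY q), (h4 q (hWA hq)).1, add_zero] at this
    · have := hb q
      rwa [hV.cv_add_right hS hS' (hY' q), (h4 q (hWA hq)).2, zero_add] at this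
  refine hle.trans ?_
  have hc : 0 < 1 - 2 * δ := by linarith
  have hp : (0 : ℝ) < (1 - 2 * δ) ^ A.card := pow_pos hc _
  have : (((1 - 2 * δ) ^ 2)⁻¹) ^ A.card = ((1 - 2 * δ) ^ A.card)⁻¹ * ((1 - 2 * δ) ^ A.card)⁻¹ := by
    rw [inv_pow, ← mul_inv, ← mul_pow, sq]
  rw [this, show ∀ a b c : ℝ, a * a * (b * c) = (a * b) * (a * c) by intros; ring]
  have l1 : TW ≤ ((1 - 2 * δ) ^ A.card)⁻¹ * T := by rw [le_inv_mul_iff₀ hp]; exact k1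
  have l2 : TW' ≤ ((1 - 2 * δ) ^ A.card)⁻¹ * T' := by rw [le_inv_mul_iff₀ hp]; exact k2
  exact mul_le_mul l1 l2 measureReal_nonneg (measureReal_nonneg.trans l1)

/-- Second moment method for Gaussian families with planted shifts: if the overlap sum is at most
`1 + η` times the square of the number of candidates, some candidate exceeds all its thresholds
with probability at least `1 / (1 + η)`. -/
theorem GaussSpace.second_moment (hV : GaussSpace P V) {Q κ : Type} [Fintype Q] [Nonempty Q]
    [Finite κ] {Y : Q → κ → Ω → ℝ} (hY : ∀ p q, Y p q ∈ V) {S : Q → Ω → ℝ} (hS : ∀ p, S p ∈ V)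
    {mac : κ → ℕ} {N : ℕ} (hmac : ∀ q, mac q < N) {th : κ → ℝ} {δ η : ℝ}
    (hδ0 : 0 ≤ δ) (hδ : δ ≤ 1 / 8) (hη : 0 ≤ η)
    (h2 : ∀ p I, P.real {ω | ∃ q, mac q = I ∧ Y p q ω + cv P (Y p q) (S p) < th q} ≤ δ)
    (h3 : ∀ p q q', mac q + 2 ≤ mac q' → cv P (Y p q) (Y p q') = 0)
    (A : Q → Q → Finset ℕ)
    (h4 : ∀ p p' q, mac q ∉ A p p' → cv P (Y p q) (S p') = 0 ∧ cv P (Y p' q) (S p) = 0)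
    (h4' : ∀ p p' q q', mac q ∉ A p p' → mac q' ∉ A p p' → cv P (Y p q) (Y p' q') = 0)
    (h5 : ∑ p, ∑ p', Real.exp (cv P (S p) (S p')) * (((1 - 2 * δ) ^ 2)⁻¹) ^ (A p p').card ≤
      (1 + η) * (Fintype.card Q : ℝ) ^ 2) :
    1 / (1 + η) ≤ P.real {ω | ∃ p, ∀ q, th q ≤ Y p q ω} := by
  set T : Q → ℝ := fun p =>
    P.real (thickEvent (Y p) (fun q => cv P (Y p q) (S p)) th mac Set.univ) with hT
  have hTpos : ∀ p, 0 < T p := by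
    intro p
    have := hV.thickEvent_union_ge (hY p) (fun q => cv P (Y p q) (S p)) th mac hδ0 hδ (h2 p) (h3 p)
      ∅ (Finset.range N)
    have e : thickEvent (Y p) (fun q => cv P (Y p q) (S p)) th mac
        (Finset.range N ∪ ∅ : Finset ℕ) =
        thickEvent (Y p) (fun q => cv P (Y p q) (S p)) th mac Set.univ := by
      ext ω; simp [thickEvent, hmac]
    have e2 : thickEvent (Y p) (fun q => cv P (Y p q) (S p)) th mac (∅ : Finset ℕ) =
        Set.univ := by
      ext ω; simp [thickEvent]
    rw [e, e2] at this
    refine lt_of_lt_of_le ?_ this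
    rw [probReal_univ, mul_one]
    exact pow_pos (by linarith) _
  set g : Q → Set Ω := fun p => {ω | ∀ q, th q ≤ Y p q ω}
  have hg : ∀ p, MeasurableSet (g p) := fun p => by
    have := hV.measurableSet_thickEvent (hY p) (fun _ => 0) th mac Set.univ
    convert this using 1
    ext ω; simp [g, thickEvent]
  have hmS : ∀ p, Measurable (S p) := fun p => hV.meas _ (hS p)
  set F : Q → Ω → ENNReal := fun p ω => (g p).indicator 1 ω *
    ENNReal.ofReal (Real.exp (S p ω - cv P (S p) (S p) / 2)) * (ENNReal.ofReal (T p))⁻¹ with hF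
  have hFm : ∀ p, Measurable (F p) := fun p =>
    ((measurable_one.indicator (hg p)).mul
      (((hmS p).sub_const _).exp.ennreal_ofReal)).mul_const _
  have hTne : ∀ p, ENNReal.ofReal (T p) ≠ 0 := fun p => by simp [hTpos p]
  have hF1 : ∀ p, ∫⁻ ω, F p ω ∂P = 1 := by
    intro p
    simp only [hF]
    rw [lintegral_mul_const' _ _ (ENNReal.inv_ne_top.2 (hTne p))]
    have := hV.cameronMartin (hY p) (hS p)
      (measurableSet_thresholds (fun _ => True) th (fun _ => 0))
    have e : ∀ ω, (g p).indicator (1 : Ω → ENNReal) ω =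
        {x : κ → ℝ | ∀ q, True → th q ≤ x q + 0}.indicator 1 (fun q => Y p q ω) := by
      intro ω
      have : {x : κ → ℝ | ∀ q, True → th q ≤ x q + 0} = {x | ∀ q, th q ≤ x q} := by ext; simp
      rw [this]
      rfl
    simp only [e]
    rw [this, ← ofReal_measureReal]
    convert ENNReal.mul_inv_cancel (hTne p) ENNReal.ofReal_ne_top using 3
    simp only [hT]
    congr 1
    ext ω
    simp [thickEvent]
  have hF2 : ∀ p p', ∫⁻ ω, F p ω * F p' ω ∂P ≤ ENNReal.ofReal
      (Real.exp (cv P (S p) (S p')) * (((1 - 2 * δ) ^ 2)⁻¹) ^ (A p p').card) := by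
    intro p p'
    have hSS := V.add_mem (hS p) (hS p')
    set C : Set (κ ⊕ κ → ℝ) := {x | ∀ q, True → Sum.elim th th q ≤ x q + 0}
    have hCM := hV.cameronMartin (X := fun q : κ ⊕ κ => Sum.elim (Y p) (Y p') q)
      (by rintro (q | q); exacts [hY p q, hY p' q]) hSS
      (measurableSet_thresholds (fun _ => True) (Sum.elim th th) (fun _ => 0))
    have hv : cv P (S p + S p') (S p + S p') =
        cv P (S p) (S p) + cv P (S p') (S p') + 2 * cv P (S p) (S p') := by
      rw [hV.cv_add_left (hS p) (hS p') hSS, hV.cv_add_right (hS p) (hS p') (hS p),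
        hV.cv_add_right (hS p) (hS p') (hS p'), cv_comm (S p') (S p)]
      ring
    have e : ∀ ω, F p ω * F p' ω = (C.indicator 1 (fun q => Sum.elim (Y p) (Y p') q ω) *
        ENNReal.ofReal (Real.exp ((S p + S p') ω - cv P (S p + S p') (S p + S p') / 2))) *
        (ENNReal.ofReal (Real.exp (cv P (S p) (S p'))) *
          ((ENNReal.ofReal (T p))⁻¹ * (ENNReal.ofReal (T p'))⁻¹)) := by
      intro ω
      have e1 : C.indicator (1 : (κ ⊕ κ → ℝ) → ENNReal) (fun q => Sum.elim (Y p) (Y p') q ω) =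
          (g p).indicator 1 ω * (g p').indicator 1 ω := by
        by_cases ha : ω ∈ g p <;> by_cases hb : ω ∈ g p' <;>
          simp only [Set.indicator, ha, hb, if_true, if_false, C] <;>
          simp only [g, Set.mem_ofPred_eq] at ha hb <;> simp [ha, hb]
      have e2 : ENNReal.ofReal (Real.exp (S p ω - cv P (S p) (S p) / 2)) *
          ENNReal.ofReal (Real.exp (S p' ω - cv P (S p') (S p') / 2)) =
          ENNReal.ofReal (Real.exp ((S p + S p') ω - cv P (S p + S p') (S p + S p') / 2)) *
          ENNReal.ofReal (Real.exp (cv P (S p) (S p'))) := by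
        rw [← ENNReal.ofReal_mul (Real.exp_nonneg _), ← ENNReal.ofReal_mul (Real.exp_nonneg _),
          ← Real.exp_add, ← Real.exp_add, hv]
        congr 2
        simp only [Pi.add_apply]
        ring
      simp only [hF]
      rw [e1]
      calc _ = ((g p).indicator 1 ω * (g p').indicator 1 ω) *
            (ENNReal.ofReal (Real.exp (S p ω - cv P (S p) (S p) / 2)) *
          ENNReal.ofReal (Real.exp (S p' ω - cv P (S p') (S p') / 2))) *
          ((ENNReal.ofReal (T p))⁻¹ * (ENNReal.ofReal (T p'))⁻¹) := by ring
        _ = _ := by rw [e2]; ring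
    simp only [e]
    rw [lintegral_mul_const' _ _ (ENNReal.mul_ne_top ENNReal.ofReal_ne_top
      (ENNReal.mul_ne_top (ENNReal.inv_ne_top.2 (hTne p)) (ENNReal.inv_ne_top.2 (hTne p')))), hCM,
      ← ofReal_measureReal]
    have k := hV.shifted_pair_le (hY p) (hY p') (hS p) (hS p') hmac hδ0 hδ (h2 p) (h2 p') (h3 p)
      (h3 p') (A p p') (h4 p p') (h4' p p')
    rw [← ENNReal.ofReal_inv_of_pos (hTpos p), ← ENNReal.ofReal_inv_of_pos (hTpos p'),
      ← ENNReal.ofReal_mul (inv_nonneg.2 (hTpos p).le), ← ENNReal.ofReal_mul (Real.exp_nonneg _),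
      ← ENNReal.ofReal_mul measureReal_nonneg]
    refine ENNReal.ofReal_le_ofReal ?_
    have e3 : {ω | (fun q => Sum.elim (Y p) (Y p') q ω + cv P (Sum.elim (Y p) (Y p') q)
          (S p + S p')) ∈ {x : κ ⊕ κ → ℝ | ∀ q, True → Sum.elim th th q ≤ x q + 0}} =
        {ω | (∀ q, th q ≤ Y p q ω + cv P (Y p q) (S p + S p')) ∧
        ∀ q, th q ≤ Y p' q ω + cv P (Y p' q) (S p + S p')} := by
      ext ω; simp
    rw [e3]
    have hx := hTpos p
    have hx' := hTpos p'
    calc _ ≤ _ := mul_le_mul_of_nonneg_right k (by positivity)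
      _ = Real.exp (cv P (S p) (S p')) * (((1 - 2 * δ) ^ 2)⁻¹) ^ (A p p').card *
          ((T p * (T p)⁻¹) * (T p' * (T p')⁻¹)) := by ring
      _ = _ := by rw [mul_inv_cancel₀ hx.ne', mul_inv_cancel₀ hx'.ne', mul_one, mul_one]
  set G : Set Ω := {ω | ∃ p, ∀ q, th q ≤ Y p q ω}
  have hG : MeasurableSet G := by
    have : G = ⋃ p, g p := by ext; simp [G, g]
    rw [this]; exact MeasurableSet.iUnion hg
  set a : ENNReal := ENNReal.ofReal ((1 + η) * Fintype.card Q) with ha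
  have hpt : ∀ ω, 2 * a * ∑ p, F p ω ≤ ∑ p, ∑ p', F p ω * F p' ω + a ^ 2 * G.indicator 1 ω := by
    intro ω
    by_cases hω : ω ∈ G
    · rw [← Finset.sum_mul_sum, Set.indicator_of_mem hω, Pi.one_apply, mul_one]
      by_cases htop : ∑ p, F p ω = ⊤
      · rw [htop]; simp
      · lift (∑ p, F p ω) to NNReal using htop with z
        have hat : a = ((((1 + η) * Fintype.card Q).toNNReal : NNReal) : ENNReal) := rfl
        rw [hat]
        generalize ((1 + η) * Fintype.card Q).toNNReal = a'
        norm_cast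
        rw [← NNReal.coe_le_coe]
        push_cast
        nlinarith [sq_nonneg ((a' : ℝ) - z)]
    · have : ∀ p, F p ω = 0 := by
        intro p
        have : ω ∉ g p := fun h => hω ⟨p, h⟩
        simp [hF, this]
      simp [this]
  have h_int := lintegral_mono (μ := P) hpt
  rw [lintegral_const_mul _ (Finset.measurable_sum _ fun p _ => hFm p),
    lintegral_finsetSum _ (fun p _ => hFm p), lintegral_add_left (by fun_prop),
    lintegral_const_mul _ (measurable_one.indicator hG), lintegral_indicator_one hG,
    lintegral_finsetSum _ (fun p _ => by fun_prop)] at h_int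
  simp only [hF1, Finset.sum_const, Finset.card_univ, nsmul_eq_mul, mul_one] at h_int
  have hsum : ∑ p, ∫⁻ ω, ∑ p', F p ω * F p' ω ∂P ≤
      ENNReal.ofReal ((1 + η) * (Fintype.card Q : ℝ) ^ 2) := by
    refine le_trans ?_ (ENNReal.ofReal_le_ofReal h5)
    have hc : (0 : ℝ) < 1 - 2 * δ := by linarith
    rw [ENNReal.ofReal_sum_of_nonneg (fun p _ => by positivity)]
    refine Finset.sum_le_sum fun p _ => ?_
    rw [ENNReal.ofReal_sum_of_nonneg (fun p _ => by positivity),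
      lintegral_finsetSum _ (fun p' _ => show Measurable fun ω => F p ω * F p' ω from
        (hFm p).mul (hFm p'))]
    exact Finset.sum_le_sum fun p' _ => hF2 p p'
  have h6 := h_int.trans (add_le_add_left hsum _)
  have hcard : (0 : ℝ) < Fintype.card Q := by exact_mod_cast Fintype.card_pos
  rw [ha, ← ofReal_measureReal (s := G), ← ENNReal.ofReal_natCast, ← ENNReal.ofReal_ofNat,
    ← ENNReal.ofReal_mul (by norm_num), ← ENNReal.ofReal_mul (by positivity),
    ← ENNReal.ofReal_pow (by positivity), ← ENNReal.ofReal_mul (by positivity),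
    ← ENNReal.ofReal_add (by positivity) (by positivity),
    ENNReal.ofReal_le_ofReal_iff (by positivity)] at h6
  have hpos : 0 < (1 + η) * (Fintype.card Q : ℝ) ^ 2 := by positivity
  rw [div_le_iff₀ (by linarith)]
  have : (1 + η) * (Fintype.card Q : ℝ) ^ 2 * 1 ≤
      (1 + η) * (Fintype.card Q : ℝ) ^ 2 * (P.real G * (1 + η)) := by nlinarith
  exact le_of_mul_le_mul_left this hpos

end
end WN

end

section

open MeasureTheory ProbabilityTheory

set_option linter.unusedSectionVars false

namespace WN

section Ratio
variable {d : ℕ} [NeZero d]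

/-- Normalised volume of the intersection of two balls of radius `t`. -/
noncomputable def ratio (t : ℝ) (x y : EuclideanSpace ℝ (Fin d)) : ℝ :=
  (volume (Metric.ball x t ∩ Metric.ball y t)).toReal /
    (volume (Metric.ball (0 : EuclideanSpace ℝ (Fin d)) t)).toReal

lemma vol_ball_pos (x : EuclideanSpace ℝ (Fin d)) {t : ℝ} (ht : 0 < t) :
    0 < (volume (Metric.ball x t)).toReal :=
  ENNReal.toReal_pos (Metric.measure_ball_pos _ _ ht).ne' measure_ball_lt_top.ne

lemma vol_ball (x : EuclideanSpace ℝ (Fin d)) {t : ℝ} (ht : 0 ≤ t) :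
    (volume (Metric.ball x t)).toReal =
      t ^ d * (volume (Metric.ball (0 : EuclideanSpace ℝ (Fin d)) 1)).toReal := by
  haveI : Nontrivial (EuclideanSpace ℝ (Fin d)) :=
    (WithLp.equiv 2 (Fin d → ℝ)).nontrivial
  rw [Measure.addHaar_ball _ _ ht, ENNReal.toReal_mul, ENNReal.toReal_ofReal (by positivity),
    finrank_euclideanSpace, Fintype.card_fin]

lemma vol_inter_ne_top (x y : EuclideanSpace ℝ (Fin d)) (t : ℝ) :
    volume (Metric.ball x t ∩ Metric.ball y t) ≠ ⊤ :=
  ne_top_of_le_ne_top measure_ball_lt_top.ne (measure_mono Set.inter_subset_left)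

lemma ratio_nonneg (t : ℝ) (x y : EuclideanSpace ℝ (Fin d)) : 0 ≤ ratio t x y := by
  unfold ratio; positivity

lemma ratio_comm (t : ℝ) (x y : EuclideanSpace ℝ (Fin d)) : ratio t x y = ratio t y x := by
  unfold ratio; rw [Set.inter_comm]

lemma ratio_le_of_subset {t s : ℝ} (ht : 0 < t) (hs : 0 ≤ s) {x y z : EuclideanSpace ℝ (Fin d)}
    (h : Metric.ball x t ∩ Metric.ball y t ⊆ Metric.ball z s) : ratio t x y ≤ (s / t) ^ d := by
  have h1 := ENNReal.toReal_mono (measure_ball_lt_top (μ := volume)).ne (measure_mono (μ := volume) h)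
  rw [vol_ball z hs] at h1
  unfold ratio
  have h2 := vol_ball_pos (0 : EuclideanSpace ℝ (Fin d)) one_pos
  rw [vol_ball 0 ht.le, div_le_iff₀ (by positivity), div_pow, ← mul_assoc,
    div_mul_cancel₀ _ (by positivity)]
  exact h1

lemma le_ratio_of_subset {t s : ℝ} (ht : 0 < t) (hs : 0 ≤ s) {x y z : EuclideanSpace ℝ (Fin d)}
    (h : Metric.ball z s ⊆ Metric.ball x t ∩ Metric.ball y t) : (s / t) ^ d ≤ ratio t x y := by
  have h1 := ENNReal.toReal_mono (vol_inter_ne_top x y t) (measure_mono (μ := volume) h)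
  rw [vol_ball z hs] at h1
  unfold ratio
  have h2 := vol_ball_pos (0 : EuclideanSpace ℝ (Fin d)) one_pos
  rw [vol_ball 0 ht.le, le_div_iff₀ (by positivity), div_pow, ← mul_assoc,
    div_mul_cancel₀ _ (by positivity)]
  exact h1

lemma ratio_self {t : ℝ} (ht : 0 < t) (x : EuclideanSpace ℝ (Fin d)) : ratio t x x = 1 := by
  unfold ratio
  rw [Set.inter_self, vol_ball x ht.le, vol_ball 0 ht.le]
  have h2 := vol_ball_pos (0 : EuclideanSpace ℝ (Fin d)) one_pos
  exact div_self (by positivity)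

lemma ratio_le_one {t : ℝ} (ht : 0 < t) (x y : EuclideanSpace ℝ (Fin d)) : ratio t x y ≤ 1 := by
  have := ratio_le_of_subset (y := y) ht ht.le (Set.inter_subset_left (s := Metric.ball x t))
  rwa [div_self ht.ne', one_pow] at this

lemma ratio_eq_zero {t : ℝ} {x y : EuclideanSpace ℝ (Fin d)} (h : 2 * t ≤ dist x y) :
    ratio t x y = 0 := by
  unfold ratio
  rw [Set.disjoint_iff_inter_eq_empty.1 (Metric.ball_disjoint_ball (by linarith))]
  simp

lemma ratio_le_exp {t : ℝ} (ht : 0 < t) (x y : EuclideanSpace ℝ (Fin d)) :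
    ratio t x y ≤ Real.exp (-(d * dist x y ^ 2 / (8 * t ^ 2))) := by
  by_cases h2 : 2 * t ≤ dist x y
  · rw [ratio_eq_zero h2]; positivity
  push Not at h2
  have hd0 : 0 ≤ dist x y := dist_nonneg
  have hpos : 0 ≤ t ^ 2 - dist x y ^ 2 / 4 := by nlinarith
  have hsub : Metric.ball x t ∩ Metric.ball y t ⊆
      Metric.ball (midpoint ℝ x y) (√(t ^ 2 - dist x y ^ 2 / 4)) := by
    rintro w ⟨h3, h4⟩
    rw [Metric.mem_ball] at *
    refine Real.lt_sqrt_of_sq_lt ?_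
    have hp := EuclideanGeometry.dist_sq_add_dist_sq_eq_two_mul_dist_midpoint_sq_add_half_dist_sq
      w x y
    have : dist w x ^ 2 < t ^ 2 := by gcongr
    have : dist w y ^ 2 < t ^ 2 := by gcongr
    nlinarith
  refine (ratio_le_of_subset ht (Real.sqrt_nonneg _) hsub).trans ?_
  have e : √(t ^ 2 - dist x y ^ 2 / 4) / t = √(1 - dist x y ^ 2 / (4 * t ^ 2)) := by
    have h0 : √(t ^ 2 - dist x y ^ 2 / 4) / √(t ^ 2) = √(1 - dist x y ^ 2 / (4 * t ^ 2)) := by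
      rw [← Real.sqrt_div hpos]
      congr 1
      field_simp
    rwa [Real.sqrt_sq ht.le] at h0
  rw [e]
  have h5 : √(1 - dist x y ^ 2 / (4 * t ^ 2)) ≤ Real.exp (-(dist x y ^ 2 / (8 * t ^ 2))) := by
    refine Real.sqrt_le_iff.2 ⟨(Real.exp_pos _).le, ?_⟩
    rw [← Real.exp_nat_mul]
    refine le_trans ?_ (Real.add_one_le_exp _)
    have : ((2 : ℕ) : ℝ) * -(dist x y ^ 2 / (8 * t ^ 2)) = - (dist x y ^ 2 / (4 * t ^ 2)) := by
      push_cast; field_simp; ring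
    rw [this]; linarith
  calc _ ≤ (Real.exp (-(dist x y ^ 2 / (8 * t ^ 2)))) ^ d := by gcongr
    _ = _ := by rw [← Real.exp_nat_mul]; congr 1; ring

lemma one_sub_ratio_le {t : ℝ} (ht : 0 < t) (x y : EuclideanSpace ℝ (Fin d)) :
    1 - ratio t x y ≤ d * dist x y / (2 * t) := by
  by_cases h2 : 2 * t ≤ dist x y
  · rw [ratio_eq_zero h2, sub_zero]
    rcases Nat.eq_zero_or_pos d with hd | hd
    · subst hd
      have : dist x y = 0 := by rw [Subsingleton.elim x y, dist_self]
      linarith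
    · have : (1 : ℝ) ≤ d := by exact_mod_cast hd
      rw [le_div_iff₀ (by positivity)]
      nlinarith
  push Not at h2
  have hd0 : 0 ≤ dist x y := dist_nonneg
  have hsub : Metric.ball (midpoint ℝ x y) (t - dist x y / 2) ⊆
      Metric.ball x t ∩ Metric.ball y t := by
    refine Set.subset_inter (Metric.ball_subset_ball' ?_) (Metric.ball_subset_ball' ?_)
    · rw [dist_midpoint_left]; norm_num; linarith
    · rw [dist_midpoint_right]; norm_num; linarith
  have h3 := le_ratio_of_subset ht (by linarith) hsub
  have h4 := one_add_mul_le_pow (a := (t - dist x y / 2) / t - 1) (by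
    have : 0 ≤ (t - dist x y / 2) / t := div_nonneg (by linarith) ht.le
    linarith) d
  rw [add_sub_cancel] at h4
  have : (d : ℝ) * dist x y / (2 * t) = - (d * ((t - dist x y / 2) / t - 1)) := by
    field_simp; ring
  linarith

lemma half_le_ratio {t : ℝ} (ht : 0 < t) {x y : EuclideanSpace ℝ (Fin d)} (h : dist x y < t) :
    √(1 - d * dist x y ^ 2 / t ^ 2) / 2 ≤ ratio t x y := by
  have hd0 : 0 ≤ dist x y := dist_nonneg
  have hpos : 0 ≤ t ^ 2 - dist x y ^ 2 := by nlinarith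
  set ρ := √(t ^ 2 - dist x y ^ 2) with hρ
  set H : Set (EuclideanSpace ℝ (Fin d)) :=
    Metric.ball x ρ ∩ {w | 0 ≤ inner ℝ (w - x) (y - x)}
  set H' : Set (EuclideanSpace ℝ (Fin d)) :=
    Metric.ball x ρ ∩ {w | inner ℝ (w - x) (y - x) ≤ 0}
  have hρ2 : ρ ^ 2 = t ^ 2 - dist x y ^ 2 := Real.sq_sqrt hpos
  have hρ0 : 0 ≤ ρ := Real.sqrt_nonneg _
  have hρt : ρ ≤ t := by nlinarith [sq_nonneg (dist x y)]
  have hsub : H ⊆ Metric.ball x t ∩ Metric.ball y t := by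
    rintro w ⟨h1, h2⟩
    refine ⟨Metric.ball_subset_ball hρt h1, ?_⟩
    rw [Metric.mem_ball, dist_eq_norm] at h1 ⊢
    have e : ‖w - y‖ ^ 2 = ‖w - x‖ ^ 2 - 2 * inner ℝ (w - x) (y - x) + ‖y - x‖ ^ 2 := by
      rw [← norm_sub_sq_real]; congr 2; abel
    have e2 : ‖y - x‖ = dist x y := by rw [dist_comm, dist_eq_norm]
    have h2' : 0 ≤ inner ℝ (w - x) (y - x) := h2
    rw [e2] at e
    have : ‖w - x‖ ^ 2 < ρ ^ 2 := by gcongr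
    exact lt_of_pow_lt_pow_left₀ 2 ht.le (by linarith)
  have hH : volume H' = volume H := by
    have := (Measure.measurePreserving_sub_left volume (x + x : EuclideanSpace ℝ (Fin d)))
    have h3 := this.measure_preimage_emb (MeasurableEquiv.subLeft (x + x)).measurableEmbedding H
    rw [← h3]
    congr 1
    ext w
    simp only [H, H', Set.mem_inter_iff, Metric.mem_ball, Set.mem_ofPred_eq, Set.mem_preimage]
    have e1 : x + x - w - x = -(w - x) := by abel
    rw [dist_eq_norm, dist_eq_norm, e1, norm_neg, inner_neg_left, neg_nonneg]
  have hcov : Metric.ball x ρ ⊆ H ∪ H' := by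
    intro w hw
    rcases le_total 0 (inner ℝ (w - x) (y - x)) with h1 | h1
    · exact Or.inl ⟨hw, h1⟩
    · exact Or.inr ⟨hw, h1⟩
  have h1 : volume (Metric.ball x ρ) ≤ 2 * volume (Metric.ball x t ∩ Metric.ball y t) := by
    calc _ ≤ volume (H ∪ H') := measure_mono hcov
      _ ≤ volume H + volume H' := measure_union_le _ _
      _ = 2 * volume H := by rw [hH, two_mul]
      _ ≤ _ := by gcongr
  have h2 := ENNReal.toReal_mono (ENNReal.mul_ne_top (by norm_num) (vol_inter_ne_top x y t)) h1
  rw [ENNReal.toReal_mul, vol_ball x hρ0] at h2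
  have h3 := vol_ball_pos (0 : EuclideanSpace ℝ (Fin d)) one_pos
  have h4 : (ρ / t) ^ d / 2 ≤ ratio t x y := by
    unfold ratio
    rw [vol_ball 0 ht.le, le_div_iff₀ (by positivity)]
    have : (ρ / t) ^ d / 2 * (t ^ d * (volume (Metric.ball (0 : EuclideanSpace ℝ (Fin d)) 1)).toReal)
      = ρ ^ d * (volume (Metric.ball (0 : EuclideanSpace ℝ (Fin d)) 1)).toReal / 2 := by
      rw [div_pow]
      field_simp
    rw [this]
    have h5 : (2 : ENNReal).toReal = 2 := rfl
    rw [h5] at h2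
    linarith
  refine le_trans ?_ h4
  gcongr
  refine Real.sqrt_le_iff.2 ⟨by positivity, ?_⟩
  rw [← pow_mul, mul_comm d 2, pow_mul, div_pow, hρ2]
  have h5 := one_add_mul_le_pow (a := (t ^ 2 - dist x y ^ 2) / t ^ 2 - 1) (by
    have : 0 ≤ (t ^ 2 - dist x y ^ 2) / t ^ 2 := by positivity
    linarith) d
  rw [add_sub_cancel] at h5
  refine le_trans (le_of_eq ?_) h5
  field_simp
  ring

end Ratio

section Kernel
variable {d : ℕ} [NeZero d]

/-- The dyadic scale `2⁻ⁱ`. -/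
noncomputable def sc (i : ℕ) : ℝ := (2 : ℝ) ^ (-(i : ℤ))

lemma sc_pos (i : ℕ) : 0 < sc i := by unfold sc; positivity

lemma sc_succ (i : ℕ) : sc (i + 1) = sc i / 2 := by
  unfold sc
  push_cast
  rw [neg_add, zpow_add₀ (by norm_num)]
  norm_num
  ring

lemma sc_anti : Antitone sc := antitone_nat_of_succ_le fun i => by
  rw [sc_succ]; linarith [sc_pos i]

/-- Covariance of the `i`-th scale of the white noise field. -/
noncomputable def scaleCov (i : ℕ) (x y : EuclideanSpace ℝ (Fin d)) : ℝ :=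
  ∫ t in Set.Ioc (sc (i + 1)) (sc i), ratio t x y * t⁻¹

lemma measurable_ratio (x y : EuclideanSpace ℝ (Fin d)) : Measurable fun t => ratio t x y := by
  have h1 : Monotone fun t : ℝ => (volume (Metric.ball x t ∩ Metric.ball y t)).toReal :=
    fun a b h => ENNReal.toReal_mono (vol_inter_ne_top x y b)
      (measure_mono (Set.inter_subset_inter (Metric.ball_subset_ball h) (Metric.ball_subset_ball h)))
  have h2 : Monotone fun t : ℝ => (volume (Metric.ball (0 : EuclideanSpace ℝ (Fin d)) t)).toReal :=
    fun a b h => ENNReal.toReal_mono measure_ball_lt_top.ne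
      (measure_mono (Metric.ball_subset_ball h))
  exact h1.measurable.div h2.measurable

lemma integrableOn_ratio {a b : ℝ} (ha : 0 < a) (x y : EuclideanSpace ℝ (Fin d)) :
    IntegrableOn (fun t => ratio t x y * t⁻¹) (Set.Ioc a b) := by
  refine Measure.integrableOn_of_bounded (M := a⁻¹) (by simp)
    ((measurable_ratio x y).mul measurable_inv).aestronglyMeasurable ?_
  refine (ae_restrict_iff' measurableSet_Ioc).2 (Filter.Eventually.of_forall fun t ht => ?_)
  have h0 : 0 < t := ha.trans ht.1
  rw [Real.norm_of_nonneg (mul_nonneg (ratio_nonneg _ _ _) (by positivity))]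
  calc _ ≤ 1 * t⁻¹ := by gcongr; exact ratio_le_one h0 x y
    _ ≤ a⁻¹ := by rw [one_mul]; exact inv_anti₀ ha ht.1.le

lemma integral_inv_scale (i : ℕ) : ∫ t in Set.Ioc (sc (i + 1)) (sc i), t⁻¹ = Real.log 2 := by
  rw [← intervalIntegral.integral_of_le (sc_anti (Nat.le_succ i)),
    integral_inv_of_pos (sc_pos _) (sc_pos _), sc_succ]
  congr 1
  have := sc_pos i
  field_simp

lemma integrableOn_inv_scale (i : ℕ) : IntegrableOn (fun t : ℝ => t⁻¹) (Set.Ioc (sc (i + 1)) (sc i)) := by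
  have := (intervalIntegral.intervalIntegrable_inv (μ := volume) (f := fun t : ℝ => t)
    (a := sc (i + 1)) (b := sc i) (fun x hx => by
      rw [Set.uIcc_of_le (sc_anti (Nat.le_succ i))] at hx
      exact ((sc_pos _).trans_le hx.1).ne') continuousOn_id)
  exact (intervalIntegrable_iff_integrableOn_Ioc_of_le (sc_anti (Nat.le_succ i))).1 this

lemma scaleCov_le_of {i : ℕ} {x y : EuclideanSpace ℝ (Fin d)} {c : ℝ}
    (h : ∀ t, sc (i + 1) < t → t ≤ sc i → ratio t x y ≤ c) :
    scaleCov i x y ≤ c * Real.log 2 := by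
  rw [← integral_inv_scale i, ← integral_const_mul]
  refine setIntegral_mono_on (integrableOn_ratio (sc_pos _) x y)
    ((integrableOn_inv_scale i).const_mul c) measurableSet_Ioc fun t ht => ?_
  have : 0 < t := (sc_pos _).trans ht.1
  have := h t ht.1 ht.2
  gcongr

lemma le_scaleCov_of {i : ℕ} {x y : EuclideanSpace ℝ (Fin d)} {c : ℝ}
    (h : ∀ t, sc (i + 1) < t → t ≤ sc i → c ≤ ratio t x y) :
    c * Real.log 2 ≤ scaleCov i x y := by
  rw [← integral_inv_scale i, ← integral_const_mul]
  refine setIntegral_mono_on ((integrableOn_inv_scale i).const_mul c)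
    (integrableOn_ratio (sc_pos _) x y) measurableSet_Ioc fun t ht => ?_
  have : 0 < t := (sc_pos _).trans ht.1
  have := h t ht.1 ht.2
  gcongr

lemma scaleCov_comm (i : ℕ) (x y : EuclideanSpace ℝ (Fin d)) : scaleCov i x y = scaleCov i y x := by
  unfold scaleCov
  simp only [ratio_comm]

lemma scaleCov_nonneg (i : ℕ) (x y : EuclideanSpace ℝ (Fin d)) : 0 ≤ scaleCov i x y := by
  have := le_scaleCov_of (i := i) (x := x) (y := y) (c := 0) fun t _ _ => ratio_nonneg t x y
  simpa using this

lemma scaleCov_self (i : ℕ) (x : EuclideanSpace ℝ (Fin d)) : scaleCov i x x = Real.log 2 := by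
  have h0 : ∀ {t}, sc (i + 1) < t → 0 < t := fun h => (sc_pos _).trans h
  have h1 := scaleCov_le_of (i := i) (x := x) (y := x) (c := 1)
    fun t h _ => (ratio_self (h0 h) x).le
  have h2 := le_scaleCov_of (i := i) (x := x) (y := x) (c := 1)
    fun t h _ => (ratio_self (h0 h) x).ge
  linarith

lemma scaleCov_le_log (i : ℕ) (x y : EuclideanSpace ℝ (Fin d)) : scaleCov i x y ≤ Real.log 2 := by
  have h1 := scaleCov_le_of (i := i) (x := x) (y := y) (c := 1)
    fun t h _ => ratio_le_one ((sc_pos _).trans h) x y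
  linarith

lemma scaleCov_eq_zero {i : ℕ} {x y : EuclideanSpace ℝ (Fin d)} (h : 2 * sc i ≤ dist x y) :
    scaleCov i x y = 0 := by
  have h1 := scaleCov_le_of (i := i) (x := x) (y := y) (c := 0)
    fun t _ ht => (ratio_eq_zero (by linarith)).le
  linarith [scaleCov_nonneg i x y]

lemma scaleCov_le_exp (i : ℕ) (x y : EuclideanSpace ℝ (Fin d)) :
    scaleCov i x y ≤ Real.exp (-(d * dist x y ^ 2 / (8 * sc i ^ 2))) := by
  have h1 := scaleCov_le_of (i := i) (x := x) (y := y)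
    (c := Real.exp (-(d * dist x y ^ 2 / (8 * sc i ^ 2)))) fun t h ht => by
      have h0 : 0 < t := (sc_pos _).trans h
      refine (ratio_le_exp h0 x y).trans ?_
      gcongr
  refine h1.trans ?_
  nlinarith [Real.exp_pos (-(d * dist x y ^ 2 / (8 * sc i ^ 2))), Real.log_two_lt_d9]

lemma le_scaleCov_of_close {i : ℕ} {x y : EuclideanSpace ℝ (Fin d)}
    (h : d * dist x y ^ 2 ≤ 0.09 * sc (i + 1) ^ 2) : 3 / 10 ≤ scaleCov i x y := by
  have h2 := le_scaleCov_of (i := i) (x := x) (y := y) (c := 0.95 / 2) fun t ht _ => by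
    have hs := sc_pos (i + 1)
    have h0 : 0 < t := hs.trans ht
    have hd : (1 : ℝ) ≤ d := by exact_mod_cast NeZero.one_le
    have h3 : d * dist x y ^ 2 ≤ 0.09 * t ^ 2 := h.trans (by gcongr)
    have h4 : dist x y < t := by
      refine lt_of_pow_lt_pow_left₀ 2 h0.le ?_
      nlinarith [sq_nonneg (dist x y), sq_pos_of_pos h0]
    refine le_trans ?_ (half_le_ratio h0 h4)
    have : (d : ℝ) * dist x y ^ 2 / t ^ 2 ≤ 0.09 := by rwa [div_le_iff₀ (by positivity)]
    gcongr
    refine Real.le_sqrt_of_sq_le ?_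
    norm_num at this ⊢
    linarith
  refine le_trans ?_ h2
  linarith [Real.log_two_gt_d9]

lemma log_sub_scaleCov_le (i : ℕ) (x y : EuclideanSpace ℝ (Fin d)) :
    Real.log 2 - scaleCov i x y ≤ d * dist x y / sc i := by
  have h2 := le_scaleCov_of (i := i) (x := x) (y := y) (c := 1 - d * dist x y / sc i)
    fun t ht _ => by
      have hs := sc_pos (i + 1)
      have h0 : 0 < t := hs.trans ht
      have := one_sub_ratio_le h0 x y
      have h3 : d * dist x y / (2 * t) ≤ d * dist x y / sc i := by
        have := sc_succ i
        have := sc_pos i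
        gcongr
        linarith
      linarith
  have : 0 ≤ d * dist x y / sc i := by have := sc_pos i; positivity
  nlinarith [Real.log_two_gt_d9, Real.log_two_lt_d9]

lemma wnKernel_eq (n m : ℕ) (x y : EuclideanSpace ℝ (Fin d)) :
    wnKernel d n m x y = ∫ t in Set.Ioc (sc (min n m)) 1, ratio t x y * t⁻¹ := by
  unfold wnKernel sc ratio
  push_cast
  rfl

lemma wnKernel_nonneg (n m : ℕ) (x y : EuclideanSpace ℝ (Fin d)) : 0 ≤ wnKernel d n m x y := by
  rw [wnKernel_eq]
  refine setIntegral_nonneg measurableSet_Ioc fun t ht => ?_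
  have : 0 < t := (sc_pos _).trans ht.1
  exact mul_nonneg (ratio_nonneg _ _ _) (by positivity)

lemma integral_succ (n : ℕ) (x y : EuclideanSpace ℝ (Fin d)) :
    ∫ t in Set.Ioc (sc (n + 1)) 1, ratio t x y * t⁻¹ =
      scaleCov n x y + ∫ t in Set.Ioc (sc n) 1, ratio t x y * t⁻¹ := by
  have h0 : sc n ≤ 1 := by
    have := sc_anti (Nat.zero_le n)
    simpa [sc] using this
  have h1 := sc_anti (Nat.le_succ n)
  rw [← Set.Ioc_union_Ioc_eq_Ioc h1 h0, setIntegral_union (by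
    rw [Set.Ioc_disjoint_Ioc]; simp) measurableSet_Ioc (integrableOn_ratio (sc_pos _) x y)
    (integrableOn_ratio (sc_pos _) x y)]
  rfl

end Kernel

section Field
variable {d : ℕ} [NeZero d] {Ω : Type} [MeasurableSpace Ω] {P : Measure Ω} [IsProbabilityMeasure P]
  {h : ℕ → EuclideanSpace ℝ (Fin d) → Ω → ℝ}

/-- The linear space spanned by the field. -/
def fieldSpan (h : ℕ → EuclideanSpace ℝ (Fin d) → Ω → ℝ) : Submodule ℝ (Ω → ℝ) :=
  Submodule.span ℝ {X | ∃ n x, 1 ≤ n ∧ X = h n x}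

omit [NeZero d] in
lemma mem_fieldSpan {n : ℕ} (hn : 1 ≤ n) (x : EuclideanSpace ℝ (Fin d)) : h n x ∈ fieldSpan h :=
  Submodule.subset_span ⟨n, x, hn, rfl⟩

omit [NeZero d] in
lemma gaussSpace_fieldSpan (hh : IsWhiteNoiseField d P h) : GaussSpace P (fieldSpan h) where
  meas X hX := by
    induction hX using Submodule.span_induction with
    | mem X hX => obtain ⟨n, x, -, rfl⟩ := hX; exact hh.1 n x
    | zero => exact measurable_const
    | add X Y _ _ h1 h2 => exact h1.add h2
    | smul a X _ h1 => exact h1.const_smul a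
  law X hX := by
    obtain ⟨N, c, g, rfl⟩ := Submodule.mem_span_set'.1 hX
    choose n x hn hg using fun i => (g i).2
    have key := hh.2.1 N (fun i => (n i, x i)) c hn
    refine ⟨_, Eq.trans ?_ key⟩
    congr 1
    ext ω
    simp only [Finset.sum_apply, Pi.smul_apply, smul_eq_mul, hg]

lemma cv_field (hh : IsWhiteNoiseField d P h) {n m : ℕ} (hn : 1 ≤ n) (hm : 1 ≤ m)
    (x y : EuclideanSpace ℝ (Fin d)) : cv P (h n x) (h m y) = wnKernel d n m x y := by
  have hV := gaussSpace_fieldSpan hh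
  have key : ∀ {X : Ω → ℝ} {q : ℝ}, X ∈ fieldSpan h → 0 ≤ q →
      P.map X = gaussianReal 0 q.toNNReal → cv P X X = q := by
    intro X q hX hq hmap
    have h1 := hV.map_eq hX
    rw [hmap] at h1
    have h2 := congrArg (fun μ => Var[id; μ]) h1
    simp only [variance_id_gaussianReal] at h2
    rw [NNReal.coe_inj, Real.toNNReal_eq_toNNReal_iff hq (cv_self_nonneg _)] at h2
    exact h2.symm
  have hX := mem_fieldSpan (h := h) hn x
  have hY := mem_fieldSpan (h := h) hm y
  have hsym : wnKernel d m n y x = wnKernel d n m x y := by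
    rw [wnKernel_eq, wnKernel_eq, min_comm]; simp only [ratio_comm]
  have h1 : cv P (h n x) (h n x) = wnKernel d n n x x := by
    refine key hX (wnKernel_nonneg _ _ _ _) ?_
    have := hh.2.1 1 (fun _ => (n, x)) (fun _ => 1) (fun _ => hn)
    simpa using this
  have h2 : cv P (h m y) (h m y) = wnKernel d m m y y := by
    refine key hY (wnKernel_nonneg _ _ _ _) ?_
    have := hh.2.1 1 (fun _ => (m, y)) (fun _ => 1) (fun _ => hm)
    simpa using this
  have h3 : cv P (h n x + h m y) (h n x + h m y) =
      wnKernel d n n x x + wnKernel d n m x y + (wnKernel d m n y x + wnKernel d m m y y) := by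
    refine key ((fieldSpan h).add_mem hX hY) ?_ ?_
    · have := fun a b x y => wnKernel_nonneg (d := d) a b x y
      have h1 := this n n x x
      have h2 := this n m x y
      have h3 := this m n y x
      have h4 := this m m y y
      linarith
    · have := hh.2.1 2 ![(n, x), (m, y)] (fun _ => 1) (by
        intro i; fin_cases i <;> simpa)
      simp only [Fin.sum_univ_two, one_mul, Matrix.cons_val_zero, Matrix.cons_val_one] at this
      exact this
  rw [hV.cv_add_left hX hY ((fieldSpan h).add_mem hX hY), hV.cv_add_right hX hY hX,
    hV.cv_add_right hX hY hY, cv_comm (h m y) (h n x), hsym] at h3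
  linarith

/-- The increment of the field over one dyadic scale. -/
def incr (h : ℕ → EuclideanSpace ℝ (Fin d) → Ω → ℝ) (i : ℕ) (x : EuclideanSpace ℝ (Fin d)) :
    Ω → ℝ := h (i + 1) x - h i x

omit [NeZero d] in
lemma incr_mem {i : ℕ} (hi : 1 ≤ i) (x : EuclideanSpace ℝ (Fin d)) : incr h i x ∈ fieldSpan h :=
  (fieldSpan h).sub_mem (mem_fieldSpan (by omega) x) (mem_fieldSpan hi x)

lemma cv_incr (hh : IsWhiteNoiseField d P h) {i i' : ℕ} (hi : 1 ≤ i) (hi' : 1 ≤ i')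
    (x y : EuclideanSpace ℝ (Fin d)) :
    cv P (incr h i x) (incr h i' y) = if i = i' then scaleCov i x y else 0 := by
  have hV := gaussSpace_fieldSpan hh
  have m := fun (n : ℕ) (hn : 1 ≤ n) x => mem_fieldSpan (h := h) hn x
  rw [incr, hV.cv_sub_left (m _ (by omega) x) (m _ hi x) (incr_mem hi' y), incr,
    hV.cv_sub_right (m _ (by omega) y) (m _ hi' y) (m _ (by omega) x),
    hV.cv_sub_right (m _ (by omega) y) (m _ hi' y) (m _ hi x),
    cv_field hh (by omega) (by omega), cv_field hh (by omega) (by omega),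
    cv_field hh (by omega) (by omega), cv_field hh (by omega) (by omega),
    wnKernel_eq, wnKernel_eq, wnKernel_eq, wnKernel_eq]
  rcases lt_trichotomy i i' with hlt | rfl | hlt
  · rw [if_neg hlt.ne, min_eq_left (show i + 1 ≤ i' + 1 by omega),
      min_eq_left (show i + 1 ≤ i' by omega), min_eq_left (show i ≤ i' + 1 by omega),
      min_eq_left hlt.le]
    ring
  · rw [if_pos rfl, min_self, min_eq_right (Nat.le_succ i), min_eq_left (Nat.le_succ i), min_self,
      integral_succ]
    ring
  · rw [if_neg hlt.ne', min_eq_right (show i' + 1 ≤ i + 1 by omega),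
      min_eq_right (show i' ≤ i + 1 by omega), min_eq_right (show i' + 1 ≤ i by omega),
      min_eq_right hlt.le]
    ring

/-- The increment of the field between two dyadic scales. -/
def incrTo (h : ℕ → EuclideanSpace ℝ (Fin d) → Ω → ℝ) (a j : ℕ) (x : EuclideanSpace ℝ (Fin d)) :
    Ω → ℝ := ∑ i ∈ Finset.Ico a j, incr h i x

omit [NeZero d] in
lemma incrTo_eq {a j : ℕ} (haj : a ≤ j) (x : EuclideanSpace ℝ (Fin d)) :
    incrTo h a j x = h j x - h a x := by
  unfold incrTo incr
  rw [Finset.sum_Ico_sub (fun i => h i x) haj]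

omit [NeZero d] in
lemma incrTo_mem {a j : ℕ} (ha : 1 ≤ a) (x : EuclideanSpace ℝ (Fin d)) :
    incrTo h a j x ∈ fieldSpan h :=
  (fieldSpan h).sum_mem fun i hi => incr_mem (by have := Finset.mem_Ico.1 hi; omega) x

lemma cv_incrTo_incr (hh : IsWhiteNoiseField d P h) {a j i : ℕ} (ha : 1 ≤ a) (hi : 1 ≤ i)
    (x y : EuclideanSpace ℝ (Fin d)) :
    cv P (incrTo h a j x) (incr h i y) = if i ∈ Finset.Ico a j then scaleCov i x y else 0 := by
  have hV := gaussSpace_fieldSpan hh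
  have hm : ∀ l ∈ Finset.Ico a j, 1 ≤ l := fun l hl => by have := Finset.mem_Ico.1 hl; omega
  rw [incrTo, hV.cv_sum_left _ (fun l hl => incr_mem (hm l hl) x) (incr_mem hi y),
    Finset.sum_congr rfl fun l hl => cv_incr hh (hm l hl) hi x y, Finset.sum_ite_eq']

lemma cv_incrTo (hh : IsWhiteNoiseField d P h) {a j j' : ℕ} (ha : 1 ≤ a)
    (x y : EuclideanSpace ℝ (Fin d)) :
    cv P (incrTo h a j x) (incrTo h a j' y) =
      ∑ i ∈ Finset.Ico a (min j j'), scaleCov i x y := by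
  have hV := gaussSpace_fieldSpan hh
  have hm : ∀ l ∈ Finset.Ico a j', 1 ≤ l := fun l hl => by have := Finset.mem_Ico.1 hl; omega
  rw [incrTo.eq_def h a j' y, hV.cv_sum_right _ (fun l hl => incr_mem (hm l hl) y)
    (incrTo_mem ha x), Finset.sum_congr rfl fun l hl => cv_incrTo_incr hh ha (hm l hl) x y,
    ← Finset.sum_filter]
  refine Finset.sum_congr ?_ fun _ _ => rfl
  ext l
  simp only [Finset.mem_filter, Finset.mem_Ico]
  omega

end Field
end WN

end

section

open Finset

namespace WN

/-! ### Lazy nearest neighbour sequences -/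

/-- `a` and `b` differ in at most one coordinate, and there by at most one. -/
def Near1 {ι : Type} (a b : ι → ℤ) : Prop := ∃ c, (∀ c', c' ≠ c → b c' = a c') ∧ |b c - a c| ≤ 1

lemma Near1.abs_le {ι : Type} {a b : ι → ℤ} (h : Near1 a b) (c : ι) : |b c - a c| ≤ 1 := by
  obtain ⟨c₀, h1, h2⟩ := h
  by_cases hc : c = c₀
  · rw [hc]; exact h2
  · rw [h1 c hc]; simp

/-- Linear interpolation of a sequence, rescaled by `K`. -/
def interp {ι : Type} (K : ℕ) (f : ℕ → ι → ℤ) (t : ℕ) (c : ι) : ℤ :=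
  K * f (t / K) c + (t % K : ℕ) * (f (t / K + 1) c - f (t / K) c)

lemma interp_succ {ι : Type} {K : ℕ} (hK : 0 < K) (f : ℕ → ι → ℤ) (t : ℕ) (c : ι) :
    interp K f (t + 1) c - interp K f t c = f (t / K + 1) c - f (t / K) c := by
  have ht := Nat.div_add_mod t K
  have hlt := Nat.mod_lt t hK
  unfold interp
  by_cases h : t % K + 1 < K
  · have h1 : (t + 1) / K = t / K := by
      rw [Nat.div_eq_iff hK]
      constructor
      · rw [mul_comm]; omega
      · have : K * (t / K + 1) = K * (t / K) + K := by ring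
        rw [mul_comm]; omega
    have h2 : (t + 1) % K = t % K + 1 := by
      have := Nat.div_add_mod (t + 1) K
      rw [h1] at this; omega
    rw [h1, h2]; push_cast; ring
  · have h3 : t + 1 = K * (t / K + 1) := by rw [mul_add, mul_one]; omega
    have h1 : (t + 1) / K = t / K + 1 := by rw [h3, Nat.mul_div_cancel_left _ hK]
    have h2 : (t + 1) % K = 0 := by rw [h3, Nat.mul_mod_right]
    have h4 : ((t % K : ℕ) : ℤ) = K - 1 := by omega
    rw [h1, h2, h4]; push_cast; ring

lemma near1_interp {ι : Type} {K : ℕ} (hK : 0 < K) {f : ℕ → ι → ℤ} {t : ℕ}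
    (h : Near1 (f (t / K)) (f (t / K + 1))) : Near1 (interp K f t) (interp K f (t + 1)) := by
  obtain ⟨c, h1, h2⟩ := h
  refine ⟨c, fun c' hc' => ?_, ?_⟩
  · have := interp_succ hK f t c'
    rw [h1 c' hc'] at this; omega
  · rw [interp_succ hK]; exact h2

/-! ### The multiscale paths -/

/-- Parameters of the construction: `R` is the scale ratio, `y` the number of level one units in an
eighth of a macroscopic step, `Q` the number of coordinate blocks, `D` the number of options of a
slot, and `G` the number of levels. -/
structure Prm where
  R : ℕ
  y : ℕ
  Q : ℕ
  D : ℕ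
  G : ℕ
  hR : 64 ≤ R
  hy : 1 ≤ y
  hQ : 16 * y + 4 * R + 4 ≤ Q
  hD : 1 ≤ D

namespace Prm
variable (A : Prm)

/-- Number of slots of a unit. -/
abbrev m : ℕ := A.R ^ 4
/-- Number of parent edges of a unit. -/
abbrev L : ℕ := 2 * A.R ^ 3
/-- Number of edges of a unit. -/
abbrev U : ℕ := 4 * A.R ^ 4
/-- The coordinates used by the construction. -/
abbrev Crd : Type := Fin 2 ⊕ Fin 4 ⊕ (Fin A.Q × Fin A.m × Fin A.D)

lemma R_pos : 0 < A.R := by have := A.hR; omega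
lemma m_pos : 0 < A.m := pow_pos A.R_pos 4
lemma L_pos : 0 < A.L := by have := pow_pos A.R_pos 3; unfold L; omega
lemma U_pos : 0 < A.U := by have := A.m_pos; unfold m at this; unfold U; omega
lemma L_mul_R : A.L * A.R = 2 * A.m := by unfold L m; ring
lemma U_eq : A.U = 4 * A.m := rfl
lemma U_eq' : A.U = 2 * A.R * A.L := by unfold U L; ring

/-- Parent edge of an edge. -/
def pe (e : ℕ) : ℕ := e / A.U * A.L + min ((e % A.U - A.m) / A.R) (A.L - 1)

/-- Time along the parent level of a vertex. -/
def bt (e : ℕ) : ℕ := e / A.U * (2 * A.m) + min (e % A.U - A.m) (2 * A.m)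

/-- Slot `s` of unit `j` is switched on at time `e`. -/
def On (e j s : ℕ) : Prop :=
  j = e / A.U ∨ (j + 1 = e / A.U ∧ e % A.U ≤ s) ∨ (j = e / A.U + 1 ∧ s + 3 * A.m < e % A.U)

lemma pe_div (e : ℕ) : A.pe e / A.L = e / A.U := by
  unfold pe
  have := A.L_pos
  rw [mul_comm, Nat.mul_add_div A.L_pos,
    Nat.div_eq_of_lt (lt_of_le_of_lt (min_le_right _ _) (by omega)), add_zero]

lemma pe_div_U (e : ℕ) : A.pe e / A.U = e / A.U / (2 * A.R) := by
  have h : A.U = A.L * (2 * A.R) := by rw [A.U_eq', mul_comm]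
  rw [← A.pe_div e, Nat.div_div_eq_div_mul, ← h]

lemma interp_bt {ι : Type} (f : ℕ → ι → ℤ) (e : ℕ) : ∃ κ : ℤ, 0 ≤ κ ∧ κ ≤ A.R ∧ ∀ c,
    interp A.R f (A.bt e) c = A.R * f (A.pe e) c + κ * (f (A.pe e + 1) c - f (A.pe e) c) := by
  have hR := A.R_pos
  have hL := A.L_pos
  set i := e / A.U
  by_cases h : e % A.U - A.m < 2 * A.m
  · have hbt : A.bt e = A.R * (i * A.L) + (e % A.U - A.m) := by
      unfold bt; rw [min_eq_left h.le, ← A.L_mul_R]; ring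
    have hlt : (e % A.U - A.m) / A.R < A.L := by
      rw [Nat.div_lt_iff_lt_mul hR, A.L_mul_R]; exact h
    have hpe : A.bt e / A.R = A.pe e := by
      rw [hbt, Nat.mul_add_div hR]; unfold pe; rw [min_eq_left (by omega)]
    refine ⟨(A.bt e % A.R : ℕ), by positivity, ?_, fun c => ?_⟩
    · exact_mod_cast (Nat.mod_lt _ hR).le
    · unfold interp; rw [hpe]
  · have hbt : A.bt e = A.R * ((i + 1) * A.L) := by
      unfold bt; rw [min_eq_right (not_lt.1 h), ← A.L_mul_R]; ring
    have hge : A.L ≤ (e % A.U - A.m) / A.R := by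
      rw [Nat.le_div_iff_mul_le hR, A.L_mul_R]; exact not_lt.1 h
    have hpe : A.pe e + 1 = (i + 1) * A.L := by
      change i * A.L + _ + 1 = _
      rw [min_eq_right (by omega), add_mul]; omega
    refine ⟨A.R, by positivity, le_rfl, fun c => ?_⟩
    unfold interp
    rw [hbt, Nat.mul_div_cancel_left _ hR, Nat.mul_mod_right, hpe]
    push_cast; ring

lemma bt_succ_or (e : ℕ) : (A.bt (e + 1) = A.bt e + 1 ∧ ∀ j s, s < A.m →
      (A.On (e + 1) j s ↔ A.On e j s)) ∨
    (A.bt (e + 1) = A.bt e ∧ ∃ j₀ s₀, s₀ < A.m ∧ ∀ j s, s < A.m → (j ≠ j₀ ∨ s ≠ s₀) →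
      (A.On (e + 1) j s ↔ A.On e j s)) := by
  have hm := A.m_pos
  have hU := A.U_eq
  have hdm := Nat.div_add_mod e A.U
  have hlt := Nat.mod_lt e A.U_pos
  have hdm' := Nat.div_add_mod (e + 1) A.U
  have hlt' := Nat.mod_lt (e + 1) A.U_pos
  by_cases hlast : e % A.U + 1 < A.U
  · have h1 : (e + 1) / A.U = e / A.U := by
      rw [Nat.div_eq_iff A.U_pos, mul_comm]
      constructor
      · omega
      · omega
    have h2 : (e + 1) % A.U = e % A.U + 1 := by rw [h1] at hdm'; omega
    unfold On bt
    rw [h1, h2]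
    generalize e / A.U = i at *
    generalize e % A.U = ρ at *
    by_cases hρ : ρ < A.m
    · right
      refine ⟨by omega, i - 1, ρ, hρ, fun j s hs hjs => by omega⟩
    · by_cases hρ2 : ρ < 3 * A.m
      · left
        exact ⟨by omega, fun j s hs => by omega⟩
      · right
        refine ⟨by omega, i + 1, ρ - 3 * A.m, by omega, fun j s hs hjs => by omega⟩
  · have h3 : e + 1 = A.U * (e / A.U + 1) := by rw [mul_add, mul_one]; omega
    have h1 : (e + 1) / A.U = e / A.U + 1 := by rw [h3, Nat.mul_div_cancel_left _ A.U_pos]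
    have h2 : (e + 1) % A.U = 0 := by rw [h3, Nat.mul_mod_right]
    right
    unfold On bt
    rw [h1, h2]
    have h4 : e % A.U = 4 * A.m - 1 := by omega
    rw [h4, add_mul]
    generalize e / A.U = i at *
    refine ⟨by omega, i + 1, A.m - 1, by omega, fun j s hs hjs => by omega⟩

end Prm

/-- Data of a path. -/
structure Pth (A : Prm) where
  v : ℕ
  S : ℕ → Fin 4 → ℤ
  ε : ℕ → ℕ → Fin A.m → Fin A.D
  hS : ∀ I c, |S (I + 1) c - S I c| ≤ 1

namespace Pth
variable {A : Prm} (p : Pth A)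

/-- Macroscopic skeleton of the path. -/
def coarse (t : ℕ) : A.Crd → ℤ
  | .inl j => if j = 0 then 4 * (t / 8 : ℕ) + min (t % 8 : ℕ) 4 else p.v
  | .inr (.inl c) => if (c : ℕ) + 4 < t % 8 then p.S (t / 8 + 1) c else p.S (t / 8) c
  | .inr (.inr _) => 0

open Classical in
/-- Displacements of level `g`. -/
noncomputable def W (g e : ℕ) : A.Crd → ℤ
  | .inl _ => 0
  | .inr (.inl _) => 0
  | .inr (.inr (b, s, o)) =>
    if g ≤ A.G ∧ ∃ j, A.On e j s ∧ j % A.Q = b ∧ p.ε g j s = o then 1 else 0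

/-- Vertices of level `g`. -/
noncomputable def vtx : ℕ → ℕ → A.Crd → ℤ
  | 0 => interp (A.L * A.y) p.coarse
  | g + 1 => fun e c => interp A.R (vtx g) (A.bt e) c + p.W (g + 1) e c

lemma W_nonneg (g e : ℕ) (c : A.Crd) : 0 ≤ p.W g e c := by
  rcases c with j | c | ⟨b, s, o⟩ <;> simp only [W] <;> first | exact le_rfl | (split_ifs <;> simp)

lemma W_le_one (g e : ℕ) (c : A.Crd) : p.W g e c ≤ 1 := by
  rcases c with j | c | ⟨b, s, o⟩ <;> simp only [W] <;>
    first | exact zero_le_one | (split_ifs <;> simp)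

lemma near1_coarse (t : ℕ) : Near1 (p.coarse t) (p.coarse (t + 1)) := by
  have hm : t % 8 < 8 := Nat.mod_lt _ (by norm_num)
  have hdm := Nat.div_add_mod t 8
  have hdm' := Nat.div_add_mod (t + 1) 8
  have hm' : (t + 1) % 8 < 8 := Nat.mod_lt _ (by norm_num)
  by_cases h4 : t % 8 < 4
  · have h1 : (t + 1) / 8 = t / 8 := by omega
    have h2 : (t + 1) % 8 = t % 8 + 1 := by omega
    refine ⟨.inl 0, fun c' hc' => ?_, ?_⟩
    · rcases c' with j | c | w
      · have : j ≠ 0 := fun h => hc' (by rw [h])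
        simp [coarse, this]
      · simp only [coarse, h1, h2]
        rw [if_neg (by omega), if_neg (by omega)]
      · rfl
    · simp only [coarse, h1, h2, if_true]
      rw [min_eq_left (by omega), min_eq_left (by omega)]
      push_cast; simp
  · set c₀ : Fin 4 := ⟨t % 8 - 4, by omega⟩ with hc₀
    refine ⟨.inr (.inl c₀), fun c' hc' => ?_, ?_⟩
    · rcases c' with j | c | w
      · simp only [coarse]
        split_ifs
        · omega
        · rfl
      · have hc : (c : ℕ) ≠ t % 8 - 4 := fun h => hc' (by rw [show c = c₀ from Fin.ext h])
        have := c.2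
        simp only [coarse]
        by_cases h7 : t % 8 = 7
        · have h1 : (t + 1) / 8 = t / 8 + 1 := by omega
          have h2 : (t + 1) % 8 = 0 := by omega
          rw [h1, h2, if_neg (by omega), if_pos (by omega)]
        · have h1 : (t + 1) / 8 = t / 8 := by omega
          have h2 : (t + 1) % 8 = t % 8 + 1 := by omega
          rw [h1, h2]
          by_cases h : (c : ℕ) + 4 < t % 8
          · rw [if_pos h, if_pos (by omega)]
          · rw [if_neg h, if_neg (by omega)]
      · rfl
    · have hcv : (c₀ : ℕ) = t % 8 - 4 := rfl
      have := p.hS (t / 8) c₀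
      simp only [coarse]
      by_cases h7 : t % 8 = 7
      · have h1 : (t + 1) / 8 = t / 8 + 1 := by omega
        have h2 : (t + 1) % 8 = 0 := by omega
        rw [h1, h2, if_neg (by omega), if_neg (by omega)]
        exact this
      · have h1 : (t + 1) / 8 = t / 8 := by omega
        have h2 : (t + 1) % 8 = t % 8 + 1 := by omega
        rw [h1, h2, if_pos (by omega), if_neg (by omega)]
        exact this

lemma near1_vtx (g e : ℕ) : Near1 (p.vtx g e) (p.vtx g (e + 1)) := by
  induction g generalizing e with
  | zero => exact near1_interp (Nat.mul_pos A.L_pos A.hy) (p.near1_coarse _)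
  | succ g ih =>
    rcases A.bt_succ_or e with ⟨h1, h2⟩ | ⟨h1, j₀, s₀, hs₀, h2⟩
    · have hW : ∀ c, p.W (g + 1) (e + 1) c = p.W (g + 1) e c := by
        rintro (j | c | ⟨b, s, o⟩) <;> simp only [W]
        congr 1
        exact propext (and_congr_right fun _ => exists_congr fun j => by rw [h2 j s s.2])
      obtain ⟨c, h3, h4⟩ := near1_interp A.R_pos (ih (A.bt e / A.R))
      refine ⟨c, fun c' hc' => ?_, ?_⟩ <;> simp only [vtx, h1, hW]
      · rw [h3 c' hc']
      · rw [add_sub_add_right_eq_sub]; exact h4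
    · have hW : ∀ c, c ≠ .inr (.inr (⟨j₀ % A.Q, Nat.mod_lt _ (by have := A.hQ; omega)⟩,
          ⟨s₀, hs₀⟩, p.ε (g + 1) j₀ ⟨s₀, hs₀⟩)) → p.W (g + 1) (e + 1) c = p.W (g + 1) e c := by
        rintro (j | c | ⟨b, s, o⟩) hc <;> simp only [W]
        congr 1
        refine propext (and_congr_right fun _ => exists_congr fun j => ?_)
        by_cases hjs : j ≠ j₀ ∨ (s : ℕ) ≠ s₀
        · rw [h2 j s s.2 hjs]
        · push Not at hjs
          obtain ⟨rfl, hs⟩ := hjs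
          have hs' : s = ⟨s₀, hs₀⟩ := Fin.ext hs
          subst hs'
          constructor <;> rintro ⟨-, h5, h6⟩ <;> refine absurd ?_ hc <;> subst h6 <;>
            congr 3 <;> exact Fin.ext h5.symm
      refine ⟨.inr (.inr (⟨j₀ % A.Q, Nat.mod_lt _ (by have := A.hQ; omega)⟩,
          ⟨s₀, hs₀⟩, p.ε (g + 1) j₀ ⟨s₀, hs₀⟩)), fun c' hc' => ?_, ?_⟩
      · simp only [vtx, h1]
        rw [hW c' hc']
      · simp only [vtx, h1, add_sub_add_left_eq_sub]
        generalize (Sum.inr _ : A.Crd) = c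
        rw [abs_le]
        constructor <;> linarith [p.W_nonneg (g + 1) (e + 1) c, p.W_le_one (g + 1) e c,
          p.W_le_one (g + 1) (e + 1) c, p.W_nonneg (g + 1) e c]

end Pth
end WN

end

section

open Finset

namespace WN

namespace Prm
variable (A : Prm)

/-- Number of children of a unit of level `g`. -/
def lam (g : ℕ) : ℕ := if g = 0 then 8 * A.y else 2 * A.R

/-- The unit of an edge of level `g`. -/
def uu (g e : ℕ) : ℕ := if g = 0 then e / (8 * (A.L * A.y)) else e / A.U

lemma lam_pos (g : ℕ) : 0 < A.lam g := by
  have := A.hy; have := A.R_pos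
  unfold lam; split_ifs <;> omega

lemma lam_le (g : ℕ) : 2 * A.lam g ≤ 16 * A.y + 4 * A.R := by unfold lam; split_ifs <;> omega

lemma uu_pe (g e : ℕ) : A.uu g (A.pe e) = A.uu (g + 1) e / A.lam g := by
  unfold uu lam
  rw [if_neg (Nat.succ_ne_zero g)]
  split_ifs with h
  · have : 8 * (A.L * A.y) = A.L * (8 * A.y) := by ring
    rw [this, ← Nat.div_div_eq_div_mul, A.pe_div]
  · exact A.pe_div_U e

lemma uu_bounds {Q' : ℕ} (hQ : 0 < Q') {i i' : ℕ} (h : i / Q' ≤ i' / Q' + 1) : i < i' + 2 * Q' := by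
  have h1 := Nat.div_add_mod i Q'
  have h2 := Nat.mod_lt i hQ
  have h3 := Nat.div_add_mod i' Q'
  have h4 : Q' * (i / Q') ≤ Q' * (i' / Q' + 1) := Nat.mul_le_mul_left _ h
  rw [mul_add] at h4
  omega

lemma interp_bt' {ι : Type} (f : ℕ → ι → ℤ) (e : ℕ) : ∃ κ κ' : ℤ, 0 ≤ κ ∧ κ ≤ κ' ∧ κ' ≤ A.R ∧
    (∀ c, interp A.R f (A.bt e) c = A.R * f (A.pe e) c + κ * (f (A.pe e + 1) c - f (A.pe e) c)) ∧
    ∀ c, interp A.R f (A.bt (e + 1)) c =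
      A.R * f (A.pe e) c + κ' * (f (A.pe e + 1) c - f (A.pe e) c) := by
  have hR := A.R_pos
  have hL := A.L_pos
  have hlt := Nat.mod_lt e A.U_pos
  have hUm := A.U_eq
  set i := e / A.U
  by_cases h : e % A.U - A.m < 2 * A.m
  · have hbt : A.bt e = A.R * (i * A.L) + (e % A.U - A.m) := by
      unfold bt; rw [min_eq_left h.le, ← A.L_mul_R]; ring
    have hlt : (e % A.U - A.m) / A.R < A.L := by
      rw [Nat.div_lt_iff_lt_mul hR, A.L_mul_R]; exact h
    have hpe : A.bt e / A.R = A.pe e := by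
      rw [hbt, Nat.mul_add_div hR]; unfold pe; rw [min_eq_left (by omega)]
    have hmod := Nat.mod_lt (A.bt e) hR
    have h0 : ∀ c, interp A.R f (A.bt e) c = A.R * f (A.pe e) c +
        ((A.bt e % A.R : ℕ) : ℤ) * (f (A.pe e + 1) c - f (A.pe e) c) := fun c => by
      unfold interp; rw [hpe]
    rcases A.bt_succ_or e with ⟨h1, -⟩ | ⟨h1, -⟩
    · refine ⟨(A.bt e % A.R : ℕ), (A.bt e % A.R : ℕ) + 1, by positivity, by omega, by omega, h0,
        fun c => ?_⟩
      have := interp_succ hR f (A.bt e) c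
      rw [← h1, hpe, h0] at this
      linear_combination this
    · refine ⟨(A.bt e % A.R : ℕ), (A.bt e % A.R : ℕ), by positivity, le_rfl, by omega, h0, ?_⟩
      rw [h1]; exact h0
  · have hbt : A.bt e = A.R * ((i + 1) * A.L) := by
      unfold bt; rw [min_eq_right (not_lt.1 h), ← A.L_mul_R]; ring
    have hbt' : A.bt (e + 1) = A.bt e := by
      rcases A.bt_succ_or e with ⟨h1, -⟩ | ⟨h1, -⟩
      · exfalso
        have hdm := Nat.div_add_mod e A.U
        have hdm' := Nat.div_add_mod (e + 1) A.U
        have hlt' := Nat.mod_lt (e + 1) A.U_pos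
        by_cases hlast : e % A.U + 1 < A.U
        · have h2 : (e + 1) / A.U = e / A.U := by
            rw [Nat.div_eq_iff A.U_pos, mul_comm]
            constructor <;> omega
          have h3 : (e + 1) % A.U = e % A.U + 1 := by rw [h2] at hdm'; omega
          unfold bt at h1
          rw [h2, h3] at h1; omega
        · have h3 : e + 1 = A.U * (e / A.U + 1) := by rw [mul_add, mul_one]; omega
          have h2 : (e + 1) / A.U = e / A.U + 1 := by rw [h3, Nat.mul_div_cancel_left _ A.U_pos]
          have h4 : (e + 1) % A.U = 0 := by rw [h3, Nat.mul_mod_right]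
          unfold bt at h1
          rw [h2, h4, add_mul] at h1; omega
      · exact h1
    have hge : A.L ≤ (e % A.U - A.m) / A.R := by
      rw [Nat.le_div_iff_mul_le hR, A.L_mul_R]; exact not_lt.1 h
    have hpe : A.pe e + 1 = (i + 1) * A.L := by
      change i * A.L + _ + 1 = _
      rw [min_eq_right (by omega), add_mul]; omega
    have h0 : ∀ c, interp A.R f (A.bt e) c = A.R * f (A.pe e) c +
        (A.R : ℤ) * (f (A.pe e + 1) c - f (A.pe e) c) := fun c => by
      unfold interp
      rw [hbt, Nat.mul_div_cancel_left _ hR, Nat.mul_mod_right, hpe]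
      push_cast; ring
    refine ⟨A.R, A.R, by positivity, le_rfl, le_rfl, h0, ?_⟩
    rw [hbt']; exact h0

end Prm

namespace Pth
variable {A : Prm} (p p' : Pth A)

lemma vtx_succ (g e : ℕ) : ∃ κ : ℤ, 0 ≤ κ ∧ κ ≤ A.R ∧ ∀ c, p.vtx (g + 1) e c =
    A.R * p.vtx g (A.pe e) c + κ * (p.vtx g (A.pe e + 1) c - p.vtx g (A.pe e) c)
      + p.W (g + 1) e c := by
  obtain ⟨κ, h1, h2, h3⟩ := A.interp_bt (p.vtx g) e
  exact ⟨κ, h1, h2, fun c => by simp only [vtx, h3]⟩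

lemma abs_vtx_succ_sub_le (g e : ℕ) (c : A.Crd) :
    |p.vtx (g + 1) e c - A.R * p.vtx g (A.pe e) c| ≤ A.R + 1 := by
  obtain ⟨κ, h1, h2, h3⟩ := p.vtx_succ g e
  have h4 := (p.near1_vtx g (A.pe e)).abs_le c
  rw [h3, add_assoc, add_sub_cancel_left]
  refine (abs_add_le _ _).trans (add_le_add ?_ ?_)
  · rw [abs_mul, abs_of_nonneg h1]; nlinarith [abs_nonneg (p.vtx g (A.pe e + 1) c - p.vtx g (A.pe e) c)]
  · rw [abs_of_nonneg (p.W_nonneg _ _ _)]; exact p.W_le_one _ _ _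

lemma abs_vtx_sub_le (g n τ : ℕ) (c : A.Crd) :
    |p.vtx (g + n) τ c - A.R ^ n * p.vtx g (A.pe^[n] τ) c| ≤ 2 * (A.R ^ n - 1) := by
  induction n generalizing τ with
  | zero => simp
  | succ n ih =>
    have h1 := ih (A.pe τ)
    have h2 := p.abs_vtx_succ_sub_le (g + n) τ c
    have hR : (64 : ℤ) ≤ A.R := by exact_mod_cast A.hR
    rw [Function.iterate_succ_apply, ← add_assoc]
    have h3 : p.vtx (g + n + 1) τ c - A.R ^ (n + 1) * p.vtx g (A.pe^[n] (A.pe τ)) c =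
      (p.vtx (g + n + 1) τ c - A.R * p.vtx (g + n) (A.pe τ) c) +
      A.R * (p.vtx (g + n) (A.pe τ) c - A.R ^ n * p.vtx g (A.pe^[n] (A.pe τ)) c) := by ring
    rw [h3]
    refine (abs_add_le _ _).trans ?_
    rw [abs_mul, abs_of_nonneg (by positivity : (0 : ℤ) ≤ A.R)]
    have h4 := mul_le_mul_of_nonneg_left h1 (by positivity : (0 : ℤ) ≤ A.R)
    rw [pow_succ]
    linarith

lemma vtx_succ_of_eq {g e : ℕ} {c : A.Crd} (h : p.vtx g (A.pe e + 1) c = p.vtx g (A.pe e) c) :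
    p.vtx (g + 1) e c = A.R * p.vtx g (A.pe e) c + p.W (g + 1) e c := by
  obtain ⟨κ, -, -, h3⟩ := p.vtx_succ g e
  rw [h3, h]; ring

/-- Away from the moving coordinates, a vertex is determined up to a small error by `W`. -/
lemma abs_vtx_sub_le_of_eq (g n τ : ℕ) (c : A.Crd)
    (h0 : p.vtx g (A.pe (A.pe (A.pe^[n] τ)) + 1) c = p.vtx g (A.pe (A.pe (A.pe^[n] τ))) c)
    (h1 : p.vtx (g + 1) (A.pe (A.pe^[n] τ) + 1) c = p.vtx (g + 1) (A.pe (A.pe^[n] τ)) c) :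
    |p.vtx (g + 2 + n) τ c - A.R ^ (n + 1) * (A.R * p.vtx g (A.pe (A.pe (A.pe^[n] τ))) c +
      p.W (g + 1) (A.pe (A.pe^[n] τ)) c)| ≤ 3 * A.R ^ n := by
  have h2 := p.abs_vtx_sub_le (g + 2) n τ c
  rw [p.vtx_succ_of_eq h1, p.vtx_succ_of_eq h0] at h2
  have h3 := p.W_nonneg (g + 1 + 1) (A.pe^[n] τ) c
  have h4 := p.W_le_one (g + 1 + 1) (A.pe^[n] τ) c
  have hR : (0 : ℤ) < A.R ^ n := pow_pos (by exact_mod_cast A.R_pos) n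
  generalize p.W (g + 1 + 1) (A.pe^[n] τ) c = w at *
  generalize (A.R : ℤ) * p.vtx g (A.pe (A.pe (A.pe^[n] τ))) c +
      p.W (g + 1) (A.pe (A.pe^[n] τ)) c = z at *
  rw [pow_succ]
  rw [abs_le] at *
  constructor <;> nlinarith

lemma exists_moving (g e : ℕ) : ∃ c₀, ∀ c, c ≠ c₀ → p.vtx g (e + 1) c = p.vtx g e c := by
  obtain ⟨c₀, h, -⟩ := p.near1_vtx g e
  exact ⟨c₀, h⟩

/-- Squared distance of two vertices. -/
noncomputable def sqd (H τ τ' : ℕ) : ℤ := ∑ c, (p.vtx H τ c - p'.vtx H τ' c) ^ 2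

lemma sqd_comm (H τ τ' : ℕ) : p.sqd p' H τ τ' = p'.sqd p H τ' τ := by
  unfold sqd; exact Finset.sum_congr rfl fun c _ => by ring

open Classical in
lemma sqd_lower (g n τ τ' : ℕ) (X : Finset A.Crd)
    (hX : ∀ c ∈ X, p.W (g + 1) (A.pe (A.pe^[n] τ)) c = 1 ∧
      p'.W (g + 1) (A.pe (A.pe^[n] τ')) c = 0) :
    ((X.card : ℤ) - 4) * A.R ^ (2 * n + 2) ≤ 4 * p.sqd p' (g + 2 + n) τ τ' := by
  obtain ⟨c₁, h1⟩ := p.exists_moving g (A.pe (A.pe (A.pe^[n] τ)))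
  obtain ⟨c₂, h2⟩ := p.exists_moving (g + 1) (A.pe (A.pe^[n] τ))
  obtain ⟨c₃, h3⟩ := p'.exists_moving g (A.pe (A.pe (A.pe^[n] τ')))
  obtain ⟨c₄, h4⟩ := p'.exists_moving (g + 1) (A.pe (A.pe^[n] τ'))
  have hR : (64 : ℤ) ≤ A.R := by exact_mod_cast A.hR
  have hRn : (0 : ℤ) < A.R ^ n := pow_pos (by linarith) n
  set E : Finset A.Crd := {c₁, c₂, c₃, c₄}
  have hE : E.card ≤ 4 := Finset.card_le_four
  have hcard : (X.card : ℤ) - 4 ≤ (X \ E).card := by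
    have := Finset.le_card_sdiff E X
    omega
  have key : ∀ c ∈ X \ E, (A.R : ℤ) ^ (2 * n + 2) ≤
      4 * (p.vtx (g + 2 + n) τ c - p'.vtx (g + 2 + n) τ' c) ^ 2 := by
    intro c hc
    rw [Finset.mem_sdiff] at hc
    have hcE := hc.2
    simp only [E, Finset.mem_insert, Finset.mem_singleton, not_or] at hcE
    have e1 := p.abs_vtx_sub_le_of_eq g n τ c (h1 c hcE.1) (h2 c hcE.2.1)
    have e2 := p'.abs_vtx_sub_le_of_eq g n τ' c (h3 c hcE.2.2.1) (h4 c hcE.2.2.2)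
    rw [(hX c hc.1).1] at e1
    rw [(hX c hc.1).2] at e2
    generalize p.vtx g (A.pe (A.pe (A.pe^[n] τ))) c = a at *
    generalize p'.vtx g (A.pe (A.pe (A.pe^[n] τ'))) c = a' at *
    generalize p.vtx (g + 2 + n) τ c = b at *
    generalize p'.vtx (g + 2 + n) τ' c = b' at *
    have hRa : 1 ≤ |(A.R : ℤ) * (a - a') + 1| := by
      rcases lt_trichotomy (a - a') 0 with h | h | h
      · rw [abs_of_neg (by nlinarith)]; nlinarith
      · rw [h]; simp
      · rw [abs_of_pos (by nlinarith)]; nlinarith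
    have e3 : |(b - b') - A.R ^ (n + 1) * (A.R * (a - a') + 1)| ≤ 6 * A.R ^ n := by
      rw [abs_le] at *; constructor <;> linarith
    have e4 : (A.R : ℤ) ^ (n + 1) ≤ |(A.R : ℤ) ^ (n + 1) * (A.R * (a - a') + 1)| := by
      rw [abs_mul, abs_of_pos (pow_pos (by linarith) _)]
      exact le_mul_of_one_le_right (pow_nonneg (by linarith) _) hRa
    have e5 := abs_sub_abs_le_abs_sub ((A.R : ℤ) ^ (n + 1) * (A.R * (a - a') + 1)) (b - b')
    rw [abs_sub_comm _ (b - b')] at e5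
    have e6 : (A.R : ℤ) ^ (n + 1) ≤ 2 * |b - b'| := by
      have : (A.R : ℤ) ^ (n + 1) = A.R ^ n * A.R := pow_succ _ _
      nlinarith
    calc (A.R : ℤ) ^ (2 * n + 2) = (A.R ^ (n + 1)) ^ 2 := by ring
      _ ≤ (2 * |b - b'|) ^ 2 := pow_le_pow_left₀ (pow_nonneg (by linarith) _) e6 2
      _ = 4 * (b - b') ^ 2 := by rw [mul_pow, sq_abs]; norm_num
  calc ((X.card : ℤ) - 4) * A.R ^ (2 * n + 2) ≤ (X \ E).card * A.R ^ (2 * n + 2) :=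
        mul_le_mul_of_nonneg_right hcard (pow_nonneg (by linarith) _)
    _ = ∑ c ∈ X \ E, (A.R : ℤ) ^ (2 * n + 2) := by rw [Finset.sum_const, nsmul_eq_mul]
    _ ≤ ∑ c ∈ X \ E, 4 * (p.vtx (g + 2 + n) τ c - p'.vtx (g + 2 + n) τ' c) ^ 2 :=
        Finset.sum_le_sum key
    _ ≤ ∑ c, 4 * (p.vtx (g + 2 + n) τ c - p'.vtx (g + 2 + n) τ' c) ^ 2 :=
        Finset.sum_le_sum_of_subset_of_nonneg (Finset.subset_univ _) fun _ _ _ => by positivity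
    _ = 4 * p.sqd p' (g + 2 + n) τ τ' := by rw [← Finset.mul_sum]; rfl

/-- The options of the unit `i` of level `g` of the two paths mostly agree. -/
def Co (g i : ℕ) : Prop := 8 * (Finset.univ.filter fun s => p.ε g i s ≠ p'.ε g i s).card < A.m

lemma co_comm (g i : ℕ) : p.Co p' g i ↔ p'.Co p g i := by
  unfold Co; simp only [ne_comm]

lemma co_of_sqd_aux {g n τ τ' i i' : ℕ} (hg : g + 1 ≤ A.G)
    (hi : i = A.pe (A.pe^[n] τ) / A.U) (hi' : i' = A.pe (A.pe^[n] τ') / A.U)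
    (hw : i < i' + (16 * A.y + 4 * A.R)) (hw' : i' < i + (16 * A.y + 4 * A.R))
    (hs : 64 * p.sqd p' (g + 2 + n) τ τ' < A.R ^ (2 * n + 6)) :
    (i ≤ i' + 1 ∧ i' ≤ i + 1) ∧ p.Co p' (g + 1) i := by
  classical
  have hQ := A.hQ
  have hQ0 : 0 < A.Q := by omega
  by_contra hcon
  set Bad : Finset (Fin A.m) := Finset.univ.filter fun s =>
    ¬ ((i ≤ i' + 1 ∧ i' ≤ i + 1) ∧ p.ε (g + 1) i s = p'.ε (g + 1) i s)
  have hBad : A.m ≤ 8 * Bad.card := by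
    by_cases h1 : i ≤ i' + 1 ∧ i' ≤ i + 1
    · have h2 : ¬ p.Co p' (g + 1) i := fun h => hcon ⟨h1, h⟩
      unfold Co at h2
      rw [not_lt] at h2
      refine h2.trans (Nat.mul_le_mul_left _ (Finset.card_le_card ?_))
      intro s hs
      simp only [Finset.mem_filter, Finset.mem_univ, true_and, Bad, ne_eq] at hs ⊢
      exact fun h => hs h.2
    · have : Bad = Finset.univ := by
        ext s; simp only [Bad, Finset.mem_filter, Finset.mem_univ, true_and, h1, false_and,
          not_false_eq_true]
      rw [this, Finset.card_univ, Fintype.card_fin]; omega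
  let f : Fin A.m → A.Crd := fun s => .inr (.inr (⟨i % A.Q, Nat.mod_lt _ hQ0⟩, s, p.ε (g + 1) i s))
  have hf : Function.Injective f := fun s s' h => by
    simp only [f, Sum.inr.injEq, Prod.mk.injEq] at h
    exact h.2.1
  have h1 := p.sqd_lower p' g n τ τ' (Bad.image f) (by
    intro c hc
    obtain ⟨s, hs, rfl⟩ := Finset.mem_image.1 hc
    refine ⟨?_, ?_⟩
    · simp only [f, W]
      rw [if_pos ⟨hg, i, Or.inl hi, rfl, rfl⟩]
    · simp only [f, W]
      rw [if_neg]
      rintro ⟨-, j, hj, hjQ, hjε⟩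
      have hj' : j ≤ i' + 1 ∧ i' ≤ j + 1 := by
        unfold Prm.On at hj
        rw [← hi'] at hj
        omega
      have hji : j = i := by
        have h5 := Nat.div_add_mod j A.Q
        have h6 := Nat.div_add_mod i A.Q
        change j % A.Q = i % A.Q at hjQ
        rcases lt_trichotomy (j / A.Q) (i / A.Q) with h | h | h
        · have := Nat.mul_le_mul_left A.Q (Nat.succ_le_of_lt h)
          rw [Nat.succ_eq_add_one, mul_add] at this; omega
        · rw [h] at h5; omega
        · have := Nat.mul_le_mul_left A.Q (Nat.succ_le_of_lt h)
          rw [Nat.succ_eq_add_one, mul_add] at this; omega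
      subst hji
      simp only [Bad, Finset.mem_filter] at hs
      exact hs.2 ⟨hj', hjε.symm⟩)
  rw [Finset.card_image_of_injective _ hf] at h1
  have hR : (64 : ℤ) ≤ A.R := by exact_mod_cast A.hR
  have h2 : (A.R : ℤ) ^ (2 * n + 6) = A.R ^ 4 * A.R ^ (2 * n + 2) := by ring
  have h3 : (A.R : ℤ) ^ 4 ≤ 8 * Bad.card := by exact_mod_cast hBad
  have h4 : (64 : ℤ) ^ 4 ≤ A.R ^ 4 := pow_le_pow_left₀ (by norm_num) hR 4
  have h5 : (0 : ℤ) < A.R ^ (2 * n + 2) := pow_pos (by linarith) _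
  nlinarith

/-- Close vertices lie in close units whose options mostly agree. -/
lemma co_of_sqd {g n τ τ' i i' : ℕ} (hg : g + 1 ≤ A.G)
    (hi : i = A.pe (A.pe^[n] τ) / A.U) (hi' : i' = A.pe (A.pe^[n] τ') / A.U)
    (hw : i < i' + (16 * A.y + 4 * A.R)) (hw' : i' < i + (16 * A.y + 4 * A.R))
    (hs : 64 * p.sqd p' (g + 2 + n) τ τ' < A.R ^ (2 * n + 6)) :
    (i ≤ i' + 1 ∧ i' ≤ i + 1) ∧ p.Co p' (g + 1) i ∧ p.Co p' (g + 1) i' := by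
  have h1 := p.co_of_sqd_aux p' hg hi hi' hw hw' hs
  have h2 := p'.co_of_sqd_aux p hg hi' hi hw' hw (by rw [sqd_comm]; exact hs)
  exact ⟨h1.1, h1.2, (co_comm _ _ _ _).1 h2.2⟩

end Pth
end WN

end

section

open Finset

namespace WN

namespace Pth
variable {A : Prm} (p p' : Pth A)

lemma vtx_mem_of_coarse {c : A.Crd} (hc : ∀ g e, p.W g e c = 0) {I : ℕ} {lo hi : ℤ}
    (h : ∀ t, 8 * I ≤ t → t ≤ 8 * I + 8 → lo ≤ p.coarse t c ∧ p.coarse t c ≤ hi) (H τ : ℕ)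
    (hτ : A.uu 0 (A.pe^[H] τ) = I) :
    ((A.R ^ H * (A.L * A.y) : ℕ) * lo ≤ p.vtx H τ c ∧
      p.vtx H τ c ≤ (A.R ^ H * (A.L * A.y) : ℕ) * hi) ∧
    ((A.R ^ H * (A.L * A.y) : ℕ) * lo ≤ p.vtx H (τ + 1) c ∧
      p.vtx H (τ + 1) c ≤ (A.R ^ H * (A.L * A.y) : ℕ) * hi) := by
  induction H generalizing τ with
  | zero =>
    have hK : 0 < A.L * A.y := Nat.mul_pos A.L_pos A.hy
    simp only [Function.iterate_zero, id_eq, Prm.uu, if_true] at hτ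
    rw [mul_comm 8, ← Nat.div_div_eq_div_mul] at hτ
    have h1 := interp_succ hK p.coarse τ c
    have h2 := h (τ / (A.L * A.y)) (by omega) (by omega)
    have h3 := h (τ / (A.L * A.y) + 1) (by omega) (by omega)
    have h4 := Nat.mod_lt τ hK
    simp only [pow_zero, one_mul, vtx]
    have h5 : interp (A.L * A.y) p.coarse τ c = (A.L * A.y : ℕ) * p.coarse (τ / (A.L * A.y)) c +
      (τ % (A.L * A.y) : ℕ) * (p.coarse (τ / (A.L * A.y) + 1) c - p.coarse (τ / (A.L * A.y)) c) :=
      rfl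
    rw [h5] at h1 ⊢
    have h6 : interp (A.L * A.y) p.coarse (τ + 1) c = (A.L * A.y : ℕ) *
      p.coarse (τ / (A.L * A.y)) c + ((τ % (A.L * A.y) : ℕ) + 1) *
      (p.coarse (τ / (A.L * A.y) + 1) c - p.coarse (τ / (A.L * A.y)) c) := by linarith
    rw [h6]
    have h7 : ((τ % (A.L * A.y) : ℕ) : ℤ) + 1 ≤ (A.L * A.y : ℕ) := by exact_mod_cast h4
    have h8 : (0 : ℤ) ≤ (τ % (A.L * A.y) : ℕ) := by positivity
    generalize ((τ % (A.L * A.y) : ℕ) : ℤ) = ρ at *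
    generalize ((A.L * A.y : ℕ) : ℤ) = K at *
    refine ⟨⟨?_, ?_⟩, ?_, ?_⟩ <;> nlinarith
  | succ H ih =>
    rw [Function.iterate_succ_apply] at hτ
    obtain ⟨⟨a1, a2⟩, b1, b2⟩ := ih _ hτ
    obtain ⟨κ, κ', h1, h2, h3, h4, h5⟩ := A.interp_bt' (p.vtx H) τ
    simp only [vtx, hc, add_zero, h4, h5]
    have h6 : ((A.R ^ (H + 1) * (A.L * A.y) : ℕ) : ℤ) =
      A.R * (A.R ^ H * (A.L * A.y) : ℕ) := by push_cast; ring
    rw [h6]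
    generalize ((A.R ^ H * (A.L * A.y) : ℕ) : ℤ) = K at *
    refine ⟨⟨?_, ?_⟩, ?_, ?_⟩ <;> nlinarith

lemma vtx_inl_zero {I : ℕ} (H τ : ℕ) (hτ : A.uu 0 (A.pe^[H] τ) = I) :
    (A.R ^ H * (A.L * A.y) : ℕ) * (4 * I : ℤ) ≤ p.vtx H τ (.inl 0) ∧
      p.vtx H τ (.inl 0) ≤ (A.R ^ H * (A.L * A.y) : ℕ) * (4 * I + 4 : ℤ) := by
  refine (p.vtx_mem_of_coarse (fun g e => rfl) (fun t h1 h2 => ?_) H τ hτ).1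
  simp only [coarse, if_true]
  have := Nat.div_add_mod t 8
  omega

lemma vtx_inl_one (H τ : ℕ) :
    p.vtx H τ (.inl 1) = (A.R ^ H * (A.L * A.y) : ℕ) * (p.v : ℤ) := by
  obtain ⟨h1, h2⟩ := (p.vtx_mem_of_coarse (c := .inl 1) (fun g e => rfl) (lo := p.v) (hi := p.v)
    (fun t h1 h2 => by simp [coarse]) H τ rfl).1
  exact le_antisymm h2 h1

lemma vtx_inr_inl {I : ℕ} (H τ : ℕ) (hτ : A.uu 0 (A.pe^[H] τ) = I) (c : Fin 4) {lo hi : ℤ}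
    (h1 : lo ≤ p.S I c ∧ p.S I c ≤ hi) (h2 : lo ≤ p.S (I + 1) c ∧ p.S (I + 1) c ≤ hi) :
    (A.R ^ H * (A.L * A.y) : ℕ) * lo ≤ p.vtx H τ (.inr (.inl c)) ∧
      p.vtx H τ (.inr (.inl c)) ≤ (A.R ^ H * (A.L * A.y) : ℕ) * hi := by
  refine (p.vtx_mem_of_coarse (fun g e => rfl) (fun t h3 h4 => ?_) H τ hτ).1
  simp only [coarse]
  have := Nat.div_add_mod t 8
  rcases eq_or_ne t (8 * I + 8) with h5 | h5
  · have h6 : t / 8 = I + 1 := by omega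
    rw [h6, if_neg (by omega)]; exact h2
  · have h6 : t / 8 = I := by omega
    rw [h6]; split_ifs; exacts [h2, h1]

/-- The skeletons of the two paths are close in the macroscopic step `I`. -/
def Nr (I : ℕ) : Prop := |(p.v : ℤ) - p'.v| ≤ 6 ∧ ∀ c, |p.S I c - p'.S I c| ≤ 6

lemma nr_comm (I : ℕ) : p.Nr p' I ↔ p'.Nr p I := by
  unfold Nr; simp only [abs_sub_comm]

lemma abs_lt_of_sqd {H τ τ' : ℕ} {K : ℤ} (hK : 0 ≤ K) (h : p.sqd p' H τ τ' < K ^ 2) (c : A.Crd) :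
    |p.vtx H τ c - p'.vtx H τ' c| < K := by
  have h1 : (p.vtx H τ c - p'.vtx H τ' c) ^ 2 ≤ p.sqd p' H τ τ' :=
    Finset.single_le_sum (f := fun c => (p.vtx H τ c - p'.vtx H τ' c) ^ 2)
      (fun _ _ => sq_nonneg _) (Finset.mem_univ c)
  exact abs_lt_of_sq_lt_sq (h1.trans_lt h) hK

lemma macro_close {H τ τ' : ℕ}
    (h : p.sqd p' H τ τ' < (((A.R ^ H * (A.L * A.y) : ℕ) : ℤ)) ^ 2) :
    (A.uu 0 (A.pe^[H] τ) ≤ A.uu 0 (A.pe^[H] τ') + 1 ∧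
      A.uu 0 (A.pe^[H] τ') ≤ A.uu 0 (A.pe^[H] τ) + 1) ∧
    p.Nr p' (A.uu 0 (A.pe^[H] τ)) ∧ p.Nr p' (A.uu 0 (A.pe^[H] τ')) := by
  have hc := p.abs_lt_of_sqd p' (by positivity) h
  have hK : (0 : ℤ) < (A.R ^ H * (A.L * A.y) : ℕ) := by
    exact_mod_cast Nat.mul_pos (pow_pos A.R_pos H) (Nat.mul_pos A.L_pos A.hy)
  obtain ⟨I, hI⟩ : ∃ I, A.uu 0 (A.pe^[H] τ) = I := ⟨_, rfl⟩
  obtain ⟨I', hI'⟩ : ∃ I, A.uu 0 (A.pe^[H] τ') = I := ⟨_, rfl⟩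
  have z1 := p.vtx_inl_zero H τ hI
  have z2 := p'.vtx_inl_zero H τ' hI'
  have o1 := p.vtx_inl_one H τ
  have o2 := p'.vtx_inl_one H τ'
  have z3 := hc (.inl 0)
  have o3 := hc (.inl 1)
  have s : ∀ c : Fin 4, ∀ lo lo' : ℤ, (lo ≤ p.S I c ∧ p.S I c ≤ lo + 1) →
      (lo ≤ p.S (I + 1) c ∧ p.S (I + 1) c ≤ lo + 1) → (lo' ≤ p'.S I' c ∧ p'.S I' c ≤ lo' + 1) →
      (lo' ≤ p'.S (I' + 1) c ∧ p'.S (I' + 1) c ≤ lo' + 1) → |lo - lo'| ≤ 1 := by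
    intro c lo lo' h1 h2 h3 h4
    have s1 := p.vtx_inr_inl H τ hI c h1 h2
    have s2 := p'.vtx_inr_inl H τ' hI' c h3 h4
    have s3 := hc (.inr (.inl c))
    rw [abs_lt] at s3
    generalize ((A.R ^ H * (A.L * A.y) : ℕ) : ℤ) = K at *
    rw [abs_le]
    constructor
    · by_contra hlt
      nlinarith
    · by_contra hlt
      nlinarith
  rw [hI, hI']
  rw [o1, o2, ← mul_sub, abs_mul, abs_of_pos hK] at o3
  have o4 : |(p.v : ℤ) - p'.v| < 1 := by nlinarith
  rw [abs_lt] at z3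
  generalize ((A.R ^ H * (A.L * A.y) : ℕ) : ℤ) = K at *
  have w1 : I ≤ I' + 1 := by
    by_contra hcon
    have : (I' : ℤ) + 2 ≤ I := by omega
    nlinarith
  have w2 : I' ≤ I + 1 := by
    by_contra hcon
    have : (I : ℤ) + 2 ≤ I' := by omega
    nlinarith
  have s' : ∀ c : Fin 4, |p.S I c - p'.S I' c| ≤ 3 := by
    intro c
    have e1 := p.hS I c
    have e2 := p'.hS I' c
    rw [abs_le] at e1 e2
    have := s c (min (p.S I c) (p.S (I + 1) c)) (min (p'.S I' c) (p'.S (I' + 1) c))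
      (by omega) (by omega) (by omega) (by omega)
    rw [abs_le] at this ⊢
    omega
  have hcase : I' = I ∨ I' = I + 1 ∨ I = I' + 1 := by omega
  refine ⟨⟨w1, w2⟩, ⟨by omega, fun c => ?_⟩, by omega, fun c => ?_⟩
  · have a1 := s' c
    rcases hcase with h1 | h1 | h1
    · rw [h1] at a1; omega
    · rw [h1] at a1
      have := p'.hS I c
      rw [abs_le] at *; omega
    · have := p'.hS I' c
      rw [← h1] at this
      rw [abs_le] at *; omega
  · have a1 := s' c
    rcases hcase with h1 | h1 | h1
    · rw [h1] at a1 ⊢; omega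
    · have := p.hS I c
      rw [← h1] at this
      rw [abs_le] at *; omega
    · have := p.hS I' c
      rw [← h1] at this
      rw [abs_le] at *; omega

/-- The unit `i` of level `g` and its ancestors have mostly the same options in both paths. -/
def Alive : ℕ → ℕ → Prop
  | 0, i => p.Nr p' i
  | g + 1, i => p.Co p' (g + 1) i ∧ Alive g (i / A.lam g)

/-- Close vertices lie in neighbouring units that are alive. -/
lemma near_alive {H g τ τ' : ℕ} (hgG : g ≤ A.G) (hgH : g < H)
    (h0 : p.sqd p' H τ τ' < (((A.R ^ H * (A.L * A.y) : ℕ) : ℤ)) ^ 2)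
    (hs : 64 * p.sqd p' H τ τ' < A.R ^ (2 * (H - g) + 4)) :
    (A.uu g (A.pe^[H - g] τ) ≤ A.uu g (A.pe^[H - g] τ') + 1 ∧
      A.uu g (A.pe^[H - g] τ') ≤ A.uu g (A.pe^[H - g] τ) + 1) ∧
    p.Alive p' g (A.uu g (A.pe^[H - g] τ)) ∧ p.Alive p' g (A.uu g (A.pe^[H - g] τ')) := by
  induction g with
  | zero => exact p.macro_close p' h0
  | succ g ih =>
    have hR : (1 : ℤ) ≤ A.R := by exact_mod_cast A.R_pos
    obtain ⟨⟨h1, h2⟩, h3, h4⟩ := ih (by omega) (by omega)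
      (hs.trans_le (pow_le_pow_right₀ hR (by omega)))
    obtain ⟨n, rfl⟩ : ∃ n, H = g + 2 + n := ⟨H - (g + 2), by omega⟩
    have e1 : g + 2 + n - g = n + 2 := by omega
    have e2 : g + 2 + n - (g + 1) = n + 1 := by omega
    have i1 : ∀ τ, A.pe^[n + 2] τ = A.pe (A.pe^[n + 1] τ) := fun τ =>
      Function.iterate_succ_apply' _ _ _
    simp only [e1, i1, A.uu_pe] at h1 h2 h3 h4
    rw [e2] at hs ⊢
    have hw := A.lam_le g
    have b1 := Prm.uu_bounds (A.lam_pos g) h1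
    have b2 := Prm.uu_bounds (A.lam_pos g) h2
    have hu : ∀ τ, A.uu (g + 1) (A.pe^[n + 1] τ) = A.pe (A.pe^[n] τ) / A.U := fun τ => by
      rw [Function.iterate_succ_apply']; simp [Prm.uu]
    obtain ⟨k1, k2, k3⟩ := p.co_of_sqd p' hgG (hu τ) (hu τ') (by omega) (by omega)
      (by have : 2 * (n + 1) + 4 = 2 * n + 6 := by ring
          rw [this] at hs; exact hs)
    exact ⟨k1, ⟨k2, h3⟩, k3, h4⟩

end Pth
end WN

end

section

open Finset

namespace WN

lemma Near1.sum_abs_le {ι : Type} [Fintype ι] {a b : ι → ℤ} (h : Near1 a b) :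
    ∑ c, |b c - a c| ≤ 1 := by
  obtain ⟨c₀, h1, h2⟩ := h
  rw [Finset.sum_eq_single c₀ (fun c _ hc => by rw [h1 c hc]; simp) (by simp)]
  exact h2

lemma Near1.sum_sq_le {ι : Type} [Fintype ι] {a b : ι → ℤ} (h : Near1 a b) :
    ∑ c, (b c - a c) ^ 2 ≤ 1 := by
  obtain ⟨c₀, h1, h2⟩ := h
  rw [Finset.sum_eq_single c₀ (fun c _ hc => by rw [h1 c hc]; simp) (by simp), ← sq_abs]
  exact pow_le_one₀ (abs_nonneg _) h2

namespace Prm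
variable (A : Prm)

/-- Number of edges of level `g` of a path with `N` macroscopic steps. -/
def T (N g : ℕ) : ℕ := N * (8 * A.y) * (2 * A.R) ^ g * A.L

/-- Number of units of level `g` of a path with `N` macroscopic steps. -/
def nu (N : ℕ) : ℕ → ℕ
  | 0 => N
  | g + 1 => nu N g * A.lam g

lemma T_succ (N g : ℕ) : A.T N (g + 1) = N * (8 * A.y) * (2 * A.R) ^ g * A.U := by
  unfold T; rw [A.U_eq']; ring

lemma pe_mul_U (k : ℕ) : A.pe (k * A.U) = k * A.L := by
  unfold pe
  rw [Nat.mul_div_cancel _ A.U_pos, Nat.mul_mod_left]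
  simp

lemma pe_T (N g : ℕ) : A.pe (A.T N (g + 1)) = A.T N g := by rw [T_succ, pe_mul_U]; rfl

lemma pe_zero : A.pe 0 = 0 := by simpa using A.pe_mul_U 0

lemma pe_iterate_T (N g n : ℕ) : A.pe^[n] (A.T N (g + n)) = A.T N g := by
  induction n with
  | zero => rfl
  | succ n ih => rw [Function.iterate_succ_apply, ← add_assoc, pe_T, ih]

lemma pe_lt_T {N g e : ℕ} (h : e < A.T N (g + 1)) : A.pe e < A.T N g := by
  rw [T_succ, ← Nat.div_lt_iff_lt_mul A.U_pos, ← A.pe_div, Nat.div_lt_iff_lt_mul A.L_pos] at h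
  exact h

lemma pe_iterate_lt_T {N g n e : ℕ} (h : e < A.T N (g + n)) : A.pe^[n] e < A.T N g := by
  induction n generalizing e with
  | zero => exact h
  | succ n ih => rw [Function.iterate_succ_apply]; exact ih (A.pe_lt_T h)

lemma uu_lt_nu {N g e : ℕ} (h : e < A.T N g) : A.uu g e < A.nu N g := by
  induction g generalizing e with
  | zero =>
    unfold uu nu
    rw [if_pos rfl, Nat.div_lt_iff_lt_mul (by have := Nat.mul_pos A.L_pos A.hy; omega)]
    unfold T at h
    calc e < _ := h
      _ = _ := by ring
  | succ g ih =>
    have := ih (A.pe_lt_T h)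
    rw [A.uu_pe, Nat.div_lt_iff_lt_mul (A.lam_pos g)] at this
    exact this

/-- The edge at the position `κ` inside the edge `e` of the parent level. -/
def ch (e κ : ℕ) : ℕ := e / A.L * A.U + (A.m + (e % A.L * A.R + κ))

lemma ch_spec (e : ℕ) {κ : ℕ} (hκ : κ ≤ A.R) : A.bt (A.ch e κ) = A.R * e + κ := by
  have h1 := Nat.mod_lt e A.L_pos
  have h2 := Nat.div_add_mod e A.L
  have h3 : e % A.L * A.R + κ ≤ 2 * A.m := by rw [← A.L_mul_R]; nlinarith
  have hm := A.m_pos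
  have h4 : A.m + (e % A.L * A.R + κ) < A.U := by rw [A.U_eq]; omega
  unfold bt ch
  rw [mul_comm (e / A.L) A.U, Nat.mul_add_div A.U_pos, Nat.div_eq_of_lt h4, Nat.mul_add_mod, Nat.mod_eq_of_lt h4,
    Nat.add_sub_cancel_left, min_eq_left h3, add_zero, ← A.L_mul_R]
  calc e / A.L * (A.L * A.R) + (e % A.L * A.R + κ) = (A.L * (e / A.L) + e % A.L) * A.R + κ := by ring
    _ = A.R * e + κ := by rw [h2]; ring

lemma pe_ch (e : ℕ) {κ : ℕ} (hκ : κ < A.R) : A.pe (A.ch e κ) = e := by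
  have h1 := Nat.mod_lt e A.L_pos
  have h2 := Nat.div_add_mod e A.L
  have h3 : e % A.L * A.R + κ ≤ 2 * A.m := by rw [← A.L_mul_R]; nlinarith
  have hm := A.m_pos
  have h4 : A.m + (e % A.L * A.R + κ) < A.U := by rw [A.U_eq]; omega
  unfold pe ch
  rw [mul_comm (e / A.L) A.U, Nat.mul_add_div A.U_pos, Nat.div_eq_of_lt h4, Nat.mul_add_mod, Nat.mod_eq_of_lt h4,
    Nat.add_sub_cancel_left, add_zero, mul_comm (e % A.L), Nat.mul_add_div A.R_pos,
    Nat.div_eq_of_lt hκ, min_eq_left (by omega), mul_comm]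
  omega

end Prm

namespace Pth
variable {A : Prm} (p p' : Pth A)

open Classical in
lemma card_W_le (g e : ℕ) : (Finset.univ.filter fun c => p.W g e c ≠ 0).card ≤ 3 * A.m := by
  have hQ0 : 0 < A.Q := by have := A.hQ; omega
  let f : Fin 3 × Fin A.m → A.Crd := fun x => .inr (.inr (⟨(e / A.U + 1 - x.1) % A.Q,
    Nat.mod_lt _ hQ0⟩, x.2, p.ε g (e / A.U + 1 - x.1) x.2))
  have h : (Finset.univ.filter fun c => p.W g e c ≠ 0) ⊆ Finset.univ.image f := by
    intro c hc
    replace hc := (Finset.mem_filter.1 hc).2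
    rcases c with j | c | ⟨b, s, o⟩
    · exact absurd rfl hc
    · exact absurd rfl hc
    simp only [W] at hc
    split_ifs at hc with h1
    · obtain ⟨-, j, h2, h3, h4⟩ := h1
      have h5 : ∃ a : Fin 3, j = e / A.U + 1 - a := by
        rcases h2 with h2 | h2 | h2
        · exact ⟨1, by simp; omega⟩
        · exact ⟨2, by simp; omega⟩
        · exact ⟨0, by simp; omega⟩
      obtain ⟨a, rfl⟩ := h5
      refine Finset.mem_image.2 ⟨(a, s), Finset.mem_univ _, ?_⟩
      simp only [f, Sum.inr.injEq, Prod.mk.injEq, true_and]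
      exact ⟨Fin.ext h3, h4⟩
    · exact absurd rfl hc
  refine (Finset.card_le_card h).trans (Finset.card_image_le.trans ?_)
  simp

lemma sum_W_le (g e : ℕ) : ∑ c, p.W g e c ≤ 3 * A.R ^ 4 := by
  classical
  have h1 : ∀ c, p.W g e c ≤ if p.W g e c ≠ 0 then 1 else 0 := fun c => by
    split_ifs with h
    · exact p.W_le_one g e c
    · rw [not_not.1 h]
  refine (Finset.sum_le_sum fun c _ => h1 c).trans ?_
  rw [Finset.sum_boole]
  exact_mod_cast p.card_W_le g e

lemma sum_abs_vtx_succ_sub_le (g e : ℕ) :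
    ∑ c, |p.vtx (g + 1) e c - A.R * p.vtx g (A.pe e) c| ≤ 4 * A.R ^ 4 := by
  obtain ⟨κ, h1, h2, h3⟩ := p.vtx_succ g e
  have hR : (64 : ℤ) ≤ A.R := by exact_mod_cast A.hR
  have h4 : ∀ c, |p.vtx (g + 1) e c - A.R * p.vtx g (A.pe e) c| ≤
      A.R * |p.vtx g (A.pe e + 1) c - p.vtx g (A.pe e) c| + p.W (g + 1) e c := fun c => by
    rw [h3, add_assoc, add_sub_cancel_left]
    refine (abs_add_le _ _).trans (add_le_add ?_ ?_)
    · rw [abs_mul, abs_of_nonneg h1]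
      exact mul_le_mul_of_nonneg_right h2 (abs_nonneg _)
    · rw [abs_of_nonneg (p.W_nonneg _ _ _)]
  refine (Finset.sum_le_sum fun c _ => h4 c).trans ?_
  rw [Finset.sum_add_distrib, ← Finset.mul_sum]
  have h5 := (p.near1_vtx g (A.pe e)).sum_abs_le
  have h6 := p.sum_W_le (g + 1) e
  have h7 : (A.R : ℤ) ≤ A.R ^ 4 := le_self_pow₀ (by linarith) (by norm_num)
  nlinarith

lemma sum_sq_vtx_succ_sub_le (g e : ℕ) :
    ∑ c, (p.vtx (g + 1) e c - A.R * p.vtx g (A.pe e) c) ^ 2 ≤ 9 * A.R ^ 4 := by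
  obtain ⟨κ, h1, h2, h3⟩ := p.vtx_succ g e
  have hR : (64 : ℤ) ≤ A.R := by exact_mod_cast A.hR
  have h4 : ∀ c, (p.vtx (g + 1) e c - A.R * p.vtx g (A.pe e) c) ^ 2 ≤
      2 * A.R ^ 2 * (p.vtx g (A.pe e + 1) c - p.vtx g (A.pe e) c) ^ 2 + 2 * p.W (g + 1) e c :=
      fun c => by
    rw [h3, add_assoc, add_sub_cancel_left]
    have h5 := p.W_nonneg (g + 1) e c
    have h6 := p.W_le_one (g + 1) e c
    generalize p.vtx g (A.pe e + 1) c - p.vtx g (A.pe e) c = D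
    generalize p.W (g + 1) e c = w at *
    have h7 : κ ^ 2 ≤ A.R ^ 2 := pow_le_pow_left₀ h1 h2 2
    have h8 : w ^ 2 ≤ w := by nlinarith
    nlinarith [sq_nonneg (κ * D - w), mul_le_mul_of_nonneg_right h7 (sq_nonneg D)]
  refine (Finset.sum_le_sum fun c _ => h4 c).trans ?_
  rw [Finset.sum_add_distrib, ← Finset.mul_sum, ← Finset.mul_sum]
  have h5 := (p.near1_vtx g (A.pe e)).sum_sq_le
  have h6 := p.sum_W_le (g + 1) e
  have h7 : (A.R : ℤ) ^ 2 ≤ A.R ^ 4 := pow_le_pow_right₀ (by linarith) (by norm_num)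
  nlinarith [sq_nonneg (A.R : ℤ)]

lemma W_eq_zero {g : ℕ} (hg : A.G < g) (e : ℕ) (c : A.Crd) : p.W g e c = 0 := by
  rcases c with j | c | ⟨b, s, o⟩ <;> simp only [W]
  rw [if_neg fun h => by omega]

/-- Beyond the last level, edges are only subdivided. -/
lemma exists_vtx_eq {g : ℕ} (hg : A.G ≤ g) (n e a : ℕ) (ha : a < A.R ^ n) :
    ∃ τ, A.pe^[n] τ = e ∧
      (∀ c, p.vtx (g + n) τ c = A.R ^ n * p.vtx g e c + a * (p.vtx g (e + 1) c - p.vtx g e c)) ∧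
      ∀ c, p.vtx (g + n) (τ + 1) c =
        A.R ^ n * p.vtx g e c + (a + 1) * (p.vtx g (e + 1) c - p.vtx g e c) := by
  induction n generalizing a with
  | zero =>
    refine ⟨e, rfl, fun c => ?_, fun c => ?_⟩
    · have : a = 0 := by simpa using ha
      simp [this]
    · have : a = 0 := by simpa using ha
      simp [this]
  | succ n ih =>
    obtain ⟨τ, h1, h2, h3⟩ := ih (a / A.R)
      (by rw [Nat.div_lt_iff_lt_mul A.R_pos, ← pow_succ]; exact ha)
    have hmod := Nat.mod_lt a A.R_pos
    have hdm : (a : ℤ) = A.R * (a / A.R : ℕ) + (a % A.R : ℕ) := by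
      exact_mod_cast (Nat.div_add_mod a A.R).symm
    have h4 : ∀ c, p.vtx (g + n + 1) (A.ch τ (a % A.R)) c =
        A.R ^ (n + 1) * p.vtx g e c + a * (p.vtx g (e + 1) c - p.vtx g e c) := fun c => by
      simp only [vtx, p.W_eq_zero (show A.G < g + n + 1 by omega), add_zero, A.ch_spec τ hmod.le]
      unfold interp
      rw [Nat.mul_add_div A.R_pos, Nat.div_eq_of_lt hmod, Nat.mul_add_mod, Nat.mod_eq_of_lt hmod,
        add_zero, h2, h3, hdm]
      ring
    refine ⟨A.ch τ (a % A.R), ?_, h4, fun c => ?_⟩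
    · rw [Function.iterate_succ_apply, A.pe_ch τ hmod, h1]
    · have h5 : A.bt (A.ch τ (a % A.R) + 1) = A.bt (A.ch τ (a % A.R)) + 1 := by
        have : A.ch τ (a % A.R) + 1 = A.ch τ (a % A.R + 1) := by unfold Prm.ch; omega
        rw [this, A.ch_spec τ hmod, A.ch_spec τ hmod.le]; omega
      have h6 := h4 c
      have h7 := interp_succ A.R_pos (p.vtx (g + n)) (A.bt (A.ch τ (a % A.R))) c
      change p.vtx (g + n + 1) (A.ch τ (a % A.R) + 1) c = _
      simp only [vtx, p.W_eq_zero (show A.G < g + n + 1 by omega), add_zero] at h6 ⊢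
      rw [h5]
      rw [A.ch_spec τ hmod.le, Nat.mul_add_div A.R_pos, Nat.div_eq_of_lt hmod, add_zero, h2, h3,
        ← A.ch_spec τ hmod.le, h6] at h7
      linear_combination h7

end Pth

/-- An embedding of the combinatorial paths into Euclidean space. -/
structure Geo (A : Prm) (d : ℕ) where
  s : ℝ
  hs : 0 < s
  e : A.Crd ↪ Fin d

namespace Geo
variable {A : Prm} {d : ℕ} (E : Geo A d)

/-- Mesh of the level `H`. -/
noncomputable def sH (H : ℕ) : ℝ := E.s / A.R ^ H

/-- The point with the given coordinates. -/
noncomputable def emb (f : A.Crd → ℝ) : EuclideanSpace ℝ (Fin d) :=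
  WithLp.toLp 2 (Function.extend E.e f 0)

/-- Position of a vertex of level `H`. -/
noncomputable def pos (p : Pth A) (H τ : ℕ) : EuclideanSpace ℝ (Fin d) :=
  E.emb fun c => E.sH H * p.vtx H τ c

lemma sH_pos (H : ℕ) : 0 < E.sH H :=
  div_pos E.hs (pow_pos (by exact_mod_cast A.R_pos) H)

lemma sH_succ (H : ℕ) : E.sH H = A.R * E.sH (H + 1) := by
  have : (A.R : ℝ) ≠ 0 := by exact_mod_cast A.R_pos.ne'
  unfold sH
  rw [pow_succ]; field_simp

lemma sH_add (H n : ℕ) : E.sH H = A.R ^ n * E.sH (H + n) := by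
  induction n with
  | zero => simp
  | succ n ih => rw [ih, sH_succ, pow_succ, add_assoc]; ring

lemma sum_emb (F : ℝ → ℝ) (hF : F 0 = 0) (f : A.Crd → ℝ) :
    ∑ j, F (E.emb f j) = ∑ c, F (f c) := by
  have h1 : ∀ c, F (f c) = F (E.emb f (E.e c)) := fun c => by
    simp only [emb]; rw [E.e.injective.extend_apply]
  simp_rw [h1]
  rw [← Finset.sum_map Finset.univ E.e (fun j => F (E.emb f j))]
  symm
  refine Finset.sum_subset (Finset.subset_univ _) fun j _ hj => ?_
  have h2 : ¬ ∃ c, E.e c = j := by simpa using hj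
  simp only [emb]
  rw [Function.extend_apply' _ _ _ h2]
  exact hF

lemma emb_sub (f f' : A.Crd → ℝ) : E.emb f - E.emb f' = E.emb fun c => f c - f' c := by
  ext j
  simp only [emb, PiLp.sub_apply]
  by_cases h : ∃ c, E.e c = j
  · obtain ⟨c, rfl⟩ := h
    simp only [E.e.injective.extend_apply]
  · simp only [Function.extend_apply' _ _ _ h]; simp

lemma dist_emb_sq (f f' : A.Crd → ℝ) :
    dist (E.emb f) (E.emb f') ^ 2 = ∑ c, (f c - f' c) ^ 2 := by
  rw [dist_eq_norm, emb_sub, EuclideanSpace.norm_sq_eq]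
  simp_rw [Real.norm_eq_abs, sq_abs]
  exact E.sum_emb (fun x => x ^ 2) (by norm_num) _

lemma dist_pos_sq (p p' : Pth A) (H τ τ' : ℕ) :
    dist (E.pos p H τ) (E.pos p' H τ') ^ 2 = E.sH H ^ 2 * (p.sqd p' H τ τ' : ℤ) := by
  unfold pos Pth.sqd
  rw [dist_emb_sq]
  push_cast
  rw [Finset.mul_sum]
  exact Finset.sum_congr rfl fun c _ => by ring

lemma dist_pos_succ_le (p : Pth A) (H τ : ℕ) :
    dist (E.pos p (H + 1) τ) (E.pos p H (A.pe τ)) ≤ 3 * A.R * E.sH H := by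
  have hs := (E.sH_pos H).le
  refine abs_le_of_sq_le_sq' ?_ (by positivity) |>.2
  unfold pos
  rw [dist_emb_sq]
  have h1 : ∀ c, (E.sH (H + 1) * (p.vtx (H + 1) τ c : ℝ) - E.sH H * p.vtx H (A.pe τ) c) ^ 2 =
      E.sH (H + 1) ^ 2 * ((p.vtx (H + 1) τ c - A.R * p.vtx H (A.pe τ) c : ℤ) : ℝ) ^ 2 := fun c => by
    rw [E.sH_succ H]; push_cast; ring
  simp_rw [h1]
  rw [← Finset.mul_sum, E.sH_succ H]
  have h2 : ((∑ c, (p.vtx (H + 1) τ c - A.R * p.vtx H (A.pe τ) c) ^ 2 : ℤ) : ℝ) ≤ 9 * A.R ^ 4 := by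
    exact_mod_cast p.sum_sq_vtx_succ_sub_le H τ
  push_cast at h2 ⊢
  calc _ ≤ E.sH (H + 1) ^ 2 * (9 * (A.R : ℝ) ^ 4) := mul_le_mul_of_nonneg_left h2 (sq_nonneg _)
    _ = _ := by ring

lemma dist_pos_iterate_le (p : Pth A) (g n τ : ℕ) :
    dist (E.pos p (g + n) τ) (E.pos p g (A.pe^[n] τ)) ≤ 3.1 * A.R * E.sH g := by
  have hR : (64 : ℝ) ≤ A.R := by exact_mod_cast A.hR
  suffices h : dist (E.pos p (g + n) τ) (E.pos p g (A.pe^[n] τ)) ≤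
      3.1 * A.R * (E.sH g - E.sH (g + n)) by
    have := E.sH_pos (g + n)
    nlinarith
  induction n generalizing τ with
  | zero => simp
  | succ n ih =>
    rw [Function.iterate_succ_apply, ← add_assoc]
    refine (dist_triangle _ (E.pos p (g + n) (A.pe τ)) _).trans ?_
    have h1 := ih (A.pe τ)
    have h2 := E.dist_pos_succ_le p (g + n) τ
    have h3 := E.sH_succ (g + n)
    have h4 := E.sH_pos (g + n + 1)
    rw [h3] at h1 h2
    nlinarith [mul_pos h4 h4, mul_nonneg h4.le (sub_nonneg.2 hR)]

lemma dist_pos_add_le (p : Pth A) (g e n : ℕ) :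
    dist (E.pos p g e) (E.pos p g (e + n)) ≤ n * E.sH g := by
  have hs := (E.sH_pos g).le
  induction n with
  | zero => simp
  | succ n ih =>
    refine (dist_triangle _ (E.pos p g (e + n)) _).trans ?_
    have h1 : dist (E.pos p g (e + n)) (E.pos p g (e + (n + 1))) ≤ E.sH g := by
      refine abs_le_of_sq_le_sq' ?_ hs |>.2
      rw [dist_pos_sq, Pth.sqd]
      have h2 := (p.near1_vtx g (e + n)).sum_sq_le
      have h3 : ((∑ c, (p.vtx g (e + n) c - p.vtx g (e + (n + 1)) c) ^ 2 : ℤ) : ℝ) ≤ 1 := by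
        norm_cast
        refine le_trans (le_of_eq (Finset.sum_congr rfl fun c _ => ?_)) h2
        rw [← add_assoc]; ring
      exact mul_le_of_le_one_right (sq_nonneg _) h3
    push_cast
    linarith

end Geo
end WN

end

section

open Finset MeasureTheory ProbabilityTheory

namespace WN

/-- Sequential filling: a nonnegative mass distribution whose potential is at least one everywhere,
with bounded mass on cliques and bounded energy. -/
lemma exists_filling {Z : Type} (s : Finset Z) {K : Z → Z → ℝ} (hK : ∀ z w, 0 ≤ K z w)
    (hKc : ∀ z w, K z w = K w z) (hKd : ∀ z, 0 < K z z) {κ : ℝ} :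
    ∃ x : Z → ℝ, (∀ z, 0 ≤ x z) ∧ (∀ z ∈ s, 1 ≤ ∑ w ∈ s, K z w * x w) ∧
      (∀ C ⊆ s, (∀ z ∈ C, ∀ w ∈ C, κ ≤ K z w) → κ * ∑ w ∈ C, x w ≤ 1) ∧
      ∑ z ∈ s, ∑ w ∈ s, x z * x w * K z w ≤ 2 * ∑ z ∈ s, x z := by
  classical
  induction s using Finset.induction_on with
  | empty =>
    refine ⟨0, by simp, by simp, fun C hC _ => ?_, by simp⟩
    rw [Finset.subset_empty.1 hC]; simp
  | insert a s ha ih =>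
    obtain ⟨x, h1, h2, h3, h4⟩ := ih
    set V := ∑ w ∈ s, K a w * x w
    set xa : ℝ := max 0 ((1 - V) / K a a)
    have hxa : 0 ≤ xa := le_max_left _ _
    set x' := Function.update x a xa
    have e1 : x' a = xa := Function.update_self _ _ _
    have e2 : ∀ w ∈ s, x' w = x w := fun w hw =>
      Function.update_of_ne (ne_of_mem_of_not_mem hw ha) _ _
    have h1' : ∀ z, 0 ≤ x' z := fun z => by
      simp only [x', Function.update_apply]; split_ifs; exacts [hxa, h1 z]
    have hs : ∀ z, ∑ w ∈ s, K z w * x' w = ∑ w ∈ s, K z w * x w := fun z =>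
      Finset.sum_congr rfl fun w hw => by rw [e2 w hw]
    have hge : 1 ≤ K a a * xa + V := by
      have : (1 - V) / K a a ≤ xa := le_max_right _ _
      rw [div_le_iff₀ (hKd a)] at this; linarith
    have heq : 0 < xa → K a a * xa + V = 1 := fun h => by
      have : xa = (1 - V) / K a a := by
        rcases max_choice 0 ((1 - V) / K a a) with h5 | h5
        · exact absurd h5 h.ne'
        · exact h5
      rw [this, mul_div_cancel₀ _ (hKd a).ne']; ring
    refine ⟨x', h1', fun z hz => ?_, fun C hC hcl => ?_, ?_⟩
    · rw [Finset.sum_insert ha, e1, hs]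
      rcases Finset.mem_insert.1 hz with rfl | hz
      · exact hge
      · have := h2 z hz
        have := mul_nonneg (hK z a) hxa
        linarith
    · by_cases hpos : a ∈ C ∧ 0 < xa
      · rw [Finset.mul_sum]
        calc ∑ w ∈ C, κ * x' w ≤ ∑ w ∈ C, K a w * x' w := Finset.sum_le_sum fun w hw =>
              mul_le_mul_of_nonneg_right (hcl a hpos.1 w hw) (h1' w)
          _ ≤ ∑ w ∈ insert a s, K a w * x' w := Finset.sum_le_sum_of_subset_of_nonneg hC
              fun w _ _ => mul_nonneg (hK a w) (h1' w)
          _ = 1 := by rw [Finset.sum_insert ha, e1, hs, heq hpos.2]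
      · have hC' : C.erase a ⊆ s := fun w hw => by
          have := hC (Finset.mem_of_mem_erase hw)
          exact (Finset.mem_insert.1 this).resolve_left (Finset.ne_of_mem_erase hw)
        have h5 := h3 (C.erase a) hC' fun z hz w hw =>
          hcl z (Finset.mem_of_mem_erase hz) w (Finset.mem_of_mem_erase hw)
        have h6 : ∑ w ∈ C, x' w = ∑ w ∈ C.erase a, x w := by
          rw [Finset.sum_congr rfl fun w hw => (e2 w (hC' hw)).symm]
          by_cases haC : a ∈ C
          · have : xa = 0 := le_antisymm (not_lt.1 fun h => hpos ⟨haC, h⟩) hxa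
            rw [← Finset.add_sum_erase C x' haC, e1, this, zero_add]
          · rw [Finset.erase_eq_of_notMem haC]
        rw [h6]; exact h5
    · have h5 : ∑ z ∈ insert a s, ∑ w ∈ insert a s, x' z * x' w * K z w =
          xa * (K a a * xa + V) + xa * V + ∑ z ∈ s, ∑ w ∈ s, x z * x w * K z w := by
        rw [Finset.sum_insert ha, Finset.sum_insert ha]
        simp only [Finset.sum_insert ha]
        rw [Finset.sum_add_distrib, e1]
        have i1 : ∑ w ∈ s, xa * x' w * K a w = xa * V := by
          rw [Finset.mul_sum]; exact Finset.sum_congr rfl fun w hw => by rw [e2 w hw]; ring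
        have i2 : ∑ z ∈ s, x' z * xa * K z a = xa * V := by
          rw [Finset.mul_sum]; exact Finset.sum_congr rfl fun w hw => by rw [e2 w hw, hKc w a]; ring
        have i3 : ∑ z ∈ s, ∑ w ∈ s, x' z * x' w * K z w = ∑ z ∈ s, ∑ w ∈ s, x z * x w * K z w :=
          Finset.sum_congr rfl fun z hz => Finset.sum_congr rfl fun w hw => by
            rw [e2 w hw, e2 z hz]
        rw [i1, i2, i3]; ring
      rw [h5, Finset.sum_insert ha, e1, Finset.sum_congr rfl e2]
      have hV : 0 ≤ V := Finset.sum_nonneg fun w _ => mul_nonneg (hK a w) (h1 w)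
      rcases hxa.eq_or_lt with h6 | h6
      · rw [← h6]; linarith
      · have h7 := heq h6
        have h8 : V ≤ 1 := by have := mul_nonneg (hKd a).le hxa; linarith
        rw [h7]
        nlinarith

lemma exists_unit_filling {Z : Type} (s : Finset Z) {K : Z → Z → ℝ} (hK : ∀ z w, 0 ≤ K z w)
    (hKc : ∀ z w, K z w = K w z) (hKd : ∀ z, 0 < K z z) {κ : ℝ} (hκ : 0 < κ) (q : Z → ℕ)
    (a n : ℕ) (hn : 0 < n) (hq : ∀ z ∈ s, q z / n = a)
    (hcl : ∀ z ∈ s, ∀ w ∈ s, q z = q w → κ ≤ K z w) :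
    ∃ x : Z → ℝ, (∀ z, 0 ≤ x z) ∧ (∀ z ∈ s, 1 ≤ ∑ w ∈ s, K z w * x w) ∧
      ∑ w ∈ s, x w ≤ n / κ ∧
      ∑ z ∈ s, ∑ w ∈ s, x z * x w * K z w ≤ 2 * (n / κ) := by
  classical
  obtain ⟨x, h1, h2, h3, h4⟩ := exists_filling s hK hKc hKd (κ := κ)
  have h5 : ∑ w ∈ s, x w ≤ n / κ := by
    have hmaps : ∀ z ∈ s, q z ∈ (Finset.range n).image fun t => n * a + t := fun z hz => by
      refine Finset.mem_image.2 ⟨q z % n, Finset.mem_range.2 (Nat.mod_lt _ hn), ?_⟩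
      rw [← hq z hz]; exact Nat.div_add_mod _ _
    rw [← Finset.sum_fiberwise_of_maps_to hmaps]
    calc _ ≤ ∑ t ∈ (Finset.range n).image fun t => n * a + t, 1 / κ := by
          refine Finset.sum_le_sum fun t _ => ?_
          rw [le_div_iff₀ hκ, mul_comm]
          refine h3 _ (Finset.filter_subset _ _) fun z hz w hw => ?_
          rw [Finset.mem_filter] at hz hw
          exact hcl z hz.1 w hw.1 (hz.2.trans hw.2.symm)
      _ ≤ n * (1 / κ) := by
          rw [Finset.sum_const, nsmul_eq_mul]
          refine mul_le_mul_of_nonneg_right ?_ (by positivity)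
          exact_mod_cast Finset.card_image_le.trans (by simp)
      _ = n / κ := by ring
  exact ⟨x, h1, h2, h5, h4.trans (by linarith)⟩

/-- All the parameters of the construction, and the relations between them. -/
structure Cfg (A : Prm) (d : ℕ) where
  E : Geo A d
  J : ℕ
  n : ℕ
  k : ℕ
  N : ℕ
  hJ : 200 ≤ J
  hR : A.R = 2 ^ J
  hy : A.y ≤ A.R ^ 30
  hD : A.D = A.R ^ 29
  hs : E.s = A.R ^ A.G * sc (n + 12) / Nat.sqrt d
  hr1 : A.R ^ 32 ≤ Nat.sqrt d
  hr2 : Nat.sqrt d ≤ 2 ^ 32 * A.R ^ 32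
  hk : 1 ≤ k
  hn : 6 * k ≤ n
  hG1 : n - 3 * k ≤ J * A.G
  hG2 : J * A.G < n - 3 * k + J
  hm1 : 2 * sc (3 * k) ≤ A.L * A.y * E.s
  hm2 : A.L * A.y * E.s ≤ 5 / 2 * sc (3 * k)

lemma d_le {d : ℕ} : (d : ℝ) ≤ (Nat.sqrt d + 1) ^ 2 := by
  have := Nat.lt_succ_sqrt' d
  have h2 : d ≤ (Nat.sqrt d + 1) ^ 2 := by rw [Nat.succ_eq_add_one] at this; omega
  exact_mod_cast h2

lemma le_d {d : ℕ} : (Nat.sqrt d : ℝ) ^ 2 ≤ d := by exact_mod_cast Nat.sqrt_le' d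

namespace Cfg
variable {A : Prm} {d : ℕ} (C : Cfg A d)

/-- The level of the path associated to a scale of the field. -/
def lev (i : ℕ) : ℕ := A.G - (C.n - 1 - i) / C.J

/-- The offset of a scale of the field inside its level. -/
def off (i : ℕ) : ℕ := (C.n - 1 - i) % C.J

lemma J_pos : 0 < C.J := by have := C.hJ; omega

lemma off_lt (i : ℕ) : C.off i < C.J := Nat.mod_lt _ C.J_pos

lemma lev_le (i : ℕ) : C.lev i ≤ A.G := Nat.sub_le _ _

lemma div_lt {i : ℕ} (hi : 3 * C.k ≤ i) (hin : i < C.n) : (C.n - 1 - i) / C.J < A.G := by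
  rw [Nat.div_lt_iff_lt_mul C.J_pos, mul_comm]
  have := C.hG1
  omega

lemma one_le_lev {i : ℕ} (hi : 3 * C.k ≤ i) (hin : i < C.n) : 1 ≤ C.lev i := by
  have := C.div_lt hi hin
  unfold lev; omega

lemma two_pow_off_mul_le (i : ℕ) : 2 * 2 ^ C.off i ≤ A.R := by
  rw [C.hR, ← pow_succ']
  exact Nat.pow_le_pow_right (by norm_num) (C.off_lt i)

include C in
lemma sqrt_pos : 0 < Nat.sqrt d := (pow_pos A.R_pos 32).trans_le C.hr1

lemma sc_eq {i : ℕ} (hi : 3 * C.k ≤ i) (hin : i < C.n) :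
    sc (i + 1) = 2 ^ (12 + C.off i) * Nat.sqrt d * C.E.sH (C.lev i) := by
  have h1 := C.div_lt hi hin
  have h2 := Nat.div_add_mod (C.n - 1 - i) C.J
  have hr : (Nat.sqrt d : ℝ) ≠ 0 := by exact_mod_cast C.sqrt_pos.ne'
  have hR0 : (A.R : ℝ) ≠ 0 := by exact_mod_cast A.R_pos.ne'
  have h3 : A.G = C.lev i + (C.n - 1 - i) / C.J := by unfold lev; omega
  have h4 : C.E.sH (C.lev i) = A.R ^ ((C.n - 1 - i) / C.J) * sc (C.n + 12) / Nat.sqrt d := by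
    unfold Geo.sH
    rw [C.hs]
    nth_rewrite 1 [h3]
    rw [pow_add]; field_simp
  have h5 : sc (i + 1) = 2 ^ (C.n - 1 - i) * (2 ^ 12 * sc (C.n + 12)) := by
    unfold sc
    rw [← zpow_natCast, ← zpow_natCast, ← zpow_add₀ (by norm_num), ← zpow_add₀ (by norm_num)]
    congr 1
    push_cast [show C.n - 1 - i = C.n - (1 + i) by omega, Nat.cast_sub (show 1 + i ≤ C.n by omega)]
    ring
  rw [h4, h5]
  nth_rewrite 1 [← h2]
  rw [pow_add, pow_mul, C.hR]
  unfold off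
  push_cast
  field_simp
  ring

include C in
lemma R_large : (2 : ℝ) ^ 200 ≤ A.R := by
  rw [C.hR]; push_cast
  exact pow_le_pow_right₀ (by norm_num) C.hJ

include C in
lemma sqrt_large : (2 : ℝ) ^ 200 ≤ Nat.sqrt d := by
  have h1 : ((A.R ^ 32 : ℕ) : ℝ) ≤ Nat.sqrt d := by exact_mod_cast C.hr1
  have h2 := C.R_large
  push_cast at h1
  have h3 : (A.R : ℝ) ≤ A.R ^ 32 := le_self_pow₀ (by linarith) (by norm_num)
  linarith

include C in
lemma neZero : NeZero d := ⟨fun h => by have := C.sqrt_pos; simp [h] at this⟩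

/-- Length of the clusters of edges used for the scale `i`. -/
def clen (i : ℕ) : ℕ := A.R * 2 ^ (10 + C.off i)

/-- Number of clusters of a unit. -/
def cnum (i : ℕ) : ℕ := 2 ^ (4 * C.J - 7 - C.off i)

lemma clen_mul_cnum (i : ℕ) : C.clen i * C.cnum i = 2 * A.R * A.U := by
  have h1 := C.off_lt i
  have h2 := C.hJ
  unfold clen cnum Prm.U
  have h3 : 2 ^ (10 + C.off i) * 2 ^ (4 * C.J - 7 - C.off i) = 8 * A.R ^ 4 := by
    rw [← pow_add, C.hR, ← pow_mul, show 10 + C.off i + (4 * C.J - 7 - C.off i) = 3 + C.J * 4 by omega,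
      pow_add]
    norm_num
  rw [mul_assoc, h3]; ring

lemma clen_pos (i : ℕ) : 0 < C.clen i := Nat.mul_pos A.R_pos (by positivity)

lemma cnum_pos (i : ℕ) : 0 < C.cnum i := by unfold cnum; positivity

lemma cnum_eq (i : ℕ) : (C.cnum i : ℝ) = A.R ^ 4 / 2 ^ (7 + C.off i) := by
  have h1 := C.off_lt i
  have h2 := C.hJ
  rw [eq_div_iff (by positivity)]
  unfold cnum
  rw [C.hR]
  push_cast
  rw [← pow_add, ← pow_mul]
  congr 1; omega

lemma cluster_close (p : Pth A) {i H τ τ' : ℕ} (hi : 3 * C.k ≤ i) (hin : i < C.n) (hH : A.G < H)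
    (h : A.pe^[H - C.lev i - 1] τ / C.clen i = A.pe^[H - C.lev i - 1] τ' / C.clen i) :
    have := C.neZero
    3 / 10 ≤ scaleCov i (C.E.pos p H τ) (C.E.pos p H τ') := by
  have := C.neZero
  refine le_scaleCov_of_close ?_
  have h0 := C.lev_le i
  set γ := C.lev i with hγ
  obtain ⟨t, rfl⟩ : ∃ t, H = γ + 1 + t := ⟨H - γ - 1, by omega⟩
  have e1 : γ + 1 + t - γ - 1 = t := by omega
  rw [e1] at h
  have d1 := C.E.dist_pos_iterate_le p (γ + 1) t τ
  have d2 := C.E.dist_pos_iterate_le p (γ + 1) t τ'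
  have hs := C.E.sH_pos (γ + 1)
  have key : ∀ e e' : ℕ, e / C.clen i = e' / C.clen i → e ≤ e' →
      dist (C.E.pos p (γ + 1) e) (C.E.pos p (γ + 1) e') ≤ C.clen i * C.E.sH (γ + 1) := by
    intro e e' hee hle
    obtain ⟨m, rfl⟩ := Nat.exists_eq_add_of_le hle
    refine (C.E.dist_pos_add_le p (γ + 1) e m).trans (mul_le_mul_of_nonneg_right ?_ hs.le)
    have f1 := Nat.div_add_mod e (C.clen i)
    have f2 := Nat.div_add_mod (e + m) (C.clen i)
    have f3 := Nat.mod_lt (e + m) (C.clen_pos i)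
    rw [← hee] at f2
    exact_mod_cast (show m ≤ C.clen i by omega)
  have d3 : dist (C.E.pos p (γ + 1) (A.pe^[t] τ)) (C.E.pos p (γ + 1) (A.pe^[t] τ')) ≤
      C.clen i * C.E.sH (γ + 1) := by
    rcases le_total (A.pe^[t] τ) (A.pe^[t] τ') with h3 | h3
    · exact key _ _ h h3
    · rw [dist_comm]; exact key _ _ h.symm h3
  have d4 : dist (C.E.pos p (γ + 1 + t) τ) (C.E.pos p (γ + 1 + t) τ') ≤
      (C.clen i + 6.2 * A.R) * C.E.sH (γ + 1) := by
    have := dist_triangle4 (C.E.pos p (γ + 1 + t) τ) (C.E.pos p (γ + 1) (A.pe^[t] τ))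
      (C.E.pos p (γ + 1) (A.pe^[t] τ')) (C.E.pos p (γ + 1 + t) τ')
    rw [dist_comm (C.E.pos p (γ + 1) (A.pe^[t] τ')) (C.E.pos p (γ + 1 + t) τ')] at this
    linarith
  have hr := C.sqrt_large
  have hsc := C.sc_eq hi hin
  rw [← hγ, C.E.sH_succ γ] at hsc
  set Z : ℝ := 2 ^ (C.off i) * (A.R * C.E.sH (γ + 1)) with hZ
  have hRp : (0 : ℝ) < A.R := by exact_mod_cast A.R_pos
  have hZ0 : 0 < Z := by positivity
  have d5 : dist (C.E.pos p (γ + 1 + t) τ) (C.E.pos p (γ + 1 + t) τ') ≤ 1031 * Z := by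
    refine d4.trans ?_
    unfold clen
    push_cast
    have : (1 : ℝ) ≤ 2 ^ C.off i := one_le_pow₀ (by norm_num)
    have h5 : A.R * C.E.sH (γ + 1) ≤ Z := le_mul_of_one_le_left (by positivity) this
    rw [pow_add]
    calc _ = 2 ^ 10 * Z + 6.2 * (A.R * C.E.sH (γ + 1)) := by rw [hZ]; ring
      _ ≤ _ := by linarith
  have hsc' : sc (i + 1) = 4096 * Nat.sqrt d * Z := by
    rw [hsc, pow_add, hZ]; ring
  rw [hsc']
  have hd := d_le (d := d)
  have h6 : (Nat.sqrt d + 1 : ℝ) ^ 2 ≤ 1.1 * Nat.sqrt d ^ 2 := by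
    nlinarith
  calc (d : ℝ) * dist (C.E.pos p (γ + 1 + t) τ) (C.E.pos p (γ + 1 + t) τ') ^ 2 ≤
      (1.1 * Nat.sqrt d ^ 2) * (1031 * Z) ^ 2 := by
        gcongr
        exact hd.trans h6
    _ ≤ _ := by nlinarith [sq_nonneg (Nat.sqrt d * Z : ℝ)]

/-- The vertices of level `H` in the unit `a` of level `g`. -/
def un (g H a : ℕ) : Finset ℕ :=
  (Finset.range (A.T C.N H)).filter fun τ => A.uu g (A.pe^[H - g] τ) = a

/-- Bound for the mass of a unit. -/
noncomputable def Ms (i : ℕ) : ℝ := C.cnum i / (3 / 10)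

lemma Ms_nonneg (i : ℕ) : 0 ≤ C.Ms i := by unfold Ms; positivity

lemma exists_plant (p : Pth A) {i H : ℕ} (hi : 3 * C.k ≤ i) (hin : i < C.n) (hH : A.G < H) :
    have := C.neZero
    ∃ x : ℕ → ℝ, (∀ τ, 0 ≤ x τ) ∧
      (∀ τ < A.T C.N H, 1 ≤ ∑ σ ∈ Finset.range (A.T C.N H),
        scaleCov i (C.E.pos p H τ) (C.E.pos p H σ) * x σ) ∧
      (∀ a, ∑ σ ∈ C.un (C.lev i) H a, x σ ≤ C.Ms i) ∧
      ∀ a, ∑ τ ∈ C.un (C.lev i) H a, ∑ σ ∈ C.un (C.lev i) H a,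
        x τ * x σ * scaleCov i (C.E.pos p H τ) (C.E.pos p H σ) ≤ 2 * C.Ms i := by
  have := C.neZero
  have h1 := C.lev_le i
  have h2 := C.one_le_lev hi hin
  have hex : ∀ a, _ := fun a => exists_unit_filling (C.un (C.lev i) H a)
    (K := fun τ σ => scaleCov i (C.E.pos p H τ) (C.E.pos p H σ))
    (fun _ _ => scaleCov_nonneg _ _ _) (fun _ _ => scaleCov_comm _ _ _)
    (fun _ => by rw [scaleCov_self]; exact Real.log_pos (by norm_num))
    (κ := 3 / 10) (by norm_num) (fun τ => A.pe^[H - C.lev i - 1] τ / C.clen i) a (C.cnum i)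
    (C.cnum_pos i) (fun τ hτ => by
      have h3 := (Finset.mem_filter.1 hτ).2
      rw [Nat.div_div_eq_div_mul, clen_mul_cnum, ← h3]
      obtain ⟨t, ht⟩ : ∃ t, H - C.lev i = t + 1 := ⟨H - C.lev i - 1, by omega⟩
      rw [ht, Nat.add_sub_cancel, Function.iterate_succ_apply', A.uu_pe, Prm.uu,
        if_neg (Nat.succ_ne_zero _), Prm.lam, if_neg (by omega), Nat.div_div_eq_div_mul, mul_comm])
    (fun τ _ σ _ h => C.cluster_close p hi hin hH h)
  choose y hy1 hy2 hy3 hy4 using hex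
  have hun : ∀ a, ∀ σ ∈ C.un (C.lev i) H a, A.uu (C.lev i) (A.pe^[H - C.lev i] σ) = a :=
    fun a σ hσ => (Finset.mem_filter.1 hσ).2
  refine ⟨fun τ => y (A.uu (C.lev i) (A.pe^[H - C.lev i] τ)) τ, fun τ => hy1 _ _, fun τ hτ => ?_,
    fun a => ?_, fun a => ?_⟩
  · refine (hy2 (A.uu (C.lev i) (A.pe^[H - C.lev i] τ)) τ
      (Finset.mem_filter.2 ⟨Finset.mem_range.2 hτ, rfl⟩)).trans ?_
    refine le_trans (Finset.sum_le_sum fun σ hσ => ?_) (Finset.sum_le_sum_of_subset_of_nonneg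
      (Finset.filter_subset _ _) fun σ _ _ => mul_nonneg (scaleCov_nonneg _ _ _) (hy1 _ _))
    simp only [hun _ σ hσ, le_refl]
  · refine le_trans (Finset.sum_le_sum fun σ hσ => ?_) (hy3 a)
    simp only [hun _ σ hσ, le_refl]
  · refine le_trans (Finset.sum_le_sum fun τ hτ => Finset.sum_le_sum fun σ hσ => ?_) (hy4 a)
    simp only [hun _ σ hσ, hun _ τ hτ, le_refl]

end Cfg
end WN

end

section

open Finset MeasureTheory ProbabilityTheory

namespace WN

section
variable {d : ℕ} [NeZero d] {Ω : Type} [MeasurableSpace Ω] {P : Measure Ω} [IsProbabilityMeasure P]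
  {h : ℕ → EuclideanSpace ℝ (Fin d) → Ω → ℝ}

lemma cv_sum_incr (hh : IsWhiteNoiseField d P h) {i : ℕ} (hi : 1 ≤ i) {ι κ : Type} (s : Finset ι)
    (t : Finset κ) (x : ι → ℝ) (y : κ → ℝ) (u : ι → EuclideanSpace ℝ (Fin d))
    (w : κ → EuclideanSpace ℝ (Fin d)) :
    cv P (∑ a ∈ s, x a • incr h i (u a)) (∑ b ∈ t, y b • incr h i (w b)) =
      ∑ a ∈ s, ∑ b ∈ t, x a * y b * scaleCov i (u a) (w b) := by
  have hV := gaussSpace_fieldSpan hh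
  have m1 : ∀ (c : ℝ) z, c • incr h i z ∈ fieldSpan h := fun c z =>
    (fieldSpan h).smul_mem _ (incr_mem hi z)
  rw [hV.cv_sum_left s (fun a _ => m1 _ _) ((fieldSpan h).sum_mem fun b _ => m1 _ _)]
  refine Finset.sum_congr rfl fun a _ => ?_
  rw [hV.cv_sum_right t (fun a _ => m1 _ _) (m1 _ _)]
  refine Finset.sum_congr rfl fun b _ => ?_
  rw [cv_smul_left, cv_smul_right, cv_incr hh hi hi, if_pos rfl]
  ring

lemma scaleCov_cross_le (hh : IsWhiteNoiseField d P h) {i : ℕ} (hi : 1 ≤ i) {ι κ : Type}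
    (s : Finset ι) (t : Finset κ) (x : ι → ℝ) (y : κ → ℝ) (u : ι → EuclideanSpace ℝ (Fin d))
    (w : κ → EuclideanSpace ℝ (Fin d)) {q : ℝ}
    (hx : ∑ a ∈ s, ∑ b ∈ s, x a * x b * scaleCov i (u a) (u b) ≤ q)
    (hy : ∑ a ∈ t, ∑ b ∈ t, y a * y b * scaleCov i (w a) (w b) ≤ q) :
    ∑ a ∈ s, ∑ b ∈ t, x a * y b * scaleCov i (u a) (w b) ≤ q := by
  have hV := gaussSpace_fieldSpan hh
  have m1 : ∀ (c : ℝ) z, c • incr h i z ∈ fieldSpan h := fun c z =>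
    (fieldSpan h).smul_mem _ (incr_mem hi z)
  have mX : ∑ a ∈ s, x a • incr h i (u a) ∈ fieldSpan h := (fieldSpan h).sum_mem fun b _ => m1 _ _
  have mY : ∑ b ∈ t, y b • incr h i (w b) ∈ fieldSpan h := (fieldSpan h).sum_mem fun b _ => m1 _ _
  have h1 := cv_self_nonneg (P := P) (∑ a ∈ s, x a • incr h i (u a) - ∑ b ∈ t, y b • incr h i (w b))
  rw [hV.cv_sub_left mX mY ((fieldSpan h).sub_mem mX mY), hV.cv_sub_right mX mY mX,
    hV.cv_sub_right mX mY mY, cv_comm (∑ b ∈ t, y b • incr h i (w b)) (∑ a ∈ s, x a • incr h i (u a)),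
    cv_sum_incr hh hi, cv_sum_incr hh hi, cv_sum_incr hh hi] at h1
  linarith

end

namespace Prm
variable (A : Prm)

/-- Number of units of level `g + t` in a unit of level `g`. -/
def pl (g t : ℕ) : ℕ := ∏ l ∈ Finset.range t, A.lam (g + l)

lemma pl_pos (g t : ℕ) : 0 < A.pl g t := Finset.prod_pos fun _ _ => A.lam_pos _

lemma uu_pe_iterate (g t e : ℕ) : A.uu g (A.pe^[t] e) = A.uu (g + t) e / A.pl g t := by
  induction t generalizing e with
  | zero => simp [pl]
  | succ t ih =>
    rw [Function.iterate_succ_apply, ih, uu_pe, Nat.div_div_eq_div_mul, pl, pl,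
      Finset.prod_range_succ, mul_comm, add_assoc]

lemma nu_add (N g t : ℕ) : A.nu N (g + t) = A.nu N g * A.pl g t := by
  induction t with
  | zero => simp [pl]
  | succ t ih => rw [← add_assoc, nu, ih, pl, pl, Finset.prod_range_succ, mul_assoc]

end Prm

lemma sum_range_mul_div (f : ℕ → ℝ) (n m : ℕ) (hm : 0 < m) :
    ∑ a ∈ Finset.range (n * m), f (a / m) = m * ∑ a ∈ Finset.range n, f a := by
  induction n with
  | zero => simp
  | succ n ih =>
    rw [Nat.succ_mul, Finset.sum_range_add, ih, Finset.sum_range_succ, mul_add]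
    congr 1
    rw [Finset.sum_congr rfl (g := fun _ => f n) fun b hb => by
      rw [mul_comm n m, Nat.mul_add_div hm, Nat.div_eq_of_lt (Finset.mem_range.1 hb), add_zero]]
    simp

namespace Pth
variable {A : Prm} (p p' : Pth A)

open Classical in
/-- Number of alive units. -/
noncomputable def sC (N g : ℕ) : ℕ := ((Finset.range (A.nu N g)).filter fun a => p.Alive p' g a).card

/-- Neighbouring units, the first of which is alive. -/
def NA (g a b : ℕ) : Prop := (a ≤ b + 1 ∧ b ≤ a + 1) ∧ p.Alive p' g a

open Classical in
lemma sum_NA_le (N g : ℕ) :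
    ∑ a ∈ Finset.range (A.nu N g), ∑ b ∈ Finset.range (A.nu N g),
      (if p.NA p' g a b then (1 : ℝ) else 0) ≤ 3 * p.sC p' N g := by
  have h1 : ∀ a, ∑ b ∈ Finset.range (A.nu N g), (if p.NA p' g a b then (1 : ℝ) else 0) ≤
      if p.Alive p' g a then 3 else 0 := fun a => by
    split_ifs with ha
    · rw [← Finset.sum_filter, Finset.sum_const, nsmul_eq_mul, mul_one]
      have : ((Finset.range (A.nu N g)).filter fun b => p.NA p' g a b) ⊆ Finset.Icc (a - 1) (a + 1) :=
        fun b hb => by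
          have := (Finset.mem_filter.1 hb).2.1
          rw [Finset.mem_Icc]; omega
      have h2 := Finset.card_le_card this
      rw [Nat.card_Icc] at h2
      exact_mod_cast h2.trans (by omega)
    · exact (Finset.sum_eq_zero fun b _ => if_neg fun h => ha h.2).le
  refine (Finset.sum_le_sum fun a _ => h1 a).trans ?_
  rw [← Finset.sum_filter, Finset.sum_const, nsmul_eq_mul, sC, mul_comm]

open Classical in
lemma sum_NA_anc_le (N g t : ℕ) :
    ∑ a ∈ Finset.range (A.nu N (g + t)), ∑ b ∈ Finset.range (A.nu N (g + t)),
      (if p.NA p' g (a / A.pl g t) (b / A.pl g t) then (1 : ℝ) else 0) ≤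
      (A.pl g t) ^ 2 * (3 * p.sC p' N g) := by
  rw [A.nu_add]
  rw [Finset.sum_congr rfl fun a _ => sum_range_mul_div
    (fun b => if p.NA p' g (a / A.pl g t) b then (1 : ℝ) else 0) _ _ (A.pl_pos g t)]
  rw [← Finset.mul_sum, sum_range_mul_div (fun a => ∑ b ∈ Finset.range (A.nu N g),
    if p.NA p' g a b then (1 : ℝ) else 0) _ _ (A.pl_pos g t)]
  have := p.sum_NA_le p' N g
  have h2 : (0 : ℝ) ≤ A.pl g t := by positivity
  nlinarith [mul_le_mul_of_nonneg_left this (mul_nonneg h2 h2)]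

end Pth

namespace Cfg
variable {A : Prm} {d : ℕ} (C : Cfg A d)

/-- Covariance bound for points of units that are not close. -/
noncomputable def xi (A : Prm) : ℝ := Real.exp (-(A.R ^ 2 / 2 ^ 33))

lemma dist_sq_of_K_le (p p' : Pth A) {H τ τ' : ℕ}
    (hK : (((A.R ^ H * (A.L * A.y) : ℕ) : ℤ)) ^ 2 ≤ p.sqd p' H τ τ') :
    2 * sc (3 * C.k) ≤ dist (C.E.pos p H τ) (C.E.pos p' H τ') := by
  refine C.hm1.trans (abs_le_of_sq_le_sq ?_ dist_nonneg |> (le_abs_self _).trans)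
  rw [C.E.dist_pos_sq]
  have h1 : ((A.R ^ H * (A.L * A.y) : ℕ) : ℝ) ^ 2 ≤ (p.sqd p' H τ τ' : ℤ) := by exact_mod_cast hK
  have h2 : (A.L * A.y * C.E.s : ℝ) = C.E.sH H * ((A.R ^ H * (A.L * A.y) : ℕ) : ℝ) := by
    have : (A.R : ℝ) ≠ 0 := by exact_mod_cast A.R_pos.ne'
    unfold Geo.sH; push_cast; field_simp
  rw [h2, mul_pow]
  exact mul_le_mul_of_nonneg_left h1 (sq_nonneg _)

lemma sc_le_sH {i : ℕ} (hi : 3 * C.k ≤ i) (hin : i < C.n) :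
    sc i ≤ 2 ^ 12 * A.R * Nat.sqrt d * C.E.sH (C.lev i) := by
  have h1 := C.sc_eq hi hin
  have h2 := C.two_pow_off_mul_le i
  have h3 : (2 * 2 ^ C.off i : ℝ) ≤ A.R := by exact_mod_cast h2
  rw [sc_succ] at h1
  have h4 := C.E.sH_pos (C.lev i)
  calc sc i = 2 ^ 12 * (2 * 2 ^ C.off i) * Nat.sqrt d * C.E.sH (C.lev i) := by
        rw [pow_add] at h1; linarith
    _ ≤ _ := by gcongr

lemma scaleCov_far (p p' : Pth A) {i H τ τ' : ℕ} (hi : 3 * C.k ≤ i) (hin : i < C.n) (hH : A.G < H)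
    (hna : ¬ p.NA p' (C.lev i) (A.uu (C.lev i) (A.pe^[H - C.lev i] τ))
      (A.uu (C.lev i) (A.pe^[H - C.lev i] τ'))) :
    have := C.neZero
    scaleCov i (C.E.pos p H τ) (C.E.pos p' H τ') ≤ xi A := by
  have := C.neZero
  have h1 := C.lev_le i
  have hxi : 0 ≤ xi A := (Real.exp_pos _).le
  by_cases h0 : p.sqd p' H τ τ' < (((A.R ^ H * (A.L * A.y) : ℕ) : ℤ)) ^ 2
  · have hs : ¬ 64 * p.sqd p' H τ τ' < A.R ^ (2 * (H - C.lev i) + 4) := fun hs => by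
      have := p.near_alive p' h1 (by omega) h0 hs
      exact hna ⟨this.1, this.2.1⟩
    refine (scaleCov_le_exp i _ _).trans (Real.exp_le_exp.2 (neg_le_neg ?_))
    rw [C.E.dist_pos_sq]
    have h2 : (A.R ^ (2 * (H - C.lev i) + 4) : ℝ) ≤ 64 * (p.sqd p' H τ τ' : ℤ) := by
      exact_mod_cast not_lt.1 hs
    have h3 := C.sc_le_sH hi hin
    have h4 := C.E.sH_add (C.lev i) (H - C.lev i)
    rw [Nat.add_sub_cancel' (by omega)] at h4
    have h5 := le_d (d := d)
    have h6 := sc_pos i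
    have hR : (0 : ℝ) < A.R := by exact_mod_cast A.R_pos
    have hr : (0 : ℝ) < Nat.sqrt d := by exact_mod_cast C.sqrt_pos
    have h7 := C.E.sH_pos (C.lev i)
    have h8 := C.E.sH_pos H
    rw [div_le_div_iff₀ (by norm_num) (by positivity)]
    have e1 : (A.R ^ (2 * (H - C.lev i) + 4) : ℝ) * C.E.sH H ^ 2 =
        A.R ^ 4 * C.E.sH (C.lev i) ^ 2 := by rw [h4]; ring
    have h9 : (A.R : ℝ) ^ 4 * C.E.sH (C.lev i) ^ 2 ≤
        64 * (C.E.sH H ^ 2 * (p.sqd p' H τ τ' : ℤ)) := by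
      rw [← e1]
      nlinarith [mul_le_mul_of_nonneg_right h2 (sq_nonneg (C.E.sH H))]
    calc (A.R : ℝ) ^ 2 * (8 * sc i ^ 2) ≤
          A.R ^ 2 * (8 * (2 ^ 12 * A.R * Nat.sqrt d * C.E.sH (C.lev i)) ^ 2) := by gcongr
      _ = Nat.sqrt d ^ 2 * ((A.R ^ 4 * C.E.sH (C.lev i) ^ 2)) * 2 ^ 27 := by ring
      _ ≤ d * (64 * (C.E.sH H ^ 2 * (p.sqd p' H τ τ' : ℤ))) * 2 ^ 27 := by gcongr
      _ = _ := by ring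
  · rw [scaleCov_eq_zero]
    · exact hxi
    · exact (mul_le_mul_of_nonneg_left (sc_anti hi) (by norm_num)).trans
        (C.dist_sq_of_K_le p p' (not_lt.1 h0))

lemma scaleCov_far_anc (p p' : Pth A) {i H τ τ' : ℕ} (hi : 3 * C.k ≤ i) (hin : i < C.n)
    (hH : A.G < H)
    (hna : ¬ p.NA p' (C.lev i - 34) (A.uu (C.lev i - 34) (A.pe^[H - (C.lev i - 34)] τ))
      (A.uu (C.lev i - 34) (A.pe^[H - (C.lev i - 34)] τ'))) :
    have := C.neZero
    scaleCov i (C.E.pos p H τ) (C.E.pos p' H τ') = 0 := by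
  have := C.neZero
  have h1 := C.lev_le i
  by_cases h0 : p.sqd p' H τ τ' < (((A.R ^ H * (A.L * A.y) : ℕ) : ℤ)) ^ 2
  · by_cases hl : C.lev i < 34
    · rw [show C.lev i - 34 = 0 by omega] at hna
      have := p.macro_close p' h0
      exact absurd ⟨this.1, this.2.1⟩ hna
    obtain ⟨g, hg⟩ : ∃ g, C.lev i = g + 34 := ⟨C.lev i - 34, by omega⟩
    rw [hg, Nat.add_sub_cancel] at hna
    have hs : ¬ 64 * p.sqd p' H τ τ' < A.R ^ (2 * (H - g) + 4) := fun hs => by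
      have := p.near_alive p' (by omega) (by omega) h0 hs
      exact hna ⟨this.1, this.2.1⟩
    refine scaleCov_eq_zero (abs_le_of_sq_le_sq ?_ dist_nonneg |> (le_abs_self _).trans)
    rw [C.E.dist_pos_sq]
    have h2 : (A.R ^ (2 * (H - g) + 4) : ℝ) ≤ 64 * (p.sqd p' H τ τ' : ℤ) := by
      exact_mod_cast not_lt.1 hs
    have h3 := C.sc_le_sH hi hin
    have h4 := C.E.sH_add g (H - g)
    rw [Nat.add_sub_cancel' (by omega)] at h4
    have h5 := C.E.sH_add g 34
    rw [← hg] at h5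
    have hR := C.R_large
    have hr : (Nat.sqrt d : ℝ) ≤ 2 ^ 32 * A.R ^ 32 := by exact_mod_cast C.hr2
    have h7 := C.E.sH_pos (C.lev i)
    have hR0 : (0 : ℝ) < A.R := by exact_mod_cast A.R_pos
    have e1 : (A.R ^ (2 * (H - g) + 4) : ℝ) * C.E.sH H ^ 2 = (A.R ^ 36 * C.E.sH (C.lev i)) ^ 2 := by
      rw [show (A.R ^ 36 * C.E.sH (C.lev i) : ℝ) = A.R ^ 2 * (A.R ^ 34 * C.E.sH (C.lev i)) by ring,
        ← h5, h4]; ring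
    have h9 : (A.R ^ 36 * C.E.sH (C.lev i) / 8) ^ 2 ≤ C.E.sH H ^ 2 * (p.sqd p' H τ τ' : ℤ) := by
      rw [div_pow, ← e1]
      nlinarith [mul_le_mul_of_nonneg_right h2 (sq_nonneg (C.E.sH H))]
    refine le_trans (pow_le_pow_left₀ (by have := sc_pos i; positivity) ?_ 2) h9
    calc 2 * sc i ≤ 2 * (2 ^ 12 * A.R * (2 ^ 32 * A.R ^ 32) * C.E.sH (C.lev i)) := by
          refine mul_le_mul_of_nonneg_left (h3.trans ?_) (by norm_num)
          gcongr
      _ = 2 ^ 48 * (A.R ^ 33 * C.E.sH (C.lev i) / 8) := by ring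
      _ ≤ A.R * (A.R ^ 33 * C.E.sH (C.lev i) / 8) := by
          refine mul_le_mul_of_nonneg_right (by linarith [show (2 : ℝ) ^ 48 ≤ 2 ^ 200 by norm_num])
            (by positivity)
      _ ≤ A.R ^ 2 * (A.R * (A.R ^ 33 * C.E.sH (C.lev i) / 8)) :=
          le_mul_of_one_le_left (by positivity) (by nlinarith [show (1 : ℝ) ≤ 2 ^ 200 by norm_num])
      _ = A.R ^ 36 * C.E.sH (C.lev i) / 8 := by ring
  · exact scaleCov_eq_zero ((mul_le_mul_of_nonneg_left (sc_anti hi) (by norm_num)).trans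
        (C.dist_sq_of_K_le p p' (not_lt.1 h0)))

lemma scale_sum_le {Ω : Type} [MeasurableSpace Ω] {P : Measure Ω} [IsProbabilityMeasure P]
    {h : ℕ → EuclideanSpace ℝ (Fin d) → Ω → ℝ} (hh : IsWhiteNoiseField d P h)
    (p p' : Pth A) {i H : ℕ} (hi : 3 * C.k ≤ i) (hin : i < C.n) (hH : A.G < H) {x x' : ℕ → ℝ} :
    have := C.neZero
    (∀ τ, 0 ≤ x τ) → (∀ τ, 0 ≤ x' τ) →
    (∀ a, ∑ σ ∈ C.un (C.lev i) H a, x σ ≤ C.Ms i) →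
    (∀ a, ∑ σ ∈ C.un (C.lev i) H a, x' σ ≤ C.Ms i) →
    (∀ a, ∑ τ ∈ C.un (C.lev i) H a, ∑ σ ∈ C.un (C.lev i) H a,
        x τ * x σ * scaleCov i (C.E.pos p H τ) (C.E.pos p H σ) ≤ 2 * C.Ms i) →
    (∀ a, ∑ τ ∈ C.un (C.lev i) H a, ∑ σ ∈ C.un (C.lev i) H a,
        x' τ * x' σ * scaleCov i (C.E.pos p' H τ) (C.E.pos p' H σ) ≤ 2 * C.Ms i) →
    ∑ τ ∈ Finset.range (A.T C.N H), ∑ σ ∈ Finset.range (A.T C.N H),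
        x τ * x' σ * scaleCov i (C.E.pos p H τ) (C.E.pos p' H σ) ≤
      6 * C.Ms i * p.sC p' C.N (C.lev i) +
        xi A * C.Ms i ^ 2 * ((A.pl (C.lev i - 34) (C.lev i - (C.lev i - 34))) ^ 2 *
          (3 * p.sC p' C.N (C.lev i - 34))) := by
  intro _ hx hx' hm hm' hq hq'
  classical
  set γ := C.lev i with hγ
  have hlev : γ ≤ A.G := C.lev_le i
  set K := fun τ σ => scaleCov i (C.E.pos p H τ) (C.E.pos p' H σ) with hK
  have hMs := C.Ms_nonneg i
  have hxi : 0 ≤ xi A := (Real.exp_pos _).le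
  have hmaps : ∀ τ ∈ Finset.range (A.T C.N H), A.uu γ (A.pe^[H - γ] τ) ∈ Finset.range (A.nu C.N γ) :=
    fun τ hτ => by
      refine Finset.mem_range.2 (A.uu_lt_nu (A.pe_iterate_lt_T ?_))
      rw [Nat.add_sub_cancel' (by omega)]; exact Finset.mem_range.1 hτ
  have e1 : ∑ τ ∈ Finset.range (A.T C.N H), ∑ σ ∈ Finset.range (A.T C.N H), x τ * x' σ * K τ σ =
      ∑ a ∈ Finset.range (A.nu C.N γ), ∑ b ∈ Finset.range (A.nu C.N γ),
        ∑ τ ∈ C.un γ H a, ∑ σ ∈ C.un γ H b, x τ * x' σ * K τ σ := by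
    rw [← Finset.sum_fiberwise_of_maps_to hmaps]
    refine Finset.sum_congr rfl fun a _ => ?_
    rw [Finset.sum_comm (s := Finset.range (A.nu C.N γ))]
    refine Finset.sum_congr rfl fun τ _ => ?_
    rw [← Finset.sum_fiberwise_of_maps_to hmaps]
    rfl
  have hun : ∀ {g a τ}, τ ∈ C.un g H a → A.uu g (A.pe^[H - g] τ) = a :=
    fun h => (Finset.mem_filter.1 h).2
  have hanc : ∀ {a τ}, τ ∈ C.un γ H a → A.uu (γ - 34) (A.pe^[H - (γ - 34)] τ) =
      a / A.pl (γ - 34) (γ - (γ - 34)) := fun {a τ} h => by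
    rw [← hun h, show H - (γ - 34) = (γ - (γ - 34)) + (H - γ) by omega, Function.iterate_add_apply,
      A.uu_pe_iterate, show γ - 34 + (γ - (γ - 34)) = γ by omega]
  have hK0 : ∀ τ σ, 0 ≤ K τ σ := fun _ _ => scaleCov_nonneg _ _ _
  have hgen : ∀ a b (c : ℝ), 0 ≤ c → (∀ τ ∈ C.un γ H a, ∀ σ ∈ C.un γ H b, K τ σ ≤ c) →
      ∑ τ ∈ C.un γ H a, ∑ σ ∈ C.un γ H b, x τ * x' σ * K τ σ ≤ c * C.Ms i ^ 2 := by
    intro a b c hc hKc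
    calc _ ≤ ∑ τ ∈ C.un γ H a, ∑ σ ∈ C.un γ H b, x τ * x' σ * c := by
          refine Finset.sum_le_sum fun τ hτ => Finset.sum_le_sum fun σ hσ => ?_
          exact mul_le_mul_of_nonneg_left (hKc τ hτ σ hσ) (mul_nonneg (hx _) (hx' _))
      _ = c * ((∑ τ ∈ C.un γ H a, x τ) * ∑ σ ∈ C.un γ H b, x' σ) := by
          rw [Finset.sum_mul_sum, Finset.mul_sum]
          refine Finset.sum_congr rfl fun τ _ => ?_
          rw [Finset.mul_sum]
          exact Finset.sum_congr rfl fun σ _ => by ring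
      _ ≤ c * C.Ms i ^ 2 := by
          rw [sq]
          refine mul_le_mul_of_nonneg_left ?_ hc
          exact mul_le_mul (hm a) (hm' b) (Finset.sum_nonneg fun _ _ => hx' _) hMs
  have hpair : ∀ a b, ∑ τ ∈ C.un γ H a, ∑ σ ∈ C.un γ H b, x τ * x' σ * K τ σ ≤
      2 * C.Ms i * (if p.NA p' γ a b then (1 : ℝ) else 0) +
      xi A * C.Ms i ^ 2 * (if p.NA p' (γ - 34) (a / A.pl (γ - 34) (γ - (γ - 34)))
        (b / A.pl (γ - 34) (γ - (γ - 34))) then (1 : ℝ) else 0) := by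
    intro a b
    by_cases h1 : p.NA p' γ a b
    · have h2 := scaleCov_cross_le hh (i := i) (by have := C.hk; omega) _ _ x x' _ _ (hq a) (hq' b)
      refine h2.trans ?_
      rw [if_pos h1, mul_one, le_add_iff_nonneg_right]
      split_ifs <;> positivity
    · rw [if_neg h1, mul_zero, zero_add]
      split_ifs with h2
      · rw [mul_one]
        refine hgen a b _ hxi fun τ hτ σ hσ => C.scaleCov_far p p' hi hin hH ?_
        rw [hun hτ, hun hσ]; exact h1
      · rw [mul_zero]
        refine (hgen a b 0 le_rfl fun τ hτ σ hσ => ?_).trans_eq (zero_mul _)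
        refine (C.scaleCov_far_anc p p' hi hin hH ?_).le
        rw [← hγ, hanc hτ, hanc hσ]; exact h2
  rw [e1]
  refine (Finset.sum_le_sum fun a _ => Finset.sum_le_sum fun b _ => hpair a b).trans ?_
  simp_rw [Finset.sum_add_distrib, ← Finset.mul_sum]
  have h3 := p.sum_NA_le p' C.N γ
  have h4 := p.sum_NA_anc_le p' C.N (γ - 34) (γ - (γ - 34))
  rw [show γ - 34 + (γ - (γ - 34)) = γ by omega] at h4
  refine add_le_add ?_ ?_
  · nlinarith [mul_le_mul_of_nonneg_left h3 hMs]
  · exact mul_le_mul_of_nonneg_left h4 (by positivity)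

end Cfg
end WN

end

section

open Finset MeasureTheory ProbabilityTheory

namespace WN
namespace Cfg
variable {A : Prm} {d : ℕ} (C : Cfg A d)

include C in
lemma J_le_R : C.J * 4000 ≤ A.R := by
  rw [C.hR]
  obtain ⟨t, ht⟩ := Nat.exists_eq_add_of_le C.hJ
  rw [ht]
  clear ht
  induction t with
  | zero => norm_num
  | succ t ih =>
    rw [← add_assoc, pow_succ]
    have : 200 ≤ 200 + t := Nat.le_add_right _ _
    linarith

include C in
lemma pow_le_exp : (A.R : ℝ) ^ 4000 ≤ Real.exp A.R := by
  have h1 : (2 : ℝ) ^ (A.R : ℕ) ≤ Real.exp A.R := by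
    rw [← Real.exp_one_pow]
    exact pow_le_pow_left₀ (by norm_num) (by linarith [Real.exp_one_gt_d9]) _
  refine le_trans ?_ h1
  nth_rewrite 1 [C.hR]
  push_cast
  rw [← pow_mul]
  exact pow_le_pow_right₀ (by norm_num) C.J_le_R

include C in
lemma xi_le : xi A ≤ Real.exp (-A.R) := by
  have h := C.R_large
  refine Real.exp_le_exp.2 (neg_le_neg ?_)
  rw [le_div_iff₀ (by norm_num), sq]
  refine mul_le_mul_of_nonneg_left ?_ (by positivity)
  linarith [show (2 : ℝ) ^ 33 ≤ 2 ^ 200 by norm_num]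

include C in
lemma lam_le_pow (g : ℕ) : A.lam g ≤ A.R ^ 31 := by
  have hR : 64 ≤ A.R := A.hR
  have h1 : 64 * A.R ^ 30 ≤ A.R ^ 31 := by rw [pow_succ' _ 30]; exact Nat.mul_le_mul_right _ hR
  have hy := C.hy
  have h2 : A.R ≤ A.R ^ 30 := Nat.le_self_pow (by norm_num) _
  unfold Prm.lam
  split_ifs <;> omega

include C in
lemma pl_le (g t : ℕ) (ht : t ≤ 34) : (A.pl g t : ℝ) ^ 2 ≤ A.R ^ 2108 := by
  have h1 : A.pl g t ≤ (A.R ^ 31) ^ t := by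
    unfold Prm.pl
    refine (Finset.prod_le_prod' fun l _ => C.lam_le_pow (g + l)).trans_eq ?_
    simp
  have h3 : (A.pl g t : ℝ) ≤ A.R ^ 1054 := by
    have h2 : (A.pl g t : ℝ) ≤ (A.R ^ 31) ^ t := by exact_mod_cast h1
    refine h2.trans ?_
    rw [← pow_mul]
    exact pow_le_pow_right₀ (by exact_mod_cast A.R_pos) (by omega)
  calc (A.pl g t : ℝ) ^ 2 ≤ (A.R ^ 1054) ^ 2 := pow_le_pow_left₀ (by positivity) h3 2
    _ = A.R ^ 2108 := by rw [← pow_mul]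

lemma Ms_eq (i : ℕ) : C.Ms i = A.R ^ 4 / 38.4 * (1 / 2) ^ C.off i := by
  unfold Ms
  rw [cnum_eq, pow_add, one_div, inv_pow]
  field_simp
  ring

lemma Ms_le (i : ℕ) : C.Ms i ≤ A.R ^ 4 := by
  rw [C.Ms_eq]
  have h1 : (1 / 2 : ℝ) ^ C.off i ≤ 1 := pow_le_one₀ (by norm_num) (by norm_num)
  have h2 : (0 : ℝ) ≤ A.R ^ 4 := by positivity
  calc _ ≤ (A.R : ℝ) ^ 4 / 38.4 * 1 := mul_le_mul_of_nonneg_left h1 (by positivity)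
    _ ≤ _ := by rw [mul_one, div_le_iff₀ (by norm_num)]; linarith

lemma lev_off_inj {i i' : ℕ} (hi : 3 * C.k ≤ i) (hin : i < C.n) (hi' : 3 * C.k ≤ i')
    (hin' : i' < C.n) (h1 : C.lev i = C.lev i') (h2 : C.off i = C.off i') : i = i' := by
  have h3 := C.div_lt hi hin
  have h4 := C.div_lt hi' hin'
  have h5 := Nat.div_add_mod (C.n - 1 - i) C.J
  have h6 := Nat.div_add_mod (C.n - 1 - i') C.J
  unfold lev at h1
  unfold off at h2
  rw [h2, show (C.n - 1 - i) / C.J = (C.n - 1 - i') / C.J by omega] at h5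
  omega

lemma sum_scales_le {F : ℕ → ℕ → ℝ} (hF : ∀ g o, 0 ≤ F g o) :
    ∑ i ∈ Finset.Ico (3 * C.k) C.n, F (C.lev i) (C.off i) ≤
      ∑ g ∈ Finset.Icc 1 A.G, ∑ o ∈ Finset.range C.J, F g o := by
  rw [← Finset.sum_product' (f := F)]
  rw [← Finset.sum_image (s := Finset.Ico (3 * C.k) C.n) (g := fun i => (C.lev i, C.off i))
    (f := fun x : ℕ × ℕ => F x.1 x.2)]
  · refine Finset.sum_le_sum_of_subset_of_nonneg (fun x hx => ?_) fun _ _ _ => hF _ _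
    obtain ⟨i, hi, rfl⟩ := Finset.mem_image.1 hx
    rw [Finset.mem_Ico] at hi
    exact Finset.mem_product.2 ⟨Finset.mem_Icc.2 ⟨C.one_le_lev hi.1 hi.2, C.lev_le i⟩,
      Finset.mem_range.2 (C.off_lt i)⟩
  · intro i hi i' hi' h
    simp only [Finset.coe_Ico, Set.mem_Ico] at hi hi'
    exact C.lev_off_inj hi.1 hi.2 hi'.1 hi'.2 (Prod.ext_iff.1 h).1 (Prod.ext_iff.1 h).2

/-- The mass distribution at scale `i`. -/
noncomputable def plant {H : ℕ} (hH : A.G < H) (p : Pth A) (i : ℕ) : ℕ → ℝ :=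
  if hi : 3 * C.k ≤ i ∧ i < C.n then (C.exists_plant p hi.1 hi.2 hH).choose else 0

lemma plant_spec {H : ℕ} (hH : A.G < H) (p : Pth A) {i : ℕ} (hi : 3 * C.k ≤ i) (hin : i < C.n) :
    have := C.neZero
    (∀ τ, 0 ≤ C.plant hH p i τ) ∧
      (∀ τ < A.T C.N H, 1 ≤ ∑ σ ∈ Finset.range (A.T C.N H),
        scaleCov i (C.E.pos p H τ) (C.E.pos p H σ) * C.plant hH p i σ) ∧
      (∀ a, ∑ σ ∈ C.un (C.lev i) H a, C.plant hH p i σ ≤ C.Ms i) ∧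
      ∀ a, ∑ τ ∈ C.un (C.lev i) H a, ∑ σ ∈ C.un (C.lev i) H a,
        C.plant hH p i τ * C.plant hH p i σ *
          scaleCov i (C.E.pos p H τ) (C.E.pos p H σ) ≤ 2 * C.Ms i := by
  have h := (C.exists_plant p hi hin hH).choose_spec
  unfold plant
  rw [dif_pos ⟨hi, hin⟩]
  exact h

/-- The direction of the Cameron-Martin shift of a path. -/
noncomputable def tilt {Ω : Type} (h : ℕ → EuclideanSpace ℝ (Fin d) → Ω → ℝ) {H : ℕ}
    (hH : A.G < H) (p : Pth A) : Ω → ℝ :=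
  √(52 * C.J) • ∑ i ∈ Finset.Ico (3 * C.k) C.n, ∑ τ ∈ Finset.range (A.T C.N H),
    C.plant hH p i τ • incr h i (C.E.pos p H τ)

section
variable {Ω : Type} [MeasurableSpace Ω] {P : Measure Ω} [IsProbabilityMeasure P]
    {h : ℕ → EuclideanSpace ℝ (Fin d) → Ω → ℝ} {H : ℕ}

lemma tilt_term_mem {i : ℕ} (hi : i ∈ Finset.Ico (3 * C.k) C.n) (hH : A.G < H) (p : Pth A) :
    ∑ τ ∈ Finset.range (A.T C.N H), C.plant hH p i τ • incr h i (C.E.pos p H τ) ∈ fieldSpan h := by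
  have hi1 : 1 ≤ i := by have := C.hk; have := (Finset.mem_Ico.1 hi).1; omega
  exact (fieldSpan h).sum_mem fun _ _ => (fieldSpan h).smul_mem _ (incr_mem hi1 _)

lemma tilt_mem (hH : A.G < H) (p : Pth A) : C.tilt h hH p ∈ fieldSpan h :=
  (fieldSpan h).smul_mem _ ((fieldSpan h).sum_mem fun _ hi => C.tilt_term_mem hi hH p)

lemma cv_tilt (hh : IsWhiteNoiseField d P h) (hH : A.G < H) (p p' : Pth A) :
    have := C.neZero
    cv P (C.tilt h hH p) (C.tilt h hH p') = 52 * C.J * ∑ i ∈ Finset.Ico (3 * C.k) C.n,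
      ∑ τ ∈ Finset.range (A.T C.N H), ∑ σ ∈ Finset.range (A.T C.N H),
        C.plant hH p i τ * C.plant hH p' i σ *
          scaleCov i (C.E.pos p H τ) (C.E.pos p' H σ) := by
  have := C.neZero
  have hV := gaussSpace_fieldSpan hh
  have hk := C.hk
  unfold tilt
  rw [cv_smul_left, cv_smul_right, ← mul_assoc, Real.mul_self_sqrt (by positivity)]
  congr 1
  rw [hV.cv_sum_left _ (fun i hi => C.tilt_term_mem hi hH p)
    ((fieldSpan h).sum_mem fun i hi => C.tilt_term_mem hi hH p')]
  refine Finset.sum_congr rfl fun i hi => ?_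
  rw [hV.cv_sum_right _ (fun i hi => C.tilt_term_mem hi hH p') (C.tilt_term_mem hi hH p),
    Finset.sum_eq_single i]
  · exact cv_sum_incr hh (by have := (Finset.mem_Ico.1 hi).1; omega) _ _ _ _ _ _
  · intro i' hi' hne
    have g1 : 1 ≤ i := by have := (Finset.mem_Ico.1 hi).1; omega
    have g2 : 1 ≤ i' := by have := (Finset.mem_Ico.1 hi').1; omega
    rw [hV.cv_sum_left _ (fun τ _ => (fieldSpan h).smul_mem _ (incr_mem g1 _))
      (C.tilt_term_mem hi' hH p')]
    refine Finset.sum_eq_zero fun τ _ => ?_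
    rw [hV.cv_sum_right _ (fun τ _ => (fieldSpan h).smul_mem _ (incr_mem g2 _))
      ((fieldSpan h).smul_mem _ (incr_mem g1 _))]
    refine Finset.sum_eq_zero fun σ _ => ?_
    rw [cv_smul_left, cv_smul_right, cv_incr hh g1 g2, if_neg (Ne.symm hne), mul_zero, mul_zero]
  · exact fun hi' => absurd hi hi'

lemma cv_tilt_le (hh : IsWhiteNoiseField d P h) (hH : A.G < H) (p p' : Pth A) :
    cv P (C.tilt h hH p) (C.tilt h hH p') ≤
      17 * C.J * A.R ^ 4 * ∑ g ∈ Finset.Icc 1 A.G, (p.sC p' C.N g : ℝ) + p.sC p' C.N 0 / A.R := by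
  have := C.neZero
  rw [C.cv_tilt hh hH]
  set f : ℕ → ℝ := fun g => p.sC p' C.N g with hf
  have hf0 : ∀ g, 0 ≤ f g := fun g => Nat.cast_nonneg _
  have hRl := C.R_large
  have hR1 : (1 : ℝ) ≤ A.R := by linarith [show (1 : ℝ) ≤ 2 ^ 200 by norm_num]
  have hR0 : (0 : ℝ) < A.R := by linarith
  set ρ : ℝ := 3 * A.R ^ 2116 * Real.exp (-A.R) with hρ
  have hρ0 : 0 ≤ ρ := by positivity
  have hterm : ∀ i ∈ Finset.Ico (3 * C.k) C.n,
      ∑ τ ∈ Finset.range (A.T C.N H), ∑ σ ∈ Finset.range (A.T C.N H),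
        C.plant hH p i τ * C.plant hH p' i σ *
          scaleCov i (C.E.pos p H τ) (C.E.pos p' H σ) ≤
      A.R ^ 4 * f (C.lev i) / 6.4 * (1 / 2) ^ C.off i + ρ * f (C.lev i - 34) := by
    intro i hi
    rw [Finset.mem_Ico] at hi
    obtain ⟨a1, -, a3, a4⟩ := C.plant_spec hH p hi.1 hi.2
    obtain ⟨b1, -, b3, b4⟩ := C.plant_spec hH p' hi.1 hi.2
    refine (C.scale_sum_le hh p p' hi.1 hi.2 hH a1 b1 a3 b3 a4 b4).trans (add_le_add ?_ ?_)
    · rw [C.Ms_eq, hf]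
      exact le_of_eq (by ring)
    · have c1 := C.xi_le
      have c2 := C.Ms_le i
      have c3 := C.pl_le (C.lev i - 34) (C.lev i - (C.lev i - 34)) (by omega)
      have c4 := C.Ms_nonneg i
      have c5 : 0 ≤ xi A := (Real.exp_pos _).le
      calc _ ≤ Real.exp (-A.R) * (A.R ^ 4) ^ 2 * (A.R ^ 2108 * (3 * f (C.lev i - 34))) := by
            gcongr
        _ = _ := by rw [hρ]; ring
  refine (mul_le_mul_of_nonneg_left ((Finset.sum_le_sum hterm).trans
    (C.sum_scales_le (F := fun g o => A.R ^ 4 * f g / 6.4 * (1 / 2) ^ o + ρ * f (g - 34))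
      fun g o => ?_)) (by positivity)).trans ?_
  · have := hf0 g; have := hf0 (g - 34); positivity
  have hgeo : ∀ g, ∑ o ∈ Finset.range C.J, (A.R ^ 4 * f g / 6.4 * (1 / 2) ^ o + ρ * f (g - 34)) ≤
      A.R ^ 4 / 3.2 * f g + C.J * ρ * f (g - 34) := by
    intro g
    rw [Finset.sum_add_distrib, ← Finset.mul_sum]
    have h1 : ∑ o ∈ Finset.range C.J, (1 / 2 : ℝ) ^ o ≤ 2 := by
      rw [geom_sum_eq (by norm_num)]
      have : (0 : ℝ) ≤ (1 / 2) ^ C.J := by positivity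
      rw [div_le_iff_of_neg (by norm_num)]; linarith
    have h2 : 0 ≤ A.R ^ 4 * f g / 6.4 := by have := hf0 g; positivity
    refine add_le_add ((mul_le_mul_of_nonneg_left h1 h2).trans_eq (by ring)) (le_of_eq ?_)
    simp; ring
  have hshift : ∑ g ∈ Finset.Icc 1 A.G, f (g - 34) ≤ 35 * f 0 + ∑ g ∈ Finset.Icc 1 A.G, f g := by
    calc _ ≤ ∑ g ∈ Finset.range (34 + (A.G + 1)), f (g - 34) :=
          Finset.sum_le_sum_of_subset_of_nonneg (fun g hg => by
            rw [Finset.mem_Icc] at hg; rw [Finset.mem_range]; omega) fun _ _ _ => hf0 _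
      _ = 34 * f 0 + ∑ g ∈ Finset.range (A.G + 1), f g := by
          rw [Finset.sum_range_add]
          congr 1
          · rw [Finset.sum_congr rfl (g := fun _ => f 0) fun g hg => by
              rw [Nat.sub_eq_zero_of_le (Finset.mem_range.1 hg).le]]
            simp
          · exact Finset.sum_congr rfl fun g _ => by rw [Nat.add_sub_cancel_left]
      _ = _ := by
          rw [Finset.sum_range_eq_add_Ico _ (Nat.succ_pos _)]
          have : Finset.Ico 1 (A.G + 1) = Finset.Icc 1 A.G := rfl
          rw [this]; ring
  have hJR : (C.J : ℝ) * 4000 ≤ A.R := by exact_mod_cast C.J_le_R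
  have hJ1 : (200 : ℝ) ≤ C.J := by exact_mod_cast C.hJ
  have hsmall : 52 * C.J * (C.J * ρ) * 35 ≤ 1 / A.R := by
    have h1 : Real.exp (-A.R) ≤ 1 / A.R ^ 4000 := by
      rw [Real.exp_neg, ← one_div]
      exact one_div_le_one_div_of_le (by positivity) C.pow_le_exp
    calc 52 * C.J * (C.J * ρ) * 35 = (C.J * 52) * (C.J * 105) * A.R ^ 2116 * Real.exp (-A.R) := by
          rw [hρ]; ring
      _ ≤ A.R * A.R * A.R ^ 2116 * (1 / A.R ^ 4000) := by
          gcongr <;> linarith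
      _ = A.R ^ 2118 * (1 / A.R ^ 4000) := by ring
      _ ≤ A.R ^ 3999 * (1 / A.R ^ 4000) := by
          exact mul_le_mul_of_nonneg_right (pow_le_pow_right₀ hR1 (by norm_num)) (by positivity)
      _ = 1 / A.R := by rw [pow_succ _ 3999]; field_simp
  have hS0 : 0 ≤ ∑ g ∈ Finset.Icc 1 A.G, f g := Finset.sum_nonneg fun g _ => hf0 g
  have hR4 : (1 : ℝ) ≤ A.R ^ 4 := one_le_pow₀ hR1
  have hinv : 1 / (A.R : ℝ) ≤ 1 := by rw [div_le_one hR0]; exact hR1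
  set κ : ℝ := 52 * C.J * (C.J * ρ) with hκ
  have hκ0 : 0 ≤ κ := by positivity
  calc _ ≤ 52 * C.J * (A.R ^ 4 / 3.2 * ∑ g ∈ Finset.Icc 1 A.G, f g +
        C.J * ρ * ∑ g ∈ Finset.Icc 1 A.G, f (g - 34)) := by
        rw [Finset.mul_sum _ f, Finset.mul_sum _ (fun g => f (g - 34)), ← Finset.sum_add_distrib]
        exact mul_le_mul_of_nonneg_left (Finset.sum_le_sum fun g _ => hgeo g) (by positivity)
    _ = 16.25 * C.J * A.R ^ 4 * ∑ g ∈ Finset.Icc 1 A.G, f g +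
        κ * ∑ g ∈ Finset.Icc 1 A.G, f (g - 34) := by rw [hκ]; ring
    _ ≤ 16.25 * C.J * A.R ^ 4 * ∑ g ∈ Finset.Icc 1 A.G, f g +
        κ * (35 * f 0 + ∑ g ∈ Finset.Icc 1 A.G, f g) := by gcongr
    _ ≤ 17 * C.J * A.R ^ 4 * ∑ g ∈ Finset.Icc 1 A.G, f g + 1 / A.R * f 0 := by
        have k1 : κ * 35 * f 0 ≤ 1 / A.R * f 0 := mul_le_mul_of_nonneg_right hsmall (hf0 0)
        have k2 : κ ≤ 0.75 * C.J * A.R ^ 4 := by nlinarith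
        have k3 := mul_le_mul_of_nonneg_right k2 hS0
        linarith
    _ = _ := by rw [hf]; ring

lemma cv_incrTo_tilt (hh : IsWhiteNoiseField d P h) (hH : A.G < H) (p : Pth A) {j : ℕ}
    (hj : j ≤ C.n) (u : EuclideanSpace ℝ (Fin d)) :
    have := C.neZero
    cv P (incrTo h (3 * C.k) j u) (C.tilt h hH p) = √(52 * C.J) * ∑ i ∈ Finset.Ico (3 * C.k) j,
      ∑ τ ∈ Finset.range (A.T C.N H), scaleCov i u (C.E.pos p H τ) * C.plant hH p i τ := by
  have := C.neZero
  have hV := gaussSpace_fieldSpan hh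
  have hk : 1 ≤ 3 * C.k := by have := C.hk; omega
  have mu := incrTo_mem (h := h) (j := j) hk u
  unfold tilt
  rw [cv_smul_right, hV.cv_sum_right _ (fun i hi => C.tilt_term_mem hi hH p) mu]
  congr 1
  have hsub : Finset.Ico (3 * C.k) j ⊆ Finset.Ico (3 * C.k) C.n :=
    Finset.Ico_subset_Ico_right hj
  have hterm : ∀ i ∈ Finset.Ico (3 * C.k) C.n, cv P (incrTo h (3 * C.k) j u)
      (∑ τ ∈ Finset.range (A.T C.N H), C.plant hH p i τ • incr h i (C.E.pos p H τ)) =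
      if i ∈ Finset.Ico (3 * C.k) j then
      ∑ τ ∈ Finset.range (A.T C.N H), scaleCov i u (C.E.pos p H τ) * C.plant hH p i τ else 0 := by
    intro i hi
    have hi1 : 1 ≤ i := by have := (Finset.mem_Ico.1 hi).1; omega
    rw [hV.cv_sum_right _ (fun τ _ => (fieldSpan h).smul_mem _ (incr_mem hi1 _)) mu]
    split_ifs with hij
    · refine Finset.sum_congr rfl fun τ _ => ?_
      rw [cv_smul_right, cv_incrTo_incr hh hk hi1, if_pos hij, mul_comm]
    · refine Finset.sum_eq_zero fun τ _ => ?_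
      rw [cv_smul_right, cv_incrTo_incr hh hk hi1, if_neg hij, mul_zero]
  rw [Finset.sum_congr rfl hterm, ← Finset.sum_filter, Finset.filter_mem_eq_inter,
    Finset.inter_eq_right.2 hsub]

lemma le_cv_incrTo_tilt (hh : IsWhiteNoiseField d P h) (hH : A.G < H) (p : Pth A) {j τ : ℕ}
    (hj : j ≤ C.n) (hj' : 3 * C.k ≤ j) (hτ : τ < A.T C.N H) :
    √(52 * C.J) * ((j : ℝ) - 3 * C.k) ≤
      cv P (incrTo h (3 * C.k) j (C.E.pos p H τ)) (C.tilt h hH p) := by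
  have := C.neZero
  rw [C.cv_incrTo_tilt hh hH p hj]
  refine mul_le_mul_of_nonneg_left ?_ (Real.sqrt_nonneg _)
  calc ((j : ℝ) - 3 * C.k) = ∑ i ∈ Finset.Ico (3 * C.k) j, (1 : ℝ) := by
        simp [Nat.cast_sub hj']
    _ ≤ _ := Finset.sum_le_sum fun i hi => by
        rw [Finset.mem_Ico] at hi
        exact (C.plant_spec hH p hi.1 (by omega)).2.1 τ hτ

end
end Cfg
end WN

end

section

open Finset MeasureTheory ProbabilityTheory

namespace WN

lemma measureReal_chain_le {Ω : Type} [MeasurableSpace Ω] {P : Measure Ω} [IsProbabilityMeasure P]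
    {f : ℕ → Finset ℕ} {pe : ℕ → ℕ} (hpe : ∀ q, ∀ e ∈ f (q + 1), pe e ∈ f q)
    {X : ℕ → ℕ → Ω → ℝ} {t : ℝ} {a b β : ℕ → ℝ}
    (h0 : ∀ e ∈ f 0, P.real {ω | t ≤ -X 0 e ω} ≤ b 0)
    (h1 : ∀ q, ∀ e ∈ f (q + 1), P.real {ω | a q ≤ X q (pe e) ω - X (q + 1) e ω} ≤ b (q + 1))
    (hb : ∀ q, (#(f q) : ℝ) * b q ≤ β q) (q : ℕ) :
    P.real {ω | ∃ e ∈ f q, X q e ω < -(t + ∑ r ∈ range q, a r)} ≤ ∑ r ∈ range (q + 1), β r := by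
  induction q with
  | zero =>
    rw [sum_range_one]
    refine le_trans ?_ (hb 0)
    calc _ ≤ P.real (⋃ e ∈ f 0, {ω | t ≤ -X 0 e ω}) := by
          refine measureReal_mono (fun ω hω => ?_) (measure_ne_top _ _)
          obtain ⟨e, he, hlt⟩ := hω
          rw [sum_range_zero, add_zero] at hlt
          exact Set.mem_biUnion he (show t ≤ -X 0 e ω by linarith)
      _ ≤ ∑ e ∈ f 0, P.real {ω | t ≤ -X 0 e ω} := measureReal_biUnion_finset_le _ _
      _ ≤ #(f 0) • b 0 := sum_le_card_nsmul _ _ _ h0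
      _ = _ := nsmul_eq_mul _ _
  | succ q ih =>
    rw [sum_range_succ _ (q + 1)]
    calc _ ≤ P.real ({ω | ∃ e ∈ f q, X q e ω < -(t + ∑ r ∈ range q, a r)} ∪
          ⋃ e ∈ f (q + 1), {ω | a q ≤ X q (pe e) ω - X (q + 1) e ω}) := by
          refine measureReal_mono (fun ω hω => ?_) (measure_ne_top _ _)
          obtain ⟨e, he, hlt⟩ := hω
          by_cases hc : a q ≤ X q (pe e) ω - X (q + 1) e ω
          · exact Or.inr (Set.mem_biUnion he hc)
          · push Not at hc
            rw [sum_range_succ] at hlt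
            exact Or.inl ⟨pe e, hpe q e he, by linarith⟩
      _ ≤ _ := measureReal_union_le _ _
      _ ≤ _ := by
        refine add_le_add ih (le_trans (measureReal_biUnion_finset_le _ _) ?_)
        refine (sum_le_card_nsmul _ _ _ (h1 q)).trans ?_
        rw [nsmul_eq_mul]
        exact hb (q + 1)

lemma Prm.pe_iterate_div (A : Prm) (c h e : ℕ) :
    A.pe^[h] e / (A.L * c) = e / (A.L * ((2 * A.R) ^ h * c)) := by
  induction h generalizing e with
  | zero => simp
  | succ h ih =>
    rw [Function.iterate_succ_apply, ih, ← Nat.div_div_eq_div_mul, A.pe_div,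
      Nat.div_div_eq_div_mul, A.U_eq']
    congr 1
    ring

namespace Cfg
variable {A : Prm} {d : ℕ} (C : Cfg A d)

lemma card_un_le (H I : ℕ) : #(C.un 0 H I) ≤ 8 * A.y * (2 * A.R) ^ H * A.L := by
  have hB : A.L * ((2 * A.R) ^ H * (8 * A.y)) = 8 * A.y * (2 * A.R) ^ H * A.L := by ring
  have hpos : 0 < 8 * A.y * (2 * A.R) ^ H * A.L := by
    have := A.R_pos; have := A.L_pos; have := A.hy; positivity
  set B := 8 * A.y * (2 * A.R) ^ H * A.L
  have hsub : C.un 0 H I ⊆ Finset.Ico (I * B) (I * B + B) := by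
    intro e he
    have h1 := (Finset.mem_filter.1 he).2
    unfold Prm.uu at h1
    rw [if_pos rfl, show 8 * (A.L * A.y) = A.L * (8 * A.y) by ring, Nat.sub_zero,
      A.pe_iterate_div, hB] at h1
    have h2 := Nat.div_add_mod e B
    have h3 := Nat.mod_lt e hpos
    rw [h1, mul_comm] at h2
    rw [Finset.mem_Ico]
    omega
  refine (card_le_card hsub).trans ?_
  rw [Nat.card_Ico]; omega

lemma pe_mem_un {H I e : ℕ} (he : e ∈ C.un 0 (H + 1) I) : A.pe e ∈ C.un 0 H I := by
  unfold un at *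
  rw [mem_filter, mem_range, Nat.sub_zero] at *
  exact ⟨A.pe_lt_T he.1, he.2⟩

include C in
lemma R_pow_eq_exp (n : ℕ) : (A.R : ℝ) ^ n = Real.exp (n * C.J * Real.log 2) := by
  rw [C.hR]
  push_cast
  rw [← pow_mul, mul_comm C.J n, ← Real.rpow_natCast, Real.rpow_def_of_pos (by norm_num)]
  push_cast
  ring_nf

include C in
lemma two_pow_le_R {c : ℕ} (hc : c ≤ 200) : 2 ^ c ≤ A.R := by
  rw [C.hR]; exact Nat.pow_le_pow_right (by norm_num) (hc.trans C.hJ)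

/-- Number of vertices of a macroscopic piece at the level where the chaining starts. -/
lemma card_un_le_pow {j : ℕ} (hj : 3 * C.k + 1 ≤ j) (hjn : j ≤ C.n) (q I : ℕ) :
    (#(C.un 0 (C.lev (j - 1) + 36 + q) I) : ℝ) ≤
      A.R ^ 75 * 4 ^ (j - 3 * C.k) * (2 * A.R) ^ q := by
  have hR := A.R_pos
  have hlev : C.J * C.lev (j - 1) ≤ (j - 3 * C.k) + 2 * C.J := by
    have h1 := C.hG2
    have h2 := Nat.div_add_mod (C.n - 1 - (j - 1)) C.J
    have h3 := Nat.mod_lt (C.n - 1 - (j - 1)) C.J_pos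
    unfold lev
    rw [Nat.mul_sub]
    omega
  have h1 : (2 * A.R) ^ C.lev (j - 1) ≤ 4 ^ (j - 3 * C.k) * A.R ^ 4 := by
    calc (2 * A.R) ^ C.lev (j - 1) ≤ (A.R * A.R) ^ C.lev (j - 1) :=
          Nat.pow_le_pow_left (Nat.mul_le_mul_right _ (by have := A.hR; omega)) _
      _ = 4 ^ (C.J * C.lev (j - 1)) := by
          rw [C.hR, ← mul_pow, ← pow_mul]; norm_num
      _ ≤ 4 ^ ((j - 3 * C.k) + 2 * C.J) := Nat.pow_le_pow_right (by norm_num) hlev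
      _ = _ := by
          rw [pow_add, C.hR, pow_mul, ← pow_mul 2, show C.J * 4 = 2 * (2 * C.J) by ring,
            pow_mul 2 2, pow_mul]; norm_num
  have h2 : (2 * A.R) ^ 36 ≤ A.R ^ 37 := by
    rw [mul_pow, pow_succ' A.R 36]
    exact Nat.mul_le_mul_right _ (C.two_pow_le_R (c := 36) (by norm_num))
  have h3 : 8 * A.y * A.L ≤ A.R ^ 34 := by
    have h4 : 16 ≤ A.R := by have := A.hR; omega
    calc 8 * A.y * A.L ≤ 8 * A.R ^ 30 * A.L :=
          Nat.mul_le_mul_right _ (Nat.mul_le_mul_left _ C.hy)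
      _ = 16 * A.R ^ 33 := by unfold Prm.L; ring
      _ ≤ A.R * A.R ^ 33 := Nat.mul_le_mul_right _ h4
      _ = _ := by ring
  have h5 : #(C.un 0 (C.lev (j - 1) + 36 + q) I) ≤
      A.R ^ 75 * 4 ^ (j - 3 * C.k) * (2 * A.R) ^ q := by
    refine (C.card_un_le _ I).trans ?_
    calc _ = (8 * A.y * A.L) * ((2 * A.R) ^ C.lev (j - 1)) * (2 * A.R) ^ 36 * (2 * A.R) ^ q := by
          ring
      _ ≤ A.R ^ 34 * (4 ^ (j - 3 * C.k) * A.R ^ 4) * A.R ^ 37 * (2 * A.R) ^ q := by gcongr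
      _ = _ := by ring
  exact_mod_cast h5

section
variable {Ω : Type} [MeasurableSpace Ω] {P : Measure Ω} [IsProbabilityMeasure P]
    {h : ℕ → EuclideanSpace ℝ (Fin d) → Ω → ℝ}

lemma cv_incrTo_self (hh : IsWhiteNoiseField d P h) (j : ℕ)
    (x : EuclideanSpace ℝ (Fin d)) :
    cv P (incrTo h (3 * C.k) j x) (incrTo h (3 * C.k) j x) = (j - 3 * C.k : ℕ) * Real.log 2 := by
  have := C.neZero
  rw [cv_incrTo hh (by have := C.hk; omega), min_self, sum_congr rfl fun i _ => scaleCov_self i x,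
    sum_const, Nat.card_Ico, nsmul_eq_mul]

lemma cv_incrTo_sub_le (hh : IsWhiteNoiseField d P h) {j : ℕ} (hj : 3 * C.k + 1 ≤ j)
    (hjn : j ≤ C.n) (p : Pth A) (q e : ℕ) :
    cv P (incrTo h (3 * C.k) j (C.E.pos p (C.lev (j - 1) + 36 + q) (A.pe e)) -
        incrTo h (3 * C.k) j (C.E.pos p (C.lev (j - 1) + 36 + (q + 1)) e))
      (incrTo h (3 * C.k) j (C.E.pos p (C.lev (j - 1) + 36 + q) (A.pe e)) -
        incrTo h (3 * C.k) j (C.E.pos p (C.lev (j - 1) + 36 + (q + 1)) e)) ≤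
      1 / (A.R : ℝ) ^ (2 + q) := by
  have := C.neZero
  have hV := gaussSpace_fieldSpan hh
  have hk : 1 ≤ 3 * C.k := by have := C.hk; omega
  set g := C.lev (j - 1) with hg
  set x := C.E.pos p (g + 36 + q) (A.pe e)
  set y := C.E.pos p (g + 36 + (q + 1)) e
  have mx := incrTo_mem (h := h) (j := j) hk x
  have my := incrTo_mem (h := h) (j := j) hk y
  have hd := C.E.dist_pos_succ_le p (g + 36 + q) e
  rw [show g + 36 + q + 1 = g + 36 + (q + 1) by ring, dist_comm] at hd
  change dist x y ≤ _ at hd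
  rw [hV.cv_sub_left mx my ((fieldSpan h).sub_mem mx my), hV.cv_sub_right mx my mx,
    hV.cv_sub_right mx my my, cv_comm (incrTo h (3 * C.k) j y) (incrTo h (3 * C.k) j x), cv_incrTo hh hk, cv_incrTo hh hk,
    cv_incrTo hh hk, min_self, ← sum_sub_distrib, ← sum_sub_distrib, ← sum_sub_distrib]
  have hterm : ∀ i ∈ Finset.Ico (3 * C.k) j, scaleCov i x x - scaleCov i x y -
      (scaleCov i x y - scaleCov i y y) ≤ 2 * (d * dist x y) * 2 ^ i := by
    intro i _
    rw [scaleCov_self, scaleCov_self]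
    have h1 := log_sub_scaleCov_le i x y
    have h2 : d * dist x y / sc i = (d * dist x y) * 2 ^ i := by
      unfold sc
      rw [zpow_neg, div_inv_eq_mul, zpow_natCast]
    rw [h2] at h1
    linarith
  refine (sum_le_sum hterm).trans ?_
  rw [← mul_sum]
  have hgeo : ∑ i ∈ Finset.Ico (3 * C.k) j, (2 : ℝ) ^ i ≤ 2 ^ j := by
    calc _ ≤ ∑ i ∈ range j, (2 : ℝ) ^ i := sum_le_sum_of_subset_of_nonneg (fun i hi => by
            simp only [Finset.mem_Ico] at hi; exact mem_range.2 hi.2) fun _ _ _ => by positivity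
      _ = 2 ^ j - 1 := by rw [geom_sum_eq (by norm_num)]; norm_num
      _ ≤ _ := by linarith
  have hsc := C.sc_eq (i := j - 1) (by omega) (by omega)
  rw [← hg, show j - 1 + 1 = j by omega] at hsc
  have hsj : sc j * 2 ^ j = 1 := by
    unfold sc
    rw [zpow_neg, zpow_natCast]
    exact inv_mul_cancel₀ (by positivity)
  have hRl := C.R_large
  have hr := C.sqrt_large
  have hd2 : (d : ℝ) ≤ 2 * Nat.sqrt d ^ 2 := by
    have := d_le (d := d)
    nlinarith
  have hr2 : (Nat.sqrt d : ℝ) ≤ 2 ^ 32 * A.R ^ 32 := by exact_mod_cast C.hr2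
  have hH := C.E.sH_add g (36 + q)
  rw [← add_assoc] at hH
  set s := C.E.sH (g + 36 + q) with hs
  have hs0 : 0 < s := C.E.sH_pos _
  have hR0 : (0 : ℝ) < A.R := by exact_mod_cast A.R_pos
  have h6 : 4096 * Nat.sqrt d * (A.R ^ (36 + q) * s) * 2 ^ j ≤ 1 := by
    rw [← hsj, hsc, hH]
    have : (1 : ℝ) ≤ 2 ^ C.off (j - 1) := one_le_pow₀ (by norm_num)
    have h7 : (4096 : ℝ) ≤ 2 ^ (12 + C.off (j - 1)) := by
      rw [pow_add]; linarith
    gcongr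
  rw [le_div_iff₀ (by positivity)]
  have e1 : (A.R : ℝ) ^ (36 + q) = A.R ^ (2 + q) * A.R ^ 34 := by rw [← pow_add]; ring_nf
  have h34 : (2 : ℝ) ^ 32 * A.R ^ 33 ≤ A.R ^ 34 := by
    rw [pow_succ' _ 33]
    gcongr
    linarith [show (2 : ℝ) ^ 32 ≤ 2 ^ 200 by norm_num]
  set r : ℝ := (Nat.sqrt d : ℝ)
  calc 2 * (d * dist x y) * (∑ i ∈ Finset.Ico (3 * C.k) j, (2 : ℝ) ^ i) * A.R ^ (2 + q) ≤
      2 * ((2 * r ^ 2) * (3 * A.R * s)) * 2 ^ j * A.R ^ (2 + q) := by gcongr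
    _ = 12 * (r * A.R) * (r * s * 2 ^ j * A.R ^ (2 + q)) := by ring
    _ ≤ 12 * (2 ^ 32 * A.R ^ 32 * A.R) * (r * s * 2 ^ j * A.R ^ (2 + q)) := by gcongr
    _ = 12 * (2 ^ 32 * A.R ^ 33) * (r * s * 2 ^ j * A.R ^ (2 + q)) := by ring
    _ ≤ 4096 * A.R ^ 34 * (r * s * 2 ^ j * A.R ^ (2 + q)) := by gcongr; norm_num
    _ = 4096 * r * (A.R ^ (36 + q) * s) * 2 ^ j := by rw [e1]; ring
    _ ≤ 1 := h6

lemma tail_start {l : ℕ} (hl : 3 ≤ l) :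
    (A.R : ℝ) ^ 75 * 4 ^ l * Real.exp (-(3 / 4 * (√(52 * C.J) * l)) ^ 2 /
      (2 * (l * Real.log 2))) ≤ 1 / (A.R ^ 12 * 2 ^ l) := by
  have hR0 : (0 : ℝ) < A.R := by exact_mod_cast A.R_pos
  have hR8 : (8 : ℝ) ≤ A.R := by linarith [C.R_large, show (8 : ℝ) ≤ 2 ^ 200 by norm_num]
  have hlog := Real.log_two_lt_d9
  have hlog0 : 0 < Real.log 2 := Real.log_pos one_lt_two
  have hl0 : (0 : ℝ) < l := by exact_mod_cast (by omega : 0 < l)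
  have hJ0 : (0 : ℝ) < C.J := by exact_mod_cast C.J_pos
  have h1 : (A.R : ℝ) ^ (30 * l) ≤ Real.exp ((3 / 4 * (√(52 * C.J) * l)) ^ 2 /
      (2 * (l * Real.log 2))) := by
    rw [C.R_pow_eq_exp]
    refine Real.exp_le_exp.2 ?_
    rw [mul_pow, mul_pow, Real.sq_sqrt (by positivity), le_div_iff₀ (by positivity)]
    have h2 : Real.log 2 * Real.log 2 ≤ 0.4875 := by nlinarith
    push_cast
    calc _ = 60 * (C.J * (l : ℝ) ^ 2) * (Real.log 2 * Real.log 2) := by ring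
      _ ≤ 60 * (C.J * (l : ℝ) ^ 2) * 0.4875 := by gcongr
      _ = _ := by ring
  have h3 : (A.R : ℝ) ^ (87 + l) ≤ A.R ^ (30 * l) :=
    pow_le_pow_right₀ (by linarith) (by omega)
  rw [neg_div, Real.exp_neg, ← div_eq_mul_inv, div_le_div_iff₀ (Real.exp_pos _) (by positivity),
    one_mul]
  refine le_trans ?_ (h3.trans h1)
  calc _ = (A.R : ℝ) ^ 87 * (8 ^ l) := by
        rw [show (8 : ℝ) = 4 * 2 by norm_num, mul_pow]; ring
    _ ≤ (A.R : ℝ) ^ 87 * A.R ^ l := by gcongr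
    _ = _ := by rw [pow_add]

lemma tail_step {l : ℕ} (hl : 3 ≤ l) (q : ℕ) :
    (A.R : ℝ) ^ 75 * 4 ^ l * (2 * A.R) ^ (q + 1) *
      Real.exp (-(√(52 * C.J) * l / 8 * (1 / 2) ^ (q + 1)) ^ 2 / (2 * (1 / A.R ^ (2 + q)))) ≤
      1 / (A.R ^ 12 * 2 ^ l) * (1 / 2) ^ (q + 1) := by
  have hR0 : (0 : ℝ) < A.R := by exact_mod_cast A.R_pos
  have hRl : (2 : ℝ) ^ 20 ≤ A.R := by
    linarith [C.R_large, show (2 : ℝ) ^ 20 ≤ 2 ^ 200 by norm_num]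
  have hlog := Real.log_two_lt_d9
  have hl0 : (3 : ℝ) ≤ l := by exact_mod_cast hl
  have hJ0 : (0 : ℝ) < C.J := by exact_mod_cast C.J_pos
  have h1 : (A.R : ℝ) ^ (87 + l + 2 * (q + 1)) ≤
      Real.exp ((√(52 * C.J) * l / 8 * (1 / 2) ^ (q + 1)) ^ 2 / (2 * (1 / A.R ^ (2 + q)))) := by
    rw [C.R_pow_eq_exp]
    refine Real.exp_le_exp.2 ?_
    have e1 : (√(52 * C.J) * l / 8 * (1 / 2 : ℝ) ^ (q + 1)) ^ 2 / (2 * (1 / A.R ^ (2 + q))) =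
        13 / 128 * C.J * l ^ 2 * A.R ^ 2 * (A.R / 4) ^ q := by
      rw [mul_pow, div_pow, mul_pow, Real.sq_sqrt (by positivity), ← pow_mul, mul_comm (q + 1) 2,
        pow_mul, div_pow, pow_add, pow_add]
      rw [show (1 ^ 2 / 2 ^ 2 : ℝ) = 1 / 4 by norm_num, div_pow, div_pow, div_pow, one_pow]
      field_simp
      norm_num
    rw [e1]
    have h2 : 1 + q * (A.R / 4 - 1 : ℝ) ≤ (A.R / 4) ^ q := by
      have := one_add_mul_le_pow (a := (A.R / 4 - 1 : ℝ)) (by linarith) q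
      rwa [add_sub_cancel] at this
    have hq : (0 : ℝ) ≤ q := Nat.cast_nonneg q
    have h3 : (1 + q : ℝ) ≤ (A.R / 4) ^ q := by nlinarith
    push_cast
    calc (87 + (l : ℝ) + 2 * (q + 1)) * C.J * Real.log 2 ≤ (87 + (l : ℝ) + 2 * (q + 1)) * C.J * 1 := by
          gcongr; linarith
      _ ≤ (100 * l * (1 + q)) * C.J * 1 := by gcongr; nlinarith
      _ ≤ (13 / 128 * (l * 3) * 2 ^ 20 * (1 + q)) * C.J * 1 := by
          gcongr ?_ * _ * _ * _; linarith
      _ = 13 / 128 * C.J * (l * 3) * 2 ^ 20 * (1 + q) := by ring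
      _ ≤ 13 / 128 * C.J * (l * l) * A.R ^ 2 * (A.R / 4) ^ q := by
          gcongr
          nlinarith
      _ = _ := by ring
  rw [neg_div, Real.exp_neg, ← div_eq_mul_inv, div_le_iff₀ (Real.exp_pos _)]
  have h4 : (A.R : ℝ) ^ 75 * 4 ^ l * (2 * A.R) ^ (q + 1) * (A.R ^ 12 * 2 ^ l) * 2 ^ (q + 1) ≤
      A.R ^ (87 + l + 2 * (q + 1)) := by
    calc _ = (A.R : ℝ) ^ 87 * 8 ^ l * (4 * A.R) ^ (q + 1) := by
          rw [show (8 : ℝ) = 4 * 2 by norm_num, show (4 : ℝ) * A.R = 2 * A.R * 2 by ring,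
            mul_pow 4 2, mul_pow (2 * A.R : ℝ) 2]
          ring
      _ ≤ (A.R : ℝ) ^ 87 * A.R ^ l * (A.R * A.R) ^ (q + 1) := by gcongr <;> linarith
      _ = _ := by rw [pow_add _ (87 + l), pow_add _ 87, pow_mul (A.R : ℝ) 2, sq]
  have h5 := h4.trans h1
  have e2 : 1 / (A.R ^ 12 * 2 ^ l) * (1 / 2 : ℝ) ^ (q + 1) =
      1 / (A.R ^ 12 * 2 ^ l * 2 ^ (q + 1)) := by
    rw [div_pow, one_pow, div_mul_div_comm, one_mul]
  rw [e2, div_mul_eq_mul_div, one_mul, le_div_iff₀ (by positivity), ← mul_assoc]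
  exact h5

lemma prob_scale_bad_le (hh : IsWhiteNoiseField d P h) (p : Pth A) {j : ℕ} (hj : 6 * C.k ≤ j)
    (hjn : j ≤ C.n) (q I : ℕ) :
    P.real {ω | ∃ e ∈ C.un 0 (C.lev (j - 1) + 36 + q) I,
      incrTo h (3 * C.k) j (C.E.pos p (C.lev (j - 1) + 36 + q) e) ω <
        -(7 / 8 * (√(52 * C.J) * (j - 3 * C.k : ℕ)))} ≤
      2 / (A.R ^ 12) * (1 / 2) ^ (j - 3 * C.k) := by
  have := C.neZero
  have hk := C.hk
  have hV := gaussSpace_fieldSpan hh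
  set l := j - 3 * C.k with hl
  have hl3 : 3 ≤ l := by omega
  have hl0 : (0 : ℝ) < l := by exact_mod_cast (by omega : 0 < l)
  have hR0 : (0 : ℝ) < A.R := by exact_mod_cast A.R_pos
  have hlog0 : 0 < Real.log 2 := Real.log_pos one_lt_two
  set μ : ℝ := √(52 * C.J) * l with hμ
  have hμ0 : 0 ≤ μ := by positivity
  set g := C.lev (j - 1) + 36 with hg
  have mem : ∀ x, incrTo h (3 * C.k) j x ∈ fieldSpan h := fun x =>
    incrTo_mem (h := h) (j := j) (by omega) x
  have hgeo : ∀ q : ℕ, ∑ r ∈ range q, (1 / 2 : ℝ) ^ r ≤ 2 := fun q => by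
    rw [geom_sum_eq (by norm_num)]
    have : (0 : ℝ) ≤ (1 / 2) ^ q := by positivity
    rw [div_le_iff_of_neg (by norm_num)]
    linarith
  have key := measureReal_chain_le (P := P) (f := fun q => C.un 0 (g + q) I) (pe := A.pe)
    (fun q e he => C.pe_mem_un he)
    (X := fun q e => incrTo h (3 * C.k) j (C.E.pos p (g + q) e)) (t := 3 / 4 * μ)
    (a := fun q => μ / 8 * (1 / 2) ^ (q + 1))
    (b := fun q => if q = 0 then Real.exp (-(3 / 4 * μ) ^ 2 / (2 * (l * Real.log 2))) else
      Real.exp (-(μ / 8 * (1 / 2) ^ q) ^ 2 / (2 * (1 / A.R ^ (1 + q)))))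
    (β := fun q => 1 / (A.R ^ 12 * 2 ^ l) * (1 / 2) ^ q)
    (fun e _ => by
      have hneg := hV.measure_ge_le (X := -incrTo h (3 * C.k) j (C.E.pos p (g + 0) e))
        ((fieldSpan h).neg_mem (mem _)) (t := 3 / 4 * μ) (v := l * Real.log 2) (by positivity)
        (by
          rw [← neg_one_smul ℝ, cv_smul_left, cv_smul_right, C.cv_incrTo_self hh]
          rw [hl]; linarith) (by positivity)
      rw [if_pos rfl]
      exact hneg)
    (fun q e _ => by
      have hstep := hV.measure_ge_le
        (X := incrTo h (3 * C.k) j (C.E.pos p (g + q) (A.pe e)) -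
          incrTo h (3 * C.k) j (C.E.pos p (g + (q + 1)) e))
        ((fieldSpan h).sub_mem (mem _) (mem _)) (t := μ / 8 * (1 / 2) ^ (q + 1))
        (v := 1 / A.R ^ (2 + q)) (by positivity)
        (C.cv_incrTo_sub_le hh (by omega) hjn p q e) (by positivity)
      rw [if_neg (Nat.succ_ne_zero q), show 1 + (q + 1) = 2 + q by ring]
      exact hstep)
    (fun q => by
      have hc := C.card_un_le_pow (j := j) (by omega) hjn q I
      rw [← hg, ← hl] at hc
      rcases q with _ | q
      · rw [if_pos rfl, pow_zero, mul_one]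
        rw [pow_zero, mul_one] at hc
        exact (mul_le_mul_of_nonneg_right hc (Real.exp_nonneg _)).trans (C.tail_start hl3)
      · rw [if_neg (Nat.succ_ne_zero q), show 1 + (q + 1) = 2 + q by ring]
        exact (mul_le_mul_of_nonneg_right hc (Real.exp_nonneg _)).trans (C.tail_step hl3 q)) q
  refine le_trans (measureReal_mono (fun ω hω => ?_) (measure_ne_top _ _)) (key.trans ?_)
  · obtain ⟨e, he, hlt⟩ := hω
    refine ⟨e, he, hlt.trans_le ?_⟩
    have h1 : ∑ r ∈ range q, μ / 8 * (1 / 2 : ℝ) ^ (r + 1) = μ / 16 * ∑ r ∈ range q, (1 / 2 : ℝ) ^ r := by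
      rw [mul_sum]
      exact sum_congr rfl fun r _ => by ring
    rw [h1]
    have := mul_le_mul_of_nonneg_left (hgeo q) (show 0 ≤ μ / 16 by positivity)
    linarith
  · rw [← mul_sum]
    calc _ ≤ 1 / ((A.R : ℝ) ^ 12 * 2 ^ l) * 2 :=
          mul_le_mul_of_nonneg_left (hgeo _) (by positivity)
      _ = _ := by rw [div_pow, one_pow]; field_simp

/-- Along a macroscopic piece of a path the field is not too negative. -/
lemma prob_bad_le (hh : IsWhiteNoiseField d P h) (p : Pth A) {H : ℕ} (hH : A.G + 36 ≤ H) (I : ℕ) :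
    P.real {ω | ∃ j, 6 * C.k ≤ j ∧ j ≤ C.n ∧ ∃ e ∈ C.un 0 H I,
      incrTo h (3 * C.k) j (C.E.pos p H e) ω < -(7 / 8 * (√(52 * C.J) * ((j : ℝ) - 3 * C.k)))} ≤
      1 / A.R := by
  have hR1 : (8 : ℝ) ≤ A.R := by linarith [C.R_large, show (8 : ℝ) ≤ 2 ^ 200 by norm_num]
  calc _ ≤ P.real (⋃ j ∈ Finset.Icc (6 * C.k) C.n, {ω | ∃ e ∈ C.un 0 H I,
        incrTo h (3 * C.k) j (C.E.pos p H e) ω < -(7 / 8 * (√(52 * C.J) * (j - 3 * C.k : ℕ)))}) := by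
        refine measureReal_mono (fun ω hω => ?_) (measure_ne_top _ _)
        obtain ⟨j, h1, h2, e, he, hlt⟩ := hω
        refine Set.mem_biUnion (Finset.mem_coe.2 (Finset.mem_Icc.2 ⟨h1, h2⟩)) ⟨e, he, ?_⟩
        rw [Nat.cast_sub (by omega)]
        push_cast
        exact hlt
    _ ≤ ∑ j ∈ Finset.Icc (6 * C.k) C.n, 2 / ((A.R : ℝ) ^ 12) * (1 / 2) ^ (j - 3 * C.k) := by
        refine (measureReal_biUnion_finset_le _ _).trans (sum_le_sum fun j hj => ?_)
        rw [Finset.mem_Icc] at hj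
        have h1 := C.lev_le (j - 1)
        obtain ⟨q, hq⟩ := Nat.exists_eq_add_of_le (show C.lev (j - 1) + 36 ≤ H by omega)
        rw [hq]
        exact C.prob_scale_bad_le hh p hj.1 hj.2 q I
    _ ≤ 2 / ((A.R : ℝ) ^ 12) * 2 := by
        rw [← mul_sum]
        refine mul_le_mul_of_nonneg_left ?_ (by positivity)
        rw [← sum_image (s := Finset.Icc (6 * C.k) C.n) (g := fun j => j - 3 * C.k)
          (f := fun l => (1 / 2 : ℝ) ^ l)
          (fun a ha b hb hab => by
            simp only [Finset.coe_Icc, Set.mem_Icc] at ha hb hab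
            omega)]
        exact (Summable.sum_le_tsum _ (fun _ _ => by positivity) summable_geometric_two).trans_eq
          tsum_geometric_two
    _ ≤ 1 / A.R := by
        rw [div_mul_eq_mul_div, div_le_div_iff₀ (by positivity) (by positivity)]
        have : (8 : ℝ) ≤ A.R ^ 11 := hR1.trans (le_self_pow₀ (by linarith) (by norm_num))
        calc (2 * 2 : ℝ) * A.R ≤ A.R ^ 11 * A.R := by gcongr; linarith
          _ = _ := by ring

end
end Cfg
end WN

end

section

open Finset

namespace WN

/-- Transition probabilities of the lazy walk with increments in `{0, 1}`. -/
noncomputable def rw1 : ℕ → ℤ → ℝ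
  | 0, z => if z = 0 then 1 else 0
  | t + 1, z => (rw1 t z + rw1 t (z - 1)) / 2

lemma rw1_neg (t : ℕ) {z : ℤ} (hz : z < 0) : rw1 t z = 0 := by
  induction t generalizing z with
  | zero => rw [rw1, if_neg hz.ne]
  | succ t ih => rw [rw1, ih hz, ih (by omega)]; norm_num

lemma rw1_natCast (t k : ℕ) : rw1 t k = t.choose k / 2 ^ t := by
  induction t generalizing k with
  | zero => cases k <;> simp [rw1]; omega
  | succ t ih =>
    cases k with
    | zero =>
      rw [rw1, ih, rw1_neg t (by norm_num)]
      simp [pow_succ]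
      field_simp
    | succ k =>
      rw [rw1, ih, show ((k + 1 : ℕ) : ℤ) - 1 = k by push_cast; ring, ih, Nat.choose_succ_succ',
        pow_succ]
      push_cast
      field_simp
      ring

lemma rw1_nonneg (t : ℕ) (z : ℤ) : 0 ≤ rw1 t z := by
  rcases lt_or_ge z 0 with h | h
  · rw [rw1_neg t h]
  · lift z to ℕ using h
    rw [rw1_natCast]; positivity

lemma centralBinom_sq_le (k : ℕ) : k.centralBinom ^ 2 * (2 * k + 1) ≤ 16 ^ k := by
  induction k with
  | zero => simp
  | succ k ih =>
    have h := Nat.succ_mul_centralBinom_succ k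
    have h1 : (k + 1) ^ 2 * ((k + 1).centralBinom ^ 2 * (2 * (k + 1) + 1)) ≤
        (k + 1) ^ 2 * 16 ^ (k + 1) := by
      calc _ = ((k + 1) * (k + 1).centralBinom) ^ 2 * (2 * k + 3) := by ring
        _ = (4 * (2 * k + 1) * (2 * k + 3)) * (k.centralBinom ^ 2 * (2 * k + 1)) := by rw [h]; ring
        _ ≤ (16 * (k + 1) ^ 2) * 16 ^ k := Nat.mul_le_mul (by nlinarith) ih
        _ = _ := by ring
    exact Nat.le_of_mul_le_mul_left h1 (pow_pos (Nat.succ_pos k) 2)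

lemma rw1_sq_le (t : ℕ) (z : ℤ) : rw1 t z ^ 2 ≤ 1 / (t + 1) := by
  rcases lt_or_ge z 0 with h | h
  · rw [rw1_neg t h, zero_pow two_ne_zero]; positivity
  lift z to ℕ using h
  rw [rw1_natCast, div_pow, ← pow_mul, mul_comm t 2, pow_mul, div_le_div_iff₀ (by positivity)
    (by positivity), one_mul]
  norm_num only
  suffices h : t.choose z ^ 2 * (t + 1) ≤ 4 ^ t by exact_mod_cast h
  have h1 : t.choose z ≤ t.choose (t / 2) := Nat.choose_le_middle z t
  refine (Nat.mul_le_mul_right _ (Nat.pow_le_pow_left h1 2)).trans ?_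
  obtain ⟨k, rfl | rfl⟩ := Nat.even_or_odd' t
  · have := centralBinom_sq_le k
    rw [Nat.mul_div_cancel_left k (by norm_num), pow_mul]
    exact this
  · have h2 := centralBinom_sq_le (k + 1)
    have h3 : (k + 1).centralBinom = 2 * (2 * k + 1).choose k := by
      rw [Nat.centralBinom, show 2 * (k + 1) = (2 * k + 1) + 1 by ring, Nat.choose_succ_succ',
        Nat.choose_symm_half]
      ring
    rw [h3] at h2
    have h4 : (2 * k + 1) / 2 = k := by omega
    have h5 : 4 ^ (2 * k + 1) * 4 = 16 ^ (k + 1) := by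
      rw [← pow_succ, show 2 * k + 1 + 1 = 2 * (k + 1) by ring, pow_mul]; norm_num
    rw [h4]
    nlinarith [sq_nonneg ((2 * k + 1).choose k)]

/-- Probability that the lazy walk is within distance six of a point. -/
noncomputable def nearProb (t : ℕ) (z : ℤ) : ℝ := ∑ u ∈ Finset.Icc (-6 : ℤ) 6, rw1 t (z + u)

lemma nearProb_nonneg (t : ℕ) (z : ℤ) : 0 ≤ nearProb t z := sum_nonneg fun _ _ => rw1_nonneg _ _

lemma nearProb_succ (t : ℕ) (z : ℤ) :
    nearProb (t + 1) z = (nearProb t z + nearProb t (z - 1)) / 2 := by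
  unfold nearProb
  rw [← sum_add_distrib, sum_div]
  refine sum_congr rfl fun u _ => ?_
  rw [rw1, show z + u - 1 = z - 1 + u by ring]

lemma nearProb_zero {z : ℤ} (hz : |z| ≤ 6) : nearProb 0 z = 1 := by
  rw [abs_le] at hz
  unfold nearProb
  rw [sum_eq_single (-z)]
  · simp [rw1]
  · intro u _ hu
    rw [rw1, if_neg (by omega)]
  · intro h
    rw [Finset.mem_Icc] at h
    omega

lemma prod_nearProb_le (t : ℕ) (z : Fin 4 → ℤ) :
    ∏ c, nearProb t (z c) ≤ 28561 * (1 / (t + 1) ^ 2) := by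
  have h1 : ∀ x, rw1 t x ≤ √(1 / (t + 1)) := fun x =>
    Real.le_sqrt_of_sq_le (rw1_sq_le t x)
  have h2 : ∀ x, nearProb t x ≤ 13 * √(1 / (t + 1)) := fun x =>
    (sum_le_card_nsmul _ _ _ fun u _ => h1 _).trans_eq (by simp)
  calc _ ≤ ∏ _c : Fin 4, 13 * √(1 / (t + 1 : ℝ)) :=
        prod_le_prod (fun _ _ => nearProb_nonneg _ _) fun _ _ => h2 _
    _ = 28561 * (√(1 / (t + 1 : ℝ)) ^ 2) ^ 2 := by
        rw [prod_const, card_univ, Fintype.card_fin]; ring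
    _ = _ := by rw [Real.sq_sqrt (by positivity), div_pow, one_pow]

lemma sum_prod_nearProb_le (n : ℕ) (y : ℕ → Fin 4 → ℤ) :
    ∑ t ∈ range n, ∏ c, nearProb t (y t c) ≤ 57122 := by
  have h : ∀ n : ℕ, ∑ t ∈ range (n + 1), (1 : ℝ) / ((t : ℝ) + 1) ^ 2 ≤ 2 - 1 / ((n : ℝ) + 1) := by
    intro n
    induction n with
    | zero => norm_num
    | succ n ih =>
      rw [sum_range_succ]
      have h1 : (1 : ℝ) / ((n + 1 : ℕ) + 1) ^ 2 ≤ 1 / (n + 1) - 1 / ((n + 1 : ℕ) + 1) := by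
        push_cast
        rw [div_sub_div _ _ (by positivity) (by positivity),
          div_le_div_iff₀ (by positivity) (by positivity)]
        nlinarith
      linarith
  calc _ ≤ ∑ t ∈ range n, 28561 * ((1 : ℝ) / ((t : ℝ) + 1) ^ 2) := sum_le_sum fun t _ =>
        prod_nearProb_le t (y t)
    _ ≤ ∑ t ∈ range (n + 1), 28561 * ((1 : ℝ) / ((t : ℝ) + 1) ^ 2) :=
        sum_le_sum_of_subset_of_nonneg (range_subset_range.2 (Nat.le_succ n))
          fun _ _ _ => by positivity
    _ ≤ _ := by
        rw [← mul_sum]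
        have := h n
        have h2 : (0 : ℝ) ≤ 1 / ((n : ℝ) + 1) := by positivity
        linarith

/-- The walk with increments `b`. -/
def walk {n : ℕ} (b : Fin n → Fin 4 → Bool) (t : ℕ) (c : Fin 4) : ℤ :=
  ∑ u : Fin n, if (u : ℕ) < t then (b u c).toInt else 0

lemma walk_zero {n : ℕ} (b : Fin n → Fin 4 → Bool) (c : Fin 4) : walk b 0 c = 0 := by
  simp [walk]

lemma walk_cons {n : ℕ} (a : Fin 4 → Bool) (b : Fin n → Fin 4 → Bool) (t : ℕ) (c : Fin 4) :
    walk (Fin.cons a b : Fin (n + 1) → Fin 4 → Bool) (t + 1) c = (a c).toInt + walk b t c := by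
  unfold walk
  rw [Fin.sum_univ_succ]
  simp

lemma abs_walk_succ_sub_le {n : ℕ} (b : Fin n → Fin 4 → Bool) (t : ℕ) (c : Fin 4) :
    |walk b (t + 1) c - walk b t c| ≤ 1 := by
  have h : walk b (t + 1) c - walk b t c =
      ∑ u : Fin n, if (u : ℕ) = t then (b u c).toInt else 0 := by
    unfold walk
    rw [← sum_sub_distrib]
    refine sum_congr rfl fun u _ => ?_
    split_ifs <;> omega
  rw [h]
  by_cases ht : t < n
  · rw [sum_eq_single (⟨t, ht⟩ : Fin n)]
    · simp only [if_pos]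
      cases b ⟨t, ht⟩ c <;> simp
    · intro u _ hu
      rw [if_neg fun h => hu (Fin.ext h)]
    · simp
  · rw [sum_eq_zero fun u _ => if_neg (by have := u.2; omega)]
    simp

lemma sum_prod_bool (f : ℤ → ℝ) (y : Fin 4 → ℤ) :
    ∑ a : Fin 4 → Bool, ∏ c, f (y c - (a c).toInt) = ∏ c, (f (y c) + f (y c - 1)) := by
  have h := Finset.prod_univ_sum (fun _ : Fin 4 => (univ : Finset Bool))
    (fun c x => f (y c - x.toInt))
  rw [Fintype.piFinset_univ] at h
  rw [← h]
  refine prod_congr rfl fun c _ => ?_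
  rw [Fintype.sum_bool, add_comm]
  simp

lemma sum_exp_near_walk_le {κ : ℝ} (hκ0 : 0 ≤ κ)
    (hκ : 2 * (Real.exp κ - 1) * 57122 ≤ 1) (n : ℕ) (y : ℕ → Fin 4 → ℤ) :
    ∑ b : Fin n → Fin 4 → Bool,
      Real.exp (κ * #{t ∈ range (n + 1) | ∀ c, |walk b t c - y t c| ≤ 6}) ≤
      16 ^ n * (1 + 2 * (Real.exp κ - 1) * ∑ t ∈ range (n + 1), ∏ c, nearProb t (y t c)) := by
  have he : 0 ≤ Real.exp κ - 1 := by linarith [Real.add_one_le_exp κ]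
  have hstart : ∀ (y : ℕ → Fin 4 → ℤ) (n : ℕ) (V : ℝ), 0 ≤ V → V ≤ 57122 →
      Real.exp (κ * if ∀ c, |0 - y 0 c| ≤ 6 then 1 else 0) *
        (1 + 2 * (Real.exp κ - 1) * V) ≤
      1 + 2 * (Real.exp κ - 1) * (V + ∏ c, nearProb 0 (y 0 c)) := by
    intro y n V hV hV2
    by_cases h : ∀ c, |0 - y 0 c| ≤ 6
    · rw [if_pos h, mul_one, prod_congr rfl fun c _ => nearProb_zero (z := y 0 c) (by
        have := h c; rwa [zero_sub, abs_neg] at this), prod_const_one]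
      have : 2 * (Real.exp κ - 1) * V ≤ 1 :=
        le_trans (mul_le_mul_of_nonneg_left hV2 (by positivity)) hκ
      nlinarith
    · rw [if_neg h, mul_zero, Real.exp_zero, one_mul]
      have : 0 ≤ ∏ c, nearProb 0 (y 0 c) := prod_nonneg fun _ _ => nearProb_nonneg _ _
      nlinarith
  have hcard : ∀ (m : ℕ) (p : ℕ → Prop) [DecidablePred p], (#{t ∈ range (m + 1) | p t} : ℝ) =
      (if p 0 then 1 else 0) + #{t ∈ range m | p (t + 1)} := by
    intro m p _
    rw [card_filter, card_filter, sum_range_succ']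
    push_cast
    ring
  induction n generalizing y with
  | zero =>
    have := hstart y 0 0 le_rfl (by norm_num)
    rw [mul_zero, add_zero, mul_one, zero_add] at this
    rw [Fintype.sum_unique, hcard, range_zero, filter_empty, card_empty]
    simp only [walk_zero]
    simpa using this
  | succ n ih =>
    set f : ℕ → ℝ := fun t => ∏ c, nearProb t (y t c)
    set y' : (Fin 4 → Bool) → ℕ → Fin 4 → ℤ := fun a t c => y (t + 1) c - (a c).toInt with hy'
    set E0 : ℝ := Real.exp (κ * if ∀ c, |0 - y 0 c| ≤ 6 then 1 else 0) with hE0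
    have h1 : ∀ a : Fin 4 → Bool, ∀ b : Fin n → Fin 4 → Bool,
        Real.exp (κ * #{t ∈ range (n + 1 + 1) |
          ∀ c, |walk (Fin.cons a b : Fin (n + 1) → Fin 4 → Bool) t c - y t c| ≤ 6}) =
        E0 * Real.exp (κ * #{t ∈ range (n + 1) | ∀ c, |walk b t c - y' a t c| ≤ 6}) := by
      intro a b
      rw [hcard, hE0, ← Real.exp_add, ← mul_add]
      simp only [walk_zero, walk_cons, hy']
      congr 5
      ext t
      simp only [mem_filter, and_congr_right_iff]
      intro _
      refine forall_congr' fun c => ?_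
      rw [show (a c).toInt + walk b t c - y (t + 1) c =
        walk b t c - (y (t + 1) c - (a c).toInt) by ring]
    have h2 : ∑ a : Fin 4 → Bool, ∑ t ∈ range (n + 1), ∏ c, nearProb t (y' a t c) =
        16 * ∑ t ∈ range (n + 1), f (t + 1) := by
      rw [sum_comm, mul_sum]
      refine sum_congr rfl fun t _ => ?_
      rw [sum_prod_bool (nearProb t) (y (t + 1))]
      simp only [f, nearProb_succ]
      rw [prod_div_distrib]
      simp
      norm_num
      ring
    rw [← (Fin.consEquiv fun _ => Fin 4 → Bool).sum_comp, Fintype.sum_prod_type]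
    calc _ = ∑ a : Fin 4 → Bool, E0 * ∑ b : Fin n → Fin 4 → Bool,
          Real.exp (κ * #{t ∈ range (n + 1) | ∀ c, |walk b t c - y' a t c| ≤ 6}) := by
          refine sum_congr rfl fun a _ => ?_
          rw [mul_sum]
          exact sum_congr rfl fun b _ => h1 a b
      _ ≤ ∑ a : Fin 4 → Bool, E0 * (16 ^ n * (1 + 2 * (Real.exp κ - 1) *
          ∑ t ∈ range (n + 1), ∏ c, nearProb t (y' a t c))) :=
          sum_le_sum fun a _ => mul_le_mul_of_nonneg_left (ih (y' a)) (Real.exp_nonneg _)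
      _ = 16 ^ (n + 1) * (E0 * (1 + 2 * (Real.exp κ - 1) * ∑ t ∈ range (n + 1), f (t + 1))) := by
          rw [← mul_sum, ← mul_sum, sum_add_distrib, ← mul_sum, h2]
          simp
          ring
      _ ≤ _ := by
          rw [sum_range_succ' _ (n + 1)]
          refine mul_le_mul_of_nonneg_left ?_ (by positivity)
          exact hstart y n _ (sum_nonneg fun t _ => prod_nonneg fun _ _ => nearProb_nonneg _ _)
            (by
              refine le_trans ?_ (sum_prod_nearProb_le (n + 2) y)
              rw [sum_range_succ' _ (n + 1)]
              have : 0 ≤ ∏ c, nearProb 0 (y 0 c) := prod_nonneg fun _ _ => nearProb_nonneg _ _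
              linarith)

lemma sum_exp_near_walk_le_two {κ : ℝ} (hκ0 : 0 ≤ κ)
    (hκ : 2 * (Real.exp κ - 1) * 57122 ≤ 1) (n : ℕ) (y : ℕ → Fin 4 → ℤ) :
    ∑ b : Fin n → Fin 4 → Bool,
      Real.exp (κ * #{t ∈ range (n + 1) | ∀ c, |walk b t c - y t c| ≤ 6}) ≤ 16 ^ n * 2 := by
  refine (sum_exp_near_walk_le hκ0 hκ n y).trans ?_
  have he : 0 ≤ Real.exp κ - 1 := by linarith [Real.add_one_le_exp κ]
  have := mul_le_mul_of_nonneg_left (sum_prod_nearProb_le (n + 1) y) (show 0 ≤ 2 * (Real.exp κ - 1) by positivity)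
  gcongr
  linarith

end WN

end

section

open Finset

namespace WN

lemma sum_le_sum_of_update {ι X : Type} [Fintype ι] [DecidableEq ι] [Fintype X]
    {f f' : (ι → X) → ℝ} (a : ι)
    (h : ∀ ε, ∑ x, f (Function.update ε a x) ≤ Fintype.card X * f' ε) :
    ∑ ε, f ε ≤ ∑ ε, f' ε := by
  rcases isEmpty_or_nonempty X with hX | hX
  · have : IsEmpty (ι → X) := ⟨fun g => hX.elim (g a)⟩
    simp
  have h1 : ∑ ε : ι → X, ∑ x, f (Function.update ε a x) = Fintype.card X * ∑ ε, f ε := by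
    have h2 : ∑ z : (ι → X) × X, f (Function.update z.1 a z.2) = ∑ z : (ι → X) × X, f z.1 := by
      refine Finset.sum_bij' (fun z _ => (Function.update z.1 a z.2, z.1 a))
        (fun z _ => (Function.update z.1 a z.2, z.1 a)) (by simp) (by simp) ?_ ?_ ?_ <;> simp
    rw [← Fintype.sum_prod_type', h2, Fintype.sum_prod_type]
    simp [mul_sum]
  have h3 : Fintype.card X * ∑ ε, f ε ≤ Fintype.card X * ∑ ε, f' ε := by
    rw [← h1, mul_sum]
    exact sum_le_sum fun ε _ => h ε
  exact le_of_mul_le_mul_left h3 (by exact_mod_cast Fintype.card_pos)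

namespace Pth
variable {A : Prm}

/-- The path with prescribed orders in the first `n` units of the levels up to `G`. -/
def mk' (v : ℕ) (S : ℕ → Fin 4 → ℤ) (hS : ∀ I c, |S (I + 1) c - S I c| ≤ 1) {n : ℕ}
    (ε : Fin (A.G + 1) → Fin n → Fin A.m → Fin A.D) : Pth A where
  v := v
  S := S
  ε g i := if hg : g < A.G + 1 then if hi : i < n then ε ⟨g, hg⟩ ⟨i, hi⟩ else fun _ => ⟨0, A.hD⟩
    else fun _ => ⟨0, A.hD⟩
  hS := hS

lemma alive_congr {p q p' : Pth A} (hv : p.v = q.v) (hS : p.S = q.S) {t : ℕ}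
    (hε : ∀ g ≤ t, p.ε g = q.ε g) (i : ℕ) : p.Alive p' t i ↔ q.Alive p' t i := by
  induction t generalizing i with
  | zero => simp only [Alive, Nr, hv, hS]
  | succ t ih =>
    simp only [Alive, Co, hε (t + 1) le_rfl, ih fun g hg => hε g (by omega)]

lemma sC_congr {p q p' : Pth A} (hv : p.v = q.v) (hS : p.S = q.S) {t : ℕ}
    (hε : ∀ g ≤ t, p.ε g = q.ε g) (N : ℕ) : p.sC p' N t = q.sC p' N t := by
  unfold sC
  congr 1
  ext i
  simp only [mem_filter, alive_congr hv hS hε]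

open Classical in
lemma sum_exp_card_le {n l : ℕ} {w c : ℝ} {z : ℕ → Fin A.m → Fin A.D} (hln : l ≤ n)
    (hbad : ∀ z : Fin A.m → Fin A.D,
      (#{x : Fin A.m → Fin A.D | 8 * #{s | x s ≠ z s} < A.m} : ℝ) * Real.exp w ≤ c * A.D ^ A.m)
    (U : ℕ → Prop) :
    ∑ x : Fin n → Fin A.m → Fin A.D,
      Real.exp (w * #{a ∈ range l | (∃ ha : a < n, 8 * #{s | x ⟨a, ha⟩ s ≠ z a s} < A.m) ∧ U a}) ≤
      (A.D ^ A.m : ℝ) ^ n * Real.exp (c * #{a ∈ range l | U a}) := by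
  let F : Fin n → (Fin A.m → Fin A.D) → ℝ := fun a x =>
    if (8 * #{s | x s ≠ z a s} < A.m) ∧ (a : ℕ) < l ∧ U a then Real.exp w else 1
  have h0 : ∀ (q : ℕ → Prop) [DecidablePred q], (#{a ∈ range l | q a} : ℝ) =
      ∑ a : Fin n, if (a : ℕ) < l ∧ q a then (1 : ℝ) else 0 := fun q _ => by
    rw [Fin.sum_univ_eq_sum_range (fun a => if a < l ∧ q a then (1 : ℝ) else 0), ← sum_filter,
      sum_const, nsmul_one]
    congr 2
    ext a
    simp only [mem_filter, mem_range]
    constructor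
    · rintro ⟨h1, h2⟩; exact ⟨by omega, h1, h2⟩
    · rintro ⟨-, h1, h2⟩; exact ⟨h1, h2⟩
  have h1 : ∀ x : Fin n → Fin A.m → Fin A.D,
      Real.exp (w * #{a ∈ range l | (∃ ha : a < n, 8 * #{s | x ⟨a, ha⟩ s ≠ z a s} < A.m) ∧ U a}) =
      ∏ a, F a (x a) := fun x => by
    rw [h0, mul_sum, Real.exp_sum]
    refine prod_congr rfl fun a _ => ?_
    have : ((a : ℕ) < l ∧ (∃ ha : (a : ℕ) < n, 8 * #{s | x ⟨a, ha⟩ s ≠ z a s} < A.m) ∧ U a) ↔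
        (8 * #{s | x a s ≠ z a s} < A.m) ∧ (a : ℕ) < l ∧ U a := by
      constructor
      · rintro ⟨h1, ⟨_, h2⟩, h3⟩; exact ⟨h2, h1, h3⟩
      · rintro ⟨h1, h2, h3⟩; exact ⟨h2, ⟨a.2, h1⟩, h3⟩
    simp only [this, F]
    split_ifs <;> simp
  have h2 : ∀ a : Fin n, ∑ x, F a x ≤
      (A.D ^ A.m : ℝ) * Real.exp (c * if (a : ℕ) < l ∧ U a then (1 : ℝ) else 0) := fun a => by
    by_cases ha : (a : ℕ) < l ∧ U a
    · rw [if_pos ha, mul_one]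
      have h3 : ∀ x, F a x ≤ 1 + if 8 * #{s | x s ≠ z a s} < A.m then Real.exp w else 0 := fun x => by
        simp only [F, ha, and_true]
        split_ifs
        · linarith [Real.exp_pos w]
        · norm_num
      calc _ ≤ ∑ x : Fin A.m → Fin A.D,
            (1 + if 8 * #{s | x s ≠ z a s} < A.m then Real.exp w else 0) := sum_le_sum fun x _ => h3 x
        _ = A.D ^ A.m + #{x : Fin A.m → Fin A.D | 8 * #{s | x s ≠ z a s} < A.m} * Real.exp w := by
            rw [sum_add_distrib, ← sum_filter, sum_const, sum_const]
            simp
        _ ≤ A.D ^ A.m + c * A.D ^ A.m := by linarith [hbad (z a)]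
        _ = A.D ^ A.m * (c + 1) := by ring
        _ ≤ _ := mul_le_mul_of_nonneg_left (Real.add_one_le_exp c) (by positivity)
    · rw [if_neg ha, mul_zero, Real.exp_zero, mul_one]
      have h3 : ∀ x, F a x = 1 := fun x => if_neg fun h => ha h.2
      simp [h3]
  have hF0 : ∀ a x, 0 ≤ F a x := fun a x => by
    simp only [F]; split_ifs
    · positivity
    · norm_num
  have h4 := Finset.prod_univ_sum (fun _ : Fin n => (univ : Finset (Fin A.m → Fin A.D))) F
  rw [Fintype.piFinset_univ] at h4
  rw [sum_congr rfl fun x _ => h1 x, ← h4]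
  refine (prod_le_prod (fun a _ => sum_nonneg fun x _ => hF0 a x) fun a _ => h2 a).trans_eq ?_
  rw [prod_mul_distrib, prod_const, card_univ, Fintype.card_fin, h0, mul_sum, Real.exp_sum]

lemma sum_exp_sC_le {n N : ℕ} (hn : A.nu N A.G ≤ n) (v : ℕ) (S : ℕ → Fin 4 → ℤ)
    (hS : ∀ I c, |S (I + 1) c - S I c| ≤ 1) (p' : Pth A) {w b c : ℝ}
    (hbad : ∀ z : Fin A.m → Fin A.D,
      (#{x : Fin A.m → Fin A.D | 8 * #{s | x s ≠ z s} < A.m} : ℝ) * Real.exp (w + b) ≤ c * A.D ^ A.m)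
    (hc : ∀ g, c * A.lam g ≤ b) :
    ∑ ε : Fin (A.G + 1) → Fin n → Fin A.m → Fin A.D,
      Real.exp (w * ∑ g ∈ Icc 1 A.G, ((mk' v S hS ε).sC p' N g : ℝ)) ≤
    ∑ ε : Fin (A.G + 1) → Fin n → Fin A.m → Fin A.D,
      Real.exp (b * (mk' v S hS ε).sC p' N 0) := by
  classical
  have hb : 0 ≤ b := by
    refine le_trans (mul_nonneg ?_ (Nat.cast_nonneg _)) (hc 0)
    have h1 := hbad fun _ => ⟨0, A.hD⟩
    have h2 : (0 : ℝ) < A.D ^ A.m := pow_pos (by exact_mod_cast A.hD) _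
    exact nonneg_of_mul_nonneg_left (le_trans (by positivity) h1) h2
  have hmono : ∀ t ≤ A.G, A.nu N t ≤ n := fun t ht => by
    obtain ⟨k, hk⟩ := Nat.exists_eq_add_of_le ht
    refine le_trans ?_ hn
    rw [hk, A.nu_add]
    exact Nat.le_mul_of_pos_right _ (A.pl_pos _ _)
  suffices h : ∀ t ≤ A.G, ∑ ε : Fin (A.G + 1) → Fin n → Fin A.m → Fin A.D,
      Real.exp (w * ∑ g ∈ Icc 1 t, ((mk' v S hS ε).sC p' N g : ℝ) + b * (mk' v S hS ε).sC p' N t) ≤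
    ∑ ε : Fin (A.G + 1) → Fin n → Fin A.m → Fin A.D,
      Real.exp (b * (mk' v S hS ε).sC p' N 0) by
    refine le_trans (sum_le_sum fun ε _ => Real.exp_le_exp.2 ?_) (h A.G le_rfl)
    have : (0 : ℝ) ≤ b * (mk' v S hS ε).sC p' N A.G := by positivity
    linarith
  intro t
  induction t with
  | zero => intro _; simp
  | succ t ih =>
    intro ht
    refine le_trans ?_ (ih (by omega))
    refine sum_le_sum_of_update (⟨t + 1, by omega⟩ : Fin (A.G + 1)) fun ε => ?_
    have h1 : ∀ x, ∀ g ≤ t, (mk' (A := A) v S hS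
        (Function.update ε ⟨t + 1, by omega⟩ x)).ε g = (mk' v S hS ε).ε g := fun x g hg => by
      funext i
      simp only [mk']
      have : ∀ h : g < A.G + 1, (⟨g, h⟩ : Fin (A.G + 1)) ≠ ⟨t + 1, by omega⟩ := fun h h' => by
        rw [Fin.mk.injEq] at h'; omega
      split_ifs with h1 h2
      · rw [Function.update_of_ne (this h1)]
      · rfl
      · rfl
    have h2 : ∀ x, ∑ g ∈ Icc 1 t, ((mk' (A := A) v S hS
        (Function.update ε ⟨t + 1, by omega⟩ x)).sC p' N g : ℝ) =
        ∑ g ∈ Icc 1 t, ((mk' v S hS ε).sC p' N g : ℝ) := fun x => by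
      refine sum_congr rfl fun g hg => ?_
      have := mem_Icc.1 hg
      rw [sC_congr (p := mk' v S hS (Function.update ε ⟨t + 1, by omega⟩ x)) (q := mk' v S hS ε)
        rfl rfl fun g' hg' => h1 x g' (by omega)]
    have h3 : ∀ x, (mk' (A := A) v S hS (Function.update ε ⟨t + 1, by omega⟩ x)).sC p' N (t + 1) =
        #{a ∈ range (A.nu N (t + 1)) | (∃ ha : a < n, 8 * #{s | x ⟨a, ha⟩ s ≠ p'.ε (t + 1) a s} < A.m) ∧
          (mk' v S hS ε).Alive p' t (a / A.lam t)} := fun x => by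
      unfold sC
      congr 1
      ext a
      rw [mem_filter, mem_filter, mem_range]
      refine and_congr_right fun ha => ?_
      rw [Alive, alive_congr (p := mk' v S hS (Function.update ε ⟨t + 1, by omega⟩ x)) (q := mk' v S hS ε)
        rfl rfl fun g' hg' => h1 x g' hg']
      have han : a < n := ha.trans_le (hmono _ ht)
      have hG : t + 1 < A.G + 1 := by omega
      simp only [Co, mk', dif_pos hG, dif_pos han, Function.update_self, exists_prop_of_true han]
    have h4 : (#{a ∈ range (A.nu N (t + 1)) | (mk' v S hS ε).Alive p' t (a / A.lam t)} : ℝ) =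
        A.lam t * (mk' v S hS ε).sC p' N t := by
      have := sum_range_mul_div (fun a => if (mk' v S hS ε).Alive p' t a then (1 : ℝ) else 0)
        (A.nu N t) (A.lam t) (A.lam_pos t)
      rw [← sum_filter, ← sum_filter, sum_const, sum_const, nsmul_one, nsmul_one] at this
      unfold sC
      rw [Prm.nu]
      convert this
    have h5 := sum_exp_card_le (n := n) (l := A.nu N (t + 1)) (w := w + b) (c := c)
      (z := p'.ε (t + 1)) (hmono _ ht) hbad fun a => (mk' v S hS ε).Alive p' t (a / A.lam t)
    calc _ = ∑ x : Fin n → Fin A.m → Fin A.D,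
          Real.exp (w * ∑ g ∈ Icc 1 t, ((mk' v S hS ε).sC p' N g : ℝ)) *
          Real.exp ((w + b) * #{a ∈ range (A.nu N (t + 1)) |
            (∃ ha : a < n, 8 * #{s | x ⟨a, ha⟩ s ≠ p'.ε (t + 1) a s} < A.m) ∧
            (mk' v S hS ε).Alive p' t (a / A.lam t)}) := by
          refine sum_congr rfl fun x _ => ?_
          rw [← Real.exp_add, sum_Icc_succ_top (by omega), h2, h3]
          congr 1
          ring
      _ ≤ Real.exp (w * ∑ g ∈ Icc 1 t, ((mk' v S hS ε).sC p' N g : ℝ)) *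
          ((A.D ^ A.m : ℝ) ^ n * Real.exp (c * #{a ∈ range (A.nu N (t + 1)) |
            (mk' v S hS ε).Alive p' t (a / A.lam t)})) := by
          rw [← mul_sum]
          exact mul_le_mul_of_nonneg_left h5 (Real.exp_nonneg _)
      _ = (A.D ^ A.m : ℝ) ^ n * Real.exp (w * ∑ g ∈ Icc 1 t, ((mk' v S hS ε).sC p' N g : ℝ) +
          c * A.lam t * (mk' v S hS ε).sC p' N t) := by
          rw [h4, Real.exp_add, mul_assoc c]; ring
      _ ≤ (A.D ^ A.m : ℝ) ^ n * Real.exp (w * ∑ g ∈ Icc 1 t, ((mk' v S hS ε).sC p' N g : ℝ) +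
          b * (mk' v S hS ε).sC p' N t) := by
          gcongr
          exact hc t
      _ = _ := by simp

end Pth
end WN

end

section

open Finset MeasureTheory ProbabilityTheory

namespace WN
namespace Cfg
variable {A : Prm} {d : ℕ} (C : Cfg A d)

lemma card_hamming_le (A : Prm) (z : Fin A.m → Fin A.D) :
    #{x : Fin A.m → Fin A.D | 8 * #{s | x s ≠ z s} < A.m} ≤ 2 ^ A.m * A.D ^ (A.m / 8) := by
  classical
  have h1 : (univ.filter fun x : Fin A.m → Fin A.D => 8 * #{s | x s ≠ z s} < A.m) ⊆
      ((univ : Finset (Finset (Fin A.m))).filter fun t => 8 * #t < A.m).biUnion fun t =>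
        Fintype.piFinset fun s => if s ∈ t then univ else {z s} := by
    intro x hx
    rw [mem_biUnion]
    refine ⟨univ.filter fun s => x s ≠ z s, ?_, ?_⟩
    · simpa using hx
    · rw [Fintype.mem_piFinset]
      intro s
      by_cases hs : x s = z s <;> simp [hs]
  refine (card_le_card h1).trans (card_biUnion_le.trans ?_)
  calc _ ≤ ∑ t ∈ (univ : Finset (Finset (Fin A.m))).filter fun t => 8 * #t < A.m,
        A.D ^ (A.m / 8) := by
        refine sum_le_sum fun t ht => ?_
        have ht' := (mem_filter.1 ht).2
        rw [Fintype.card_piFinset]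
        calc _ = ∏ s, if s ∈ t then A.D else 1 := prod_congr rfl fun s _ => by
              split_ifs <;> simp
          _ = A.D ^ #t := by rw [prod_ite_mem, univ_inter, prod_const]
          _ ≤ _ := Nat.pow_le_pow_right A.hD (by omega)
    _ ≤ ∑ t : Finset (Fin A.m), A.D ^ (A.m / 8) :=
        sum_le_sum_of_subset (filter_subset _ _)
    _ = _ := by simp

/-- Weight of the units that use nearly the same order. -/
noncomputable def hw : ℝ := 1 / A.R ^ 32

include C in
lemma hamming_weight_le (z : Fin A.m → Fin A.D) :
    (#{x : Fin A.m → Fin A.D | 8 * #{s | x s ≠ z s} < A.m} : ℝ) *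
      Real.exp (17 * C.J * A.R ^ 4 + 1 / A.R) ≤ hw (A := A) * A.D ^ A.m := by
  have hR0 : (0 : ℝ) < A.R := by exact_mod_cast A.R_pos
  have hm8 : 8 * (A.m / 8) = A.m := by
    refine Nat.mul_div_cancel' ?_
    have h8 : 8 ∣ A.R := by
      rw [C.hR]
      exact (show 8 = 2 ^ 3 by norm_num) ▸ pow_dvd_pow 2 (by have := C.hJ; omega)
    exact h8.trans (dvd_pow_self _ (by norm_num))
  set m' := A.m / 8 with hm'
  have hmR : (A.R : ℝ) ^ 4 = 8 * m' := by exact_mod_cast hm8.symm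
  have h1 : (#{x : Fin A.m → Fin A.D | 8 * #{s | x s ≠ z s} < A.m} : ℝ) ≤ 2 ^ A.m * A.D ^ m' := by
    exact_mod_cast card_hamming_le A z
  have hD : (A.D : ℝ) = A.R ^ 29 := by exact_mod_cast C.hD
  have h2 : (2 : ℝ) ^ A.m = Real.exp (8 * m' * Real.log 2) := by
    rw [← Real.rpow_natCast, Real.rpow_def_of_pos (by norm_num), ← hm8]
    push_cast
    ring_nf
  have h3 : (A.D : ℝ) ^ A.m = A.D ^ m' * Real.exp (203 * m' * C.J * Real.log 2) := by
    rw [← hm8, show 8 * m' = m' + 7 * m' by ring, pow_add, hD, ← pow_mul _ 29 (7 * m'),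
      C.R_pow_eq_exp (29 * (7 * m'))]
    push_cast
    ring_nf
  have h4 : hw (A := A) = Real.exp (-(32 * C.J * Real.log 2)) := by
    rw [hw, C.R_pow_eq_exp, Real.exp_neg]
    push_cast
    rw [one_div]
  have hJ : (200 : ℝ) ≤ C.J := by exact_mod_cast C.hJ
  have hl := Real.log_two_gt_d9
  have hl2 := Real.log_two_lt_d9
  have hRb := C.R_large
  have hm1 : (1000 : ℝ) ≤ m' := by
    have : (2 : ℝ) ^ 200 ≤ A.R ^ 4 := hRb.trans (le_self_pow₀ (by linarith [show (1 : ℝ) ≤ 2 ^ 200 by norm_num]) (by norm_num))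
    linarith [show (8000 : ℝ) ≤ 2 ^ 200 by norm_num]
  have hR1 : 1 / (A.R : ℝ) ≤ 1 := by
    rw [div_le_one hR0]; linarith [show (1 : ℝ) ≤ 2 ^ 200 by norm_num]
  have h5 : 8 * m' * Real.log 2 + (17 * C.J * A.R ^ 4 + 1 / A.R) ≤
      -(32 * C.J * Real.log 2) + 203 * m' * C.J * Real.log 2 := by
    rw [hmR]
    have e1 : (4.7 : ℝ) * (C.J * m') ≤ 203 * m' * C.J * Real.log 2 - 17 * C.J * (8 * m') := by
      have : (0 : ℝ) ≤ C.J * m' := by positivity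
      nlinarith
    have e2 : 200 * (m' : ℝ) ≤ C.J * m' := mul_le_mul_of_nonneg_right hJ (by positivity)
    have e3 : (C.J : ℝ) * 1000 ≤ C.J * m' := mul_le_mul_of_nonneg_left hm1 (by positivity)
    have e4 : 8 * (m' : ℝ) * Real.log 2 ≤ 8 * m' := by
      have : (0 : ℝ) ≤ m' := by positivity
      nlinarith
    have e5 : 32 * (C.J : ℝ) * Real.log 2 ≤ 32 * C.J := by nlinarith
    linarith
  calc _ ≤ (2 ^ A.m * A.D ^ m' : ℝ) * Real.exp (17 * C.J * A.R ^ 4 + 1 / A.R) := by gcongr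
    _ = A.D ^ m' * Real.exp (8 * m' * Real.log 2 + (17 * C.J * A.R ^ 4 + 1 / A.R)) := by
        rw [h2, Real.exp_add (8 * m' * Real.log 2)]; ring
    _ ≤ A.D ^ m' * Real.exp (-(32 * C.J * Real.log 2) + 203 * m' * C.J * Real.log 2) := by gcongr
    _ = _ := by rw [h3, h4, Real.exp_add]; ring

include C in
lemma hw_mul_lam_le (g : ℕ) : hw (A := A) * A.lam g ≤ 1 / A.R := by
  have hR0 : (0 : ℝ) < A.R := by exact_mod_cast A.R_pos
  have h : (A.lam g : ℝ) ≤ A.R ^ 31 := by exact_mod_cast C.lam_le_pow g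
  calc _ ≤ 1 / A.R ^ 32 * (A.R : ℝ) ^ 31 := by unfold hw; gcongr
    _ = _ := by field_simp

/-- Indices of the paths of the family. -/
abbrev Ix (B : ℕ) : Type :=
  (Fin B × (Fin C.N → Fin 4 → Bool)) × (Fin (A.G + 1) → Fin (A.nu C.N A.G) → Fin A.m → Fin A.D)

/-- A walk that returns to the origin. -/
def bridge {N : ℕ} (b : Fin N → Fin 4 → Bool) (I : ℕ) (c : Fin 4) : ℤ := walk b (min I (N - I)) c

lemma abs_bridge_succ_sub_le {N : ℕ} (b : Fin N → Fin 4 → Bool) (I : ℕ) (c : Fin 4) :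
    |bridge b (I + 1) c - bridge b I c| ≤ 1 := by
  unfold bridge
  have h : min (I + 1) (N - (I + 1)) = min I (N - I) + 1 ∨
      min I (N - I) = min (I + 1) (N - (I + 1)) + 1 ∨
      min (I + 1) (N - (I + 1)) = min I (N - I) := by omega
  rcases h with h | h | h
  · rw [h]; exact abs_walk_succ_sub_le b _ c
  · rw [h, abs_sub_comm]; exact abs_walk_succ_sub_le b _ c
  · rw [h]; simp

/-- The paths of the family. -/
def pth {B : ℕ} (q : C.Ix B) : Pth A :=
  Pth.mk' q.1.1 (bridge q.1.2) (abs_bridge_succ_sub_le q.1.2) q.2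

lemma card_near_bridge_le {N : ℕ} (b b' : Fin N → Fin 4 → Bool) :
    #{I ∈ range N | ∀ c, |bridge b I c - bridge b' I c| ≤ 6} ≤
      2 * #{t ∈ range (N + 1) | ∀ c, |walk b t c - walk b' t c| ≤ 6} := by
  refine card_le_mul_card_image_of_maps_to (f := fun I => min I (N - I)) (fun I hI => ?_) 2
    fun t _ => ?_
  · simp only [mem_filter, mem_range] at hI ⊢
    exact ⟨by omega, hI.2⟩
  · refine (card_le_card (t := {t, N - t}) fun I hI => ?_).trans card_le_two
    simp only [mem_filter, mem_range] at hI
    rw [mem_insert, mem_singleton]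
    omega

lemma sC_zero_le {B : ℕ} (q q' : C.Ix B) :
    (C.pth q).sC (C.pth q') C.N 0 ≤ if |((q.1.1 : ℕ) : ℤ) - (q'.1.1 : ℕ)| ≤ 6 then
      2 * #{t ∈ range (C.N + 1) | ∀ c, |walk q.1.2 t c - walk q'.1.2 t c| ≤ 6} else 0 := by
  classical
  unfold Pth.sC
  split_ifs with h
  · refine le_trans (card_le_card fun I hI => ?_) (card_near_bridge_le _ _)
    rw [mem_filter] at hI ⊢
    exact ⟨hI.1, hI.2.2⟩
  · rw [Nat.le_zero, card_eq_zero, filter_eq_empty_iff]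
    intro I _ hI
    exact h hI.1

lemma card_near_le {B : ℕ} (v : Fin B) : #{u : Fin B | |((u : ℕ) : ℤ) - (v : ℕ)| ≤ 6} ≤ 13 := by
  have : #((Icc (((v : ℕ) : ℤ) - 6) ((v : ℕ) + 6))) = 13 := by rw [Int.card_Icc]; omega
  rw [← this]
  refine card_le_card_of_injOn (fun u => ((u : ℕ) : ℤ)) (fun u hu => ?_) (fun a _ b _ h => ?_)
  · simp only [coe_filter, mem_univ, true_and, Set.mem_ofPred_eq] at hu
    rw [abs_le] at hu
    simp only [coe_Icc, Set.mem_Icc]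
    omega
  · exact Fin.ext (by simpa using h)

include C in
lemma sum_exp_sC_zero_le {B : ℕ} (hB : 0 < B) (q' : C.Ix B) :
    ∑ q : C.Ix B, Real.exp (7 / A.R * (C.pth q).sC (C.pth q') C.N 0) ≤
      (1 + 13 / B) * Fintype.card (C.Ix B) := by
  classical
  have hR := C.R_large
  have hR0 : (0 : ℝ) < A.R := by exact_mod_cast A.R_pos
  have hB0 : (0 : ℝ) < B := by exact_mod_cast hB
  set κ : ℝ := 14 / A.R with hκ
  have hκ0 : 0 ≤ κ := by positivity
  have hκ1 : κ ≤ 1 / 300000 := by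
    rw [hκ, div_le_div_iff₀ hR0 (by norm_num)]
    linarith [show (14 * 300000 : ℝ) ≤ 2 ^ 200 by norm_num]
  have hκ2 : 2 * (Real.exp κ - 1) * 57122 ≤ 1 := by
    have := Real.abs_exp_sub_one_le (x := κ) (by rw [abs_of_nonneg hκ0]; linarith)
    rw [abs_of_nonneg hκ0] at this
    linarith [le_abs_self (Real.exp κ - 1)]
  have h1 : ∀ q : C.Ix B, Real.exp (7 / A.R * (C.pth q).sC (C.pth q') C.N 0) ≤
      if |((q.1.1 : ℕ) : ℤ) - (q'.1.1 : ℕ)| ≤ 6 then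
        Real.exp (κ * #{t ∈ range (C.N + 1) | ∀ c, |walk q.1.2 t c - walk q'.1.2 t c| ≤ 6})
      else 1 := fun q => by
    have h := C.sC_zero_le q q'
    split_ifs with hv
    · rw [if_pos hv] at h
      refine Real.exp_le_exp.2 ?_
      have h' : ((C.pth q).sC (C.pth q') C.N 0 : ℝ) ≤
          2 * #{t ∈ range (C.N + 1) | ∀ c, |walk q.1.2 t c - walk q'.1.2 t c| ≤ 6} := by
        exact_mod_cast h
      calc _ ≤ 7 / A.R * (2 * #{t ∈ range (C.N + 1) | ∀ c, |walk q.1.2 t c - walk q'.1.2 t c| ≤ 6} : ℝ) := by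
            gcongr
        _ = _ := by rw [hκ]; ring
    · rw [if_neg hv, Nat.le_zero] at h
      simp [h]
  have hcard : (Fintype.card (C.Ix B) : ℝ) = B * 16 ^ C.N *
      Fintype.card (Fin (A.G + 1) → Fin (A.nu C.N A.G) → Fin A.m → Fin A.D) := by
    rw [Fintype.card_prod, Fintype.card_prod, Fintype.card_fin, Fintype.card_fun]
    simp
  have h2 := sum_exp_near_walk_le_two hκ0 hκ2 C.N (walk q'.1.2)
  set e : ℝ := ((Fintype.card (Fin (A.G + 1) → Fin (A.nu C.N A.G) → Fin A.m → Fin A.D) : ℕ) : ℝ) with he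
  refine (sum_le_sum fun q _ => h1 q).trans ?_
  rw [Fintype.sum_prod_type]
  simp only [sum_const, card_univ, nsmul_eq_mul]
  rw [← mul_sum, Fintype.sum_prod_type, ← he]
  have h3 : ∀ v : Fin B, (∑ b : Fin C.N → Fin 4 → Bool, if |((v : ℕ) : ℤ) - (q'.1.1 : ℕ)| ≤ 6 then
        Real.exp (κ * #{t ∈ range (C.N + 1) | ∀ c, |walk b t c - walk q'.1.2 t c| ≤ 6})
      else 1) ≤ 16 ^ C.N * (1 + if |((v : ℕ) : ℤ) - (q'.1.1 : ℕ)| ≤ 6 then 1 else 0) := fun v => by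
    split_ifs with hv
    · refine h2.trans_eq ?_
      norm_num
    · simp
  calc _ ≤ e * ∑ v : Fin B, (16 : ℝ) ^ C.N * (1 + if |((v : ℕ) : ℤ) - (q'.1.1 : ℕ)| ≤ 6 then 1 else 0) :=
        mul_le_mul_of_nonneg_left (sum_le_sum fun v _ => h3 v) (by positivity)
    _ = e * (16 ^ C.N * (B + #{u : Fin B | |((u : ℕ) : ℤ) - (q'.1.1 : ℕ)| ≤ 6})) := by
        rw [← mul_sum, sum_add_distrib, sum_boole]
        simp
    _ ≤ e * (16 ^ C.N * (B + 13)) := by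
        have : (#{u : Fin B | |((u : ℕ) : ℤ) - (q'.1.1 : ℕ)| ≤ 6} : ℝ) ≤ 13 := by
          exact_mod_cast card_near_le q'.1.1
        gcongr
    _ = _ := by rw [hcard]; field_simp

variable {Ω : Type} [MeasurableSpace Ω] {P : Measure Ω} [IsProbabilityMeasure P]
    {h : ℕ → EuclideanSpace ℝ (Fin d) → Ω → ℝ} {H : ℕ}

lemma sum_pair_le (hh : IsWhiteNoiseField d P h) (hH : A.G < H) {B : ℕ} (hB : 0 < B) :
    ∑ q : C.Ix B, ∑ q' : C.Ix B, Real.exp (cv P (C.tilt h hH (C.pth q)) (C.tilt h hH (C.pth q'))) *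
      (((1 - 2 * (1 / A.R : ℝ)) ^ 2)⁻¹) ^ (C.pth q).sC (C.pth q') C.N 0 ≤
      (1 + 13 / B) * (Fintype.card (C.Ix B) : ℝ) ^ 2 := by
  have hR := C.R_large
  have hR0 : (0 : ℝ) < A.R := by exact_mod_cast A.R_pos
  set δ : ℝ := 1 / A.R with hδ
  have hδ0 : 0 < δ := by positivity
  have hδ1 : δ ≤ 1 / 100 := by
    rw [hδ, div_le_div_iff₀ hR0 (by norm_num)]
    linarith [show (100 : ℝ) ≤ 2 ^ 200 by norm_num]
  have h1 : ((1 - 2 * δ) ^ 2)⁻¹ ≤ Real.exp (5 * δ) := by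
    have h2 : Real.exp (-(5 / 2 * δ)) ≤ 1 - 2 * δ := by
      have h3 := Real.abs_exp_sub_one_sub_id_le (x := -(5 / 2 * δ)) (by
        rw [abs_neg, abs_of_nonneg (by positivity)]; linarith)
      have h4 := (le_abs_self _).trans h3
      nlinarith
    rw [inv_le_comm₀ (by nlinarith) (Real.exp_pos _), ← Real.exp_neg]
    calc _ = Real.exp (-(5 / 2 * δ)) ^ 2 := by rw [← Real.exp_nat_mul]; ring_nf
      _ ≤ _ := pow_le_pow_left₀ (Real.exp_nonneg _) h2 2
  have h2 : ∀ q q' : C.Ix B, Real.exp (cv P (C.tilt h hH (C.pth q)) (C.tilt h hH (C.pth q'))) *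
      (((1 - 2 * δ) ^ 2)⁻¹) ^ (C.pth q).sC (C.pth q') C.N 0 ≤
      Real.exp (17 * C.J * A.R ^ 4 * ∑ g ∈ Icc 1 A.G, ((C.pth q).sC (C.pth q') C.N g : ℝ)) *
      Real.exp (6 / A.R * (C.pth q).sC (C.pth q') C.N 0) := fun q q' => by
    have h3 := C.cv_tilt_le hh hH (C.pth q) (C.pth q')
    calc _ ≤ Real.exp (17 * C.J * A.R ^ 4 * ∑ g ∈ Icc 1 A.G, ((C.pth q).sC (C.pth q') C.N g : ℝ) +
          (C.pth q).sC (C.pth q') C.N 0 / A.R) * Real.exp (5 * δ) ^ (C.pth q).sC (C.pth q') C.N 0 := by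
          gcongr
      _ = _ := by
          rw [← Real.exp_nat_mul, ← Real.exp_add, ← Real.exp_add, hδ]
          congr 1
          ring
  have h3 : ∀ q' : C.Ix B, ∑ q : C.Ix B, Real.exp (cv P (C.tilt h hH (C.pth q)) (C.tilt h hH (C.pth q'))) *
      (((1 - 2 * δ) ^ 2)⁻¹) ^ (C.pth q).sC (C.pth q') C.N 0 ≤
      (1 + 13 / B) * (Fintype.card (C.Ix B) : ℝ) := fun q' => by
    refine le_trans (sum_le_sum fun q _ => h2 q q') ?_
    refine le_trans ?_ (C.sum_exp_sC_zero_le hB q')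
    have hsplit : ∀ f : C.Ix B → ℝ, ∑ q, f q = ∑ x, ∑ ε, f (x, ε) := fun f =>
      Fintype.sum_prod_type f
    rw [hsplit, hsplit]
    refine sum_le_sum fun x _ => ?_
    have h4 := Pth.sum_exp_sC_le (A := A) (N := C.N) (le_refl (A.nu C.N A.G)) x.1 (bridge x.2) (abs_bridge_succ_sub_le x.2)
      (C.pth q') C.hamming_weight_le C.hw_mul_lam_le
    have h5 : ∀ ε ε' , (C.pth (B := B) (x, ε)).sC (C.pth q') C.N 0 =
        (C.pth (B := B) (x, ε')).sC (C.pth q') C.N 0 := fun ε ε' => rfl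
    have := A.hD
    let ε₀ : Fin (A.G + 1) → Fin (A.nu C.N A.G) → Fin A.m → Fin A.D := fun _ _ _ => ⟨0, this⟩
    set c : ℝ := (((C.pth (B := B) (x, ε₀)).sC (C.pth q') C.N 0 : ℕ) : ℝ) with hc
    have h6 : ∀ ε, (((C.pth (B := B) (x, ε)).sC (C.pth q') C.N 0 : ℕ) : ℝ) = c := fun ε => by
      rw [hc, h5 ε ε₀]
    calc _ = (∑ ε, Real.exp (17 * C.J * A.R ^ 4 *
            ∑ g ∈ Icc 1 A.G, ((C.pth (B := B) (x, ε)).sC (C.pth q') C.N g : ℝ))) *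
            Real.exp (6 / A.R * c) := by
          rw [sum_mul]
          refine sum_congr rfl fun ε _ => ?_
          rw [h6]
      _ ≤ (∑ ε, Real.exp (1 / A.R * (C.pth (B := B) (x, ε)).sC (C.pth q') C.N 0)) *
            Real.exp (6 / A.R * c) := by
          gcongr ?_ * _
          exact h4
      _ = _ := by
          rw [sum_mul]
          refine sum_congr rfl fun ε _ => ?_
          rw [h6, ← Real.exp_add]
          congr 1
          ring
  rw [sum_comm]
  refine (sum_le_sum fun q' _ => h3 q').trans_eq ?_
  rw [sum_const, card_univ, nsmul_eq_mul]
  ring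

end Cfg
end WN

end

section

open Finset MeasureTheory ProbabilityTheory

namespace WN
namespace Cfg
variable {A : Prm} {d : ℕ} (C : Cfg A d)
variable {Ω : Type} [MeasurableSpace Ω] {P : Measure Ω} [IsProbabilityMeasure P]
    {h : ℕ → EuclideanSpace ℝ (Fin d) → Ω → ℝ} {H : ℕ}

lemma cv_incrTo_eq_zero (hh : IsWhiteNoiseField d P h) {j j' : ℕ}
    {x y : EuclideanSpace ℝ (Fin d)} (hxy : 2 * sc (3 * C.k) ≤ dist x y) :
    cv P (incrTo h (3 * C.k) j x) (incrTo h (3 * C.k) j' y) = 0 := by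
  have := C.neZero
  rw [cv_incrTo hh (by have := C.hk; omega)]
  refine sum_eq_zero fun i hi => scaleCov_eq_zero ?_
  have := sc_anti (mem_Ico.1 hi).1
  linarith

lemma cv_incrTo_tilt_eq_zero (hh : IsWhiteNoiseField d P h) (hH : A.G < H) (p : Pth A) {j : ℕ}
    (hj : j ≤ C.n) {x : EuclideanSpace ℝ (Fin d)}
    (hx : ∀ τ, 2 * sc (3 * C.k) ≤ dist x (C.E.pos p H τ)) :
    cv P (incrTo h (3 * C.k) j x) (C.tilt h hH p) = 0 := by
  have := C.neZero
  rw [C.cv_incrTo_tilt hh hH p hj]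
  refine mul_eq_zero_of_right _ (sum_eq_zero fun i hi => sum_eq_zero fun τ _ => ?_)
  rw [scaleCov_eq_zero, zero_mul]
  have := sc_anti (mem_Ico.1 hi).1
  linarith [hx τ]

/-- The points that have to be thick. -/
abbrev Pt (H : ℕ) : Type := Fin (A.T C.N H) × {j // j ∈ Icc (6 * C.k) C.n}

lemma prob_thick_ge (hh : IsWhiteNoiseField d P h) (hH : A.G + 36 ≤ H) {B : ℕ} (hB : 0 < B)
    {α : ℝ} (hα : α ≤ √(52 * C.J) / 8) :
    1 / (1 + 13 / (B : ℝ)) ≤ P.real {ω | ∃ q : C.Ix B, ∀ τ < A.T C.N H, ∀ j, 6 * C.k ≤ j → j ≤ C.n →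
      α * ((j : ℝ) - 3 * C.k) ≤ incrTo h (3 * C.k) j (C.E.pos (C.pth q) H τ) ω} := by
  classical
  have hV := gaussSpace_fieldSpan hh
  have hk := C.hk
  have hHG : A.G < H := by omega
  have hR8 : (8 : ℝ) ≤ A.R := by linarith [C.R_large, show (8 : ℝ) ≤ 2 ^ 200 by norm_num]
  have : Nonempty (Fin B) := ⟨⟨0, hB⟩⟩
  have hD := A.hD
  have : Nonempty (Fin A.D) := ⟨⟨0, hD⟩⟩
  have h1 := hV.second_moment (Q := C.Ix B) (κ := C.Pt H)
    (Y := fun q x => incrTo h (3 * C.k) x.2 (C.E.pos (C.pth q) H x.1))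
    (fun q x => incrTo_mem (by omega) _) (S := fun q => C.tilt h hHG (C.pth q))
    (fun q => C.tilt_mem hHG _) (mac := fun x => A.uu 0 (A.pe^[H] x.1)) (N := C.N)
    (fun x => A.uu_lt_nu (g := 0) (A.pe_iterate_lt_T (by rw [zero_add]; exact x.1.2)))
    (th := fun x => α * (((x.2 : ℕ) : ℝ) - 3 * C.k)) (δ := 1 / A.R) (η := 13 / B)
    (by positivity) (one_div_le_one_div_of_le (by norm_num) hR8) (by positivity)
    ?_ ?_ (fun q q' => {I ∈ range C.N | (C.pth q).Nr (C.pth q') I}) ?_ ?_ (C.sum_pair_le hh hHG hB)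
  · refine h1.trans (measureReal_mono (fun ω hω => ?_) (measure_ne_top _ _))
    obtain ⟨q, hq⟩ := hω
    exact ⟨q, fun τ hτ j hj hj' => hq (⟨τ, hτ⟩, ⟨j, mem_Icc.2 ⟨hj, hj'⟩⟩)⟩
  · intro q I
    refine le_trans (measureReal_mono (fun ω hω => ?_) (measure_ne_top _ _))
      (C.prob_bad_le hh (C.pth q) hH I)
    obtain ⟨⟨τ, j, hj⟩, hI, hlt⟩ := hω
    rw [mem_Icc] at hj
    refine ⟨j, hj.1, hj.2, τ, ?_, ?_⟩
    · rw [un, mem_filter, mem_range]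
      exact ⟨τ.2, hI⟩
    · have h2 := C.le_cv_incrTo_tilt hh hHG (C.pth q) hj.2 (by omega) τ.2
      have h3 : (0 : ℝ) ≤ (j : ℝ) - 3 * C.k := by
        rw [sub_nonneg]
        exact_mod_cast (by omega : 3 * C.k ≤ j)
      have h4 := mul_le_mul_of_nonneg_right hα h3
      dsimp only at hlt
      linarith
  · rintro q ⟨τ, j, hj⟩ ⟨τ', j', hj'⟩ hmac
    refine C.cv_incrTo_eq_zero hh (C.dist_sq_of_K_le _ _ (not_lt.1 fun hlt => ?_))
    have := ((C.pth q).macro_close _ hlt).1.2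
    dsimp only at hmac this
    omega
  · rintro q q' ⟨τ, j, hj⟩ hmac
    rw [mem_Icc] at hj
    have hmac' : ¬ (C.pth q).Nr (C.pth q') (A.uu 0 (A.pe^[H] τ)) := fun hn =>
      hmac (mem_filter.2 ⟨mem_range.2
        (A.uu_lt_nu (g := 0) (A.pe_iterate_lt_T (by rw [zero_add]; exact τ.2))), hn⟩)
    refine ⟨C.cv_incrTo_tilt_eq_zero hh hHG _ hj.2 fun σ => C.dist_sq_of_K_le _ _ (not_lt.1 fun hlt => ?_),
      C.cv_incrTo_tilt_eq_zero hh hHG _ hj.2 fun σ => C.dist_sq_of_K_le _ _ (not_lt.1 fun hlt => ?_)⟩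
    · exact hmac' ((C.pth q).macro_close _ hlt).2.1
    · exact hmac' (((C.pth q').nr_comm _ _).1 ((C.pth q').macro_close _ hlt).2.1)
  · rintro q q' ⟨τ, j, hj⟩ ⟨τ', j', hj'⟩ hmac -
    refine C.cv_incrTo_eq_zero hh (C.dist_sq_of_K_le _ _ (not_lt.1 fun hlt => ?_))
    exact hmac (mem_filter.2 ⟨mem_range.2
        (A.uu_lt_nu (g := 0) (A.pe_iterate_lt_T (by rw [zero_add]; exact τ.2))),
      ((C.pth q).macro_close _ hlt).2.1⟩)

end Cfg
end WN

end

section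

open Finset MeasureTheory ProbabilityTheory Filter Topology

namespace WN

namespace Prm
variable (A : Prm)

lemma lt_T_of_pe {N g e : ℕ} (h : A.pe e < A.T N g) : e < A.T N (g + 1) := by
  unfold T at h
  rw [T_succ, ← Nat.div_lt_iff_lt_mul A.U_pos, ← A.pe_div, Nat.div_lt_iff_lt_mul A.L_pos]
  exact h

lemma lt_T_of_pe_iterate {N g n e : ℕ} (h : A.pe^[n] e < A.T N g) : e < A.T N (g + n) := by
  induction n generalizing e with
  | zero => exact h
  | succ n ih =>
    rw [Function.iterate_succ_apply] at h
    exact A.lt_T_of_pe (ih h)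

end Prm

namespace Geo
variable {A : Prm} {d : ℕ} (E : Geo A d)

lemma emb_add_smul (f f' : A.Crd → ℝ) (a : ℝ) :
    E.emb f + a • (E.emb f' - E.emb f) = E.emb fun c => f c + a * (f' c - f c) := by
  have h : ∀ g : A.Crd → ℝ, a • E.emb g = E.emb fun c => a * g c := fun g => by
    ext j
    simp only [emb, PiLp.smul_apply, smul_eq_mul]
    by_cases hj : ∃ c, E.e c = j
    · obtain ⟨c, rfl⟩ := hj
      rw [E.e.injective.extend_apply, E.e.injective.extend_apply]
    · rw [Function.extend_apply' _ _ _ hj, Function.extend_apply' _ _ _ hj]; simp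
  have h' : ∀ g g' : A.Crd → ℝ, E.emb g + E.emb g' = E.emb fun c => g c + g' c := fun g g' => by
    have := E.emb_sub (fun c => g c + g' c) g'
    simp only [add_sub_cancel_right] at this
    rw [← this, sub_add_cancel]
  rw [E.emb_sub, h, h']

lemma exists_pos_eq (p : Pth A) {g : ℕ} (hg : A.G ≤ g) (n e a : ℕ) (ha : a < A.R ^ n) :
    ∃ τ, A.pe^[n] τ = e ∧ E.pos p (g + n) τ =
      E.pos p g e + ((a : ℝ) / A.R ^ n) • (E.pos p g (e + 1) - E.pos p g e) := by
  obtain ⟨τ, h1, h2, -⟩ := p.exists_vtx_eq hg n e a ha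
  refine ⟨τ, h1, ?_⟩
  unfold pos
  rw [E.emb_add_smul]
  congr 1
  funext c
  have hR : (A.R : ℝ) ≠ 0 := by exact_mod_cast A.R_pos.ne'
  rw [h2, E.sH_add g n]
  push_cast
  field_simp

/-- A closed set that contains arbitrarily fine vertices of the path contains the polyline. -/
lemma segment_subset_of_closed (p : Pth A) {N g m : ℕ} (hg : A.G ≤ g)
    {s : Set (EuclideanSpace ℝ (Fin d))} (hs : IsClosed s)
    (h : ∀ n, ∀ τ < A.T N (g + m + n), E.pos p (g + m + n) τ ∈ s) {e : ℕ} (he : e < A.T N g) :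
    segment ℝ (E.pos p g e) (E.pos p g (e + 1)) ⊆ s := by
  set f : ℝ → EuclideanSpace ℝ (Fin d) := fun a =>
    E.pos p g e + a • (E.pos p g (e + 1) - E.pos p g e) with hf
  have hfc : Continuous f := by fun_prop
  have hR1 : (1 : ℝ) < A.R := by
    have := A.hR
    exact_mod_cast (by omega : 1 < A.R)
  have h1 : Set.Ico (0 : ℝ) 1 ⊆ f ⁻¹' s := fun a ha => by
    have h2 : Tendsto (fun n : ℕ => (⌊a * (A.R : ℝ) ^ (m + n)⌋₊ : ℝ) / (A.R : ℝ) ^ (m + n)) atTop (𝓝 a) :=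
      (tendsto_nat_floor_mul_div_atTop ha.1).comp
        ((tendsto_pow_atTop_atTop_of_one_lt hR1).comp (tendsto_add_atTop_nat m |>.congr fun n => by ring))
    refine hs.mem_of_tendsto ((hfc.tendsto a).comp h2) (Eventually.of_forall fun n => ?_)
    obtain ⟨τ, h3, h4⟩ := E.exists_pos_eq p hg (m + n) e ⌊a * (A.R : ℝ) ^ (m + n)⌋₊ (by
      rw [Nat.floor_lt (mul_nonneg ha.1 (by positivity))]
      push_cast
      exact mul_lt_of_lt_one_left (by positivity) ha.2)
    have h5 := h n τ (by rw [add_assoc]; exact A.lt_T_of_pe_iterate (h3.trans_lt he))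
    rw [add_assoc, h4] at h5
    exact h5
  rw [segment_eq_image']
  rintro _ ⟨a, ha, rfl⟩
  have h2 := closure_minimal h1 (hs.preimage hfc)
  rw [closure_Ico zero_ne_one] at h2
  exact h2 ha

end Geo

namespace Cfg
variable {A : Prm} {d : ℕ} (C : Cfg A d)
variable {Ω : Type} {h : ℕ → EuclideanSpace ℝ (Fin d) → Ω → ℝ}

/-- The thick points. -/
def thk (h : ℕ → EuclideanSpace ℝ (Fin d) → Ω → ℝ) (α : ℝ) (ω : Ω) :
    Set (EuclideanSpace ℝ (Fin d)) :=
  {x | ∀ j, 6 * C.k ≤ j → j ≤ C.n → α * ((j : ℝ) - 3 * C.k) ≤ h j x ω - h (3 * C.k) x ω}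

lemma mem_thk_iff [MeasurableSpace Ω] {α : ℝ} {ω : Ω} {x : EuclideanSpace ℝ (Fin d)} :
    x ∈ C.thk h α ω ↔ ∀ j, 6 * C.k ≤ j → j ≤ C.n →
      α * ((j : ℝ) - 3 * C.k) ≤ incrTo h (3 * C.k) j x ω := by
  have := C.neZero
  refine forall_congr' fun j => forall_congr' fun hj => ?_
  rw [incrTo_eq (by omega)]
  rfl

variable [MeasurableSpace Ω] {P : Measure Ω}

lemma isClosed_thk (hh : IsWhiteNoiseField d P h) (α : ℝ) (ω : Ω) : IsClosed (C.thk h α ω) := by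
  have : C.thk h α ω = ⋂ j, ⋂ (_ : 6 * C.k ≤ j), ⋂ (_ : j ≤ C.n),
      {x | α * ((j : ℝ) - 3 * C.k) ≤ h j x ω - h (3 * C.k) x ω} := by
    ext x; simp [thk]
  rw [this]
  exact isClosed_iInter fun j => isClosed_iInter fun _ => isClosed_iInter fun _ =>
    isClosed_le continuous_const ((hh.2.2 ω j).sub (hh.2.2 ω _))

lemma measurableSet_thk (hh : IsWhiteNoiseField d P h) (α : ℝ) (x : EuclideanSpace ℝ (Fin d)) :
    MeasurableSet {ω | x ∈ C.thk h α ω} := by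
  have : {ω | x ∈ C.thk h α ω} = ⋂ j, ⋂ (_ : 6 * C.k ≤ j), ⋂ (_ : j ≤ C.n),
      {ω | α * ((j : ℝ) - 3 * C.k) ≤ h j x ω - h (3 * C.k) x ω} := by
    ext ω; simp [thk]
  rw [this]
  exact MeasurableSet.iInter fun j => MeasurableSet.iInter fun _ => MeasurableSet.iInter fun _ =>
    measurableSet_le measurable_const ((hh.1 j x).sub (hh.1 _ x))

/-- With high probability the polyline of level `G` of a path of the family is thick. -/
theorem prob_polyline_ge [IsProbabilityMeasure P] (hh : IsWhiteNoiseField d P h) {B : ℕ} (hB : 0 < B)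
    {α : ℝ} (hα : α ≤ √(52 * C.J) / 8) :
    ENNReal.ofReal (1 / (1 + 13 / (B : ℝ))) ≤ P {ω | ∃ q : C.Ix B, ∀ e < A.T C.N A.G,
      segment ℝ (C.E.pos (C.pth q) A.G e) (C.E.pos (C.pth q) A.G (e + 1)) ⊆ C.thk h α ω} := by
  set F : C.Ix B → ℕ → Set Ω := fun q m => {ω | ∀ τ < A.T C.N (A.G + 36 + m),
    C.E.pos (C.pth q) (A.G + 36 + m) τ ∈ C.thk h α ω} with hF
  have hFm : ∀ q m, MeasurableSet (F q m) := fun q m => by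
    have : F q m = ⋂ τ, ⋂ (_ : τ < A.T C.N (A.G + 36 + m)),
        {ω | C.E.pos (C.pth q) (A.G + 36 + m) τ ∈ C.thk h α ω} := by ext ω; simp [F]
    rw [this]
    exact MeasurableSet.iInter fun τ => MeasurableSet.iInter fun _ => C.measurableSet_thk hh α _
  have hFa : ∀ q, Antitone (F q) := fun q => antitone_nat_of_succ_le fun m ω hω τ hτ => by
    obtain ⟨σ, h1, h2⟩ := C.E.exists_pos_eq (C.pth q) (g := A.G + 36 + m) (by omega) 1 τ 0
      (pow_pos A.R_pos 1)
    have h3 := hω σ (A.lt_T_of_pe_iterate (n := 1) (h1.trans_lt hτ))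
    rw [← add_assoc, h2] at h3
    simpa using h3
  set U : ℕ → Set Ω := fun m => ⋃ q, F q m with hU
  have hUm : ∀ m, MeasurableSet (U m) := fun m => MeasurableSet.iUnion fun q => hFm q m
  have hUa : Antitone U := fun m m' hm => Set.iUnion_mono fun q => hFa q hm
  have h1 : ∀ m, ENNReal.ofReal (1 / (1 + 13 / (B : ℝ))) ≤ P (U m) := fun m => by
    have h2 := C.prob_thick_ge hh (H := A.G + 36 + m) (by omega) hB hα
    refine (ENNReal.ofReal_le_ofReal h2).trans ?_
    rw [ofReal_measureReal]
    refine measure_mono ?_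
    rintro ω ⟨q, hq⟩
    exact Set.mem_iUnion.2 ⟨q, fun τ hτ => C.mem_thk_iff.2 (hq τ hτ)⟩
  refine (ge_of_tendsto' (tendsto_measure_iInter_atTop (fun m => (hUm m).nullMeasurableSet) hUa
    ⟨0, measure_ne_top _ _⟩) h1).trans (measure_mono fun ω hω => ?_)
  rw [Set.mem_iInter] at hω
  obtain ⟨q, hq⟩ : ∃ q, ∀ m, ω ∈ F q m := by
    by_contra! hcon
    choose m hm using hcon
    obtain ⟨q, hq⟩ := Set.mem_iUnion.1 (hω (univ.sup m))
    exact hm q (hFa q (le_sup (mem_univ q)) hq)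
  exact ⟨q, fun e he => C.E.segment_subset_of_closed (C.pth q) le_rfl (C.isClosed_thk hh α ω)
    (m := 36) (fun n τ hτ => hq n τ hτ) he⟩

end Cfg
end WN

end

section

namespace WN

/-- Loop erasure of a finite sequence. -/
lemma exists_loop_erasure {X : Type} (z : ℕ → X) (m : ℕ) :
    ∃ (L : ℕ) (x : ℕ → X), 1 ≤ L ∧ L ≤ m + 1 ∧ (∀ i j, i < L → j < L → x i = x j → i = j) ∧
      x 0 = z 0 ∧ x (L - 1) = z m ∧ (∀ i < L, ∃ t ≤ m, x i = z t) ∧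
      ∀ i, i + 1 < L → ∃ t < m, x i = z t ∧ x (i + 1) = z (t + 1) := by
  classical
  induction m using Nat.strong_induction_on generalizing z with
  | _ m ih =>
  set s := Nat.findGreatest (fun s => z s = z 0) m with hs
  have hs0 : z s = z 0 := Nat.findGreatest_spec (P := fun s => z s = z 0) (Nat.zero_le m) rfl
  have hsm : s ≤ m := Nat.findGreatest_le m
  have hlast : ∀ t, s < t → t ≤ m → z t ≠ z 0 := fun t h1 h2 =>
    Nat.findGreatest_is_greatest h1 h2
  rcases hsm.eq_or_lt with h | h
  · refine ⟨1, fun _ => z 0, le_rfl, by omega, fun i j _ _ _ => by omega, rfl, ?_, fun i _ =>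
      ⟨0, Nat.zero_le _, rfl⟩, fun i hi => by omega⟩
    rw [← h, hs0]
  · obtain ⟨L, x, h1, h2, h3, h4, h5, h6, h7⟩ := ih (m - (s + 1)) (by omega) fun t => z (s + 1 + t)
    have hne : ∀ i < L, x i ≠ z 0 := fun i hi => by
      obtain ⟨t, ht, e⟩ := h6 i hi
      rw [e]
      exact hlast _ (by omega) (by omega)
    refine ⟨L + 1, fun i => if i = 0 then z 0 else x (i - 1), by omega, by omega, fun i j hi hj hij => ?_,
      if_pos rfl, ?_, fun i hi => ?_, fun i hi => ?_⟩
    · rcases i with _ | i <;> rcases j with _ | j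
      · rfl
      · exact absurd hij.symm (hne j (by omega))
      · exact absurd hij (hne i (by omega))
      · rw [h3 i j (by omega) (by omega) hij]
    · change (if L = 0 then z 0 else x (L - 1)) = z m
      rw [if_neg (by omega), h5]
      congr 1
      omega
    · rcases i with _ | i
      · exact ⟨0, Nat.zero_le _, rfl⟩
      · obtain ⟨t, ht, e⟩ := h6 i (by omega)
        exact ⟨s + 1 + t, by omega, e⟩
    · rcases i with _ | i
      · exact ⟨s, h, hs0.symm, h4⟩
      · obtain ⟨t, ht, e, e'⟩ := h7 i (by omega)
        exact ⟨s + 1 + t, by omega, e, e'⟩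

end WN

end

section

open Finset

namespace WN

lemma walk_abs_le {n : ℕ} (b : Fin n → Fin 4 → Bool) (t : ℕ) (c : Fin 4) : |walk b t c| ≤ t := by
  induction t with
  | zero => simp [walk_zero]
  | succ t ih =>
    have := abs_walk_succ_sub_le b t c
    rw [abs_le] at *
    push_cast
    constructor <;> linarith

lemma abs_bridge_le {N : ℕ} (b : Fin N → Fin 4 → Bool) {I : ℕ} (hI : I ≤ N) (c : Fin 4) :
    2 * |Cfg.bridge b I c| ≤ N := by
  have := walk_abs_le b (min I (N - I)) c
  unfold Cfg.bridge
  omega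

namespace Pth
variable {A : Prm} (p : Pth A)

lemma vtx_zero_mul (t : ℕ) (c : A.Crd) : p.vtx 0 (A.L * A.y * t) c = (A.L * A.y : ℕ) * p.coarse t c := by
  have h : 0 < A.L * A.y := Nat.mul_pos A.L_pos A.hy
  simp only [vtx, interp, Nat.mul_div_cancel_left t h, Nat.mul_mod_right]
  simp

lemma sum_crd {M : Type} [AddCommMonoid M] (f : A.Crd → M) :
    ∑ c, f c = f (.inl 0) + f (.inl 1) + (∑ c, f (.inr (.inl c)) + ∑ x, f (.inr (.inr x))) := by
  rw [Fintype.sum_sum_type, Fintype.sum_sum_type, Fin.sum_univ_two]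

lemma T_zero (N : ℕ) : A.T N 0 = A.L * A.y * (8 * N) := by unfold Prm.T; ring

lemma sum_abs_coarse_start (h : ∀ c, p.S 0 c = 0) :
    ∑ c, |p.vtx 0 0 c| = (A.L * A.y : ℕ) * (p.v : ℤ) := by
  have h1 := p.vtx_zero_mul 0
  rw [mul_zero] at h1
  simp_rw [h1]
  rw [sum_crd]
  simp [coarse, h, abs_mul]

lemma sum_abs_coarse_end {N : ℕ} (h : ∀ c, p.S N c = 0) :
    ∑ c, |p.vtx 0 (A.T N 0) c - if c = .inl 0 then ((A.L * A.y : ℕ) * (4 * N) : ℤ) else 0| =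
      (A.L * A.y : ℕ) * (p.v : ℤ) := by
  rw [T_zero]
  simp_rw [vtx_zero_mul]
  rw [sum_crd]
  simp [coarse, h, abs_mul]

lemma sum_abs_vtx_zero_le {N e : ℕ} (he : e ≤ A.T N 0) (hS : ∀ I ≤ N, ∀ c, 2 * |p.S I c| ≤ N) :
    ∑ c, |p.vtx 0 e c| ≤ (A.L * A.y : ℕ) * (6 * N + p.v : ℤ) := by
  have hK : (0 : ℤ) < (A.L * A.y : ℕ) := by exact_mod_cast Nat.mul_pos A.L_pos A.hy
  set K : ℤ := ((A.L * A.y : ℕ) : ℤ) with hKd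
  obtain ⟨b, hb⟩ : ∃ b : ℤ, b = ((N / 2 : ℕ) : ℤ) := ⟨_, rfl⟩
  have hS' : ∀ I ≤ N, ∀ c, -b ≤ p.S I c ∧ p.S I c ≤ b := fun I hI c => by
    have := hS I hI c
    rw [← abs_le]
    omega
  have hb4 : 4 * b ≤ 2 * N := by omega
  have h0 : |p.vtx 0 e (.inl 0)| ≤ K * (4 * N) ∧ |p.vtx 0 e (.inl 1)| ≤ K * p.v ∧
      ∀ c, |p.vtx 0 e (.inr (.inl c))| ≤ K * b := by
    rcases he.eq_or_lt with rfl | hlt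
    · rw [T_zero]
      simp_rw [vtx_zero_mul, abs_mul, ← hKd, abs_of_pos hK]
      refine ⟨?_, ?_, fun c => ?_⟩ <;> refine mul_le_mul_of_nonneg_left ?_ hK.le
      · simp [coarse]
      · simp [coarse]
      · simpa [coarse, abs_le] using hS' N le_rfl c
    · obtain ⟨I, hI⟩ : ∃ I, A.uu 0 (A.pe^[0] e) = I := ⟨_, rfl⟩
      have hIN : I < N := hI ▸ A.uu_lt_nu (g := 0) (N := N) hlt
      have h1 := p.vtx_inl_zero 0 e hI
      have h2 := p.vtx_inl_one 0 e
      have h3 := fun c => p.vtx_inr_inl 0 e hI c (hS' I hIN.le c) (hS' (I + 1) hIN c)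
      rw [pow_zero, one_mul, ← hKd] at h1 h2
      simp_rw [pow_zero, one_mul, ← hKd] at h3
      have hIN' : (I : ℤ) + 1 ≤ N := by exact_mod_cast hIN
      refine ⟨?_, ?_, fun c => ?_⟩
      · rw [abs_of_nonneg (le_trans (by positivity) h1.1)]
        exact h1.2.trans (mul_le_mul_of_nonneg_left (by linarith) hK.le)
      · rw [h2, abs_of_nonneg (by positivity)]
      · rw [abs_le, ← mul_neg]
        exact h3 c
  have h5 : ∀ x, p.vtx 0 e (.inr (.inr x)) = 0 := fun x => by simp [vtx, interp, coarse]
  have h6 : ∑ c, |p.vtx 0 e (.inr (.inl c))| ≤ 4 * (K * b) := by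
    refine (sum_le_sum fun c _ => h0.2.2 c).trans_eq ?_
    simp
  have h7 : 4 * (K * b) ≤ K * (2 * N) := by
    calc _ = K * (4 * b) := by ring
      _ ≤ _ := mul_le_mul_of_nonneg_left hb4 hK.le
  rw [sum_crd]
  simp_rw [h5, abs_zero, sum_const_zero]
  linarith [h0.1, h0.2.1]

end Pth

namespace Geo
variable {A : Prm} {d : ℕ} (E : Geo A d)

lemma sum_abs_emb (f : A.Crd → ℝ) : ∑ j, |E.emb f j| = ∑ c, |f c| := E.sum_emb _ abs_zero f

lemma sum_abs_emb_sub (f f' : A.Crd → ℝ) : ∑ j, |E.emb f j - E.emb f' j| = ∑ c, |f c - f' c| := by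
  rw [← E.sum_abs_emb, ← E.emb_sub]
  rfl

lemma sum_abs_pos_sub_le (p : Pth A) (g e : ℕ) :
    ∑ j, |E.pos p g e j - E.pos p 0 (A.pe^[g] e) j| ≤ 8 * A.R ^ 3 * (E.s - E.sH g) := by
  have hR : (64 : ℝ) ≤ A.R := by exact_mod_cast A.hR
  induction g generalizing e with
  | zero => simp [sH]
  | succ g ih =>
    have h1 : ∑ j, |E.pos p (g + 1) e j - E.pos p g (A.pe e) j| ≤ E.sH (g + 1) * (4 * A.R ^ 4) := by
      unfold pos
      rw [sum_abs_emb_sub]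
      have h2 : ((∑ c, |p.vtx (g + 1) e c - A.R * p.vtx g (A.pe e) c| : ℤ) : ℝ) ≤ 4 * A.R ^ 4 := by
        exact_mod_cast p.sum_abs_vtx_succ_sub_le g e
      refine le_trans (le_of_eq ?_) (mul_le_mul_of_nonneg_left h2 (E.sH_pos (g + 1)).le)
      push_cast
      rw [mul_sum]
      refine sum_congr rfl fun c _ => ?_
      rw [E.sH_succ g, mul_comm (A.R : ℝ), mul_assoc, ← mul_sub, abs_mul, abs_of_pos (E.sH_pos _)]
    have h3 := ih (A.pe e)
    rw [Function.iterate_succ_apply]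
    calc _ ≤ ∑ j, (|E.pos p (g + 1) e j - E.pos p g (A.pe e) j| +
          |E.pos p g (A.pe e) j - E.pos p 0 (A.pe^[g] (A.pe e)) j|) :=
          sum_le_sum fun j _ => abs_sub_le _ _ _
      _ ≤ E.sH (g + 1) * (4 * A.R ^ 4) + 8 * A.R ^ 3 * (E.s - E.sH g) := by
          rw [sum_add_distrib]; exact add_le_add h1 h3
      _ ≤ _ := by
          rw [E.sH_succ g]
          have := E.sH_pos (g + 1)
          have h4 : 0 ≤ E.sH (g + 1) * (A.R ^ 3 * (A.R - 2) : ℝ) := by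
            have : (0 : ℝ) ≤ A.R - 2 := by linarith
            positivity
          nlinarith

lemma sum_abs_pos_zero (p : Pth A) (e : ℕ) :
    ∑ j, |E.pos p 0 e j| = E.s * ((∑ c, |p.vtx 0 e c| : ℤ) : ℝ) := by
  unfold pos
  rw [sum_abs_emb]
  push_cast
  rw [mul_sum]
  refine sum_congr rfl fun c _ => ?_
  rw [abs_mul, abs_of_pos (E.sH_pos 0)]
  simp [sH]

lemma sum_abs_le_add {ι : Type} [Fintype ι] (a b : ι → ℝ) : ∑ j, |a j| ≤ ∑ j, |a j - b j| + ∑ j, |b j| := by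
  rw [← sum_add_distrib]
  exact sum_le_sum fun j _ => by linarith [abs_sub_abs_le_abs_sub (a j) (b j)]

lemma cast_L (A : Prm) : (A.L : ℝ) = 2 * (A.R : ℝ) ^ 3 := by simp [Prm.L]

/-- Size of one macroscopic step. -/
noncomputable def sc₀ : ℝ := A.L * A.y * E.s

lemma sum_abs_pos_le (p : Pth A) {N g e : ℕ} (he : e ≤ A.T N g)
    (hS : ∀ I ≤ N, ∀ c, 2 * |p.S I c| ≤ N) :
    ∑ j, |E.pos p g e j| ≤ E.sc₀ * (6 * N + p.v) + 8 * A.R ^ 3 * E.s := by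
  have he0 : A.pe^[g] e ≤ A.T N 0 := by
    rcases he.eq_or_lt with rfl | hlt
    · have := A.pe_iterate_T N 0 g
      rw [zero_add] at this
      exact this.le
    · exact (A.pe_iterate_lt_T (g := 0) (by rwa [zero_add])).le
  have h1 := E.sum_abs_pos_sub_le p g e
  have h2 := p.sum_abs_vtx_zero_le he0 hS
  have h3 : ((∑ c, |p.vtx 0 (A.pe^[g] e) c| : ℤ) : ℝ) ≤ A.L * A.y * (6 * N + p.v) := by
    exact_mod_cast h2
  have h4 := mul_le_mul_of_nonneg_left h3 E.hs.le
  rw [← E.sum_abs_pos_zero] at h4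
  have h5 := E.sH_pos g
  have h6 := sum_abs_le_add (fun j => E.pos p g e j) (fun j => E.pos p 0 (A.pe^[g] e) j)
  have h7 : 0 ≤ 8 * (A.R : ℝ) ^ 3 * E.sH g := by positivity
  unfold sc₀
  nlinarith

lemma sum_abs_pos_start_le (p : Pth A) (g : ℕ) (hS : ∀ c, p.S 0 c = 0) :
    ∑ j, |E.pos p g 0 j| ≤ E.sc₀ * p.v + 8 * A.R ^ 3 * E.s := by
  have he0 : A.pe^[g] 0 = 0 := Function.iterate_fixed A.pe_zero g
  have h1 := E.sum_abs_pos_sub_le p g 0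
  rw [he0] at h1
  have h2 := p.sum_abs_coarse_start hS
  have h4 := E.sum_abs_pos_zero p 0
  rw [h2] at h4
  push_cast at h4
  have h5 := E.sH_pos g
  have h6 := sum_abs_le_add (fun j => E.pos p g 0 j) (fun j => E.pos p 0 0 j)
  have h7 : 0 ≤ 8 * (A.R : ℝ) ^ 3 * E.sH g := by positivity
  unfold sc₀
  rw [cast_L]
  nlinarith

lemma sum_abs_pos_end_le (p : Pth A) {N : ℕ} (g : ℕ) (hS : ∀ c, p.S N c = 0) (w : ℝ) :
    ∑ j, |E.pos p g (A.T N g) j - E.emb (fun c => if c = .inl 0 then w else 0) j| ≤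
      E.sc₀ * p.v + 8 * A.R ^ 3 * E.s + |E.sc₀ * (4 * N) - w| := by
  have he0 : A.pe^[g] (A.T N g) = A.T N 0 := by
    have := A.pe_iterate_T N 0 g
    rwa [zero_add] at this
  have h1 := E.sum_abs_pos_sub_le p g (A.T N g)
  rw [he0] at h1
  have h2 : ∑ j, |E.pos p 0 (A.T N 0) j -
      E.emb (fun c => if c = .inl 0 then E.sc₀ * (4 * N) else 0) j| = E.sc₀ * p.v := by
    unfold pos
    rw [sum_abs_emb_sub]
    have h3 := congrArg (fun z : ℤ => E.s * (z : ℝ)) (p.sum_abs_coarse_end hS)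
    beta_reduce at h3
    push_cast at h3
    rw [mul_sum] at h3
    unfold sc₀
    rw [cast_L]
    calc _ = _ := sum_congr rfl fun c _ => by
          rw [← abs_of_pos E.hs, ← abs_mul, abs_of_pos E.hs, show E.sH 0 = E.s by simp [sH], mul_sub]
          split_ifs
          · congr 2; ring
          · simp
      _ = _ := h3
      _ = _ := by ring
  have h3 : ∑ j, |E.emb (fun c => if c = .inl 0 then E.sc₀ * (4 * N) else 0) j -
      E.emb (fun c => if c = .inl 0 then w else 0) j| = |E.sc₀ * (4 * N) - w| := by
    rw [sum_abs_emb_sub, Finset.sum_eq_single (.inl 0)]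
    · simp
    · intro c _ hc; simp [hc]
    · simp
  have h5 := E.sH_pos g
  have h7 : 0 ≤ 8 * (A.R : ℝ) ^ 3 * E.sH g := by positivity
  have h6 : ∑ j, |E.pos p g (A.T N g) j - E.emb (fun c => if c = .inl 0 then w else 0) j| ≤
      ∑ j, (|E.pos p g (A.T N g) j - E.pos p 0 (A.T N 0) j| + (|E.pos p 0 (A.T N 0) j -
      E.emb (fun c => if c = .inl 0 then E.sc₀ * (4 * N) else 0) j| +
      |E.emb (fun c => if c = .inl 0 then E.sc₀ * (4 * N) else 0) j -
      E.emb (fun c => if c = .inl 0 then w else 0) j|)) := sum_le_sum fun j _ =>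
    (abs_sub_le _ _ _).trans (add_le_add_right (abs_sub_le _ _ _) _)
  rw [sum_add_distrib, sum_add_distrib, h2, h3] at h6
  linarith

end Geo
end WN

end

section

open Finset

namespace WN

lemma Near1.sum_abs_eq {ι : Type} [Fintype ι] {a b : ι → ℤ} (h : Near1 a b) (hne : a ≠ b) :
    ∑ c, |b c - a c| = 1 := by
  refine le_antisymm h.sum_abs_le ?_
  obtain ⟨c, hc⟩ := Function.ne_iff.1 hne
  have h1 : 1 ≤ |b c - a c| := Int.one_le_abs (sub_ne_zero.2 (Ne.symm hc))
  exact h1.trans (single_le_sum (f := fun c => |b c - a c|) (fun _ _ => abs_nonneg _) (mem_univ c))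

namespace Geo
variable {A : Prm} {d : ℕ} (E : Geo A d) (p : Pth A)

/-- The path of level `g`, with every edge cut into `K` pieces. -/
noncomputable def fine (g K t : ℕ) : EuclideanSpace ℝ (Fin d) :=
  E.emb fun c => E.sH g / K * interp K (p.vtx g) t c

lemma fine_mul {g K : ℕ} (hK : 0 < K) (e : ℕ) : E.fine p g K (K * e) = E.pos p g e := by
  have hK' : (K : ℝ) ≠ 0 := by exact_mod_cast hK.ne'
  unfold fine pos
  congr 1
  funext c
  simp only [interp, Nat.mul_div_cancel_left e hK, Nat.mul_mod_right]
  push_cast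
  field_simp
  ring

lemma fine_mem {g K : ℕ} (hK : 0 < K) (t : ℕ) :
    E.fine p g K t ∈ segment ℝ (E.pos p g (t / K)) (E.pos p g (t / K + 1)) := by
  have hK' : (0 : ℝ) < K := by exact_mod_cast hK
  rw [segment_eq_image']
  refine ⟨((t % K : ℕ) : ℝ) / K, ⟨by positivity, ?_⟩, ?_⟩
  · rw [div_le_one hK']; exact_mod_cast (Nat.mod_lt t hK).le
  · beta_reduce
    unfold fine pos
    rw [E.emb_add_smul]
    congr 1
    funext c
    simp only [interp, Int.cast_add, Int.cast_mul, Int.cast_sub, Int.cast_natCast]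
    field_simp

lemma fine_succ_mem {g K : ℕ} (hK : 0 < K) (t : ℕ) :
    E.fine p g K (t + 1) ∈ segment ℝ (E.pos p g (t / K)) (E.pos p g (t / K + 1)) := by
  have hK' : (0 : ℝ) < K := by exact_mod_cast hK
  rw [segment_eq_image']
  refine ⟨((t % K : ℕ) + 1 : ℝ) / K, ⟨by positivity, ?_⟩, ?_⟩
  · rw [div_le_one hK']; exact_mod_cast Nat.mod_lt t hK
  · beta_reduce
    unfold fine pos
    rw [E.emb_add_smul]
    congr 1
    funext c
    have h := interp_succ hK (p.vtx g) t c
    have h' : interp K (p.vtx g) (t + 1) c =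
      interp K (p.vtx g) t c + (p.vtx g (t / K + 1) c - p.vtx g (t / K) c) := by linarith
    rw [h']
    simp only [interp, Int.cast_add, Int.cast_mul, Int.cast_sub, Int.cast_natCast]
    field_simp
    ring

lemma sum_abs_fine_sub {g K t : ℕ} (hK : 0 < K) (hne : E.fine p g K t ≠ E.fine p g K (t + 1)) :
    ∑ j, |E.fine p g K (t + 1) j - E.fine p g K t j| = E.sH g / K := by
  have hK' : (0 : ℝ) < K := by exact_mod_cast hK
  have h1 := (near1_interp hK (p.near1_vtx g (t / K))).sum_abs_eq fun h => hne (by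
    unfold fine; rw [h])
  unfold fine
  rw [sum_abs_emb_sub]
  simp_rw [← mul_sub, abs_mul, abs_of_pos (div_pos (E.sH_pos g) hK')]
  rw [← mul_sum]
  have h2 : ((∑ c, |interp K (p.vtx g) (t + 1) c - interp K (p.vtx g) t c| : ℤ) : ℝ) = 1 := by
    exact_mod_cast h1
  push_cast at h2
  rw [h2, mul_one]

lemma fine_lattice (g K t : ℕ) (j : Fin d) : ∃ m : ℤ, E.fine p g K t j = E.sH g / K * m := by
  by_cases hj : ∃ c, E.e c = j
  · obtain ⟨c, rfl⟩ := hj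
    refine ⟨interp K (p.vtx g) t c, ?_⟩
    simp only [fine, emb]
    rw [E.e.injective.extend_apply]
  · refine ⟨0, ?_⟩
    simp only [fine, emb]
    rw [Function.extend_apply' _ _ _ hj]
    simp

lemma convex_sum_abs_le (d : ℕ) (b : ℝ) :
    Convex ℝ {x : EuclideanSpace ℝ (Fin d) | ∑ j, |x j| ≤ b} := by
  intro x hx y hy u v hu hv huv
  simp only [Set.mem_ofPred_eq] at *
  calc _ ≤ ∑ j, (u * |x j| + v * |y j|) := by
        refine sum_le_sum fun j _ => ?_
        simp only [PiLp.add_apply, PiLp.smul_apply, smul_eq_mul]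
        refine (abs_add_le _ _).trans_eq ?_
        rw [abs_mul, abs_mul, abs_of_nonneg hu, abs_of_nonneg hv]
    _ = u * ∑ j, |x j| + v * ∑ j, |y j| := by rw [sum_add_distrib, mul_sum, mul_sum]
    _ ≤ u * b + v * b := by gcongr
    _ = b := by rw [← add_mul, huv, one_mul]

/-- The polyline contains a self-avoiding lattice path with the same end points. -/
lemma exists_lattice_path {g K T : ℕ} (hK : 0 < K) {δ b : ℝ} (hδ : E.sH g / K = δ)
    (hb : ∀ e ≤ T, ∑ j, |E.pos p g e j| ≤ b)
    {S : Set (EuclideanSpace ℝ (Fin d))}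
    (hS : ∀ e < T, segment ℝ (E.pos p g e) (E.pos p g (e + 1)) ⊆ S) :
    ∃ (L : ℕ) (x : ℕ → EuclideanSpace ℝ (Fin d)), 1 ≤ L ∧ L ≤ K * T + 1 ∧
      (∀ i j, i < L → j < L → x i = x j → i = j) ∧
      (∀ i, i < L → ∀ j : Fin d, ∃ m : ℤ, x i j = δ * m) ∧
      (∀ i, i + 1 < L → ∑ j, |x (i + 1) j - x i j| = δ) ∧
      x 0 = E.pos p g 0 ∧ x (L - 1) = E.pos p g T ∧
      (∀ i, i < L → ∑ j, |x i j| ≤ b) ∧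
      ∀ i, i + 1 < L → segment ℝ (x i) (x (i + 1)) ⊆ S := by
  subst hδ
  obtain ⟨L, x, h1, h2, h3, h4, h5, h6, h7⟩ := exists_loop_erasure (E.fine p g K) (K * T)
  have hdiv : ∀ t, t < K * T → t / K < T := fun t ht => Nat.div_lt_of_lt_mul ht
  refine ⟨L, x, h1, h2, h3, fun i hi j => ?_, fun i hi => ?_, ?_, ?_, fun i hi => ?_, fun i hi => ?_⟩
  · obtain ⟨t, -, ht⟩ := h6 i hi
    rw [ht]; exact E.fine_lattice p g K t j
  · obtain ⟨t, -, ht, ht'⟩ := h7 i hi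
    rw [ht, ht']
    refine E.sum_abs_fine_sub p hK fun he => ?_
    rw [← ht, ← ht'] at he
    have := h3 i (i + 1) (by omega) hi he
    omega
  · rw [h4, ← E.fine_mul p hK 0, mul_zero]
  · rw [h5, E.fine_mul p hK]
  · obtain ⟨t, ht, hxt⟩ := h6 i hi
    rw [hxt]
    rcases ht.eq_or_lt with rfl | hlt
    · rw [E.fine_mul p hK]; exact hb T le_rfl
    · have := hdiv t hlt
      exact (convex_sum_abs_le d b).segment_subset (hb _ (by omega)) (hb _ (by omega))
        (E.fine_mem p hK t)
  · obtain ⟨t, hlt, ht, ht'⟩ := h7 i hi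
    rw [ht, ht']
    exact ((convex_segment _ _).segment_subset (E.fine_mem p hK t) (E.fine_succ_mem p hK t)).trans
      (hS _ (hdiv t hlt))

end Geo
end WN

end

section

open Finset

namespace WN

set_option exponentiation.threshold 300

lemma exists_crd_embedding {A : Prm} {d : ℕ} (h : 6 + A.Q * A.m * A.D ≤ d) :
    ∃ e : A.Crd ↪ Fin d, ((e (.inl 0) : Fin d) : ℕ) = 0 := by
  have hd : 0 < d := by omega
  obtain ⟨e⟩ : Nonempty (A.Crd ↪ Fin d) := by
    apply Function.Embedding.nonempty_of_card_le
    simp only [Prm.Crd, Fintype.card_sum, Fintype.card_prod, Fintype.card_fin]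
    rw [mul_assoc] at h
    omega
  refine ⟨e.trans (Equiv.swap (e (.inl 0)) ⟨0, hd⟩).toEmbedding, ?_⟩
  simp

/-- The choice of the number of macroscopic units in a macroscopic step. -/
lemma exists_unit_count {R r t c : ℝ} (hR : 4 ≤ R) (hr1 : R ^ 32 ≤ r) (hr2 : r ≤ 2 ^ 32 * R ^ 32)
    (hc : 0 < c) (ht0 : 0 < t) (ht1 : c ≤ 2 ^ 12 * t) (ht2 : t ≤ R * c) : ∃ y : ℕ, 1 ≤ y ∧
      y ≤ 2 ^ 45 * R ^ 29 ∧ 2 * c ≤ 2 * R ^ 3 * (t / r) * y ∧ 2 * R ^ 3 * (t / r) * y ≤ 5 / 2 * c := by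
  have hR0 : 0 < R := by linarith
  have hr0 : 0 < r := (pow_pos hR0 32).trans_le hr1
  obtain ⟨s, hs⟩ : ∃ s : ℝ, s = t / r := ⟨_, rfl⟩
  have hs0 : 0 < s := hs ▸ div_pos ht0 hr0
  obtain ⟨u, hu⟩ : ∃ u : ℝ, u = 2 * R ^ 3 * s := ⟨_, rfl⟩
  have hu0 : 0 < u := by rw [hu]; positivity
  have hsR : s * R ^ 32 ≤ t := by
    rw [hs, div_mul_eq_mul_div, div_le_iff₀ hr0]
    gcongr
  have hu1 : u ≤ 1 / 2 * c := by
    have h1 : 4 * (R : ℝ) ^ 4 ≤ R ^ 32 := by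
      have : (4 : ℝ) ≤ R ^ 28 := by
        calc (4 : ℝ) ≤ R ^ 1 := by linarith
          _ ≤ R ^ 28 := pow_le_pow_right₀ (by linarith) (by norm_num)
      calc 4 * (R : ℝ) ^ 4 ≤ R ^ 28 * R ^ 4 := by gcongr
        _ = _ := by ring
    have h2 : R * u * 2 ≤ R * c := by
      calc R * u * 2 = s * (4 * R ^ 4) := by rw [hu]; ring
        _ ≤ s * R ^ 32 := by gcongr
        _ ≤ _ := hsR.trans ht2
    have h3 : u * 2 ≤ c := by
      rw [mul_assoc] at h2
      exact le_of_mul_le_mul_left h2 hR0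
    linarith
  obtain ⟨y, hy⟩ : ∃ y : ℕ, y = ⌈2 * c / u⌉₊ := ⟨_, rfl⟩
  have hy1 : 1 ≤ y := hy ▸ Nat.ceil_pos.2 (by positivity)
  have hyl : 2 * c ≤ u * y := by
    have := Nat.le_ceil (2 * c / u)
    rwa [div_le_iff₀ hu0, ← hy, mul_comm _ u] at this
  have hyu : u * y ≤ 5 / 2 * c := by
    have := Nat.ceil_lt_add_one (show 0 ≤ 2 * c / u by positivity)
    rw [← hy] at this
    have h1 : u * y ≤ u * (2 * c / u + 1) := by gcongr
    have h2 : u * (2 * c / u + 1) = 2 * c + u := by field_simp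
    linarith
  have hyb : (y : ℝ) ≤ 2 ^ 45 * R ^ 29 := by
    have h1 : u * y ≤ 5 / 2 * (2 ^ 12 * t) := hyu.trans (by linarith)
    have h2 : t ≤ s * (2 ^ 32 * R ^ 32) := by
      rw [hs, div_mul_eq_mul_div, le_div_iff₀ hr0]
      gcongr
    have h3 : (R ^ 3 * s) * (2 * y) ≤ (R ^ 3 * s) * (5 / 2 * 2 ^ 44 * R ^ 29) := by
      calc _ = u * y := by rw [hu]; ring
        _ ≤ 5 / 2 * (2 ^ 12 * t) := h1
        _ ≤ 5 / 2 * (2 ^ 12 * (s * (2 ^ 32 * R ^ 32))) := by gcongr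
        _ = _ := by ring
    have h4 := le_of_mul_le_mul_left h3 (by positivity)
    have : (0 : ℝ) ≤ R ^ 29 := by positivity
    linarith
  rw [← hs, ← hu]
  exact ⟨y, hy1, hyb, hyl, hyu⟩

lemma exists_nat_mul_le {c : ℝ} (hc : 0 < c) (M : ℕ) :
    ∃ N : ℕ, 4 * N * c ≤ 2 * M ∧ 2 * M < 4 * (N + 1) * c := by
  refine ⟨⌊2 * M / (4 * c)⌋₊, ?_, ?_⟩
  · have := Nat.floor_le (show (0 : ℝ) ≤ 2 * M / (4 * c) by positivity)
    rw [le_div_iff₀ (by positivity)] at this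
    linarith
  · have := Nat.lt_floor_add_one (2 * M / (4 * c))
    rw [div_lt_iff₀ (by positivity)] at this
    linarith

/-- Admissible parameters exist in every high enough dimension. -/
lemma exists_cfg {J d n k M : ℕ} (hJ : 200 ≤ J) (hd1 : 2 ^ (64 * J) ≤ d) (hd2 : d < 2 ^ (64 * J + 64))
    (hk : 1 ≤ k) (hn : 6 * k ≤ n) : ∃ (A : Prm) (C : Cfg A d), C.J = J ∧ C.n = n ∧ C.k = k ∧
      ((C.E.e (.inl 0) : Fin d) : ℕ) = 0 ∧ 4 * C.N * C.E.sc₀ ≤ 2 * M ∧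
      2 * M < 4 * (C.N + 1) * C.E.sc₀ := by
  obtain ⟨R, hR⟩ : ∃ R : ℕ, R = 2 ^ J := ⟨_, rfl⟩
  have hRbig : 2 ^ 200 ≤ R := hR ▸ Nat.pow_le_pow_right (by norm_num) hJ
  have hRpos : 0 < R := by rw [hR]; positivity
  have hd1' : R ^ 64 ≤ d := by rw [hR, ← pow_mul, mul_comm]; exact hd1
  obtain ⟨r, hr⟩ : ∃ r : ℕ, r = Nat.sqrt d := ⟨_, rfl⟩
  have hr1 : R ^ 32 ≤ r := by
    rw [hr, Nat.le_sqrt, ← pow_add]; exact hd1'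
  obtain ⟨G, hG1, hG2⟩ : ∃ G, n - 3 * k ≤ J * G ∧ J * G < n - 3 * k + J := by
    refine ⟨(n - 3 * k + J - 1) / J, ?_, ?_⟩
    · have h1 := Nat.div_add_mod (n - 3 * k + J - 1) J
      have h2 := Nat.mod_lt (n - 3 * k + J - 1) (show 0 < J by omega)
      omega
    · have h1 := Nat.mul_div_le (n - 3 * k + J - 1) J
      omega
  have hRR : (4 : ℝ) ≤ R := by exact_mod_cast le_trans (by norm_num) hRbig
  have hR0 : (0 : ℝ) < R := by exact_mod_cast hRpos
  obtain ⟨W, hW⟩ : ∃ W : ℝ, W = R ^ 32 := ⟨_, rfl⟩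
  have hr1R : W ≤ r := hW ▸ by exact_mod_cast hr1
  have hr2R : (r : ℝ) ≤ 2 ^ 32 * W := by
    have hd2' : d < 2 ^ 64 * R ^ 64 := by rw [hR, ← pow_mul, mul_comm J, ← pow_add, add_comm]; exact hd2
    have hr2 : r ≤ 2 ^ 32 * R ^ 32 := by
      have : r < 2 ^ 32 * R ^ 32 + 1 := by
        rw [hr, Nat.sqrt_lt]
        calc d < 2 ^ 64 * R ^ 64 := hd2'
          _ = (2 ^ 32 * R ^ 32) * (2 ^ 32 * R ^ 32) := by ring
          _ ≤ _ := by gcongr <;> omega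
      omega
    rw [hW]
    exact_mod_cast hr2
  have hr0 : (0 : ℝ) < r := lt_of_lt_of_le (hW ▸ pow_pos hR0 32) hr1R
  obtain ⟨t, ht⟩ : ∃ t : ℝ, t = R ^ G * sc (n + 12) := ⟨_, rfl⟩
  have hpow : (R : ℝ) ^ G = 2 ^ (J * G) := by rw [hR]; push_cast; rw [← pow_mul]
  have hsc : ∀ i : ℕ, sc i = ((2 : ℝ) ^ i)⁻¹ := fun i => by unfold sc; rw [zpow_neg, zpow_natCast]
  have hsc0 : 0 < sc (3 * k) := by rw [hsc]; positivity
  have ht1 : sc (3 * k) ≤ 2 ^ 12 * t := by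
    have h1 : (2 : ℝ) ^ (n - 3 * k) ≤ 2 ^ (J * G) := pow_le_pow_right₀ (by norm_num) hG1
    have h2 : (2 : ℝ) ^ (n - 3 * k) * sc n = sc (3 * k) := by
      rw [hsc, hsc]
      obtain ⟨a, rfl⟩ : ∃ a, n = 3 * k + a := ⟨n - 3 * k, by omega⟩
      rw [Nat.add_sub_cancel_left, pow_add]; field_simp
    have h3 : 2 ^ 12 * sc (n + 12) = sc n := by rw [hsc, hsc, pow_add]; field_simp
    have h4 : 0 < sc n := by rw [hsc]; positivity
    rw [ht, hpow, ← h2, mul_left_comm, h3]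
    gcongr
  have ht2 : t ≤ R * sc (3 * k) := by
    have h1 : (2 : ℝ) ^ (J * G) ≤ 2 ^ (n - 3 * k + J) := pow_le_pow_right₀ (by norm_num) hG2.le
    have h2 : (2 : ℝ) ^ (n - 3 * k) * sc n = sc (3 * k) := by
      rw [hsc, hsc]
      obtain ⟨a, rfl⟩ : ∃ a, n = 3 * k + a := ⟨n - 3 * k, by omega⟩
      rw [Nat.add_sub_cancel_left, pow_add]; field_simp
    have h3 : sc (n + 12) ≤ sc n := by
      rw [hsc, hsc]
      apply inv_anti₀ (by positivity)
      exact pow_le_pow_right₀ (by norm_num) (by omega)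
    have h4 : 0 < sc (n + 12) := by rw [hsc]; positivity
    have h5 : (R : ℝ) = 2 ^ J := by rw [hR]; push_cast; rfl
    calc t ≤ 2 ^ (n - 3 * k + J) * sc n := by rw [ht, hpow]; gcongr
      _ = R * (2 ^ (n - 3 * k) * sc n) := by rw [pow_add, h5]; ring
      _ = _ := by rw [h2]
  have ht0 : 0 < t := by
    have : 0 < 2 ^ 12 * t := hsc0.trans_le ht1
    linarith
  obtain ⟨y, hy1, hyb, hyl, hyu⟩ := exists_unit_count hRR (hW ▸ hr1R) (hW ▸ hr2R) hsc0 ht0 ht1 ht2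
  obtain ⟨s, hs⟩ : ∃ s : ℝ, s = t / r := ⟨_, rfl⟩
  rw [← hs] at hyl hyu
  have hs0 : 0 < s := hs ▸ div_pos ht0 hr0
  obtain ⟨u, hu⟩ : ∃ u : ℝ, u = 2 * R ^ 3 * s := ⟨_, rfl⟩
  rw [← hu] at hyl hyu
  have hybN : y ≤ 2 ^ 45 * R ^ 29 := by exact_mod_cast hyb
  have hR29 : R ≤ R ^ 29 := Nat.le_self_pow (by norm_num) R
  have hR30 : 2 ^ 200 * R ^ 29 ≤ R ^ 30 := by rw [pow_succ' R 29]; gcongr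
  let A : Prm := ⟨R, y, R ^ 30, R ^ 29, G, le_trans (by norm_num) hRbig, hy1, by omega,
    Nat.one_le_pow _ _ hRpos⟩
  obtain ⟨e, he⟩ : ∃ e : A.Crd ↪ Fin d, ((e (.inl 0) : Fin d) : ℕ) = 0 := by
    apply exists_crd_embedding
    change 6 + R ^ 30 * R ^ 4 * R ^ 29 ≤ d
    have h1 : R ^ 30 * R ^ 4 * R ^ 29 = R ^ 63 := by ring
    have h2 : 2 ^ 200 * R ^ 63 ≤ R ^ 64 := by rw [pow_succ' R 63]; gcongr
    have h3 : 0 < R ^ 63 := Nat.pow_pos hRpos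
    omega
  have hsc₀ : (A.L * A.y * s : ℝ) = u * y := by
    rw [hu]
    change (((2 * R ^ 3 : ℕ) : ℝ) * y * s) = _
    push_cast; ring
  have hc0 : 0 < u * y := lt_of_lt_of_le (by linarith) hyl
  obtain ⟨N, hN1, hN2⟩ := exists_nat_mul_le hc0 M
  refine ⟨A, ⟨⟨s, hs0, e⟩, J, n, k, N, hJ, hR, hybN.trans ?_, rfl, ?_, hr ▸ hr1, ?_, hk, hn,
    hG1, hG2, ?_, ?_⟩, rfl, rfl, rfl, he, ?_, ?_⟩
  · change _ ≤ R ^ 30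
    omega
  · rw [← hr]; exact hs.trans (by rw [ht])
  · rw [← hr]
    change r ≤ 2 ^ 32 * R ^ 32
    rw [hW] at hr2R
    exact_mod_cast hr2R
  · exact hyl.trans_eq hsc₀.symm
  · exact hsc₀.trans_le hyu
  · change 4 * (N : ℝ) * (A.L * A.y * s) ≤ 2 * M
    rwa [hsc₀]
  · change 2 * (M : ℝ) < 4 * ((N : ℝ) + 1) * (A.L * A.y * s)
    rwa [hsc₀]

end WN

end

section

open Finset MeasureTheory ProbabilityTheory

namespace WN

lemma two_pow_mul_eight_pow_lt {G n : ℕ} (h : 3 * G ≤ n) (hn : 0 < n) : 8 ^ n * 2 ^ G < 11 ^ n := by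
  obtain ⟨m, rfl⟩ := Nat.exists_eq_add_of_le h
  have h1 : 8 ^ (3 * G + m) * 2 ^ G = 1024 ^ G * 8 ^ m := by
    rw [show (1024 : ℕ) = 8 ^ 3 * 2 by norm_num, mul_pow, ← pow_mul, pow_add]; ring
  have h2 : 11 ^ (3 * G + m) = 1331 ^ G * 11 ^ m := by
    rw [show (1331 : ℕ) = 11 ^ 3 by norm_num, ← pow_mul, pow_add]
  rw [h1, h2]
  rcases Nat.eq_zero_or_pos G with rfl | hG
  · simpa using Nat.pow_lt_pow_left (show 8 < 11 by norm_num) (show m ≠ 0 by omega)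
  · exact Nat.mul_lt_mul_of_lt_of_le (Nat.pow_lt_pow_left (by norm_num) hG.ne')
      (Nat.pow_le_pow_left (by norm_num) m) (by positivity)

namespace Cfg
variable {A : Prm} {d : ℕ} (C : Cfg A d)

lemma mul_s_le : 8 * A.R ^ 3 * C.E.s ≤ sc (3 * C.k) := by
  have hkn : 3 * C.k < C.n := by have := C.hk; have := C.hn; omega
  have hR := C.E.hs
  have h1 := C.sc_eq le_rfl hkn
  have hR2 : (64 : ℝ) ≤ A.R := by exact_mod_cast A.hR
  have hr : (A.R : ℝ) ^ 32 ≤ Nat.sqrt d := by exact_mod_cast C.hr1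
  have hlev : C.lev (3 * C.k) ≤ 1 := by
    unfold lev
    have h2 : A.G - 1 ≤ (C.n - 1 - 3 * C.k) / C.J := by
      rw [Nat.le_div_iff_mul_le C.J_pos, Nat.sub_mul, mul_comm]
      have := C.hG2
      omega
    omega
  have hsH : C.E.s ≤ A.R * C.E.sH (C.lev (3 * C.k)) := by
    have h3 : C.E.sH 0 = C.E.s := by simp [Geo.sH]
    have h4 := C.E.sH_succ 0
    have h5 := C.E.sH_pos 0
    rw [h3] at h4 h5
    interval_cases C.lev (3 * C.k)
    · rw [h3]; nlinarith
    · rw [← h4]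
  have h6 : (Nat.sqrt d : ℝ) * C.E.sH (C.lev (3 * C.k)) ≤ sc (3 * C.k) := by
    refine le_trans ?_ (sc_anti (Nat.le_succ _))
    rw [Nat.succ_eq_add_one, h1, mul_assoc]
    exact le_mul_of_one_le_left (by have := C.E.sH_pos (C.lev (3 * C.k)); positivity)
      (one_le_pow₀ (by norm_num))
  calc _ ≤ 8 * (A.R : ℝ) ^ 3 * (A.R * C.E.sH (C.lev (3 * C.k))) := by gcongr
    _ = 8 * (A.R : ℝ) ^ 4 * C.E.sH (C.lev (3 * C.k)) := by ring
    _ ≤ A.R ^ 32 * C.E.sH (C.lev (3 * C.k)) := by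
        refine mul_le_mul_of_nonneg_right ?_ (C.E.sH_pos _).le
        calc 8 * (A.R : ℝ) ^ 4 ≤ A.R * (A.R : ℝ) ^ 4 := by gcongr; linarith
          _ = (A.R : ℝ) ^ 5 := by ring
          _ ≤ _ := pow_le_pow_right₀ (by linarith) (by norm_num)
    _ ≤ _ := (mul_le_mul_of_nonneg_right hr (C.E.sH_pos _).le).trans h6

lemma three_G_le : 3 * A.G ≤ C.n := by
  have h1 := C.hG2
  have h2 := C.hJ
  have h3 := C.hk
  have h4 := C.hn
  rcases Nat.lt_or_ge A.G 2 with h | h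
  · omega
  · obtain ⟨g, hg⟩ := Nat.exists_eq_add_of_le h
    rw [hg] at h1 ⊢
    have : 200 * (g + 1) ≤ C.J * (g + 1) := Nat.mul_le_mul_right _ h2
    have h5 : C.J * (2 + g) = C.J * (g + 1) + C.J := by ring
    omega

lemma sH_G_div {K : ℕ} (hK : K = 2 ^ (2 * C.n - 12)) : C.E.sH A.G / K =
    (2 : ℝ) ^ (-(3 * (C.n : ℤ))) / Nat.sqrt d := by
  have hR : (A.R : ℝ) ≠ 0 := by exact_mod_cast A.R_pos.ne'
  have hn : 12 ≤ 2 * C.n := by have := C.hk; have := C.hn; omega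
  have h1 : (K : ℝ) = 2 ^ (2 * (C.n : ℤ) - 12) := by
    rw [hK]
    push_cast
    rw [← zpow_natCast, Nat.cast_sub hn]
    push_cast
    rfl
  have h2 : sc (C.n + 12) = 2 ^ (2 * (C.n : ℤ) - 12) * (2 : ℝ) ^ (-(3 * (C.n : ℤ))) := by
    unfold sc
    rw [← zpow_add₀ (by norm_num)]
    congr 1
    push_cast
    ring
  rw [h1, Geo.sH, C.hs, h2]
  field_simp

lemma card_steps_le {M : ℕ} (hM : 1 ≤ M) (hN : 4 * C.N * C.E.sc₀ ≤ 2 * M) :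
    2 ^ (2 * C.n - 12) * A.T C.N A.G + 1 ≤ 4 * M * Nat.sqrt d * 11 ^ C.n := by
  have hn : 12 ≤ 2 * C.n := by have := C.hk; have := C.hn; omega
  have hr : 1 ≤ Nat.sqrt d := le_trans (Nat.one_le_pow _ _ A.R_pos) C.hr1
  have hr0 : (0 : ℝ) < Nat.sqrt d := by exact_mod_cast hr
  have h1 : 2 * (C.N * A.L * A.y * A.R ^ A.G : ℝ) ≤ M * Nat.sqrt d * 2 ^ (C.n + 12) := by
    have h2 : 4 * C.N * C.E.sc₀ = 4 * (C.N * A.L * A.y * A.R ^ A.G : ℝ) / (Nat.sqrt d * 2 ^ (C.n + 12)) := by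
      unfold Geo.sc₀
      rw [C.hs, sc, zpow_neg, zpow_natCast]
      field_simp
    rw [h2, div_le_iff₀ (by positivity)] at hN
    linarith
  have h1' : 2 * (C.N * A.L * A.y * A.R ^ A.G) ≤ M * Nat.sqrt d * 2 ^ (C.n + 12) := by
    exact_mod_cast h1
  have h3 := two_pow_mul_eight_pow_lt C.three_G_le (by omega)
  have h4 : 2 ^ (2 * C.n - 12) * 2 ^ (C.n + 12) = 8 ^ C.n := by
    rw [← pow_add, show 2 * C.n - 12 + (C.n + 12) = 3 * C.n by omega, pow_mul]
    norm_num
  have hMr : 1 ≤ 4 * M * Nat.sqrt d := by nlinarith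
  calc 2 ^ (2 * C.n - 12) * A.T C.N A.G + 1
      = 2 ^ (2 * C.n - 12) * 2 ^ A.G * 4 * (2 * (C.N * A.L * A.y * A.R ^ A.G)) + 1 := by
        unfold Prm.T; rw [mul_pow]; ring
    _ ≤ 2 ^ (2 * C.n - 12) * 2 ^ A.G * 4 * (M * Nat.sqrt d * 2 ^ (C.n + 12)) + 1 := by gcongr
    _ = 4 * M * Nat.sqrt d * (2 ^ (2 * C.n - 12) * 2 ^ (C.n + 12) * 2 ^ A.G) + 1 := by ring
    _ = 4 * M * Nat.sqrt d * (8 ^ C.n * 2 ^ A.G) + 1 := by rw [h4]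
    _ ≤ 4 * M * Nat.sqrt d * (8 ^ C.n * 2 ^ A.G) + 4 * M * Nat.sqrt d := by gcongr
    _ = 4 * M * Nat.sqrt d * (8 ^ C.n * 2 ^ A.G + 1) := by ring
    _ ≤ _ := Nat.mul_le_mul_left _ h3

lemma sc₀_bounds : 0 < C.E.sc₀ ∧ C.E.sc₀ ≤ 5 / 16 ∧ C.E.sc₀ * 2 ^ C.k ≤ 5 / 8 ∧
    8 * A.R ^ 3 * C.E.s ≤ 1 / 8 := by
  have h1 := C.hm1
  have h2 := C.hm2
  have h3 := C.mul_s_le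
  have h4 := C.hk
  have hs : sc (3 * C.k) = (2 ^ (3 * C.k))⁻¹ := by unfold sc; rw [zpow_neg, zpow_natCast]
  have h5 : sc (3 * C.k) ≤ 1 / 8 := by
    refine (sc_anti (show 3 ≤ 3 * C.k by omega)).trans_eq ?_
    norm_num [sc]
  have h6 : sc (3 * C.k) * 2 ^ C.k ≤ 1 / 4 := by
    have h7 : (4 : ℝ) ≤ 2 ^ (2 * C.k) := by
      calc (4 : ℝ) = 2 ^ 2 := by norm_num
        _ ≤ _ := pow_le_pow_right₀ (by norm_num) (by omega)
    rw [hs, inv_mul_le_iff₀ (by positivity), show 3 * C.k = 2 * C.k + C.k by ring, pow_add]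
    have : (0 : ℝ) < 2 ^ C.k := by positivity
    nlinarith
  have h7 := sc_pos (3 * C.k)
  have h8 : C.E.sc₀ = A.L * A.y * C.E.s := rfl
  rw [← h8] at h1 h2
  refine ⟨by linarith, by linarith, ?_, by linarith⟩
  have : (0 : ℝ) < 2 ^ C.k := by positivity
  nlinarith

/-- A thick polyline contains a path as required. -/
lemma exists_path_of_thick {M : ℕ} (hM : 10 ≤ M) (hN1 : 4 * C.N * C.E.sc₀ ≤ 2 * M)
    (hN2 : 2 * M < 4 * (C.N + 1) * C.E.sc₀) (he : ((C.E.e (.inl 0) : Fin d) : ℕ) = 0)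
    {q : C.Ix (2 ^ C.k)} {S : Set (EuclideanSpace ℝ (Fin d))}
    (hS : ∀ e < A.T C.N A.G,
      segment ℝ (C.E.pos (C.pth q) A.G e) (C.E.pos (C.pth q) A.G (e + 1)) ⊆ S) :
    ∃ (L : ℕ) (x : ℕ → EuclideanSpace ℝ (Fin d)),
      1 ≤ L ∧ L ≤ 4 * M * Nat.sqrt d * 11 ^ C.n ∧
      (∀ i j, i < L → j < L → x i = x j → i = j) ∧
      (∀ i, i < L → ∀ jj : Fin d, ∃ m : ℤ,
        x i jj = (2 : ℝ) ^ (-(3 * (C.n : ℤ))) / (Nat.sqrt d : ℝ) * m) ∧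
      (∀ i, i + 1 < L → (∑ jj, |x (i + 1) jj - x i jj|) =
        (2 : ℝ) ^ (-(3 * (C.n : ℤ))) / (Nat.sqrt d : ℝ)) ∧
      (∑ jj, |x 0 jj|) ≤ 2 ∧
      (∑ jj, |x (L - 1) jj - (if (jj : ℕ) = 0 then 2 * (M : ℝ) else 0)|) ≤ 2 ∧
      (∀ i, i < L → (∑ jj, |x i jj|) ≤ 10 * M) ∧
      ∀ p ∈ ⋃ (i : ℕ) (_ : i + 1 < L), segment ℝ (x i) (x (i + 1)), p ∈ S := by
  obtain ⟨b1, b2, b3, b4⟩ := C.sc₀_bounds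
  have hM' : (10 : ℝ) ≤ M := by exact_mod_cast hM
  have hv : C.E.sc₀ * ((C.pth q).v : ℝ) ≤ 5 / 8 := by
    refine le_trans (mul_le_mul_of_nonneg_left ?_ b1.le) b3
    have : (C.pth q).v ≤ 2 ^ C.k := q.1.1.2.le
    exact_mod_cast this
  have hSbd : ∀ I ≤ C.N, ∀ c, 2 * |(C.pth q).S I c| ≤ C.N := fun I hI c =>
    abs_bridge_le q.1.2 hI c
  have hS0 : ∀ c, (C.pth q).S 0 c = 0 := fun c => by
    change bridge q.1.2 0 c = 0
    simp [bridge, walk_zero]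
  have hSN : ∀ c, (C.pth q).S C.N c = 0 := fun c => by
    change bridge q.1.2 C.N c = 0
    simp [bridge, walk_zero]
  have hb : ∀ e ≤ A.T C.N A.G, ∑ j, |C.E.pos (C.pth q) A.G e j| ≤ 10 * M := fun e h => by
    have := C.E.sum_abs_pos_le (C.pth q) h hSbd
    nlinarith
  obtain ⟨K, hK⟩ : ∃ K : ℕ, K = 2 ^ (2 * C.n - 12) := ⟨_, rfl⟩
  have hK0 : 0 < K := by rw [hK]; positivity
  obtain ⟨L, x, h1, h2, h3, h4, h5, h6, h7, h8, h9⟩ := C.E.exists_lattice_path (C.pth q) hK0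
    (C.sH_G_div hK) hb hS
  rw [hK] at h2
  refine ⟨L, x, h1, h2.trans (C.card_steps_le (by omega) hN1), h3, h4, h5, ?_, ?_, h8, fun p hp => ?_⟩
  · rw [h6]
    have := C.E.sum_abs_pos_start_le (C.pth q) A.G hS0
    linarith
  · rw [h7]
    have h10 := C.E.sum_abs_pos_end_le (C.pth q) A.G hSN (2 * M)
    have h11 : |C.E.sc₀ * (4 * C.N) - 2 * M| ≤ 5 / 4 := by
      rw [abs_le]; constructor <;> nlinarith
    have h12 : ∀ jj : Fin d, C.E.emb (fun c => if c = .inl 0 then 2 * (M : ℝ) else 0) jj =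
        if (jj : ℕ) = 0 then 2 * (M : ℝ) else 0 := fun jj => by
      have h13 : (jj : ℕ) = 0 ↔ jj = C.E.e (.inl 0) := by rw [Fin.ext_iff, he]
      simp only [Geo.emb]
      by_cases hj : ∃ c, C.E.e c = jj
      · obtain ⟨c, rfl⟩ := hj
        rw [C.E.e.injective.extend_apply]
        simp only [h13, C.E.e.injective.eq_iff]
      · rw [Function.extend_apply' _ _ _ hj, if_neg]
        · rfl
        · rw [h13]; rintro rfl; exact hj ⟨_, rfl⟩
    simp_rw [h12] at h10
    linarith
  · simp only [Set.mem_iUnion] at hp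
    obtain ⟨i, hi, hp⟩ := hp
    exact h9 i hi hp

end Cfg

lemma exists_straight_path {d M n : ℕ} (hd : 2 ≤ d) (hM : 10 ≤ M) :
    ∃ (L : ℕ) (x : ℕ → EuclideanSpace ℝ (Fin d)),
      1 ≤ L ∧ L ≤ 4 * M * Nat.sqrt d * 11 ^ n ∧
      (∀ i j, i < L → j < L → x i = x j → i = j) ∧
      (∀ i, i < L → ∀ jj : Fin d, ∃ m : ℤ,
        x i jj = (2 : ℝ) ^ (-(3 * (n : ℤ))) / (Nat.sqrt d : ℝ) * m) ∧
      (∀ i, i + 1 < L → (∑ jj, |x (i + 1) jj - x i jj|) =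
        (2 : ℝ) ^ (-(3 * (n : ℤ))) / (Nat.sqrt d : ℝ)) ∧
      (∑ jj, |x 0 jj|) ≤ 2 ∧
      (∑ jj, |x (L - 1) jj - (if (jj : ℕ) = 0 then 2 * (M : ℝ) else 0)|) ≤ 2 ∧
      (∀ i, i < L → (∑ jj, |x i jj|) ≤ 10 * M) := by
  have hr : 1 ≤ Nat.sqrt d := Nat.sqrt_pos.2 (by omega)
  have hr0 : (0 : ℝ) < Nat.sqrt d := by exact_mod_cast hr
  obtain ⟨δ, hδ⟩ : ∃ δ : ℝ, δ = (2 : ℝ) ^ (-(3 * (n : ℤ))) / (Nat.sqrt d : ℝ) := ⟨_, rfl⟩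
  have hδ0 : 0 < δ := by rw [hδ]; positivity
  have hend : δ * ((2 * M * Nat.sqrt d * 8 ^ n : ℕ) : ℝ) = 2 * M := by
    have h8 : ((8 : ℝ)) ^ n = 2 ^ (3 * (n : ℤ)) := by
      rw [zpow_mul]; norm_num
    push_cast
    rw [hδ, h8, zpow_neg]
    field_simp
  obtain ⟨m, hm⟩ : ∃ m, m = 2 * M * Nat.sqrt d * 8 ^ n := ⟨_, rfl⟩
  rw [← hm] at hend
  let z : Fin d := ⟨0, by omega⟩
  have hz : ∀ jj : Fin d, (jj : ℕ) = 0 ↔ jj = z := fun jj => by rw [Fin.ext_iff]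
  let x : ℕ → EuclideanSpace ℝ (Fin d) := fun i => WithLp.toLp 2 fun jj => if jj = z then δ * i else 0
  have hx : ∀ i jj, x i jj = if jj = z then δ * i else 0 := fun i jj => rfl
  have hsum : ∀ i (a : ℝ), ∑ jj, |x i jj - if jj = z then a else 0| = |δ * i - a| := fun i a => by
    rw [Finset.sum_eq_single z]
    · simp [hx]
    · intro jj _ hjj; simp [hx, hjj]
    · simp
  have hsum0 : ∀ i, ∑ jj, |x i jj| = δ * i := fun i => by
    have := hsum i 0
    simp only [ite_self, sub_zero] at this
    rw [this, abs_of_nonneg (by positivity)]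
  rw [← hδ]
  refine ⟨m + 1, x, by omega, ?_, fun i j _ _ h => ?_, fun i _ jj => ?_, fun i _ => ?_, ?_, ?_,
    fun i hi => ?_⟩
  · have h1 : 8 ^ n ≤ 11 ^ n := Nat.pow_le_pow_left (by norm_num) n
    have h2 : 1 ≤ 2 * M * Nat.sqrt d * 11 ^ n :=
      Nat.mul_pos (Nat.mul_pos (by omega) hr) (by positivity)
    calc m + 1 ≤ 2 * M * Nat.sqrt d * 11 ^ n + 2 * M * Nat.sqrt d * 11 ^ n := by
          rw [hm]; gcongr
      _ = _ := by ring
  · have h1 := congrArg (fun w : EuclideanSpace ℝ (Fin d) => w z) h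
    simp only [hx, if_true] at h1
    exact_mod_cast mul_left_cancel₀ hδ0.ne' h1
  · rw [hx]
    split_ifs
    · exact ⟨i, by push_cast; rfl⟩
    · exact ⟨0, by simp⟩
  · have := hsum (i + 1) (δ * i)
    simp_rw [← hx] at this
    rw [this, ← mul_sub]
    push_cast
    rw [add_sub_cancel_left, mul_one, abs_of_pos hδ0]
  · rw [hsum0]; simp
  · simp_rw [hz]
    rw [hsum, Nat.add_sub_cancel, hend]
    simp
  · rw [hsum0]
    have h1 : (i : ℝ) ≤ m := by exact_mod_cast Nat.lt_succ_iff.1 hi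
    calc δ * i ≤ δ * m := by gcongr
      _ = 2 * M := hend
      _ ≤ 10 * M := by gcongr; norm_num

lemma exists_exponent {J₀ d : ℕ} (h : 2 ^ (64 * J₀) ≤ d) :
    ∃ J, J₀ ≤ J ∧ 2 ^ (64 * J) ≤ d ∧ d < 2 ^ (64 * J + 64) := by
  have hd : d ≠ 0 := by
    rintro rfl
    have : 0 < 2 ^ (64 * J₀) := by positivity
    omega
  have h1 : 64 * J₀ ≤ Nat.log 2 d := Nat.le_log_of_pow_le (by norm_num) h
  have h2 := Nat.pow_log_le_self 2 hd
  have h3 := Nat.lt_pow_succ_log_self (b := 2) (by norm_num) d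
  refine ⟨Nat.log 2 d / 64, by omega, le_trans (Nat.pow_le_pow_right (by norm_num) (by omega)) h2,
    h3.trans_le (Nat.pow_le_pow_right (by norm_num) (by omega))⟩

end WN

end

/-- For fixed `α > 0` and all sufficiently large `d`, there is
`ε : ℕ → (0,1)` with `ε(k) → 0` such that for all `n ≥ k ≥ 1` and `M ≥ 10`: with
probability at least `1 − ε(k)` there is a self-avoiding nearest-neighbor path
`P = (x_1, …, x_L)` on `(1/𝔯)2^{−3n}ℤ^d` (where `𝔯 = ⌊√d⌋`) with at most `4M𝔯·11^n`
vertices, `|x_1|₁ ≤ 2`, `|x_L − 2M e₁|₁ ≤ 2`, `|x_i|₁ ≤ 10M` for all `i`, and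
`h_j(x) − h_{3k}(x) ≥ α(j − 3k)` for every `6k ≤ j ≤ n` and every point `x` on `P̄`
(the union of the segments between consecutive vertices). -/
theorem wn_thick_path_between_sets (α : ℝ) (hα : 0 < α) :
    ∃ D : ℕ, ∀ d : ℕ, 2 ≤ d → D ≤ d →
      ∀ (Ω : Type) (_ : MeasurableSpace Ω) (P : Measure Ω), IsProbabilityMeasure P →
      ∀ h : ℕ → EuclideanSpace ℝ (Fin d) → Ω → ℝ, IsWhiteNoiseField d P h →
      ∃ ε : ℕ → ℝ, (∀ k, 0 < ε k ∧ ε k < 1) ∧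
        Filter.Tendsto ε Filter.atTop (nhds 0) ∧
        ∀ n k M : ℕ, 1 ≤ k → k ≤ n → 10 ≤ M →
          ENNReal.ofReal (1 - ε k) ≤
            P {ω | ∃ (L : ℕ) (x : ℕ → EuclideanSpace ℝ (Fin d)),
              1 ≤ L ∧ L ≤ 4 * M * Nat.sqrt d * 11 ^ n ∧
              (∀ i j, i < L → j < L → x i = x j → i = j) ∧
              (∀ i, i < L → ∀ jj : Fin d, ∃ m : ℤ,
                x i jj = (2 : ℝ) ^ (-(3 * (n : ℤ))) / (Nat.sqrt d : ℝ) * m) ∧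
              (∀ i, i + 1 < L → (∑ jj, |x (i + 1) jj - x i jj|) =
                (2 : ℝ) ^ (-(3 * (n : ℤ))) / (Nat.sqrt d : ℝ)) ∧
              (∑ jj, |x 0 jj|) ≤ 2 ∧
              (∑ jj, |x (L - 1) jj - (if (jj : ℕ) = 0 then 2 * (M : ℝ) else 0)|) ≤ 2 ∧
              (∀ i, i < L → (∑ jj, |x i jj|) ≤ 10 * M) ∧
              (∀ j' : ℕ, 6 * k ≤ j' → j' ≤ n →
                ∀ p ∈ ⋃ (i : ℕ) (_ : i + 1 < L), segment ℝ (x i) (x (i + 1)),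
                  α * ((j' : ℝ) - 3 * k) ≤ h j' p ω - h (3 * k) p ω)} := by
  refine ⟨2 ^ (64 * (200 + ⌈2 * α ^ 2⌉₊)), fun d hd2 hd Ω _ P _ h hh =>
    ⟨fun k => 1 - 1 / (1 + 13 / 2 ^ k), fun k => ?_, ?_, fun n k M hk hkn hM => ?_⟩⟩
  · have h1 : (0 : ℝ) < 13 / 2 ^ k := by positivity
    have h2 : 1 / (1 + 13 / (2 : ℝ) ^ k) < 1 := by rw [div_lt_one (by positivity)]; linarith
    have h3 : 0 < 1 / (1 + 13 / (2 : ℝ) ^ k) := by positivity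
    constructor <;> linarith
  · have h1 : Filter.Tendsto (fun k : ℕ => 13 / (2 : ℝ) ^ k) Filter.atTop (nhds 0) :=
      tendsto_const_nhds.div_atTop (tendsto_pow_atTop_atTop_of_one_lt (by norm_num))
    have h2 := ((tendsto_const_nhds (x := (1 : ℝ))).div (h1.const_add 1) (by norm_num)).const_sub 1
    simpa using h2
  · obtain ⟨J, hJ, hJ1, hJ2⟩ := WN.exists_exponent hd
    clear hd
    rw [sub_sub_cancel]
    rcases Nat.lt_or_ge n (6 * k) with hn | hn
    · obtain ⟨L, x, h1, h2, h3, h4, h5, h6, h7, h8⟩ := WN.exists_straight_path (n := n) hd2 hM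
      refine le_trans (b := P Set.univ) ?_ (measure_mono fun ω _ => ?_)
      · rw [measure_univ, ENNReal.ofReal_le_one, div_le_one (by positivity)]
        have : (0 : ℝ) ≤ 13 / 2 ^ k := by positivity
        linarith
      · exact ⟨L, x, h1, h2, h3, h4, h5, h6, h7, h8, fun j' h9 h10 => by omega⟩
    · obtain ⟨A, C, rfl, rfl, rfl, he, hN1, hN2⟩ :=
        WN.exists_cfg (M := M) (show 200 ≤ J by omega) hJ1 hJ2 hk hn
      clear hJ1 hJ2
      have hα' : α ≤ √(52 * C.J) / 8 := by
        rw [le_div_iff₀ (by norm_num)]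
        apply Real.le_sqrt_of_sq_le
        have h1 := Nat.le_ceil (2 * α ^ 2)
        have h2 : ((200 + ⌈2 * α ^ 2⌉₊ : ℕ) : ℝ) ≤ C.J := by exact_mod_cast hJ
        push_cast at h2
        nlinarith
      have h1 := C.prob_polyline_ge hh (B := 2 ^ C.k) (by positivity) hα'
      push_cast at h1
      refine h1.trans (measure_mono fun ω hω => ?_)
      obtain ⟨q, hq⟩ := hω
      obtain ⟨L, x, h1, h2, h3, h4, h5, h6, h7, h8, h9⟩ := C.exists_path_of_thick hM hN1 hN2 he hq
      exact ⟨L, x, h1, h2, h3, h4, h5, h6, h7, h8, fun j' h10 h11 p hp => h9 p hp j' h10 h11⟩
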